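/- Let $X$ be a topological space. An action of $X$ on a C*-algebra $A$ is an order-preserving map $U\mapsto A(U)$ from the open subsets of $X$ to the closed two-sided ideals of $A$; a map $\psi:A\to B$ between C*-algebras with actions of $X$ is $X$-equivariant if $\psi(A(U))\subseteq B(U)$ for every open $U$. Let $\mathcal K$ be the algebra of compact operators on $\ell^2(\mathbb N)$, and let $X$ act on $\mathcal K\otimes B$ by $U\mapsto\mathcal K\otimes B(U)$. Let $\iota,\bar\iota:A\to QA=A\star A$ be the two inclusions in the free product, let $qA$ be the kernel of the homomorphism $QA\to A$ that identifies the two copies of $A$, let $qx=\iota(x)-\bar\iota(x)$ for $x\in A$, and let $\pi_A:qA\to A$ be the restriction of $\mathrm{id}\star 0$. Let $KK(X;A,B)$ be the set of homotopy classes of $*$-homomorphisms $\varphi:qA\to\mathcal K\otimes B$ for which $x\mapsto\varphi(qx)$ is $X$-equivariant, with point-norm continuous homotopies through such homomorphisms. For $X$-equivariant $*$-homomorphisms $f:A'\to A$ and $g:B\to B'$ let $f^*[\varphi]=[\varphi\circ q(f)]$ and $g_*[\varphi]=[(\mathrm{id}_{\mathcal K}\otimes g)\circ\varphi]$; an $X$-equivariant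 $*$-homomorphism $f:A\to B$ has the class $[f]=[e_{11}\otimes f\pi_A(\cdot)]\in KK(X;A,B)$. For all C*-algebras $A,B$ with an action of $X$, the set $KK(X;A,B)$ is an abelian group under $[\varphi]+[\psi]=[\varphi\oplus\psi]$, where $M_2(\mathcal K\otimes B)$ is identified with $\mathcal K\otimes B$ by means of the isomorphism $M_2(\mathcal K)\cong\mathcal K$ given by the bijection of $\mathbb N\sqcup\mathbb N$ with $\mathbb N$ onto the even and the odd numbers. There are products $$KK(X;A,B)\times KK(X;B,C)\to KK(X;A,C),\qquad (a,b)\mapsto a\cdot b,$$ for all C*-algebras $A,B,C$ with an action of $X$ such that $A$ is separable, with the following properties. 1. The product is bilinear. 2. It is associative: $(a\cdot b)\cdot c=a\cdot(b\cdot c)$ for $a\in KK(X;A,B)$, $b\in KK(X;B,C)$, $c\in KK(X;C,D)$ and $A,B$ separable. 3. It is natural: for $X$-equivariant $*$-homomorphisms $f:A'\to A$, $h:B\to B'$, $g:C\to C'$ with $A$ and $A'$ separable, and $a\in KK(X;A,B)$, $b\in KK(X;B,C)$, $b'\in KK(X;B',C)$, one has $f^*a\cdot b=f^*(a\cdot b)$,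 $h_*a\cdot b'=a\cdot h^*b'$ and $a\cdot g_*b=g_*(a\cdot b)$. 4. It extends the composition of $X$-equivariant $*$-homomorphisms: $[f]\cdot[g]=[g\circ f]$, and more generally $[f]\cdot b=f^*b$ and $a\cdot[g]=g_*a$. -/

import Mathlib

universe u v

set_option linter.unusedSectionVars false

noncomputable section

theorem continuous_cstarHom {D E : Type*} [NonUnitalCStarAlgebra D] [NonUnitalCStarAlgebra E]
    (f : D →⋆ₙₐ[ℂ] E) : Continuous f :=
  AddMonoidHomClass.continuous_of_bound f 1 fun a => by
    rw [one_mul]; exact NonUnitalStarAlgHom.norm_apply_le f a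

/-- A C*-seminorm on a complex `*`-algebra `P`. -/
structure CStarSeminorm (P : Type u) [NonUnitalRing P] [StarRing P] [Module ℂ P] extends
    Seminorm ℂ P where
  mul_le' : ∀ a b, toFun (a * b) ≤ toFun a * toFun b
  star_mul_self' : ∀ a, toFun (star a * a) = toFun a * toFun a

namespace CStarSeminorm

variable {P : Type u} [NonUnitalRing P] [StarRing P] [Module ℂ P]

/-- The `*`-algebra `P`, regarded as a seminormed `*`-algebra with the seminorm `p`. -/
@[nolint unusedArguments]
def Carrier (_p : CStarSeminorm P) : Type u := P

variable (p : CStarSeminorm P)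

theorem mul_le (a b : P) : p.toSeminorm (a * b) ≤ p.toSeminorm a * p.toSeminorm b := p.mul_le' a b

theorem star_mul_self (a : P) : p.toSeminorm (star a * a) = p.toSeminorm a * p.toSeminorm a :=
  p.star_mul_self' a

theorem apply_star (a : P) : p.toSeminorm (star a) = p.toSeminorm a := by
  have key : ∀ a : P, p.toSeminorm a ≤ p.toSeminorm (star a) := by
    intro a
    by_cases h : p.toSeminorm a = 0
    · rw [h]; exact apply_nonneg _ _
    · have h0 : 0 < p.toSeminorm a := lt_of_le_of_ne (apply_nonneg _ _) (Ne.symm h)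
      have h1 : p.toSeminorm a * p.toSeminorm a ≤ p.toSeminorm (star a) * p.toSeminorm a :=
        (p.star_mul_self' a).symm.le.trans (p.mul_le' _ _)
      exact le_of_mul_le_mul_right h1 h0
  exact le_antisymm (by simpa using key (star a)) (key a)

instance : NonUnitalRing p.Carrier := inferInstanceAs (NonUnitalRing P)
instance : StarRing p.Carrier := inferInstanceAs (StarRing P)
instance : Module ℂ p.Carrier := inferInstanceAs (Module ℂ P)
instance [StarModule ℂ P] : StarModule ℂ p.Carrier := inferInstanceAs (StarModule ℂ P)
instance [IsScalarTower ℂ P P] : IsScalarTower ℂ p.Carrier p.Carrier :=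
  inferInstanceAs (IsScalarTower ℂ P P)
instance [SMulCommClass ℂ P P] : SMulCommClass ℂ p.Carrier p.Carrier :=
  inferInstanceAs (SMulCommClass ℂ P P)

instance : SeminormedAddCommGroup p.Carrier :=
  { p.toSeminorm.toAddGroupSeminorm.toSeminormedAddCommGroup with
    toAddCommGroup := inferInstance }

theorem carrier_norm_def (a : p.Carrier) : ‖a‖ = p.toSeminorm (show P from a) := rfl

instance : NonUnitalSeminormedRing p.Carrier where
  norm_mul_le a b := p.mul_le' a b
  dist_eq a b := dist_eq_norm_neg_add a b

instance : NormedSpace ℂ p.Carrier where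
  norm_smul_le c a := (map_smul_eq_mul p.toSeminorm c (show P from a)).le

/-- The Hausdorff completion of `P` in the C*-seminorm `p`, a C*-algebra. -/
def Compl : Type u := UniformSpace.Completion p.Carrier

namespace Compl

open UniformSpace UniformSpace.Completion Function

instance : NormedAddCommGroup p.Compl := inferInstanceAs (NormedAddCommGroup (Completion p.Carrier))
instance : NormedSpace ℂ p.Compl := inferInstanceAs (NormedSpace ℂ (Completion p.Carrier))
instance : CompleteSpace p.Compl := inferInstanceAs (CompleteSpace (Completion p.Carrier))

/-- The canonical map from `P` to its completion. -/
def coe (a : P) : p.Compl := @Completion.coe' p.Carrier _ a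

theorem denseRange_coe : DenseRange (coe p) := @Completion.denseRange_coe p.Carrier _

theorem norm_coe (a : P) : ‖coe p a‖ = p.toSeminorm a :=
  Completion.norm_coe (E := p.Carrier) a

theorem coe_add (a b : P) : coe p (a + b) = coe p a + coe p b :=
  Completion.coe_add (α := p.Carrier) a b

theorem coe_zero : coe p 0 = 0 := Completion.coe_zero (α := p.Carrier)

theorem coe_smul (c : ℂ) (a : P) : coe p (c • a) = c • coe p a :=
  Completion.coe_smul (X := p.Carrier) c a

instance : Mul p.Compl :=
  ⟨curry <| (isDenseInducing_coe.prodMap isDenseInducing_coe).extend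
    (fun ab : p.Carrier × p.Carrier => ((ab.1 * ab.2 : p.Carrier) : Completion p.Carrier))⟩

theorem coe_mul (a b : P) : coe p (a * b) = coe p a * coe p b :=
  ((isDenseInducing_coe.prodMap isDenseInducing_coe).extend_eq
    ((continuous_coe p.Carrier).comp (continuous_mul (M := p.Carrier))) (a, b)).symm

instance : ContinuousMul p.Compl where
  continuous_mul := by
    let m := (AddMonoidHom.mul : p.Carrier →+ p.Carrier →+ p.Carrier).compr₂ toCompl
    have : Continuous fun p : p.Carrier × p.Carrier => m p.1 p.2 :=
      (continuous_coe p.Carrier).comp continuous_mul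
    have di : IsDenseInducing (toCompl : p.Carrier → Completion p.Carrier) := isDenseInducing_coe
    exact (di.extend_Z_bilin di this :)

instance : Star p.Compl :=
  ⟨Completion.map (fun a : p.Carrier => (star a : p.Carrier))⟩

theorem uniformContinuous_star : UniformContinuous fun a : p.Carrier => (star a : p.Carrier) := by
  refine (AddMonoidHomClass.isometry_of_norm (starAddEquiv : p.Carrier ≃+ p.Carrier)
    (fun a => ?_)).uniformContinuous
  exact p.apply_star a

theorem coe_star (a : P) : coe p (star a) = star (coe p a) :=
  (Completion.map_coe (uniformContinuous_star p) a).symm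

theorem continuous_star' : Continuous (star : p.Compl → p.Compl) := Completion.continuous_map

variable {p}

theorem ind {q : p.Compl → Prop} (hc : IsClosed {x | q x}) (h : ∀ a, q (coe p a)) (x : p.Compl) :
    q x := (denseRange_coe p).induction_on x hc h

theorem ind₂ {q : p.Compl → p.Compl → Prop}
    (hc : IsClosed {x : p.Compl × p.Compl | q x.1 x.2}) (h : ∀ a b, q (coe p a) (coe p b))
    (x y : p.Compl) : q x y := (denseRange_coe p).induction_on₂ hc h x y

theorem ind₃ {q : p.Compl → p.Compl → p.Compl → Prop}
    (hc : IsClosed {x : p.Compl × p.Compl × p.Compl | q x.1 x.2.1 x.2.2})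
    (h : ∀ a b c, q (coe p a) (coe p b) (coe p c)) (x y z : p.Compl) :
    q x y z := (denseRange_coe p).induction_on₃ hc h x y z

variable (p)

instance : NonUnitalRing p.Compl :=
  { (inferInstance : AddCommGroup p.Compl), (inferInstance : Mul p.Compl) with
    zero_mul := by
      apply ind
      · exact isClosed_eq (by fun_prop) (by fun_prop)
      · intro a; rw [← coe_zero, ← coe_mul, zero_mul]
    mul_zero := by
      apply ind
      · exact isClosed_eq (by fun_prop) (by fun_prop)
      · intro a; rw [← coe_zero, ← coe_mul, mul_zero]
    mul_assoc := by
      apply ind₃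
      · exact isClosed_eq (by fun_prop) (by fun_prop)
      · intro a b c; simp only [← coe_mul, mul_assoc]
    left_distrib := by
      apply ind₃
      · exact isClosed_eq (by fun_prop) (by fun_prop)
      · intro a b c; simp only [← coe_mul, ← coe_add, mul_add]
    right_distrib := by
      apply ind₃
      · exact isClosed_eq (by fun_prop) (by fun_prop)
      · intro a b c; simp only [← coe_mul, ← coe_add, add_mul] }

instance : NonUnitalNormedRing p.Compl :=
  { (inferInstance : NormedAddCommGroup p.Compl), (inferInstance : NonUnitalRing p.Compl) with
    norm_mul_le := by
      apply ind₂
      · exact isClosed_le (by fun_prop) (by fun_prop)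
      · intro a b; rw [← coe_mul, norm_coe, norm_coe, norm_coe]; exact p.mul_le' a b }

instance : StarRing p.Compl where
  star_involutive := by
    have h := continuous_star' p
    apply ind
    · exact isClosed_eq (h.comp h) continuous_id
    · intro a; rw [← coe_star, ← coe_star, star_star]
  star_mul := by
    have h := continuous_star' p
    apply ind₂
    · exact isClosed_eq (h.comp continuous_mul)
        ((h.comp continuous_snd).mul (h.comp continuous_fst))
    · intro a b; simp only [← coe_star, ← coe_mul, star_mul]
  star_add := by
    have h := continuous_star' p
    apply ind₂
    · exact isClosed_eq (h.comp continuous_add)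
        ((h.comp continuous_fst).add (h.comp continuous_snd))
    · intro a b; simp only [← coe_star, ← coe_add, star_add]

instance : CStarRing p.Compl where
  norm_mul_self_le := by
    have h := continuous_star' p
    apply ind
    · exact isClosed_le (by fun_prop) ((h.mul continuous_id).norm)
    · intro a; rw [← coe_star, ← coe_mul, norm_coe, norm_coe]; exact (p.star_mul_self' a).ge

instance [StarModule ℂ P] [IsScalarTower ℂ P P] [SMulCommClass ℂ P P] :
    NonUnitalCStarAlgebra p.Compl :=
  { (inferInstance : NonUnitalNormedRing p.Compl), (inferInstance : StarRing p.Compl),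
    (inferInstance : CStarRing p.Compl), (inferInstance : NormedSpace ℂ p.Compl),
    (inferInstance : CompleteSpace p.Compl) with
    smul_assoc := by
      intro c
      apply ind₂
      · exact isClosed_eq ((continuous_fst.const_smul c).mul continuous_snd)
          ((continuous_fst.mul continuous_snd).const_smul c)
      · intro a b; simp only [smul_eq_mul, ← coe_smul, ← coe_mul, smul_mul_assoc]
    smul_comm := by
      intro c
      apply ind₂
      · exact isClosed_eq ((continuous_fst.mul continuous_snd).const_smul c)
          (continuous_fst.mul (continuous_snd.const_smul c))
      · intro a b; simp only [smul_eq_mul, ← coe_smul, ← coe_mul, mul_smul_comm]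
    star_smul := by
      have h := continuous_star' p
      intro c
      apply ind
      · exact isClosed_eq (h.comp (continuous_const_smul c)) ((continuous_const_smul (star c)).comp h)
      · intro a; simp only [← coe_smul, ← coe_star, star_smul] }

variable [StarModule ℂ P] [IsScalarTower ℂ P P] [SMulCommClass ℂ P P]

/-- The canonical `*`-homomorphism from `P` to its completion. -/
def of : P →⋆ₙₐ[ℂ] p.Compl where
  toFun := coe p
  map_smul' := coe_smul p
  map_zero' := coe_zero p
  map_add' := coe_add p
  map_mul' := coe_mul p
  map_star' := coe_star p

theorem denseRange_of : DenseRange (of p) := denseRange_coe p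

theorem norm_of (a : P) : ‖of p a‖ = p.toSeminorm a := norm_coe p a

variable {p} {E : Type*} [NonUnitalCStarAlgebra E]

theorem lift_continuous (h : P →⋆ₙₐ[ℂ] E) (hp : ∀ a, ‖h a‖ ≤ p.toSeminorm a) :
    Continuous (show p.Carrier →+ E from (h : P →+ E)) :=
  AddMonoidHomClass.continuous_of_bound (show p.Carrier →+ E from (h : P →+ E)) 1 fun a => by
    rw [one_mul]; exact hp a

/-- A `*`-homomorphism of `P` to a C*-algebra which is bounded by `p` extends to the completion. -/
def lift (h : P →⋆ₙₐ[ℂ] E) (hp : ∀ a, ‖h a‖ ≤ p.toSeminorm a) : p.Compl →⋆ₙₐ[ℂ] E :=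
  let F : p.Compl →+ E :=
    (show p.Carrier →+ E from (h : P →+ E)).extension (lift_continuous h hp)
  have hF : Continuous F := AddMonoidHom.continuous_extension _ (lift_continuous h hp)
  have hFc : ∀ a, F (of p a) = h a := fun a => AddMonoidHom.extension_coe _ (lift_continuous h hp) a
  { F with
    map_smul' := by
      intro c
      apply ind
      · exact isClosed_eq (hF.comp (continuous_const_smul c)) ((continuous_const_smul c).comp hF)
      · intro a
        change F (c • of p a) = c • F (of p a)
        rw [← map_smul, hFc, hFc, map_smul]
    map_mul' := by
      apply ind₂
      · exact isClosed_eq (hF.comp continuous_mul)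
          ((hF.comp continuous_fst).mul (hF.comp continuous_snd))
      · intro a b
        change F (of p a * of p b) = F (of p a) * F (of p b)
        rw [← map_mul, hFc, hFc, hFc, map_mul]
    map_star' := by
      apply ind
      · exact isClosed_eq (hF.comp continuous_star) hF.star
      · intro a
        change F (star (of p a)) = star (F (of p a))
        rw [← map_star, hFc, hFc, map_star] }

theorem lift_of (h : P →⋆ₙₐ[ℂ] E) (hp : ∀ a, ‖h a‖ ≤ p.toSeminorm a) (a : P) :
    lift h hp (of p a) = h a :=
  AddMonoidHom.extension_coe _ (lift_continuous h hp) a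

end Compl

end CStarSeminorm

/-- Words in two copies of the letters `x ∈ A`. -/
abbrev FreeWord (A : Type u) : Type u := FreeSemigroup (A ⊕ A)

/-- The complex `*`-algebra of non-commutative polynomials without constant term
in the letters of two copies of `A`. -/
def FreePoly (A : Type u) : Type u := MonoidAlgebra ℂ (FreeWord A)

namespace FreePoly

variable {A : Type u}

instance : NonUnitalRing (FreePoly A) :=
  inferInstanceAs (NonUnitalRing (MonoidAlgebra ℂ (FreeWord A)))
instance : Module ℂ (FreePoly A) := inferInstanceAs (Module ℂ (MonoidAlgebra ℂ (FreeWord A)))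
instance : IsScalarTower ℂ (FreePoly A) (FreePoly A) :=
  inferInstanceAs (IsScalarTower ℂ (MonoidAlgebra ℂ (FreeWord A)) (MonoidAlgebra ℂ (FreeWord A)))
instance : SMulCommClass ℂ (FreePoly A) (FreePoly A) :=
  inferInstanceAs (SMulCommClass ℂ (MonoidAlgebra ℂ (FreeWord A)) (MonoidAlgebra ℂ (FreeWord A)))

/-- The monomial `c • w`. -/
def mono (w : FreeWord A) (c : ℂ) : FreePoly A := MonoidAlgebra.single w c

theorem mono_mul (w w' : FreeWord A) (c c' : ℂ) :
    mono w c * mono w' c' = mono (w * w') (c * c') := MonoidAlgebra.single_mul_single ..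

theorem smul_mono (w : FreeWord A) (c c' : ℂ) : c • mono w c' = mono w (c * c') :=
  MonoidAlgebra.smul_single ..

theorem induction {q : FreePoly A → Prop} (h0 : q 0) (ha : ∀ z z', q z → q z' → q (z + z'))
    (hm : ∀ w c, q (mono w c)) (z : FreePoly A) : q z :=
  MonoidAlgebra.induction_linear z h0 ha hm

/-- The letter `s` as a polynomial. -/
def letter (s : A ⊕ A) : FreePoly A := mono (FreeSemigroup.of s) 1

section Star

variable [InvolutiveStar A]

/-- The involution on words: reverse the word and apply `*` to the letters. -/
def revStar : FreeWord A →ₙ* (FreeWord A)ᵐᵒᵖ :=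
  FreeSemigroup.lift fun x => MulOpposite.op (FreeSemigroup.of (Sum.map star star x))

theorem revStar_revStar (w : FreeWord A) : (revStar (revStar w).unop).unop = w := by
  induction w using FreeSemigroup.recOnMul with
  | ih1 x => cases x <;> simp [revStar]
  | ih2 x y hx hy => rw [map_mul, MulOpposite.unop_mul, map_mul, MulOpposite.unop_mul, hx, hy]

/-- The conjugate linear extension to polynomials of the involution on words. -/
def starHom : FreePoly A →+ FreePoly A :=
  (Finsupp.liftAddHom fun w : FreeWord A =>
    (((MonoidAlgebra.singleAddHom (revStar w).unop).comp (starAddEquiv (R := ℂ)).toAddMonoidHom :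
      ℂ →+ MonoidAlgebra ℂ (FreeWord A)))).comp MonoidAlgebra.coeffAddEquiv.toAddMonoidHom

theorem starHom_mono (w : FreeWord A) (c : ℂ) :
    starHom (mono w c) = mono (revStar w).unop (star c) := by
  exact (Finsupp.liftAddHom_apply_single _ _ _)

instance : StarRing (FreePoly A) where
  star := starHom
  star_involutive := by
    apply induction
    · simp
    · intro z z' h h'; simp only [map_add, h, h']
    · intro w c; simp only [starHom_mono, star_star, revStar_revStar]
  star_mul := by
    intro a b
    induction a using induction with
    | h0 => simp
    | ha z z' h h' => simp only [add_mul, mul_add, map_add, h, h']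
    | hm w c =>
      induction b using induction with
      | h0 => simp
      | ha z z' h h' => simp only [add_mul, mul_add, map_add, h, h']
      | hm w' c' => simp only [starHom_mono, mono_mul, map_mul, MulOpposite.unop_mul, star_mul]
  star_add := map_add _

theorem star_mono (w : FreeWord A) (c : ℂ) :
    star (mono w c) = mono (revStar w).unop (star c) := starHom_mono w c

theorem star_letter (s : A ⊕ A) : star (letter s) = letter (Sum.map star star s) := by
  rw [letter, star_mono, star_one]; rfl

instance : StarModule ℂ (FreePoly A) where
  star_smul := by
    intro c
    apply induction
    · simp
    · intro z z' h h'; simp only [smul_add, star_add, h, h']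
    · intro w c'; rw [smul_mono, star_mono, star_mono, smul_mono, star_mul, mul_comm]

end Star

section Lift

variable {E : Type*} [NonUnitalCStarAlgebra E]

/-- The homomorphism from polynomials given on letters by a function. -/
def eval (f : A ⊕ A → E) : FreePoly A →ₙₐ[ℂ] E :=
  MonoidAlgebra.liftMagma ℂ (FreeSemigroup.lift f)

theorem eval_mono (f : A ⊕ A → E) (w : FreeWord A) (c : ℂ) :
    eval f (mono w c) = c • FreeSemigroup.lift f w := by
  change Finsupp.liftAddHom _ (Finsupp.single w c) = _
  rw [Finsupp.liftAddHom_apply_single]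
  rfl

theorem eval_letter (f : A ⊕ A → E) (s : A ⊕ A) : eval f (letter s) = f s := by
  simp [letter, eval_mono]

theorem lift_revStar [InvolutiveStar A] (f : A ⊕ A → E)
    (hf : ∀ s, f (Sum.map star star s) = star (f s)) (w : FreeWord A) :
    FreeSemigroup.lift f (revStar w).unop = star (FreeSemigroup.lift f w) := by
  induction w using FreeSemigroup.recOnMul with
  | ih1 x => simp [revStar, hf]
  | ih2 x y hx hy => rw [map_mul, MulOpposite.unop_mul, map_mul, map_mul, star_mul, hx, hy]

/-- The `*`-homomorphism from polynomials given by `*`-preserving values on letters. -/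
def evalStar [InvolutiveStar A] (f : A ⊕ A → E)
    (hf : ∀ s, f (Sum.map star star s) = star (f s)) : FreePoly A →⋆ₙₐ[ℂ] E :=
  { eval f with
    map_star' := by
      change ∀ z, eval f (star z) = star (eval f z)
      apply induction
      · simp
      · intro z z' h h'; simp only [star_add, map_add, h, h']
      · intro w c
        rw [star_mono, eval_mono, eval_mono, star_smul, lift_revStar f hf] }

theorem evalStar_letter [InvolutiveStar A] (f : A ⊕ A → E)
    (hf : ∀ s, f (Sum.map star star s) = star (f s)) (s : A ⊕ A) :
    evalStar f hf (letter s) = f s := eval_letter f s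

end Lift

section Norm

variable [NonUnitalCStarAlgebra A]

/-- A C*-seminorm on polynomials is compatible with `A` if it is at most the norm on the letters of
both copies of `A`, and the relations of `A` between the letters of each of the two copies
hold modulo its null space. -/
structure Compatible (p : CStarSeminorm (FreePoly A)) : Prop where
  le_l : ∀ x : A, p.toSeminorm (letter (.inl x)) ≤ ‖x‖
  le_r : ∀ x : A, p.toSeminorm (letter (.inr x)) ≤ ‖x‖
  add_l : ∀ x y : A,
    p.toSeminorm (letter (.inl (x + y)) - (letter (.inl x) + letter (.inl y))) = 0
  add_r : ∀ x y : A,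
    p.toSeminorm (letter (.inr (x + y)) - (letter (.inr x) + letter (.inr y))) = 0
  smul_l : ∀ (c : ℂ) (x : A), p.toSeminorm (letter (.inl (c • x)) - c • letter (.inl x)) = 0
  smul_r : ∀ (c : ℂ) (x : A), p.toSeminorm (letter (.inr (c • x)) - c • letter (.inr x)) = 0
  mul_l : ∀ x y : A, p.toSeminorm (letter (.inl (x * y)) - letter (.inl x) * letter (.inl y)) = 0
  mul_r : ∀ x y : A, p.toSeminorm (letter (.inr (x * y)) - letter (.inr x) * letter (.inr y)) = 0

/-- The C*-seminorm `z ↦ ‖h z‖` given by a `*`-homomorphism to a C*-algebra. -/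
def pullbackNorm {E : Type*} [NonUnitalCStarAlgebra E] (h : FreePoly A →⋆ₙₐ[ℂ] E) :
    CStarSeminorm (FreePoly A) where
  toFun z := ‖h z‖
  map_zero' := by simp
  add_le' a b := by rw [map_add]; exact norm_add_le _ _
  neg' a := by rw [map_neg, norm_neg]
  smul' c a := by rw [map_smul, norm_smul]
  mul_le' a b := by rw [map_mul]; exact norm_mul_le _ _
  star_mul_self' a := by
    rw [map_mul, map_star, CStarRing.norm_star_mul_self]

theorem pullbackNorm_apply {E : Type*} [NonUnitalCStarAlgebra E] (h : FreePoly A →⋆ₙₐ[ℂ] E)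
    (z : FreePoly A) : (pullbackNorm h).toSeminorm z = ‖h z‖ := rfl

instance : Nonempty {p : CStarSeminorm (FreePoly A) // Compatible p} :=
  ⟨pullbackNorm (E := ℂ) 0, by
    constructor <;> intros <;> simp [pullbackNorm_apply]⟩

theorem bddAbove_compatible (z : FreePoly A) :
    BddAbove (Set.range fun p : {p : CStarSeminorm (FreePoly A) // Compatible p} =>
      p.1.toSeminorm z) := by
  suffices h : ∃ r : ℝ, ∀ p : {p : CStarSeminorm (FreePoly A) // Compatible p},
      p.1.toSeminorm z ≤ r by
    obtain ⟨r, hr⟩ := h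
    exact ⟨r, by rintro _ ⟨p, rfl⟩; exact hr p⟩
  induction z using induction with
  | h0 => exact ⟨0, fun p => by simp⟩
  | ha z z' h h' =>
    obtain ⟨r, hr⟩ := h
    obtain ⟨r', hr'⟩ := h'
    exact ⟨r + r', fun p => (map_add_le_add _ _ _).trans (add_le_add (hr p) (hr' p))⟩
  | hm w c =>
    have key : ∃ r : ℝ, 0 ≤ r ∧ ∀ p : {p : CStarSeminorm (FreePoly A) // Compatible p},
        p.1.toSeminorm (mono w 1) ≤ r := by
      induction w using FreeSemigroup.recOnMul with
      | ih1 x =>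
        cases x with
        | inl x => exact ⟨‖x‖, norm_nonneg _, fun p => p.2.le_l x⟩
        | inr x => exact ⟨‖x‖, norm_nonneg _, fun p => p.2.le_r x⟩
      | ih2 x y hx hy =>
        obtain ⟨r, h0, hr⟩ := hx
        obtain ⟨r', h0', hr'⟩ := hy
        refine ⟨r * r', mul_nonneg h0 h0', fun p => ?_⟩
        have := p.1.mul_le (mono (FreeSemigroup.of x) 1) (mono y 1)
        rw [mono_mul, mul_one] at this
        exact this.trans (mul_le_mul (hr p) (hr' p) (apply_nonneg _ _) h0)
    obtain ⟨r, -, hr⟩ := key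
    refine ⟨‖c‖ * r, fun p => ?_⟩
    have : mono w c = c • mono w 1 := by rw [smul_mono, mul_one]
    rw [this, map_smul_eq_mul]
    exact mul_le_mul_of_nonneg_left (hr p) (norm_nonneg _)

variable (A) in
/-- The universal C*-seminorm: the supremum of all compatible C*-seminorms. -/
def univNorm : CStarSeminorm (FreePoly A) where
  toFun z := ⨆ p : {p : CStarSeminorm (FreePoly A) // Compatible p}, p.1.toSeminorm z
  map_zero' := by simp
  add_le' a b := ciSup_le fun p => (map_add_le_add _ _ _).trans
    (add_le_add (le_ciSup (bddAbove_compatible a) p) (le_ciSup (bddAbove_compatible b) p))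
  neg' a := by simp
  smul' c a := by
    simp only [map_smul_eq_mul]
    rw [Real.mul_iSup_of_nonneg (norm_nonneg c)]
  mul_le' a b := ciSup_le fun p => (p.1.mul_le a b).trans
    (mul_le_mul (le_ciSup (bddAbove_compatible a) p) (le_ciSup (bddAbove_compatible b) p)
      (apply_nonneg _ _) ((apply_nonneg _ _).trans (le_ciSup (bddAbove_compatible a) p)))
  star_mul_self' a := by
    apply le_antisymm
    · refine ciSup_le fun p => (p.1.star_mul_self a).le.trans ?_
      exact mul_self_le_mul_self (apply_nonneg _ _) (le_ciSup (bddAbove_compatible a) p)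
    · have h : ⨆ p : {p : CStarSeminorm (FreePoly A) // Compatible p}, p.1.toSeminorm a ≤
          √(⨆ p : {p : CStarSeminorm (FreePoly A) // Compatible p},
            p.1.toSeminorm (star a * a)) := ciSup_le fun p => Real.le_sqrt_of_sq_le (by
        rw [pow_two, ← p.1.star_mul_self]
        exact le_ciSup (bddAbove_compatible (star a * a)) p)
      refine (mul_self_le_mul_self (Real.iSup_nonneg fun p => apply_nonneg _ _) h).trans ?_
      rw [Real.mul_self_sqrt (Real.iSup_nonneg fun p => apply_nonneg _ _)]

theorem univNorm_apply (z : FreePoly A) : (univNorm A).toSeminorm z =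
    ⨆ p : {p : CStarSeminorm (FreePoly A) // Compatible p}, p.1.toSeminorm z := rfl

theorem le_univNorm (p : CStarSeminorm (FreePoly A)) (hp : Compatible p) (z : FreePoly A) :
    p.toSeminorm z ≤ (univNorm A).toSeminorm z := by
  rw [univNorm_apply]
  exact le_ciSup (bddAbove_compatible z)
    (⟨p, hp⟩ : {p : CStarSeminorm (FreePoly A) // Compatible p})

theorem univNorm_le {z : FreePoly A} {r : ℝ}
    (h : ∀ p : CStarSeminorm (FreePoly A), Compatible p → p.toSeminorm z ≤ r) :
    (univNorm A).toSeminorm z ≤ r := by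
  rw [univNorm_apply]
  exact ciSup_le fun p => h p.1 p.2

theorem univNorm_eq_zero {z : FreePoly A}
    (h : ∀ p : CStarSeminorm (FreePoly A), Compatible p → p.toSeminorm z = 0) :
    (univNorm A).toSeminorm z = 0 :=
  le_antisymm (univNorm_le fun p hp => (h p hp).le) (apply_nonneg _ _)

theorem univNorm_compatible : Compatible (univNorm A) where
  le_l x := univNorm_le fun _ hp => hp.le_l x
  le_r x := univNorm_le fun _ hp => hp.le_r x
  add_l x y := univNorm_eq_zero fun _ hp => hp.add_l x y
  add_r x y := univNorm_eq_zero fun _ hp => hp.add_r x y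
  smul_l x y := univNorm_eq_zero fun _ hp => hp.smul_l x y
  smul_r x y := univNorm_eq_zero fun _ hp => hp.smul_r x y
  mul_l x y := univNorm_eq_zero fun _ hp => hp.mul_l x y
  mul_r x y := univNorm_eq_zero fun _ hp => hp.mul_r x y

end Norm

end FreePoly

/-- The C*-algebraic free product `QA = A ⋆ A`. -/
def QAlg (A : Type u) [NonUnitalCStarAlgebra A] : Type u := (FreePoly.univNorm A).Compl

namespace QAlg

open FreePoly CStarSeminorm

variable (A : Type u) [NonUnitalCStarAlgebra A]

instance : NonUnitalCStarAlgebra (QAlg A) :=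
  inferInstanceAs (NonUnitalCStarAlgebra (FreePoly.univNorm A).Compl)

/-- The canonical `*`-homomorphism from polynomials to `QA`. -/
def ofPoly : FreePoly A →⋆ₙₐ[ℂ] QAlg A := Compl.of (univNorm A)

variable {A}

theorem norm_ofPoly (z : FreePoly A) : ‖ofPoly A z‖ = (univNorm A).toSeminorm z :=
  Compl.norm_of _ z

theorem ofPoly_eq {z z' : FreePoly A} (h : (univNorm A).toSeminorm (z - z') = 0) :
    ofPoly A z = ofPoly A z' := by
  rw [← sub_eq_zero, ← map_sub, ← norm_eq_zero, norm_ofPoly, h]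

variable (A)

/-- The inclusion `ι` of the first copy of `A` in `QA`. -/
def ι : A →⋆ₙₐ[ℂ] QAlg A where
  toFun x := ofPoly A (letter (.inl x))
  map_smul' c x := (ofPoly_eq (univNorm_compatible.smul_l c x)).trans (map_smul _ _ _)
  map_zero' := by
    have h := univNorm_compatible (A := A) |>.le_l 0
    rw [norm_zero, ← norm_ofPoly] at h
    exact norm_le_zero_iff.1 h
  map_add' x y := (ofPoly_eq (univNorm_compatible.add_l x y)).trans (map_add _ _ _)
  map_mul' x y := (ofPoly_eq (univNorm_compatible.mul_l x y)).trans (map_mul _ _ _)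
  map_star' x := by rw [← map_star, star_letter]; rfl

/-- The inclusion `ῑ` of the second copy of `A` in `QA`. -/
def ιbar : A →⋆ₙₐ[ℂ] QAlg A where
  toFun x := ofPoly A (letter (.inr x))
  map_smul' c x := (ofPoly_eq (univNorm_compatible.smul_r c x)).trans (map_smul _ _ _)
  map_zero' := by
    have h := univNorm_compatible (A := A) |>.le_r 0
    rw [norm_zero, ← norm_ofPoly] at h
    exact norm_le_zero_iff.1 h
  map_add' x y := (ofPoly_eq (univNorm_compatible.add_r x y)).trans (map_add _ _ _)
  map_mul' x y := (ofPoly_eq (univNorm_compatible.mul_r x y)).trans (map_mul _ _ _)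
  map_star' x := by rw [← map_star, star_letter]; rfl

variable {A} {E : Type*} [NonUnitalCStarAlgebra E]

/-- The `*`-homomorphism on polynomials given by a pair of `*`-homomorphisms on `A`. -/
def liftPoly (f g : A →⋆ₙₐ[ℂ] E) : FreePoly A →⋆ₙₐ[ℂ] E :=
  evalStar (Sum.elim f g) (by rintro (x | x) <;> simp [map_star])

theorem compatible_liftPoly (f g : A →⋆ₙₐ[ℂ] E) : Compatible (pullbackNorm (liftPoly f g)) := by
  have hl : ∀ x, liftPoly f g (letter (.inl x)) = f x := fun x => evalStar_letter _ _ _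
  have hr : ∀ x, liftPoly f g (letter (.inr x)) = g x := fun x => evalStar_letter _ _ _
  constructor <;> intros
  · change ‖liftPoly f g _‖ ≤ _
    rw [hl]; exact NonUnitalStarAlgHom.norm_apply_le f _
  · change ‖liftPoly f g _‖ ≤ _
    rw [hr]; exact NonUnitalStarAlgHom.norm_apply_le g _
  all_goals
    change ‖liftPoly f g _‖ = 0
    simp [hl, hr]

/-- The homomorphism `f ⋆ g : QA → E` that restricts to `f` and `g` on the two copies of `A`. -/
def lift (f g : A →⋆ₙₐ[ℂ] E) : QAlg A →⋆ₙₐ[ℂ] E :=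
  Compl.lift (liftPoly f g) (le_univNorm _ (compatible_liftPoly f g))

theorem lift_ι (f g : A →⋆ₙₐ[ℂ] E) (x : A) : lift f g (ι A x) = f x :=
  (Compl.lift_of _ _ _).trans (evalStar_letter _ _ _)

theorem lift_ιbar (f g : A →⋆ₙₐ[ℂ] E) (x : A) : lift f g (ιbar A x) = g x :=
  (Compl.lift_of _ _ _).trans (evalStar_letter _ _ _)

/-- Homomorphisms on `QA` are determined by their restrictions to the two copies of `A`. -/
theorem hom_ext {f g : QAlg A →⋆ₙₐ[ℂ] E} (h : ∀ x, f (ι A x) = g (ι A x))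
    (h' : ∀ x, f (ιbar A x) = g (ιbar A x)) : f = g := by
  have key : ∀ z, f (ofPoly A z) = g (ofPoly A z) := by
    apply induction
    · simp
    · intro z z' hz hz'; simp only [map_add, hz, hz']
    · intro w c
      have hw : mono w c = c • mono w 1 := by rw [smul_mono, mul_one]
      rw [hw, map_smul, map_smul, map_smul]
      congr 1
      induction w using FreeSemigroup.recOnMul with
      | ih1 x =>
        cases x with
        | inl x => exact h x
        | inr x => exact h' x
      | ih2 x y hx hy =>
        have hxy : mono (FreeSemigroup.of x * y) 1 = mono (FreeSemigroup.of x) 1 * mono y 1 := by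
          rw [mono_mul, mul_one]
        rw [hxy, map_mul, map_mul, map_mul, hx (by rw [smul_mono, mul_one]),
          hy (by rw [smul_mono, mul_one])]
  exact DFunLike.coe_injective ((Compl.denseRange_of (univNorm A)).equalizer (continuous_cstarHom f)
    (continuous_cstarHom g) (funext key))
end QAlg

/-- `qA`, the kernel of the homomorphism `QA → A` that identifies the two copies of `A`. -/
def qSub (A : Type u) [NonUnitalCStarAlgebra A] : NonUnitalStarSubalgebra ℂ (QAlg A) where
  carrier := {z | QAlg.lift (NonUnitalStarAlgHom.id ℂ A) (NonUnitalStarAlgHom.id ℂ A) z = 0}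
  add_mem' {a b} ha hb := by
    rw [Set.mem_ofPred_eq] at *; rw [map_add, ha, hb, add_zero]
  zero_mem' := map_zero _
  mul_mem' {a b} ha hb := by
    rw [Set.mem_ofPred_eq] at *; rw [map_mul, ha, hb, mul_zero]
  smul_mem' c a ha := by
    rw [Set.mem_ofPred_eq] at *; rw [map_smul, ha, smul_zero]
  star_mem' {a} ha := by
    rw [Set.mem_ofPred_eq] at *; rw [map_star, ha, star_zero]

instance (A : Type u) [NonUnitalCStarAlgebra A] : IsClosed (qSub A : Set (QAlg A)) :=
  isClosed_eq (continuous_cstarHom _) continuous_const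

/-- The C*-algebra `qA`. -/
abbrev qAlg (A : Type u) [NonUnitalCStarAlgebra A] : Type u := qSub A

namespace qAlg

variable {A : Type u} [NonUnitalCStarAlgebra A]

theorem mem_iff (z : QAlg A) : z ∈ qSub A ↔
    QAlg.lift (NonUnitalStarAlgHom.id ℂ A) (NonUnitalStarAlgHom.id ℂ A) z = 0 := Iff.rfl

/-- The element `qx = ι(x) - ῑ(x)` of `qA`. -/
def q (x : A) : qAlg A :=
  ⟨QAlg.ι A x - QAlg.ιbar A x, by
    rw [mem_iff, map_sub, QAlg.lift_ι, QAlg.lift_ιbar, sub_self]⟩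

/-- The inclusion of `qA` in `QA`. -/
def incl (A : Type u) [NonUnitalCStarAlgebra A] : qAlg A →⋆ₙₐ[ℂ] QAlg A :=
  NonUnitalStarSubalgebraClass.subtype (qSub A)

/-- The evaluation map `π_A : qA → A`, the restriction to `qA` of `id ⋆ 0 : QA → A`. -/
def π (A : Type u) [NonUnitalCStarAlgebra A] : qAlg A →⋆ₙₐ[ℂ] A :=
  (QAlg.lift (NonUnitalStarAlgHom.id ℂ A) 0).comp (incl A)

theorem π_q (x : A) : π A (q x) = x := by
  change QAlg.lift _ _ (QAlg.ι A x - QAlg.ιbar A x) = x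
  rw [map_sub, QAlg.lift_ι, QAlg.lift_ιbar]
  simp

end qAlg

attribute [local instance] CStarAlgebra.spectralOrder CStarAlgebra.spectralOrderedRing

/-- The infinite matrices over `B` with finitely many non-zero entries. -/
def finMatSubmodule (B : Type u) [NonUnitalCStarAlgebra B] : Submodule ℂ (ℕ → ℕ → B) where
  carrier := {M | ∃ n, ∀ i j, n ≤ i ∨ n ≤ j → M i j = 0}
  add_mem' := by
    rintro M N ⟨m, hm⟩ ⟨n, hn⟩
    refine ⟨max m n, fun i j h => ?_⟩
    simp only [max_le_iff] at h
    rw [Pi.add_apply, Pi.add_apply, hm i j (by tauto), hn i j (by tauto), add_zero]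
  zero_mem' := ⟨0, fun _ _ _ => rfl⟩
  smul_mem' := by
    rintro c M ⟨m, hm⟩
    refine ⟨m, fun i j h => ?_⟩
    rw [Pi.smul_apply, Pi.smul_apply, hm i j h, smul_zero]

/-- The `*`-algebra `M_∞(B)` of infinite matrices over `B` with finitely many non-zero entries. -/
def FinMat (B : Type u) [NonUnitalCStarAlgebra B] : Type u := finMatSubmodule B

namespace FinMat

variable {B : Type u} [NonUnitalCStarAlgebra B]

instance : AddCommGroup (FinMat B) := inferInstanceAs (AddCommGroup (finMatSubmodule B))
instance : Module ℂ (FinMat B) := inferInstanceAs (Module ℂ (finMatSubmodule B))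

/-- The entries of a matrix. -/
def entry (M : FinMat B) (i j : ℕ) : B := M.1 i j

/-- All non-zero entries of `M` are in the upper left `n × n` block. -/
def Within (n : ℕ) (M : FinMat B) : Prop := ∀ i j, n ≤ i ∨ n ≤ j → M.entry i j = 0

theorem exists_within (M : FinMat B) : ∃ n, Within n M := M.2

theorem Within.mono {n m : ℕ} {M : FinMat B} (h : Within n M) (hnm : n ≤ m) : Within m M :=
  fun i j hij => h i j (by omega)

theorem ext {M N : FinMat B} (h : ∀ i j, M.entry i j = N.entry i j) : M = N :=
  Subtype.ext (funext fun i => funext fun j => h i j)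

theorem entry_add (M N : FinMat B) (i j : ℕ) : (M + N).entry i j = M.entry i j + N.entry i j := rfl
theorem entry_zero (i j : ℕ) : (0 : FinMat B).entry i j = 0 := rfl
theorem entry_smul (c : ℂ) (M : FinMat B) (i j : ℕ) : (c • M).entry i j = c • M.entry i j := rfl

/-- The matrix with given entries, all in the upper left `n × n` block. -/
def ofFun (f : ℕ → ℕ → B) (n : ℕ) (h : ∀ i j, n ≤ i ∨ n ≤ j → f i j = 0) : FinMat B :=
  ⟨f, n, h⟩

theorem entry_ofFun (f : ℕ → ℕ → B) (n : ℕ) (h : ∀ i j, n ≤ i ∨ n ≤ j → f i j = 0) (i j : ℕ) :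
    (ofFun f n h).entry i j = f i j := rfl

theorem within_ofFun (f : ℕ → ℕ → B) (n : ℕ) (h : ∀ i j, n ≤ i ∨ n ≤ j → f i j = 0) :
    Within n (ofFun f n h) := h

/-- The size of the smallest upper left block that contains all non-zero entries. -/
def size (M : FinMat B) : ℕ := sInf {n | Within n M}

theorem within_size (M : FinMat B) : Within M.size M := Nat.sInf_mem M.exists_within

/-- Matrix multiplication. -/
instance : Mul (FinMat B) where
  mul M N := ofFun (fun i k => ∑ j ∈ Finset.range M.size, M.entry i j * N.entry j k)
    (max M.size N.size) (by
      intro i k h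
      simp only [max_le_iff] at h
      refine Finset.sum_eq_zero fun j _ => ?_
      rcases h with h | h
      · rw [M.within_size i j (by tauto), zero_mul]
      · rw [N.within_size j k (by tauto), mul_zero])

/-- The conjugate transpose. -/
instance : Star (FinMat B) where
  star M := ofFun (fun i j => star (M.entry j i)) M.size fun i j h =>
    (congrArg star (M.within_size j i (by tauto))).trans (star_zero B)

theorem entry_star (M : FinMat B) (i j : ℕ) : (star M).entry i j = star (M.entry j i) := rfl

theorem entry_mul_of_within {n : ℕ} {M : FinMat B} (hM : Within n M) (N : FinMat B) (i k : ℕ) :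
    (M * N).entry i k = ∑ j ∈ Finset.range n, M.entry i j * N.entry j k := by
  change ∑ j ∈ Finset.range M.size, M.entry i j * N.entry j k = _
  refine Finset.sum_subset (Finset.range_mono (Nat.sInf_le hM)) fun j _ hj => ?_
  rw [M.within_size i j (by simp at hj; omega), zero_mul]

theorem Within.mul {n : ℕ} {M N : FinMat B} (hM : Within n M) (hN : Within n N) :
    Within n (M * N) := by
  intro i k h
  rw [entry_mul_of_within hM]
  refine Finset.sum_eq_zero fun j _ => ?_
  rcases h with h | h
  · rw [hM i j (by tauto), zero_mul]
  · rw [hN j k (by tauto), mul_zero]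

theorem Within.star {n : ℕ} {M : FinMat B} (hM : Within n M) : Within n (star M) := fun i j h => by
  rw [entry_star, hM j i (by tauto), star_zero]

theorem Within.add {n : ℕ} {M N : FinMat B} (hM : Within n M) (hN : Within n N) :
    Within n (M + N) := fun i j h => by rw [entry_add, hM i j h, hN i j h, add_zero]

theorem exists_within₂ (M N : FinMat B) : ∃ n, Within n M ∧ Within n N := by
  obtain ⟨m, hm⟩ := M.exists_within
  obtain ⟨n, hn⟩ := N.exists_within
  exact ⟨max m n, hm.mono (le_max_left _ _), hn.mono (le_max_right _ _)⟩

instance : NonUnitalRing (FinMat B) :=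
  { (inferInstance : AddCommGroup (FinMat B)), (inferInstance : Mul (FinMat B)) with
    zero_mul := fun M => ext fun i k => by
      rw [entry_mul_of_within (n := 0) (fun _ _ _ => rfl)]; rfl
    mul_zero := fun M => ext fun i k => by
      obtain ⟨n, hn⟩ := M.exists_within
      rw [entry_mul_of_within hn]
      simp [entry_zero]
    left_distrib := fun M N L => ext fun i k => by
      obtain ⟨n, hn⟩ := M.exists_within
      simp only [entry_add, entry_mul_of_within hn, mul_add, Finset.sum_add_distrib]
    right_distrib := fun M N L => ext fun i k => by
      obtain ⟨n, hn, hn'⟩ := exists_within₂ M N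
      simp only [entry_add, entry_mul_of_within hn, entry_mul_of_within hn',
        entry_mul_of_within (hn.add hn'), add_mul, Finset.sum_add_distrib]
    mul_assoc := fun M N L => ext fun i k => by
      obtain ⟨n, hn, hn'⟩ := exists_within₂ M N
      simp only [entry_mul_of_within hn, entry_mul_of_within hn',
        entry_mul_of_within (hn.mul hn'), Finset.sum_mul, Finset.mul_sum, mul_assoc]
      exact Finset.sum_comm }

instance : StarRing (FinMat B) where
  star_involutive M := ext fun i j => by rw [entry_star, entry_star, star_star]
  star_add M N := ext fun i j => by simp only [entry_star, entry_add, star_add]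
  star_mul M N := ext fun i k => by
    obtain ⟨n, hn, hn'⟩ := exists_within₂ M N
    simp only [entry_star, entry_mul_of_within hn, entry_mul_of_within hn'.star, star_sum, star_mul]

instance : StarModule ℂ (FinMat B) where
  star_smul c M := ext fun i j => by simp only [entry_star, entry_smul, star_smul]

instance : IsScalarTower ℂ (FinMat B) (FinMat B) where
  smul_assoc c M N := ext fun i k => by
    obtain ⟨n, hn⟩ := M.exists_within
    have hn' : Within n (c • M) := fun i j h => by rw [entry_smul, hn i j h, smul_zero]
    simp only [smul_eq_mul, entry_smul, entry_mul_of_within hn, entry_mul_of_within hn',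
      Finset.smul_sum, smul_mul_assoc]

instance : SMulCommClass ℂ (FinMat B) (FinMat B) where
  smul_comm c M N := ext fun i k => by
    obtain ⟨n, hn⟩ := M.exists_within
    simp only [smul_eq_mul, entry_smul, entry_mul_of_within hn, Finset.smul_sum, mul_smul_comm]

/-- The upper left `n × n` block of a matrix. -/
def block (n : ℕ) (M : FinMat B) : CStarMatrix (Fin n) (Fin n) B :=
  CStarMatrix.ofMatrix (Matrix.of fun i j => M.entry i j)

theorem block_apply (n : ℕ) (M : FinMat B) (i j : Fin n) : block n M i j = M.entry i j := rfl

theorem block_mul {n : ℕ} {M : FinMat B} (hM : Within n M) (N : FinMat B) :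
    block n (M * N) = block n M * block n N := by
  ext i k
  rw [block_apply, entry_mul_of_within hM, CStarMatrix.mul_apply, Finset.sum_range]
  rfl

theorem block_star (n : ℕ) (M : FinMat B) : block n (star M) = star (block n M) := rfl
theorem block_add (n : ℕ) (M N : FinMat B) : block n (M + N) = block n M + block n N := rfl
theorem block_smul (n : ℕ) (c : ℂ) (M : FinMat B) : block n (c • M) = c • block n M := rfl

variable (B) in
/-- The embedding of `M_n(B)` in `M_∞(B)` as the upper left block. -/
def embed (n : ℕ) : CStarMatrix (Fin n) (Fin n) B →⋆ₙₐ[ℂ] FinMat B where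
  toFun M := ofFun (fun i j => if h : i < n ∧ j < n then M ⟨i, h.1⟩ ⟨j, h.2⟩ else 0) n
    fun i j h => dif_neg (by omega)
  map_smul' c M := ext fun i j => by
    rw [entry_smul, entry_ofFun, entry_ofFun]
    split_ifs
    · rfl
    · exact (smul_zero _).symm
  map_zero' := ext fun i j => by
    rw [entry_zero, entry_ofFun]
    split_ifs <;> rfl
  map_add' M N := ext fun i j => by
    rw [entry_add, entry_ofFun, entry_ofFun, entry_ofFun]
    split_ifs
    · rfl
    · exact (add_zero _).symm
  map_mul' M N := ext fun i k => by
    rw [entry_mul_of_within (within_ofFun _ n _), entry_ofFun]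
    simp only [entry_ofFun]
    by_cases hi : i < n
    · by_cases hk : k < n
      · simp [hi, hk, CStarMatrix.mul_apply, Finset.sum_range]
      · simp [hk]
    · simp [hi]
  map_star' M := ext fun i j => by
    rw [entry_star, entry_ofFun, entry_ofFun]
    by_cases h : i < n ∧ j < n
    · rw [dif_pos h, dif_pos ⟨h.2, h.1⟩]; rfl
    · rw [dif_neg h, dif_neg (by tauto), star_zero]

theorem embed_entry (n : ℕ) (M : CStarMatrix (Fin n) (Fin n) B) (i j : ℕ) :
    (embed B n M).entry i j = if h : i < n ∧ j < n then M ⟨i, h.1⟩ ⟨j, h.2⟩ else 0 := rfl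

theorem within_embed (n : ℕ) (M : CStarMatrix (Fin n) (Fin n) B) : Within n (embed B n M) :=
  fun i j h => dif_neg (by omega)

theorem block_embed (n : ℕ) (M : CStarMatrix (Fin n) (Fin n) B) : block n (embed B n M) = M := by
  ext i j
  rw [block_apply, embed_entry, dif_pos ⟨i.2, j.2⟩]

theorem embed_block {n : ℕ} {M : FinMat B} (hM : Within n M) : embed B n (block n M) = M := by
  refine ext fun i j => ?_
  rw [embed_entry]
  split_ifs with h
  · rfl
  · exact (hM i j (by omega)).symm

theorem norm_block_eq {n m : ℕ} (hnm : n ≤ m) {M : FinMat B} (hM : Within n M) :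
    ‖block m M‖ = ‖block n M‖ := by
  let φ : CStarMatrix (Fin n) (Fin n) B →⋆ₙₐ[ℂ] CStarMatrix (Fin m) (Fin m) B :=
    { toFun := fun N => block m (embed B n N)
      map_smul' := fun c N => by rw [map_smul, block_smul]; rfl
      map_zero' := by rw [map_zero]; rfl
      map_add' := fun N L => by rw [map_add, block_add]
      map_mul' := fun N L => by rw [map_mul, block_mul ((within_embed n N).mono hnm)]
      map_star' := fun N => by rw [map_star, block_star] }
  have hφ : Function.Injective φ := by
    intro N L h
    have h' : embed B n N = embed B n L := by
      rw [← embed_block ((within_embed n N).mono hnm), ← embed_block ((within_embed n L).mono hnm)]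
      exact congrArg _ h
    rw [← block_embed n N, h', block_embed]
  have := NonUnitalStarAlgHom.norm_map φ hφ (block n M)
  rw [← this]
  change _ = ‖block m (embed B n (block n M))‖
  rw [embed_block hM]

theorem norm_block_size {n : ℕ} {M : FinMat B} (hM : Within n M) :
    ‖block M.size M‖ = ‖block n M‖ := (norm_block_eq (Nat.sInf_le hM) M.within_size).symm

variable (B) in
/-- The C*-norm on `M_∞(B)`: the norm of `M` is its norm in the C*-algebra `M_n(B)`,
for any `n` such that all non-zero entries of `M` are in the upper left `n × n` block. -/
def matNorm : CStarSeminorm (FinMat B) where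
  toFun M := ‖block M.size M‖
  map_zero' := by
    rw [norm_block_size (n := 0) (fun _ _ _ => rfl)]
    exact norm_zero
  add_le' M N := by
    obtain ⟨n, hn, hn'⟩ := exists_within₂ M N
    rw [norm_block_size hn, norm_block_size hn', norm_block_size (hn.add hn')]
    exact norm_add_le _ _
  neg' M := by
    have hn : Within M.size (-M) := fun i j h => neg_eq_zero.2 (M.within_size i j h)
    rw [norm_block_size hn]
    exact norm_neg _
  smul' c M := by
    have hn : Within M.size (c • M) := fun i j h => by
      rw [entry_smul, M.within_size i j h, smul_zero]
    rw [norm_block_size hn, block_smul, norm_smul]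
  mul_le' M N := by
    obtain ⟨n, hn, hn'⟩ := exists_within₂ M N
    change ‖block (M * N).size (M * N)‖ ≤ ‖block M.size M‖ * ‖block N.size N‖
    rw [norm_block_size hn, norm_block_size hn', norm_block_size (hn.mul hn'), block_mul hn]
    exact norm_mul_le _ _
  star_mul_self' M := by
    have hn := M.within_size
    change ‖block (star M * M).size (star M * M)‖ = ‖block M.size M‖ * ‖block M.size M‖
    rw [norm_block_size (hn.star.mul hn), block_mul hn.star, block_star,
      CStarRing.norm_star_mul_self]

theorem matNorm_apply (M : FinMat B) : (matNorm B).toSeminorm M = ‖block M.size M‖ := rfl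

/-- Every `*`-homomorphism of `M_∞(B)` to a C*-algebra is contractive. -/
theorem norm_hom_le {E : Type*} [NonUnitalCStarAlgebra E] (h : FinMat B →⋆ₙₐ[ℂ] E)
    (M : FinMat B) : ‖h M‖ ≤ (matNorm B).toSeminorm M := by
  have := NonUnitalStarAlgHom.norm_apply_le (h.comp (embed B M.size)) (block M.size M)
  rwa [NonUnitalStarAlgHom.comp_apply, embed_block M.within_size] at this

variable (B) in
/-- The matrix `e₁₁ ⊗ b`. -/
def corner : B →⋆ₙₐ[ℂ] FinMat B where
  toFun b := ofFun (fun i j => if i = 0 ∧ j = 0 then b else 0) 1 fun i j h => if_neg (by omega)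
  map_smul' c x := ext fun i j => by
    rw [entry_smul, entry_ofFun, entry_ofFun]; split_ifs <;> simp
  map_zero' := ext fun i j => by rw [entry_zero, entry_ofFun]; simp
  map_add' x y := ext fun i j => by
    rw [entry_add, entry_ofFun, entry_ofFun, entry_ofFun]; split_ifs <;> simp
  map_mul' x y := ext fun i j => by
    rw [entry_mul_of_within (within_ofFun _ 1 _), Finset.sum_range_one]
    simp only [entry_ofFun]
    by_cases hi : i = 0 <;> by_cases hj : j = 0 <;> simp [hi, hj]
  map_star' x := ext fun i j => by
    rw [entry_star, entry_ofFun, entry_ofFun]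
    by_cases hi : i = 0 <;> by_cases hj : j = 0 <;> simp [hi, hj]

/-- The entrywise application of a `*`-homomorphism. -/
def map {C : Type*} [NonUnitalCStarAlgebra C] (f : B →⋆ₙₐ[ℂ] C) : FinMat B →⋆ₙₐ[ℂ] FinMat C where
  toFun M := ofFun (fun i j => f (M.entry i j)) M.size fun i j h =>
    (congrArg f (M.within_size i j h)).trans (map_zero f)
  map_smul' c x := ext fun i j => map_smul f _ _
  map_zero' := ext fun i j => map_zero f
  map_add' x y := ext fun i j => map_add f _ _
  map_mul' M N := ext fun i k => by
    rw [entry_mul_of_within (within_ofFun _ M.size _), entry_ofFun,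
      entry_mul_of_within M.within_size, map_sum]
    exact Finset.sum_congr rfl fun j _ => map_mul f _ _
  map_star' x := ext fun i j => map_star f _

theorem entry_map {C : Type*} [NonUnitalCStarAlgebra C] (f : B →⋆ₙₐ[ℂ] C) (M : FinMat B)
    (i j : ℕ) : (map f M).entry i j = f (M.entry i j) := rfl

/-- The relabelling of indices along the embedding `i ↦ 2 i + k` (`k = 0` or `1`),
`e_ij ⊗ b ↦ e_{2i+k, 2j+k} ⊗ b`. -/
def spread (k : Fin 2) : FinMat B →⋆ₙₐ[ℂ] FinMat B where
  toFun M := ofFun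
    (fun i j => if i % 2 = k ∧ j % 2 = k then M.entry (i / 2) (j / 2) else 0) (2 * M.size)
    fun i j h => by
      split_ifs
      · exact M.within_size _ _ (by omega)
      · rfl
  map_smul' c M := ext fun i j => by
    rw [entry_smul, entry_ofFun, entry_ofFun]; split_ifs <;> simp [entry_smul]
  map_zero' := ext fun i j => by rw [entry_zero, entry_ofFun]; simp [entry_zero]
  map_add' M N := ext fun i j => by
    rw [entry_add, entry_ofFun, entry_ofFun, entry_ofFun]; split_ifs <;> simp [entry_add]
  map_mul' M N := ext fun i j => by
    rw [entry_mul_of_within (within_ofFun _ _ _)]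
    simp only [entry_ofFun]
    by_cases hi : i % 2 = k
    · by_cases hj : j % 2 = k
      · simp only [hi, hj, true_and, and_true, if_true, entry_mul_of_within M.within_size]
        have h : ∀ (f : ℕ → B) (s : ℕ), ∑ m ∈ Finset.range (2 * s), f m =
            ∑ m ∈ Finset.range s, (f (2 * m) + f (2 * m + 1)) := by
          intro f s
          induction s with
          | zero => rfl
          | succ s ih =>
            rw [mul_add, mul_one, Finset.sum_range_succ, Finset.sum_range_succ, ih,
              Finset.sum_range_succ, add_assoc]
        rw [h]
        refine Finset.sum_congr rfl fun m _ => ?_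
        have h2 : (2 * m + 1) / 2 = m := by omega
        fin_cases k <;> simp [h2, Nat.add_mod]
      · simp [hj]
    · simp [hi]
  map_star' M := ext fun i j => by
    rw [entry_star, entry_ofFun, entry_ofFun]
    by_cases hi : i % 2 = k <;> by_cases hj : j % 2 = k <;> simp [hi, hj, entry_star]

theorem entry_spread (k : Fin 2) (M : FinMat B) (i j : ℕ) : (spread k M).entry i j =
    if i % 2 = k ∧ j % 2 = k then M.entry (i / 2) (j / 2) else 0 := rfl

theorem spread_mul_spread {k l : Fin 2} (hkl : k ≠ l) (M N : FinMat B) :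
    spread k M * spread l N = 0 := ext fun i j => by
  rw [entry_mul_of_within (within_size _), entry_zero]
  refine Finset.sum_eq_zero fun m _ => ?_
  rw [entry_spread, entry_spread]
  by_cases hk : m % 2 = k
  · have hl : m % 2 ≠ l := fun h => hkl (Fin.ext (hk.symm.trans h))
    simp [hl]
  · simp [hk]

end FinMat

/-- The stabilization `K ⊗ B`, where `K` is the algebra of compact operators on `ℓ²(ℕ)`:
the completion of `M_∞(B) = ⋃ₙ M_n(B)` in its C*-norm. -/
def Stab (B : Type u) [NonUnitalCStarAlgebra B] : Type u := (FinMat.matNorm B).Compl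

namespace Stab

open CStarSeminorm

variable {B : Type u} [NonUnitalCStarAlgebra B]

instance : NonUnitalCStarAlgebra (Stab B) :=
  inferInstanceAs (NonUnitalCStarAlgebra (FinMat.matNorm B).Compl)

variable (B) in
/-- The inclusion of `M_∞(B)` in `K ⊗ B`. -/
def ofMat : FinMat B →⋆ₙₐ[ℂ] Stab B := Compl.of (FinMat.matNorm B)

theorem denseRange_ofMat : DenseRange (ofMat B) := Compl.denseRange_of (FinMat.matNorm B)

/-- The extension to `K ⊗ B` of a homomorphism on `M_∞(B)`. -/
def lift {E : Type*} [NonUnitalCStarAlgebra E] (h : FinMat B →⋆ₙₐ[ℂ] E) : Stab B →⋆ₙₐ[ℂ] E :=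
  Compl.lift h (FinMat.norm_hom_le h)

theorem lift_ofMat {E : Type*} [NonUnitalCStarAlgebra E] (h : FinMat B →⋆ₙₐ[ℂ] E)
    (M : FinMat B) : lift h (ofMat B M) = h M := Compl.lift_of _ _ _

variable (B) in
/-- The corner embedding `b ↦ e₁₁ ⊗ b`. -/
def corner : B →⋆ₙₐ[ℂ] Stab B := (ofMat B).comp (FinMat.corner B)

/-- The homomorphism `id_K ⊗ f : K ⊗ B → K ⊗ C`. -/
def map {C : Type*} [NonUnitalCStarAlgebra C] (f : B →⋆ₙₐ[ℂ] C) : Stab B →⋆ₙₐ[ℂ] Stab C :=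
  lift ((ofMat C).comp (FinMat.map f))

/-- The endomorphism `Ad(S_k) ⊗ id_B` of `K ⊗ B`, where `S_k` is the isometry of `ℓ²(ℕ)`
that maps the basis vector `δ_i` to `δ_{2i+k}` (`k = 0, 1`). -/
def spread (k : Fin 2) : Stab B →⋆ₙₐ[ℂ] Stab B := lift ((ofMat B).comp (FinMat.spread k))

theorem spread_mul_spread {k l : Fin 2} (hkl : k ≠ l) (x y : Stab B) :
    spread k x * spread l y = 0 := by
  refine denseRange_ofMat.induction_on₂ (p := fun x y => spread k x * spread l y = 0)
    ?_ ?_ x y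
  · exact isClosed_eq (((continuous_cstarHom _).comp continuous_fst).mul
      ((continuous_cstarHom _).comp continuous_snd)) continuous_const
  · intro M N
    rw [spread, spread, lift_ofMat, lift_ofMat, NonUnitalStarAlgHom.comp_apply,
      NonUnitalStarAlgHom.comp_apply, ← map_mul, FinMat.spread_mul_spread hkl, map_zero]

/-- The block sum `diag(φ, ψ) : D → M₂(K ⊗ B)` of two homomorphisms `φ, ψ : D → K ⊗ B`, followed by
the isomorphism `M₂(K ⊗ B) ≅ K ⊗ B` that comes from the isomorphism `M₂(K) ≅ K`,
`(t_kl) ↦ ∑ S_k t_kl S_l*`, given by the bijection `ℕ ⊔ ℕ ≅ ℕ` onto even and odd numbers. -/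
def blockSum {D : Type*} [NonUnitalCStarAlgebra D] (φ ψ : D →⋆ₙₐ[ℂ] Stab B) :
    D →⋆ₙₐ[ℂ] Stab B where
  toFun z := spread 0 (φ z) + spread 1 (ψ z)
  map_smul' c z := by simp only [map_smul, smul_add, MonoidHom.id_apply]
  map_zero' := by simp only [map_zero, add_zero]
  map_add' z w := by simp only [map_add]; abel
  map_mul' z w := by
    have h01 := spread_mul_spread (B := B) (k := 0) (l := 1) (by decide)
    have h10 := spread_mul_spread (B := B) (k := 1) (l := 0) (by decide)
    simp only [map_mul, mul_add, add_mul, h01, h10, add_zero, zero_add]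
  map_star' z := by simp only [map_star, star_add]

theorem blockSum_apply {D : Type*} [NonUnitalCStarAlgebra D] (φ ψ : D →⋆ₙₐ[ℂ] Stab B) (z : D) :
    blockSum φ ψ z = spread 0 (φ z) + spread 1 (ψ z) := rfl

/-- For a two-sided ideal `I` of `B`, the closure `K ⊗ I` in `K ⊗ B` of the matrices with entries
in `I`. -/
def idealCarrier (I : TwoSidedIdeal B) : Set (Stab B) :=
  closure (ofMat B '' {M | ∀ i j, M.entry i j ∈ I})

theorem idealCarrier_mono {I J : TwoSidedIdeal B} (h : I ≤ J) : idealCarrier I ⊆ idealCarrier J :=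
  closure_mono (Set.image_mono fun _ hM i j => h (hM i j))

/-- The closed two-sided ideal `K ⊗ I` of `K ⊗ B`. -/
def ideal (I : TwoSidedIdeal B) : TwoSidedIdeal (Stab B) :=
  TwoSidedIdeal.mk' (idealCarrier I)
    (subset_closure ⟨0, fun _ _ => I.zero_mem, map_zero _⟩)
    (fun hx hy => map_mem_closure₂ continuous_add hx hy (by
      rintro _ ⟨M, hM, rfl⟩ _ ⟨N, hN, rfl⟩
      exact ⟨M + N, fun i j => I.add_mem (hM i j) (hN i j), map_add _ _ _⟩))
    (fun hx => map_mem_closure continuous_neg hx (by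
      rintro _ ⟨M, hM, rfl⟩
      exact ⟨-M, fun i j => I.neg_mem (hM i j), map_neg _ _⟩))
    (fun {x y} hy => map_mem_closure₂ continuous_mul (denseRange_ofMat x) hy (by
      rintro _ ⟨M, rfl⟩ _ ⟨N, hN, rfl⟩
      refine ⟨M * N, fun i j => ?_, map_mul _ _ _⟩
      rw [FinMat.entry_mul_of_within M.within_size]
      exact sum_mem fun k _ => I.mul_mem_left _ _ (hN k j)))
    (fun {x y} hx => map_mem_closure₂ continuous_mul hx (denseRange_ofMat y) (by
      rintro _ ⟨M, hM, rfl⟩ _ ⟨N, rfl⟩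
      refine ⟨M * N, fun i j => ?_, map_mul _ _ _⟩
      rw [FinMat.entry_mul_of_within M.within_size]
      exact sum_mem fun k _ => I.mul_mem_right _ _ (hM i k)))

theorem mem_ideal {I : TwoSidedIdeal B} {x : Stab B} : x ∈ ideal I ↔ x ∈ idealCarrier I :=
  TwoSidedIdeal.mem_mk' ..

theorem isClosed_ideal (I : TwoSidedIdeal B) : IsClosed (ideal I : Set (Stab B)) := by
  have : (ideal I : Set (Stab B)) = idealCarrier I := Set.ext fun _ => mem_ideal
  rw [this]; exact isClosed_closure

theorem corner_mem {I : TwoSidedIdeal B} {b : B} (hb : b ∈ I) : corner B b ∈ ideal I :=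
  mem_ideal.2 (subset_closure ⟨FinMat.corner B b, fun i j => by
    change (if i = 0 ∧ j = 0 then b else 0) ∈ I
    split_ifs
    · exact hb
    · exact I.zero_mem, rfl⟩)

theorem lift_mem {C : Type*} [NonUnitalCStarAlgebra C] {I : TwoSidedIdeal B} {J : TwoSidedIdeal C}
    {h : FinMat B →⋆ₙₐ[ℂ] FinMat C}
    (hh : ∀ M, (∀ i j, M.entry i j ∈ I) → ∀ i j, (h M).entry i j ∈ J) {x : Stab B}
    (hx : x ∈ ideal I) : lift ((ofMat C).comp h) x ∈ ideal J := by
  rw [mem_ideal] at hx ⊢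
  refine map_mem_closure (continuous_cstarHom _) hx ?_
  rintro _ ⟨M, hM, rfl⟩
  exact ⟨h M, hh M hM, (lift_ofMat ((ofMat C).comp h) M).symm⟩

theorem map_mem {C : Type*} [NonUnitalCStarAlgebra C] {I : TwoSidedIdeal B} {J : TwoSidedIdeal C}
    {f : B →⋆ₙₐ[ℂ] C} (hf : ∀ b ∈ I, f b ∈ J) {x : Stab B} (hx : x ∈ ideal I) :
    map f x ∈ ideal J := lift_mem (fun _ hM i j => hf _ (hM i j)) hx

theorem spread_mem {I : TwoSidedIdeal B} (k : Fin 2) {x : Stab B} (hx : x ∈ ideal I) :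
    spread k x ∈ ideal I := lift_mem (fun M hM i j => by
      rw [FinMat.entry_spread]
      split_ifs
      · exact hM _ _
      · exact I.zero_mem) hx

end Stab

/-- A C*-algebra with an action of a topological space `X`: an order preserving map `U ↦ A(U)` from
the open subsets of `X` to the closed two-sided ideals of `A`. -/
structure XAlgebra (X : Type v) [TopologicalSpace X] where
  carrier : Type u
  [cstar : NonUnitalCStarAlgebra carrier]
  ideal : TopologicalSpace.Opens X → TwoSidedIdeal carrier
  isClosed_ideal : ∀ U, IsClosed (ideal U : Set carrier)
  ideal_mono : ∀ U V, U ≤ V → ideal U ≤ ideal V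

namespace XAlgebra

variable {X : Type v} [TopologicalSpace X]

instance : CoeSort (XAlgebra.{u} X) (Type u) := ⟨carrier⟩

instance (A : XAlgebra.{u} X) : NonUnitalCStarAlgebra A := A.cstar

/-- `K ⊗ B` with the action `U ↦ K ⊗ B(U)`. -/
def stab (B : XAlgebra.{u} X) : XAlgebra.{u} X where
  carrier := Stab B
  ideal U := Stab.ideal (B.ideal U)
  isClosed_ideal _ := Stab.isClosed_ideal _
  ideal_mono U V h _ hx :=
    Stab.mem_ideal.2 (Stab.idealCarrier_mono (B.ideal_mono U V h) (Stab.mem_ideal.1 hx))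

end XAlgebra

variable {X : Type v} [TopologicalSpace X]

/-- A map between C*-algebras with an action of `X` is `X`-equivariant if it maps `A(U)` to `B(U)`
for every open `U`. -/
def XEquivariant (A B : XAlgebra.{u} X) (ψ : A → B) : Prop :=
  ∀ U, ∀ x ∈ A.ideal U, ψ x ∈ B.ideal U

/-- The `X`-equivariant `*`-homomorphisms `A → B`. -/
structure XHom (A B : XAlgebra.{u} X) where
  hom : A →⋆ₙₐ[ℂ] B
  equivariant : XEquivariant A B hom

/-- The composition `g ∘ f`. -/
def XHom.comp {A B C : XAlgebra.{u} X} (g : XHom B C) (f : XHom A B) : XHom A C :=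
  ⟨g.hom.comp f.hom, fun U x hx => g.equivariant U _ (f.equivariant U x hx)⟩

/-- The functor `q` on homomorphisms: `q(f) : qA → qB` is the restriction of `ι f ⋆ ῑ f`. -/
def qAlg.map {A B : Type*} [NonUnitalCStarAlgebra A] [NonUnitalCStarAlgebra B]
    (f : A →⋆ₙₐ[ℂ] B) : qAlg A →⋆ₙₐ[ℂ] qAlg B :=
  NonUnitalStarAlgHom.codRestrict
    ((QAlg.lift ((QAlg.ι B).comp f) ((QAlg.ιbar B).comp f)).comp (qAlg.incl A)) (qSub B) (by
      intro z
      have h : (QAlg.lift (NonUnitalStarAlgHom.id ℂ B) (NonUnitalStarAlgHom.id ℂ B)).comp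
          (QAlg.lift ((QAlg.ι B).comp f) ((QAlg.ιbar B).comp f)) =
          f.comp (QAlg.lift (NonUnitalStarAlgHom.id ℂ A) (NonUnitalStarAlgHom.id ℂ A)) := by
        apply QAlg.hom_ext
        · intro x
          simp only [NonUnitalStarAlgHom.comp_apply, QAlg.lift_ι]
          rfl
        · intro x
          simp only [NonUnitalStarAlgHom.comp_apply, QAlg.lift_ιbar]
          rfl
      have hz := DFunLike.congr_fun h (z : QAlg A)
      rw [qAlg.mem_iff]
      exact hz.trans ((congrArg f z.2).trans (map_zero f)))

theorem qAlg.map_q {A B : Type*} [NonUnitalCStarAlgebra A] [NonUnitalCStarAlgebra B]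
    (f : A →⋆ₙₐ[ℂ] B) (x : A) : qAlg.map f (qAlg.q x) = qAlg.q (f x) := by
  apply Subtype.ext
  change QAlg.lift _ _ (QAlg.ι A x - QAlg.ιbar A x) = QAlg.ι B (f x) - QAlg.ιbar B (f x)
  rw [map_sub, QAlg.lift_ι, QAlg.lift_ιbar]
  rfl

/-- The `q_X`-equivariant `*`-homomorphisms `φ : qA → D`: those for which `x ↦ φ(qx)` is
`X`-equivariant. -/
structure QXHom (A D : XAlgebra.{u} X) where
  hom : qAlg A →⋆ₙₐ[ℂ] D
  equivariant : XEquivariant A D fun x => hom (qAlg.q x)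

/-- The point-norm topology. A path in this topology is a homotopy in the category of
`q_X`-equivariant homomorphisms. -/
instance (A D : XAlgebra.{u} X) : TopologicalSpace (QXHom A D) :=
  TopologicalSpace.induced (fun φ (z : qAlg A) => φ.hom z) inferInstance

theorem QXHom.continuous_eval {A D : XAlgebra.{u} X} (z : qAlg A) :
    Continuous fun φ : QXHom A D => φ.hom z :=
  (continuous_pi_iff.1 (continuous_induced_dom (f := fun (φ : QXHom A D) (z : qAlg A) => φ.hom z)) z)

theorem QXHom.continuous_of {Y : Type*} [TopologicalSpace Y] {A D : XAlgebra.{u} X}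
    {F : Y → QXHom A D} (h : ∀ z, Continuous fun y => (F y).hom z) : Continuous F :=
  continuous_induced_rng.2 (continuous_pi h)

/-- `KK(X; A, B)`: the homotopy classes of `q_X`-equivariant `*`-homomorphisms `qA → K ⊗ B`. -/
def KK (A B : XAlgebra.{u} X) : Type u := ZerothHomotopy (QXHom A B.stab)

namespace KK

variable {A A' B B' : XAlgebra.{u} X}

/-- The homotopy class of a `q_X`-equivariant homomorphism. -/
def mk (φ : QXHom A B.stab) : KK A B := ZerothHomotopy.mk φ

/-- The class `[f]` of an `X`-equivariant `*`-homomorphism `f : A → B`, represented by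
`qA → A → B → K ⊗ B` (the evaluation map `π_A`, then `f`, then the corner embedding). -/
def ofHom (f : XHom A B) : KK A B :=
  mk ⟨(Stab.corner B).comp (f.hom.comp (qAlg.π A)), fun U x hx => by
    change Stab.corner B (f.hom (qAlg.π A (qAlg.q x))) ∈ Stab.ideal (B.ideal U)
    rw [qAlg.π_q]
    exact Stab.corner_mem (f.equivariant U x hx)⟩

/-- The block sum of representatives. -/
def sumRep (φ ψ : QXHom A B.stab) : QXHom A B.stab :=
  ⟨Stab.blockSum (B := B) φ.hom ψ.hom, fun U x hx =>
    (Stab.ideal (B.ideal U)).add_mem (Stab.spread_mem 0 (φ.equivariant U x hx))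
      (Stab.spread_mem 1 (ψ.equivariant U x hx))⟩

theorem continuous_sumRep :
    Continuous fun φψ : QXHom A B.stab × QXHom A B.stab => sumRep φψ.1 φψ.2 :=
  QXHom.continuous_of fun z =>
    Continuous.add (M := Stab B)
      ((continuous_cstarHom (Stab.spread (B := B) 0)).comp
        ((QXHom.continuous_eval z).comp continuous_fst))
      ((continuous_cstarHom (Stab.spread (B := B) 1)).comp
        ((QXHom.continuous_eval z).comp continuous_snd))

/-- The sum in `KK(X; A, B)`: `[φ] + [ψ] = [φ ⊕ ψ]`. -/
instance : Add (KK A B) where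
  add := Quotient.map₂ sumRep fun _ _ ⟨p⟩ _ _ ⟨p'⟩ => ⟨(p.prod p').map continuous_sumRep⟩

/-- The composition of `φ : qA → K ⊗ B` with `q(f) : qA' → qA`. -/
def pullbackRep (f : XHom A' A) (φ : QXHom A B.stab) : QXHom A' B.stab :=
  ⟨φ.hom.comp (qAlg.map f.hom), fun U x hx => by
    have h := φ.equivariant U _ (f.equivariant U x hx)
    beta_reduce at h
    rw [← qAlg.map_q] at h
    exact h⟩

/-- The map `f^* : KK(X; A, B) → KK(X; A', B)` given by an `X`-equivariant `f : A' → A`. -/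
def pullback (f : XHom A' A) : KK A B → KK A' B :=
  Quotient.map (pullbackRep f) fun _ _ ⟨p⟩ =>
    ⟨p.map (QXHom.continuous_of fun z => QXHom.continuous_eval (qAlg.map f.hom z))⟩

/-- The composition of `φ : qA → K ⊗ B` with `id_K ⊗ g : K ⊗ B → K ⊗ B'`. -/
def pushforwardRep (g : XHom B B') (φ : QXHom A B.stab) : QXHom A B'.stab :=
  ⟨(Stab.map g.hom).comp φ.hom, fun U x hx =>
    Stab.map_mem (g.equivariant U) (φ.equivariant U x hx)⟩

/-- The map `g_* : KK(X; A, B) → KK(X; A, B')` given by an `X`-equivariant `g : B → B'`. -/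
def pushforward (g : XHom B B') : KK A B → KK A B' :=
  Quotient.map (pushforwardRep g) fun _ _ ⟨p⟩ =>
    ⟨p.map (QXHom.continuous_of fun z =>
      (continuous_cstarHom (Stab.map g.hom)).comp (QXHom.continuous_eval z))⟩

end KK

end

noncomputable section

attribute [local instance] CStarAlgebra.spectralOrder CStarAlgebra.spectralOrderedRing

open Filter Topology

/-! ### Approximate units -/

/-- The canonical approximate unit of a C*-algebra. -/
def approxUnit (E : Type*) [NonUnitalCStarAlgebra E] : Filter E := CStarAlgebra.approximateUnit E

namespace approxUnit

variable {E : Type*} [NonUnitalCStarAlgebra E]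

instance : (approxUnit E).NeBot := (CStarAlgebra.increasingApproximateUnit E).neBot

theorem tendsto_mul_right (m : E) : Tendsto (fun e => e * m) (approxUnit E) (𝓝 m) :=
  (CStarAlgebra.increasingApproximateUnit E).tendsto_mul_right m

theorem tendsto_mul_left (m : E) : Tendsto (fun e => m * e) (approxUnit E) (𝓝 m) :=
  (CStarAlgebra.increasingApproximateUnit E).tendsto_mul_left m

variable (E) in
theorem eventually_norm : ∀ᶠ e in approxUnit E, ‖e‖ ≤ 1 :=
  (CStarAlgebra.increasingApproximateUnit E).eventually_norm

variable (E) in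
theorem eventually_isSelfAdjoint : ∀ᶠ e in approxUnit E, IsSelfAdjoint e :=
  (CStarAlgebra.increasingApproximateUnit E).eventually_isSelfAdjoint

theorem eventually_nonneg_map {A : Type*} [NonUnitalCStarAlgebra A] (φ : E →⋆ₙₐ[ℂ] A) :
    ∀ᶠ e in approxUnit E, 0 ≤ φ e :=
  (CStarAlgebra.increasingApproximateUnit E).eventually_nonneg.mono fun _ he => map_nonneg φ he

end approxUnit

/-! ### Closed ideals of C*-algebras -/

section ClosedIdeal

variable {A : Type*} [NonUnitalCStarAlgebra A]

/-- For `x` in a closed ideal `I` there are `y ∈ I` with `x y` close to `x`. -/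
theorem TwoSidedIdeal.exists_norm_sub_mul_lt {I : TwoSidedIdeal A} {x : A}
    (hx : x ∈ I) {ε : ℝ} (hε : 0 < ε) : ∃ y ∈ I, IsSelfAdjoint y ∧ ‖x - x * y‖ < ε := by
  set a := star x * x with ha
  have hasa : IsSelfAdjoint a := IsSelfAdjoint.star_mul_self x
  have hann : 0 ≤ a := star_mul_self_nonneg x
  obtain ⟨c, hc0, hc⟩ : ∃ c : ℝ, 0 < c ∧ √c < 2 * (ε * ε) := by
    refine ⟨(ε * ε) ^ 2, by positivity, ?_⟩
    rw [Real.sqrt_sq (by positivity)]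
    nlinarith [mul_pos hε hε]
  have hden : ∀ t : ℝ, t ^ 2 + c ≠ 0 := fun t => by positivity
  let k : ℝ → ℝ := fun t => t / (t ^ 2 + c)
  have hk : Continuous k := continuous_id.div (by fun_prop) hden
  have hk0 : k 0 = 0 := by simp [k]
  set y := a * cfcₙ k a with hy
  have hyI : y ∈ I := I.mul_mem_right _ _ (I.mul_mem_left _ _ hx)
  have hyc : y = cfcₙ (fun t => t * k t) a := by
    rw [cfcₙ_mul (fun t => t) k a (by fun_prop) rfl hk.continuousOn hk0, cfcₙ_id' ℝ a]
  have hysa : IsSelfAdjoint y := by rw [hyc]; exact cfcₙ_predicate _ _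
  refine ⟨y, hyI, hysa, ?_⟩
  have h1 : star (x - x * y) * (x - x * y) = a - a * y - (y * a - y * a * y) := by
    rw [star_sub, star_mul, hysa.star_eq, ha]
    simp only [sub_mul, mul_sub, mul_assoc]
    abel
  have hid : a = cfcₙ (fun t : ℝ => t) a := (cfcₙ_id' ℝ a).symm
  have hg : Continuous fun t : ℝ => t * k t := continuous_id.mul hk
  have h2 : a - a * y - (y * a - y * a * y) =
      cfcₙ (fun t : ℝ => t - t * (t * k t) - ((t * k t) * t - (t * k t) * t * (t * k t))) a := by
    rw [cfcₙ_sub _ _ a (by fun_prop) (by simp) (by fun_prop) (by simp),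
      cfcₙ_sub _ _ a (by fun_prop) (by simp) (by fun_prop) (by simp),
      cfcₙ_sub _ _ a (by fun_prop) (by simp) (by fun_prop) (by simp),
      cfcₙ_mul (fun t => t) (fun t => t * k t) a (by fun_prop) (by simp) (by fun_prop) (by simp),
      cfcₙ_mul (fun t => t * k t * t) (fun t => t * k t) a (by fun_prop) (by simp) (by fun_prop)
        (by simp),
      cfcₙ_mul (fun t => t * k t) (fun t => t) a (by fun_prop) (by simp) (by fun_prop) (by simp),
      ← hyc, ← hid]
  have h3 : ‖x - x * y‖ * ‖x - x * y‖ ≤ √c / 2 := by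
    rw [← CStarRing.norm_star_mul_self, h1, h2]
    refine norm_cfcₙ_le fun t ht => ?_
    have ht0 : 0 ≤ t := quasispectrum_nonneg_of_nonneg a hann t ht
    have h4 : t - t * (t * k t) - ((t * k t) * t - (t * k t) * t * (t * k t)) =
        t * c ^ 2 / (t ^ 2 + c) ^ 2 := by
      simp only [k]; field_simp [hden t]; ring
    rw [h4, Real.norm_of_nonneg (by positivity), div_le_iff₀ (by positivity)]
    obtain ⟨s, hs0, rfl⟩ : ∃ s : ℝ, 0 < s ∧ c = s ^ 2 :=
      ⟨√c, Real.sqrt_pos.2 hc0, (Real.sq_sqrt hc0.le).symm⟩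
    rw [Real.sqrt_sq hs0.le]
    have h5 : 2 * t * s ≤ t ^ 2 + s ^ 2 := by nlinarith [sq_nonneg (t - s)]
    have h6 : s ^ 2 ≤ t ^ 2 + s ^ 2 := by nlinarith [sq_nonneg t]
    have h7 : (2 * t * s) * s ^ 2 ≤ (t ^ 2 + s ^ 2) * (t ^ 2 + s ^ 2) :=
      mul_le_mul h5 h6 (by positivity) (by positivity)
    nlinarith
  by_contra hcon
  push Not at hcon
  nlinarith [mul_le_mul hcon hcon hε.le (norm_nonneg _)]

variable {I : TwoSidedIdeal A} (hI : IsClosed (I : Set A))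

include hI in
theorem TwoSidedIdeal.mem_of_forall_norm_sub_lt {x : A}
    (h : ∀ ε > 0, ∃ y ∈ I, ‖x - y‖ < ε) : x ∈ I := by
  rw [← SetLike.mem_coe, ← hI.closure_eq, Metric.mem_closure_iff]
  intro ε hε
  obtain ⟨y, hy, h⟩ := h ε hε
  exact ⟨y, hy, by rwa [dist_eq_norm]⟩

include hI in
theorem TwoSidedIdeal.star_mem_of_isClosed {x : A} (hx : x ∈ I) : star x ∈ I := by
  refine mem_of_forall_norm_sub_lt hI fun ε hε => ?_
  obtain ⟨y, hy, hys, h⟩ := exists_norm_sub_mul_lt hx hε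
  refine ⟨y * star x, I.mul_mem_right _ _ hy, ?_⟩
  rwa [← norm_star, star_sub, star_mul, star_star, hys.star_eq]

include hI in
theorem TwoSidedIdeal.smul_mem_of_isClosed (c : ℂ) {x : A} (hx : x ∈ I) : c • x ∈ I := by
  refine mem_of_forall_norm_sub_lt hI fun ε hε => ?_
  obtain ⟨y, hy, -, h⟩ := exists_norm_sub_mul_lt hx (ε := ε / (‖c‖ + 1)) (by positivity)
  refine ⟨x * (c • y), I.mul_mem_right _ _ hx, ?_⟩
  rw [mul_smul_comm, ← smul_sub, norm_smul]
  rw [lt_div_iff₀ (by positivity)] at h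
  nlinarith [norm_nonneg (x - x * y), norm_nonneg c]

/-- A closed ideal of a C*-algebra as a C*-subalgebra. -/
def TwoSidedIdeal.toStarSubalgebra (I : TwoSidedIdeal A) (hI : IsClosed (I : Set A)) :
    NonUnitalStarSubalgebra ℂ A where
  carrier := I
  add_mem' := I.add_mem
  zero_mem' := I.zero_mem
  mul_mem' ha _ := I.mul_mem_right _ _ ha
  smul_mem' c _ hx := I.smul_mem_of_isClosed hI c hx
  star_mem' hx := I.star_mem_of_isClosed hI hx

/-- A closed ideal of a C*-algebra has an approximate unit. -/
theorem TwoSidedIdeal.exists_approximateUnit (I : TwoSidedIdeal A) (hI : IsClosed (I : Set A)) :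
    ∃ l : Filter A, l.NeBot ∧ (∀ᶠ e in l, e ∈ I ∧ 0 ≤ e ∧ ‖e‖ ≤ 1) ∧
      ∀ j ∈ I, Tendsto (fun e => e * j) l (𝓝 j) ∧ Tendsto (fun e => j * e) l (𝓝 j) := by
  have : IsClosed (I.toStarSubalgebra hI : Set A) := hI
  refine ⟨(approxUnit (I.toStarSubalgebra hI)).map Subtype.val, inferInstance,
    ?_, fun j hj => ⟨?_, ?_⟩⟩
  · rw [eventually_map]
    filter_upwards [approxUnit.eventually_nonneg_map
      (NonUnitalStarSubalgebraClass.subtype (I.toStarSubalgebra hI)),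
      approxUnit.eventually_norm _] with e he he'
    exact ⟨e.2, he, he'⟩
  · rw [tendsto_map'_iff]
    exact (continuous_subtype_val.tendsto _).comp
      (approxUnit.tendsto_mul_right (⟨j, hj⟩ : I.toStarSubalgebra hI))
  · rw [tendsto_map'_iff]
    exact (continuous_subtype_val.tendsto _).comp
      (approxUnit.tendsto_mul_left (⟨j, hj⟩ : I.toStarSubalgebra hI))

include hI in
/-- Quasi-central approximate units: for a closed ideal `I` there are positive contractions in `I`
that act almost as a unit on finitely many elements of `I` and almost commute with finitely many
elements of the algebra. -/
theorem TwoSidedIdeal.exists_quasicentral (F G : Finset A) (hG : ∀ j ∈ G, j ∈ I) {ε : ℝ}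
    (hε : 0 < ε) : ∃ f ∈ I, 0 ≤ f ∧ ‖f‖ ≤ 1 ∧ (∀ j ∈ G, ‖f * j - j‖ < ε) ∧
      ∀ y ∈ F, ‖f * y - y * f‖ < ε := by
  classical
  obtain ⟨l, hl, hlI, hlj⟩ := I.exists_approximateUnit hI
  obtain ⟨C, hC1, hC⟩ : ∃ C : ℝ, 1 ≤ C ∧ ∀ y ∈ F ∪ F.image star, ‖y‖ ≤ C := by
    refine ⟨1 + ∑ y ∈ F ∪ F.image star, ‖y‖, ?_, fun y hy => ?_⟩
    · linarith [Finset.sum_nonneg fun y (_ : y ∈ F ∪ F.image star) => norm_nonneg y]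
    · linarith [Finset.single_le_sum (fun y _ => norm_nonneg y) hy]
  set F' := F ∪ F.image star with hF'
  set δ : ℝ := ε ^ 2 / (16 * C) with hδ
  have hδ0 : 0 < δ := by positivity
  let T : A → A → A := fun e y => y * e - e * y * e
  obtain ⟨e, heP, her⟩ := exists_seq_of_forall_finset_exists
    (fun e : A => e ∈ I ∧ 0 ≤ e ∧ ‖e‖ ≤ 1 ∧ ∀ j ∈ G, ‖e * j - j‖ < ε)
    (fun e e' => ∀ y ∈ F', ‖e' * T e y - T e y‖ < δ) (by
      intro s hs
      have h1 : ∀ᶠ e in l, ∀ j ∈ G, ‖e * j - j‖ < ε := by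
        rw [Filter.eventually_all_finset]
        intro j hj
        have := (tendsto_iff_norm_sub_tendsto_zero.1 (hlj j (hG j hj)).1)
        exact this.eventually_lt_const hε
      have h2 : ∀ᶠ e' in l, ∀ e ∈ s, ∀ y ∈ F', ‖e' * T e y - T e y‖ < δ := by
        rw [Filter.eventually_all_finset]
        intro e he
        rw [Filter.eventually_all_finset]
        intro y hy
        have hT : T e y ∈ I := I.sub_mem (I.mul_mem_left _ _ (hs e he).1)
          (I.mul_mem_left _ _ (hs e he).1)
        have := (tendsto_iff_norm_sub_tendsto_zero.1 (hlj _ hT).1)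
        exact this.eventually_lt_const hδ0
      obtain ⟨e', h, h', h''⟩ := (hlI.and (h1.and h2)).exists
      exact ⟨e', ⟨h.1, h.2.1, h.2.2, h'⟩, h''⟩)
  obtain ⟨n, hn⟩ := exists_nat_gt (64 * C ^ 2 / ε ^ 2)
  have hn0 : (0 : ℝ) < n := lt_of_le_of_lt (by positivity) hn
  have hmean : ∀ y ∈ F', ‖((n : ℝ)⁻¹ • ∑ k ∈ Finset.range n, T (e k) y)‖ < ε / 2 := by
    intro y hy
    set S := ∑ k ∈ Finset.range n, T (e k) y with hS
    have hTn : ∀ k, ‖T (e k) y‖ ≤ 2 * C := fun k => by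
      have h1 : ‖y * e k‖ ≤ C := (norm_mul_le _ _).trans (by
        nlinarith [hC y hy, (heP k).2.2.1, norm_nonneg y, norm_nonneg (e k)])
      have h2 : ‖e k * y * e k‖ ≤ C := by
        rw [mul_assoc]
        exact (norm_mul_le _ _).trans (by
          nlinarith [(heP k).2.2.1, norm_nonneg (y * e k), norm_nonneg (e k)])
      exact (norm_sub_le _ _).trans (by linarith)
    have hlt : ∀ k m, k < m → ‖star (T (e k) y) * T (e m) y‖ ≤ δ * C := by
      intro k m hkm
      have hsa : star (e m) = e m := (IsSelfAdjoint.of_nonneg (heP m).2.1).star_eq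
      have h1 : star (T (e k) y) * T (e m) y =
          -(star (e m * T (e k) y - T (e k) y) * (y * e m)) := by
        have h0 : T (e m) y = y * e m - e m * (y * e m) := by simp only [T, mul_assoc]
        rw [h0]
        generalize T (e k) y = t
        rw [star_sub, star_mul, hsa]
        simp only [sub_mul, mul_sub, mul_assoc]
        abel
      rw [h1, norm_neg]
      refine (norm_mul_le _ _).trans (mul_le_mul ?_ ?_ (norm_nonneg _) hδ0.le)
      · rw [norm_star]; exact (her k m hkm y hy).le
      · exact (norm_mul_le _ _).trans (by
          nlinarith [hC y hy, (heP m).2.2.1, norm_nonneg y, norm_nonneg (e m)])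
    have hne : ∀ k m, k ≠ m → ‖star (T (e k) y) * T (e m) y‖ ≤ δ * C := by
      intro k m hkm
      rcases lt_or_gt_of_ne hkm with h | h
      · exact hlt k m h
      · rw [← norm_star, star_mul, star_star]; exact hlt m k h
    have hS2 : ‖S‖ * ‖S‖ ≤ n * (4 * C ^ 2) + n * (n * (δ * C)) := by
      rw [← CStarRing.norm_star_mul_self, hS, star_sum, Finset.sum_mul]
      refine (norm_sum_le _ _).trans ?_
      have hrow : ∀ k ∈ Finset.range n,
          ‖star (T (e k) y) * ∑ m ∈ Finset.range n, T (e m) y‖ ≤ 4 * C ^ 2 + n * (δ * C) := by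
        intro k hk
        rw [Finset.mul_sum, ← Finset.add_sum_erase _ _ hk]
        refine (norm_add_le _ _).trans (add_le_add ?_ ?_)
        · refine (norm_mul_le _ _).trans ?_
          rw [norm_star]
          nlinarith [hTn k, norm_nonneg (T (e k) y)]
        · refine (norm_sum_le _ _).trans ((Finset.sum_le_sum fun m hm =>
            hne k m (Finset.ne_of_mem_erase hm).symm).trans ?_)
          rw [Finset.sum_const, nsmul_eq_mul]
          have : (((Finset.range n).erase k).card : ℝ) ≤ n := by
            exact_mod_cast (Finset.card_erase_le).trans (Finset.card_range n).le
          exact mul_le_mul_of_nonneg_right this (by positivity)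
      refine (Finset.sum_le_sum hrow).trans ?_
      rw [Finset.sum_const, nsmul_eq_mul, Finset.card_range]
      ring_nf; rfl
    have hδC : δ * C = ε ^ 2 / 16 := by rw [hδ]; field_simp
    rw [norm_smul, norm_inv, Real.norm_of_nonneg hn0.le, inv_mul_lt_iff₀ hn0]
    by_contra hcon
    push Not at hcon
    have h1 : (n * (ε / 2)) * (n * (ε / 2)) ≤ ‖S‖ * ‖S‖ :=
      mul_le_mul hcon hcon (by positivity) (norm_nonneg _)
    rw [div_lt_iff₀ (by positivity)] at hn
    rw [hδC] at hS2
    have h2 : (n : ℝ) * (64 * C ^ 2) < n * (n * ε ^ 2) := by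
      rw [mul_lt_mul_iff_right₀ hn0]; exact hn
    nlinarith
  refine ⟨(n : ℝ)⁻¹ • ∑ k ∈ Finset.range n, e k, ?_, ?_, ?_, ?_, ?_⟩
  · have : (n : ℝ)⁻¹ • ∑ k ∈ Finset.range n, e k =
        (((n : ℝ)⁻¹ : ℝ) : ℂ) • ∑ k ∈ Finset.range n, e k := by rw [Complex.coe_smul]
    rw [this]
    exact I.smul_mem_of_isClosed hI _ (sum_mem fun k _ => (heP k).1)
  · exact smul_nonneg (by positivity) (Finset.sum_nonneg fun k _ => (heP k).2.1)
  · rw [norm_smul, norm_inv, Real.norm_of_nonneg hn0.le, inv_mul_le_iff₀ hn0, mul_one]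
    refine (norm_sum_le _ _).trans ((Finset.sum_le_sum fun k _ => (heP k).2.2.1).trans ?_)
    simp
  · intro j hj
    have h1 : ((n : ℝ)⁻¹ • ∑ k ∈ Finset.range n, e k) * j - j =
        (n : ℝ)⁻¹ • ∑ k ∈ Finset.range n, (e k * j - j) := by
      rw [Finset.sum_sub_distrib, smul_sub, smul_mul_assoc, Finset.sum_mul, Finset.sum_const,
        Finset.card_range, ← Nat.cast_smul_eq_nsmul ℝ, smul_smul, inv_mul_cancel₀ hn0.ne', one_smul]
    rw [h1, norm_smul, norm_inv, Real.norm_of_nonneg hn0.le, inv_mul_lt_iff₀ hn0]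
    refine (norm_sum_le _ _).trans_lt ?_
    refine (Finset.sum_lt_sum_of_nonempty (Finset.nonempty_range_iff.2 (by
      rintro rfl; simp at hn0)) fun k _ => (heP k).2.2.2 j hj).trans_le ?_
    simp
  · intro y hy
    have hy1 : y ∈ F' := Finset.mem_union_left _ hy
    have hy2 : star y ∈ F' := Finset.mem_union_right _ (Finset.mem_image_of_mem _ hy)
    have h1 : ((n : ℝ)⁻¹ • ∑ k ∈ Finset.range n, e k) * y -
        y * ((n : ℝ)⁻¹ • ∑ k ∈ Finset.range n, e k) =
        star ((n : ℝ)⁻¹ • ∑ k ∈ Finset.range n, T (e k) (star y)) -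
          (n : ℝ)⁻¹ • ∑ k ∈ Finset.range n, T (e k) y := by
      rw [star_smul, star_trivial, smul_mul_assoc, mul_smul_comm, ← smul_sub, ← smul_sub, star_sum,
        Finset.sum_mul, Finset.mul_sum, ← Finset.sum_sub_distrib, ← Finset.sum_sub_distrib]
      congr 1
      refine Finset.sum_congr rfl fun k _ => ?_
      have hsa : star (e k) = e k := (IsSelfAdjoint.of_nonneg (heP k).2.1).star_eq
      simp only [T, star_sub, star_mul, star_star, hsa, mul_assoc]
      abel
    rw [h1]
    refine (norm_sub_le _ _).trans_lt ?_
    rw [norm_star]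
    linarith [hmean y hy1, hmean _ hy2]

end ClosedIdeal

end

noncomputable section

attribute [local instance] CStarAlgebra.spectralOrder CStarAlgebra.spectralOrderedRing

open Filter Topology

/-! ### Homomorphisms of C*-algebras -/

section Hom

variable {D E M : Type*} [NonUnitalCStarAlgebra D] [NonUnitalCStarAlgebra E]
  [NonUnitalCStarAlgebra M]

theorem isometry_cstarHom {j : E →⋆ₙₐ[ℂ] M} (hj : Function.Injective j) : Isometry j :=
  AddMonoidHomClass.isometry_of_norm j (NonUnitalStarAlgHom.norm_map j hj)

theorem isClosed_range_cstarHom {j : E →⋆ₙₐ[ℂ] M} (hj : Function.Injective j) :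
    IsClosed (Set.range j) := (isometry_cstarHom hj).isClosedEmbedding.isClosed_range

/-- The corestriction of a homomorphism `f` along an injective homomorphism `j`
whose range contains that of `f`. -/
def NonUnitalStarAlgHom.factor (f : D →⋆ₙₐ[ℂ] M) (j : E →⋆ₙₐ[ℂ] M) (hj : Function.Injective j)
    (h : ∀ z, f z ∈ Set.range j) : D →⋆ₙₐ[ℂ] E :=
  let F : D → E := fun z => Classical.choose (h z)
  have hF : ∀ z, j (F z) = f z := fun z => Classical.choose_spec (h z)
  { toFun := F
    map_smul' := fun c z => hj (by
      rw [hF, MonoidHom.id_apply, map_smul, map_smul, hF])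
    map_zero' := hj (by rw [hF, map_zero, map_zero])
    map_add' := fun z w => hj (by rw [hF, map_add, map_add, hF, hF])
    map_mul' := fun z w => hj (by rw [hF, map_mul, map_mul, hF, hF])
    map_star' := fun z => hj (by rw [hF, map_star, map_star, hF]) }

theorem NonUnitalStarAlgHom.factor_spec (f : D →⋆ₙₐ[ℂ] M) (j : E →⋆ₙₐ[ℂ] M)
    (hj : Function.Injective j) (h : ∀ z, f z ∈ Set.range j) (z : D) :
    j (f.factor j hj h z) = f z := Classical.choose_spec (h z)

/-- A family of homomorphisms which is pointwise continuous on a dense set is pointwise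
continuous. -/
theorem continuous_cstarHom_family {Y : Type*} [TopologicalSpace Y] (F : Y → D →⋆ₙₐ[ℂ] E)
    {s : Set D} (hs : Dense s) (h : ∀ z ∈ s, Continuous fun y => F y z) (z : D) :
    Continuous fun y => F y z := by
  rw [continuous_iff_continuousAt]
  intro y₀
  rw [ContinuousAt, Metric.tendsto_nhds]
  intro ε hε
  obtain ⟨w, hw, hzw⟩ := Metric.dense_iff.1 hs z (ε / 3) (by positivity)
  have hw' := (Metric.tendsto_nhds.1 ((h w hzw).tendsto y₀)) (ε / 3) (by positivity)
  filter_upwards [hw'] with y hy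
  have hlip : ∀ y, dist (F y z) (F y w) ≤ dist z w := fun y => by
    rw [dist_eq_norm, dist_eq_norm, ← map_sub]; exact NonUnitalStarAlgHom.norm_apply_le (F y) _
  have h1 := hlip y
  have h2 := hlip y₀
  rw [Metric.mem_ball, dist_comm] at hw
  rw [dist_comm] at h2
  linarith [dist_triangle4 (F y z) (F y w) (F y₀ w) (F y₀ z)]

end Hom

/-! ### Multipliers -/

/-- The multiplier algebra. -/
abbrev Mult (E : Type*) [NonUnitalCStarAlgebra E] := DoubleCentralizer ℂ E

namespace Mult

variable {E : Type*} [NonUnitalCStarAlgebra E]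

variable (E) in
/-- The inclusion of a C*-algebra in its multiplier algebra. -/
def of : E →⋆ₙₐ[ℂ] Mult E := DoubleCentralizer.coeHom

theorem of_fst (a x : E) : (of E a).fst x = a * x := rfl

theorem eq_of_mul_left {x y : E} (h : ∀ c, c * x = c * y) : x = y := by
  rw [← sub_eq_zero, ← CStarRing.star_mul_self_eq_zero_iff, mul_sub, h, sub_self]

theorem eq_of_mul_right {x y : E} (h : ∀ c, x * c = y * c) : x = y := by
  rw [← sub_eq_zero, ← CStarRing.mul_star_self_eq_zero_iff, sub_mul, h, sub_self]

theorem central (m : Mult E) (x y : E) : m.snd x * y = x * m.fst y :=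
  DoubleCentralizer.central m x y

theorem fst_mul (m : Mult E) (a b : E) : m.fst (a * b) = m.fst a * b :=
  eq_of_mul_left fun c => by rw [← central, ← mul_assoc, ← mul_assoc, ← central]

theorem ext_fst {m n : Mult E} (h : ∀ x, m.fst x = n.fst x) : m = n := by
  apply DoubleCentralizer.ext
  refine Prod.ext (ContinuousLinearMap.ext h) (ContinuousLinearMap.ext fun x => ?_)
  exact eq_of_mul_right fun c => by
    have h1 := central m x c
    have h2 := central n x c
    rw [h c, ← h2] at h1
    exact h1

theorem mul_of (m : Mult E) (a : E) : m * of E a = of E (m.fst a) :=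
  ext_fst fun x => (fst_mul m a x)

theorem of_mul (a : E) (m : Mult E) : of E a * m = of E (m.snd a) :=
  ext_fst fun x => (central m a x).symm

theorem of_injective : Function.Injective (of E) := fun a b h =>
  eq_of_mul_right fun c => by rw [← of_fst, h, of_fst]

theorem norm_of (a : E) : ‖of E a‖ = ‖a‖ := NonUnitalStarAlgHom.norm_map (of E) of_injective a

theorem norm_fst_le (m : Mult E) (x : E) : ‖m.fst x‖ ≤ ‖m‖ * ‖x‖ := by
  rw [← DoubleCentralizer.norm_fst]; exact m.fst.le_opNorm x

/-- A closed ideal is invariant under multipliers. -/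
theorem fst_mem {I : TwoSidedIdeal E} (hI : IsClosed (I : Set E)) (m : Mult E) {x : E}
    (hx : x ∈ I) : m.fst x ∈ I := by
  refine TwoSidedIdeal.mem_of_forall_norm_sub_lt hI fun ε hε => ?_
  obtain ⟨y, hy, -, h⟩ := TwoSidedIdeal.exists_norm_sub_mul_lt hx
    (ε := ε / (‖m‖ + 1)) (by positivity)
  refine ⟨m.fst x * y, I.mul_mem_left _ _ hy, ?_⟩
  rw [← fst_mul, ← map_sub]
  refine (norm_fst_le _ _).trans_lt ?_
  rw [lt_div_iff₀ (by positivity)] at h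
  nlinarith [norm_nonneg (x - x * y), norm_nonneg m]

theorem snd_mem {I : TwoSidedIdeal E} (hI : IsClosed (I : Set E)) (m : Mult E) {x : E}
    (hx : x ∈ I) : m.snd x ∈ I := by
  have h := fst_mem hI (star m) (TwoSidedIdeal.star_mem_of_isClosed hI hx)
  rw [DoubleCentralizer.star_fst, star_star] at h
  simpa using TwoSidedIdeal.star_mem_of_isClosed hI h

/-- A closed ideal of `E` is a closed ideal of the multiplier algebra. -/
def ideal (I : TwoSidedIdeal E) (hI : IsClosed (I : Set E)) : TwoSidedIdeal (Mult E) :=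
  TwoSidedIdeal.mk' (of E '' I) ⟨0, I.zero_mem, map_zero _⟩
    (by rintro _ _ ⟨a, ha, rfl⟩ ⟨b, hb, rfl⟩; exact ⟨a + b, I.add_mem ha hb, map_add _ _ _⟩)
    (by rintro _ ⟨a, ha, rfl⟩; exact ⟨-a, I.neg_mem ha, map_neg _ _⟩)
    (by rintro m _ ⟨a, ha, rfl⟩; exact ⟨m.fst a, fst_mem hI m ha, (mul_of m a).symm⟩)
    (by rintro _ m ⟨a, ha, rfl⟩; exact ⟨m.snd a, snd_mem hI m ha, (of_mul a m).symm⟩)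

theorem mem_ideal {I : TwoSidedIdeal E} {hI : IsClosed (I : Set E)} {m : Mult E} :
    m ∈ ideal I hI ↔ ∃ a ∈ I, of E a = m := TwoSidedIdeal.mem_mk' ..

theorem isClosed_ideal (I : TwoSidedIdeal E) (hI : IsClosed (I : Set E)) :
    IsClosed (ideal I hI : Set (Mult E)) := by
  have : (ideal I hI : Set (Mult E)) = of E '' I := Set.ext fun _ => mem_ideal
  rw [this]
  exact (isometry_cstarHom of_injective).isClosedEmbedding.isClosedMap _ hI

/-- The endomorphism `x ↦ V x V*` of `E` given by an isometry `V` in the multiplier algebra. -/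
def Ad (V : Mult E) (hV : star V * V = 1) : E →⋆ₙₐ[ℂ] E where
  toFun x := (star V).snd (V.fst x)
  map_smul' c x := by simp only [map_smul]; rfl
  map_zero' := by simp only [map_zero]
  map_add' x y := by simp only [map_add]
  map_mul' x y := of_injective (by
    simp only [map_mul, ← mul_of, ← of_mul]
    simp only [mul_assoc]
    rw [← mul_assoc (star V) V, hV, one_mul])
  map_star' x := of_injective (by
    simp only [map_star, ← mul_of, ← of_mul, star_mul, star_star, mul_assoc])

theorem of_Ad (V : Mult E) (hV : star V * V = 1) (x : E) :
    of E (Ad V hV x) = V * of E x * star V := by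
  change of E ((star V).snd (V.fst x)) = _
  rw [← of_mul, ← mul_of]

theorem Ad_mem (V : Mult E) (hV : star V * V = 1) {I : TwoSidedIdeal E}
    (hI : IsClosed (I : Set E)) {x : E} (hx : x ∈ I) : Ad V hV x ∈ I :=
  snd_mem hI _ (fst_mem hI _ hx)

theorem continuous_Ad {Y : Type*} [TopologicalSpace Y] {V : Y → Mult E}
    (hV : ∀ y, star (V y) * V y = 1) (hc : Continuous V) (x : E) :
    Continuous fun y => Ad (V y) (hV y) x := by
  rw [(isometry_cstarHom (of_injective (E := E))).isEmbedding.continuous_iff]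
  have : of E ∘ (fun y => Ad (V y) (hV y) x) = fun y => V y * of E x * star (V y) :=
    funext fun y => of_Ad _ _ _
  rw [this]
  fun_prop

/-- A sequence of self-adjoint elements which converges pointwise converges strictly to a
self-adjoint multiplier. -/
theorem exists_strict_limit (h : ℕ → E) (hsa : ∀ n, IsSelfAdjoint (h n))
    (g : E → E) (hg : ∀ x, Tendsto (fun n => h n * x) atTop (𝓝 (g x))) :
    ∃ m : Mult E, IsSelfAdjoint m ∧ ∀ x, m.fst x = g x := by
  have h1 : Tendsto (fun n x => ContinuousLinearMap.mul ℂ E (h n) x) atTop (𝓝 g) :=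
    tendsto_pi_nhds.2 hg
  have h2 : Tendsto (fun n x => (ContinuousLinearMap.mul ℂ E).flip (h n) x) atTop
      (𝓝 fun x => star (g (star x))) := by
    refine tendsto_pi_nhds.2 fun x => ?_
    have := (hg (star x)).star
    simpa [(hsa _).star_eq] using this
  let L := continuousLinearMapOfTendsto _ h1
  let R := continuousLinearMapOfTendsto _ h2
  have hL : ∀ x, L x = g x := fun x => rfl
  have hR : ∀ x, R x = star (g (star x)) := fun x => rfl
  have hc : ∀ x y, R x * y = x * L y := fun x y => by
    refine tendsto_nhds_unique (f := fun n => x * h n * y) (l := atTop) ?_ ?_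
    · exact (tendsto_pi_nhds.1 h2 x).mul_const y
    · simp only [mul_assoc]
      exact (hg y).const_mul x
  refine ⟨⟨(L, R), hc⟩, ?_, fun x => rfl⟩
  refine ext_fst fun x => ?_
  rw [DoubleCentralizer.star_fst]
  change star (R (star x)) = L x
  rw [hR, hL, star_star, star_star]

end Mult

/-! ### Homomorphisms on `qA` given by pairs -/

namespace QAlg

open FreePoly CStarSeminorm

variable {A : Type*} [NonUnitalCStarAlgebra A]

theorem induction_on {p : QAlg A → Prop} (hc : IsClosed {z | p z}) (h0 : p 0)
    (hadd : ∀ z w, p z → p w → p (z + w)) (hsmul : ∀ (c : ℂ) z, p z → p (c • z))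
    (hmul : ∀ z w, p z → p w → p (z * w)) (hι : ∀ x, p (ι A x)) (hιb : ∀ x, p (ιbar A x))
    (z : QAlg A) : p z := by
  refine (Compl.denseRange_of (univNorm A)).induction_on (p := p) z hc fun z => ?_
  change p (ofPoly A z)
  induction z using FreePoly.induction with
  | h0 => rwa [map_zero]
  | ha z w hz hw => rw [map_add]; exact hadd _ _ hz hw
  | hm w c =>
    have hw : mono w c = c • mono w 1 := by rw [smul_mono, mul_one]
    rw [hw, map_smul]
    refine hsmul _ _ ?_
    clear hw
    induction w using FreeSemigroup.recOnMul with
    | ih1 x =>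
      cases x with
      | inl x => exact hι x
      | inr x => exact hιb x
    | ih2 x y hx hy =>
      have hxy : mono (FreeSemigroup.of x * y) 1 = mono (FreeSemigroup.of x) 1 * mono y 1 := by
        rw [mono_mul, mul_one]
      rw [hxy, map_mul]
      exact hmul _ _ hx hy

variable {M : Type*} [NonUnitalCStarAlgebra M]

theorem continuous_lift {Y : Type*} [TopologicalSpace Y] {f g : Y → A →⋆ₙₐ[ℂ] M}
    (hf : ∀ x, Continuous fun y => f y x) (hg : ∀ x, Continuous fun y => g y x) (z : QAlg A) :
    Continuous fun y => lift (f y) (g y) z := by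
  refine continuous_cstarHom_family (fun y => lift (f y) (g y))
    (s := {z | Continuous fun y => lift (f y) (g y) z}) ?_ (fun _ hz => hz) z
  intro z
  refine induction_on (p := fun z => z ∈ closure {z | Continuous fun y => lift (f y) (g y) z})
    isClosed_closure ?_ ?_ ?_ ?_ ?_ ?_ z
  · exact subset_closure (by simp only [map_zero, Set.mem_ofPred_eq]; exact continuous_const)
  · intro z w hz hw
    exact map_mem_closure₂ continuous_add hz hw fun z hz w hw => by
      simp only [map_add, Set.mem_ofPred_eq] at *; exact hz.add hw
  · intro c z hz
    exact map_mem_closure (continuous_const_smul c) hz fun z hz => by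
      simp only [map_smul, Set.mem_ofPred_eq] at *; exact hz.const_smul c
  · intro z w hz hw
    exact map_mem_closure₂ continuous_mul hz hw fun z hz w hw => by
      simp only [map_mul, Set.mem_ofPred_eq] at *; exact hz.mul hw
  · intro x; exact subset_closure (by simpa only [lift_ι, Set.mem_ofPred_eq] using hf x)
  · intro x; exact subset_closure (by simpa only [lift_ιbar, Set.mem_ofPred_eq] using hg x)

variable (A) in
/-- The homomorphism `QA → A` that identifies the two copies of `A`. -/
def fold : QAlg A →⋆ₙₐ[ℂ] A := lift (NonUnitalStarAlgHom.id ℂ A) (NonUnitalStarAlgHom.id ℂ A)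

theorem fold_ι (x : A) : fold A (ι A x) = x := lift_ι _ _ _
theorem fold_ιbar (x : A) : fold A (ιbar A x) = x := lift_ιbar _ _ _
theorem fold_coe (z : qAlg A) : fold A (z : QAlg A) = 0 := z.2

/-- If `f` and `g` agree modulo a set `s` which is a closed ideal, then `f ⋆ g` maps `qA` to `s`. -/
theorem lift_mem_of_sub_mem {f g : A →⋆ₙₐ[ℂ] M} {s : Set M} (hs : IsClosed s) (h0 : (0 : M) ∈ s)
    (hadd : ∀ a ∈ s, ∀ b ∈ s, a + b ∈ s) (hsmul : ∀ (c : ℂ), ∀ a ∈ s, c • a ∈ s)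
    (hl : ∀ m, ∀ a ∈ s, m * a ∈ s) (hr : ∀ m, ∀ a ∈ s, a * m ∈ s) (h : ∀ x, f x - g x ∈ s)
    (z : qAlg A) : lift f g (z : QAlg A) ∈ s := by
  have key : ∀ z : QAlg A, lift f g z - f (fold A z) ∈ s := by
    apply induction_on
    · exact hs.preimage ((continuous_cstarHom _).sub
        ((continuous_cstarHom _).comp (continuous_cstarHom _)))
    · simpa using h0
    · intro z w hz hw
      have : lift f g (z + w) - f (fold A (z + w)) =
          (lift f g z - f (fold A z)) + (lift f g w - f (fold A w)) := by
        simp only [map_add]; abel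
      rw [this]; exact hadd _ hz _ hw
    · intro c z hz
      have : lift f g (c • z) - f (fold A (c • z)) = c • (lift f g z - f (fold A z)) := by
        simp only [map_smul, smul_sub]
      rw [this]; exact hsmul _ _ hz
    · intro z w hz hw
      have : lift f g (z * w) - f (fold A (z * w)) =
          (lift f g z - f (fold A z)) * lift f g w +
            f (fold A z) * (lift f g w - f (fold A w)) := by
        simp only [map_mul, sub_mul, mul_sub]; abel
      rw [this]; exact hadd _ (hr _ _ hz) _ (hl _ _ hw)
    · intro x; rw [lift_ι, fold_ι, sub_self]; exact h0
    · intro x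
      rw [lift_ιbar, fold_ιbar]
      have : g x - f x = (-1 : ℂ) • (f x - g x) := by rw [neg_one_smul, neg_sub]
      rw [this]; exact hsmul _ _ (h x)
  have := key z
  rwa [fold_coe, map_zero, sub_zero] at this

end QAlg

namespace qAlg

variable {A E M : Type*} [NonUnitalCStarAlgebra A] [NonUnitalCStarAlgebra E]
  [NonUnitalCStarAlgebra M]

theorem incl_apply (z : qAlg A) : incl A z = (z : QAlg A) := rfl

theorem incl_injective : Function.Injective (incl A) := Subtype.val_injective

theorem incl_q (x : A) : incl A (q x) = QAlg.ι A x - QAlg.ιbar A x := rfl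

theorem incl_map {B : Type*} [NonUnitalCStarAlgebra B] (f : A →⋆ₙₐ[ℂ] B) (z : qAlg A) :
    incl B (map f z) = QAlg.lift ((QAlg.ι B).comp f) ((QAlg.ιbar B).comp f) (incl A z) := rfl

/-- The data of a C*-algebra `E` as an ideal of `M`. -/
structure IdealEmbedding (j : E →⋆ₙₐ[ℂ] M) : Prop where
  injective : Function.Injective j
  mul_left : ∀ m e, m * j e ∈ Set.range j
  mul_right : ∀ m e, j e * m ∈ Set.range j

theorem IdealEmbedding.of : IdealEmbedding (Mult.of E) :=
  ⟨Mult.of_injective, fun m e => ⟨_, (Mult.mul_of m e).symm⟩,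
    fun m e => ⟨_, (Mult.of_mul e m).symm⟩⟩

theorem IdealEmbedding.incl : IdealEmbedding (incl A) :=
  ⟨incl_injective,
    fun m e => ⟨⟨m * e, by rw [mem_iff, map_mul, e.2, mul_zero]⟩, rfl⟩,
    fun m e => ⟨⟨e * m, by rw [mem_iff, map_mul, e.2, zero_mul]⟩, rfl⟩⟩

variable {j : E →⋆ₙₐ[ℂ] M} (hj : IdealEmbedding j) {f g : A →⋆ₙₐ[ℂ] M}
  (h : ∀ x, f x - g x ∈ Set.range j)

include hj h in
theorem lift_mem_range (z : qAlg A) : QAlg.lift f g (incl A z) ∈ Set.range j := by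
  refine QAlg.lift_mem_of_sub_mem (isClosed_range_cstarHom hj.injective) ⟨0, map_zero j⟩
    ?_ ?_ ?_ ?_ h z
  · rintro _ ⟨a, rfl⟩ _ ⟨b, rfl⟩; exact ⟨a + b, map_add _ _ _⟩
  · rintro c _ ⟨a, rfl⟩; exact ⟨c • a, map_smul _ _ _⟩
  · rintro m _ ⟨a, rfl⟩; exact hj.mul_left m a
  · rintro m _ ⟨a, rfl⟩; exact hj.mul_right m a

/-- The homomorphism `qA → E` given by a pair of homomorphisms `A → M` which agree modulo the
ideal `E` of `M`. -/
def ofPair : qAlg A →⋆ₙₐ[ℂ] E :=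
  ((QAlg.lift f g).comp (incl A)).factor j hj.injective (lift_mem_range hj h)

theorem ofPair_spec (z : qAlg A) : j (ofPair hj h z) = QAlg.lift f g (incl A z) :=
  NonUnitalStarAlgHom.factor_spec _ _ _ _ _

theorem ofPair_q (x : A) : j (ofPair hj h (q x)) = f x - g x := by
  rw [ofPair_spec, incl_q, map_sub, QAlg.lift_ι, QAlg.lift_ιbar]

theorem continuous_ofPair {Y : Type*} [TopologicalSpace Y] {f g : Y → A →⋆ₙₐ[ℂ] M}
    (h : ∀ y x, f y x - g y x ∈ Set.range j)
    (hf : ∀ x, Continuous fun y => f y x) (hg : ∀ x, Continuous fun y => g y x) (z : qAlg A) :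
    Continuous fun y => ofPair hj (h y) z := by
  rw [(isometry_cstarHom hj.injective).isEmbedding.continuous_iff]
  have : j ∘ (fun y => ofPair hj (h y) z) = fun y => QAlg.lift (f y) (g y) (incl A z) :=
    funext fun y => ofPair_spec _ _ _
  rw [this]
  exact QAlg.continuous_lift hf hg _

end qAlg

end

noncomputable section

attribute [local instance] CStarAlgebra.spectralOrder CStarAlgebra.spectralOrderedRing

open Filter Topology
open scoped Classical

/-! ### Matrix units and isometries of `K ⊗ B` -/

namespace FinMat

variable {B : Type u} [NonUnitalCStarAlgebra B]

/-- The matrix `e_ij ⊗ b`. -/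
def single (i j : ℕ) (b : B) : FinMat B :=
  ofFun (fun k l => if k = i ∧ l = j then b else 0) (max i j + 1) fun k l h => if_neg (by omega)

theorem entry_single (i j : ℕ) (b : B) (k l : ℕ) :
    (single i j b).entry k l = if k = i ∧ l = j then b else 0 := rfl

theorem entry_sum {κ : Type*} (s : Finset κ) (f : κ → FinMat B) (i j : ℕ) :
    (∑ k ∈ s, f k).entry i j = ∑ k ∈ s, (f k).entry i j := by
  classical
  induction s using Finset.induction_on with
  | empty => simp [entry_zero]
  | insert a s ha ih => rw [Finset.sum_insert ha, Finset.sum_insert ha, entry_add, ih]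

theorem eq_sum_single {n : ℕ} {M : FinMat B} (hM : Within n M) :
    M = ∑ i ∈ Finset.range n, ∑ j ∈ Finset.range n, single i j (M.entry i j) := by
  refine ext fun i j => ?_
  simp only [entry_sum, entry_single]
  by_cases hi : i < n
  · by_cases hj : j < n
    · rw [Finset.sum_eq_single i, Finset.sum_eq_single j]
      · simp
      · intro k _ hk; rw [if_neg (by tauto)]
      · intro h; simp at h; omega
      · intro k _ hk; exact Finset.sum_eq_zero fun l _ => if_neg (by tauto)
      · intro h; simp at h; omega
    · rw [hM i j (by omega)]
      exact (Finset.sum_eq_zero fun k _ => Finset.sum_eq_zero fun l hl =>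
        if_neg (by simp at hl; omega)).symm
  · rw [hM i j (by omega)]
    exact (Finset.sum_eq_zero fun k hk => Finset.sum_eq_zero fun l _ =>
      if_neg (by simp at hk; omega)).symm

theorem entry_mul_of_subset {M N : FinMat B} {i k : ℕ} (s : Finset ℕ)
    (hs : ∀ j ∉ s, M.entry i j = 0) :
    (M * N).entry i k = ∑ j ∈ s, M.entry i j * N.entry j k := by
  classical
  rw [entry_mul_of_within M.within_size]
  trans ∑ j ∈ Finset.range M.size ∪ s, M.entry i j * N.entry j k
  · refine Finset.sum_subset Finset.subset_union_left fun j _ hj => ?_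
    rw [M.within_size i j (by simp at hj; omega), zero_mul]
  · refine (Finset.sum_subset Finset.subset_union_right fun j _ hj => ?_).symm
    rw [hs j hj, zero_mul]

theorem star_single (i j : ℕ) (b : B) : star (single i j b) = single j i (star b) :=
  ext fun k l => by
    rw [entry_star, entry_single, entry_single]
    by_cases h : k = j ∧ l = i
    · rw [if_pos h, if_pos h.symm]
    · rw [if_neg h, if_neg (by tauto), star_zero]

theorem entry_single_eq_zero (i : ℕ) {j : ℕ} (b : B) (k : ℕ) :
    ∀ n ∉ ({j} : Finset ℕ), (single i j b).entry k n = 0 := fun n hn =>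
  if_neg fun h => hn (by rw [h.2]; exact Finset.mem_singleton_self j)

theorem single_mul_single (i j l : ℕ) (b c : B) :
    single i j b * single j l c = single i l (b * c) := ext fun k m => by
  rw [entry_mul_of_subset {j} (entry_single_eq_zero i b k), Finset.sum_singleton]
  simp only [entry_single]
  by_cases hk : k = i <;> by_cases hm : m = l <;> simp [hk, hm]

theorem single_mul_single_of_ne {i j k l : ℕ} (h : j ≠ k) (b c : B) :
    single i j b * single k l c = 0 := ext fun r s => by
  rw [entry_mul_of_subset {j} (entry_single_eq_zero i b r), Finset.sum_singleton,
    entry_single, entry_single, if_neg (by tauto : ¬(j = k ∧ s = l)), mul_zero, entry_zero]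

theorem single_add (i j : ℕ) (b c : B) : single i j (b + c) = single i j b + single i j c :=
  ext fun k l => by rw [entry_add, entry_single, entry_single, entry_single]; split_ifs <;> simp

/-- The rows of a matrix reindexled along an injection `σ`. -/
def rowMap (σ : ℕ ↪ ℕ) : FinMat B →ₗ[ℂ] FinMat B where
  toFun M := ofFun (fun i j => if h : ∃ k, σ k = i then M.entry h.choose j else 0)
    (max M.size ((Finset.range M.size).sup σ + 1)) (by
      intro i j hij
      split_ifs with h
      · refine M.within_size _ _ ?_
        rcases hij with hij | hij
        · left
          by_contra hlt
          have := Finset.le_sup (f := σ) (Finset.mem_range.2 (not_le.1 hlt))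
          rw [h.choose_spec] at this
          omega
        · right; omega
      · rfl)
  map_add' M N := ext fun i j => by
    rw [entry_add, entry_ofFun, entry_ofFun, entry_ofFun]; split_ifs <;> simp [entry_add]
  map_smul' c M := ext fun i j => by
    rw [entry_smul, entry_ofFun, entry_ofFun]; split_ifs <;> simp [entry_smul]

theorem entry_rowMap (σ : ℕ ↪ ℕ) (M : FinMat B) (i j : ℕ) :
    (rowMap σ M).entry (σ i) j = M.entry i j := by
  have h : ∃ k, σ k = σ i := ⟨i, rfl⟩
  change (if h : ∃ k, σ k = σ i then M.entry h.choose j else 0) = _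
  rw [dif_pos h, σ.injective h.choose_spec]

theorem entry_rowMap_of_notMem (σ : ℕ ↪ ℕ) (M : FinMat B) {i : ℕ} (hi : ∀ k, σ k ≠ i) (j : ℕ) :
    (rowMap σ M).entry i j = 0 := dif_neg (by push Not; exact hi)

/-- The rows of a matrix with labels in the range of the injection `σ`. -/
def rowComap (σ : ℕ ↪ ℕ) : FinMat B →ₗ[ℂ] FinMat B where
  toFun M :=
    have h := ((σ.injective.nat_tendsto_atTop).eventually_ge_atTop M.size).exists_forall_of_atTop
    ofFun (fun i j => M.entry (σ i) j) (max M.size h.choose) (by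
      intro i j hij
      refine M.within_size _ _ ?_
      rcases hij with hij | hij
      · left; exact h.choose_spec i (by omega)
      · right; omega)
  map_add' M N := ext fun i j => rfl
  map_smul' c M := ext fun i j => rfl

theorem entry_rowComap (σ : ℕ ↪ ℕ) (M : FinMat B) (i j : ℕ) :
    (rowComap σ M).entry i j = M.entry (σ i) j := rfl

theorem star_rowMap_mul (σ : ℕ ↪ ℕ) (M N : FinMat B) :
    star (rowMap σ M) * N = star M * rowComap σ N := ext fun i k => by
  rw [entry_mul_of_subset ((Finset.range M.size).map σ), Finset.sum_map,
    entry_mul_of_within M.within_size.star]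
  · refine Finset.sum_congr rfl fun j _ => ?_
    rw [entry_star, entry_star, entry_rowMap, entry_rowComap]
  · intro j hj
    rw [entry_star]
    by_cases h : ∃ l, σ l = j
    · obtain ⟨l, rfl⟩ := h
      rw [entry_rowMap, M.within_size _ _ (by simp at hj; tauto), star_zero]
    · push Not at h
      rw [entry_rowMap_of_notMem σ M h, star_zero]

theorem rowComap_rowMap (σ : ℕ ↪ ℕ) (M : FinMat B) : rowComap σ (rowMap σ M) = M :=
  ext fun i j => by rw [entry_rowComap, entry_rowMap]

theorem rowMap_single (σ : ℕ ↪ ℕ) (i j : ℕ) (b : B) :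
    rowMap σ (single i j b) = single (σ i) j b := ext fun k l => by
  by_cases h : ∃ m, σ m = k
  · obtain ⟨m, rfl⟩ := h
    rw [entry_rowMap, entry_single, entry_single]
    simp
  · push Not at h
    rw [entry_rowMap_of_notMem σ _ h, entry_single, if_neg]
    rintro ⟨rfl, -⟩; exact h i rfl

end FinMat

/-- The multiplier given by an operator `T` and its adjoint `T'`. -/
def Mult.ofAdjoint {E : Type*} [NonUnitalCStarAlgebra E] (T T' : E →L[ℂ] E)
    (h : ∀ x y, star (T x) * y = star x * T' y) : Mult E where
  fst := T
  snd := (((starₗᵢ ℂ : E ≃ₗᵢ⋆[ℂ] E) : E →L⋆[ℂ] E).comp T').comp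
    ((starₗᵢ ℂ : E ≃ₗᵢ⋆[ℂ] E) : E →L⋆[ℂ] E)
  central x y := by
    change star (T' (star x)) * y = x * T y
    have := congrArg star (h y (star x))
    rw [star_mul, star_mul, star_star, star_star, star_star] at this
    exact this.symm

namespace Stab

variable {B : Type u} [NonUnitalCStarAlgebra B]

/-- The element `e_ij ⊗ b`. -/
def single (i j : ℕ) (b : B) : Stab B := ofMat B (FinMat.single i j b)

theorem induction_on {p : Stab B → Prop} (hc : IsClosed {x | p x}) (h0 : p 0)
    (hadd : ∀ x y, p x → p y → p (x + y)) (h : ∀ i j b, p (single i j b)) (x : Stab B) : p x := by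
  refine denseRange_ofMat.induction_on x hc fun M => ?_
  rw [FinMat.eq_sum_single M.within_size, map_sum]
  refine Finset.sum_induction _ p hadd h0 fun i _ => ?_
  rw [map_sum]
  exact Finset.sum_induction _ p hadd h0 fun j _ => h _ _ _

theorem clm_ext {E : Type*} [NormedAddCommGroup E] [NormedSpace ℂ E] {f g : Stab B →L[ℂ] E}
    (h : ∀ i j b, f (single i j b) = g (single i j b)) : f = g :=
  ContinuousLinearMap.ext (induction_on (isClosed_eq f.continuous g.continuous) (by simp)
    (fun x y hx hy => by rw [map_add, map_add, hx, hy]) h)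

theorem hom_ext {E : Type*} [NonUnitalCStarAlgebra E] {f g : Stab B →⋆ₙₐ[ℂ] E}
    (h : ∀ i j b, f (single i j b) = g (single i j b)) : f = g :=
  NonUnitalStarAlgHom.ext (induction_on
    (isClosed_eq (continuous_cstarHom f) (continuous_cstarHom g)) (by simp)
    (fun x y hx hy => by rw [map_add, map_add, hx, hy]) h)

theorem star_single (i j : ℕ) (b : B) : star (single i j b) = single j i (star b) := by
  rw [single, single, ← map_star, FinMat.star_single]

theorem single_mul_single (i j l : ℕ) (b c : B) :
    single i j b * single j l c = single i l (b * c) := by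
  rw [single, single, single, ← map_mul, FinMat.single_mul_single]

theorem single_mul_single_of_ne {i j k l : ℕ} (h : j ≠ k) (b c : B) :
    single i j b * single k l c = 0 := by
  rw [single, single, ← map_mul, FinMat.single_mul_single_of_ne h, map_zero]

theorem single_add (i j : ℕ) (b c : B) : single i j (b + c) = single i j b + single i j c := by
  rw [single, single, single, ← map_add, FinMat.single_add]

theorem single_zero (i j : ℕ) : single i j (0 : B) = 0 := by
  have := single_add i j (0 : B) 0
  rw [add_zero] at this
  exact left_eq_add.1 this

/-- The bounded operator on `K ⊗ B` given by a linear map on `M_∞(B)`. -/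
def extend (L : FinMat B →ₗ[ℂ] FinMat B) : Stab B →L[ℂ] Stab B :=
  (((ofMat B : FinMat B →ₗ[ℂ] Stab B)).comp L).extendOfNorm (ofMat B : FinMat B →ₗ[ℂ] Stab B)

theorem extend_ofMat {L : FinMat B →ₗ[ℂ] FinMat B} (hL : ∀ M, ‖ofMat B (L M)‖ ≤ ‖ofMat B M‖)
    (M : FinMat B) : extend L (ofMat B M) = ofMat B (L M) :=
  LinearMap.extendOfNorm_eq (f := ((ofMat B : FinMat B →ₗ[ℂ] Stab B)).comp L)
    (e := (ofMat B : FinMat B →ₗ[ℂ] Stab B)) denseRange_ofMat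
    ⟨1, fun M => by rw [one_mul]; exact hL M⟩ M

theorem norm_rowMap (σ : ℕ ↪ ℕ) (M : FinMat B) :
    ‖ofMat B (FinMat.rowMap σ M)‖ = ‖ofMat B M‖ := by
  rw [← mul_self_inj (norm_nonneg _) (norm_nonneg _), ← CStarRing.norm_star_mul_self,
    ← CStarRing.norm_star_mul_self, ← map_star (ofMat B), ← map_star (ofMat B),
    ← map_mul (ofMat B), ← map_mul (ofMat B), FinMat.star_rowMap_mul, FinMat.rowComap_rowMap]

theorem norm_rowComap_le (σ : ℕ ↪ ℕ) (M : FinMat B) :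
    ‖ofMat B (FinMat.rowComap σ M)‖ ≤ ‖ofMat B M‖ := by
  set N := FinMat.rowComap σ M with hN
  by_cases h0 : ‖ofMat B N‖ = 0
  · rw [h0]; exact norm_nonneg _
  · have hpos : 0 < ‖ofMat B N‖ := lt_of_le_of_ne (norm_nonneg _) (Ne.symm h0)
    refine le_of_mul_le_mul_left ?_ hpos
    rw [← CStarRing.norm_star_mul_self, ← map_star, ← map_mul]
    conv_lhs => rw [hN, ← FinMat.star_rowMap_mul, ← hN, map_mul, map_star]
    refine (norm_mul_le _ _).trans ?_
    rw [norm_star, norm_rowMap]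

/-- The isometry `S_σ ⊗ 1` in the multiplier algebra of `K ⊗ B` that maps the basis vector `δ_i` to
`δ_{σ(i)}`. -/
def isom (σ : ℕ ↪ ℕ) : Mult (Stab B) :=
  Mult.ofAdjoint (extend (FinMat.rowMap σ)) (extend (FinMat.rowComap σ)) fun x y => by
    refine denseRange_ofMat.induction_on₂ (p := fun x y => star (extend (FinMat.rowMap σ) x) * y =
      star x * extend (FinMat.rowComap σ) y) ?_ ?_ x y
    · exact isClosed_eq (by fun_prop) (by fun_prop)
    · intro M N
      rw [extend_ofMat fun M => (norm_rowMap σ M).le, extend_ofMat (norm_rowComap_le σ), ← map_star,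
        ← map_mul, FinMat.star_rowMap_mul, map_mul, map_star]

theorem isom_fst_single (σ : ℕ ↪ ℕ) (i j : ℕ) (b : B) :
    (isom σ).fst (single i j b) = single (σ i) j b := by
  change extend (FinMat.rowMap σ) (ofMat B _) = _
  rw [extend_ofMat fun M => (norm_rowMap σ M).le, FinMat.rowMap_single]; rfl

theorem star_isom_snd_single (σ : ℕ ↪ ℕ) (i j : ℕ) (b : B) :
    (star (isom σ)).snd (single i j b) = single i (σ j) b := by
  rw [DoubleCentralizer.star_snd, star_single, isom_fst_single, star_single, star_star]

theorem star_isom_fst_ofMat (σ : ℕ ↪ ℕ) (M : FinMat B) :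
    (star (isom σ)).fst (ofMat B M) = ofMat B (FinMat.rowComap σ M) := by
  change star (star (extend (FinMat.rowComap σ) (star (star (ofMat B M))))) = _
  rw [star_star, star_star, extend_ofMat (norm_rowComap_le σ)]

theorem mult_ext {m n : Mult (Stab B)} (h : ∀ i j b, m.fst (single i j b) = n.fst (single i j b)) :
    m = n := Mult.ext_fst fun x => by
  have := clm_ext (f := m.fst) (g := n.fst) h
  rw [this]

theorem star_isom_mul_isom (σ : ℕ ↪ ℕ) : star (isom σ : Mult (Stab B)) * isom σ = 1 := by
  refine mult_ext fun i j b => ?_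
  change (star (isom σ)).fst ((isom σ).fst (single i j b)) = single i j b
  rw [isom_fst_single, single, star_isom_fst_ofMat, ← FinMat.rowMap_single,
    FinMat.rowComap_rowMap]
  rfl

theorem star_isom_mul_isom_of_disjoint {σ τ : ℕ ↪ ℕ} (h : ∀ i j, σ i ≠ τ j) :
    star (isom σ : Mult (Stab B)) * isom τ = 0 := by
  refine mult_ext fun i j b => ?_
  change (star (isom σ)).fst ((isom τ).fst (single i j b)) = 0
  rw [isom_fst_single, single, star_isom_fst_ofMat]
  have : FinMat.rowComap σ (FinMat.single (τ i) j b) = 0 := FinMat.ext fun k l => by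
    rw [FinMat.entry_rowComap, FinMat.entry_single, if_neg fun h' => h k i h'.1, FinMat.entry_zero]
  rw [this, map_zero]

theorem isom_mul_isom (σ τ : ℕ ↪ ℕ) : (isom σ : Mult (Stab B)) * isom τ = isom (τ.trans σ) := by
  refine mult_ext fun i j b => ?_
  change (isom σ).fst ((isom τ).fst (single i j b)) = _
  rw [isom_fst_single, isom_fst_single, isom_fst_single]; rfl

/-- The endomorphism `e_ij ⊗ b ↦ e_{σ(i),σ(j)} ⊗ b` of `K ⊗ B`. -/
def reindex (σ : ℕ ↪ ℕ) : Stab B →⋆ₙₐ[ℂ] Stab B := Mult.Ad (isom σ) (star_isom_mul_isom σ)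

theorem reindex_single (σ : ℕ ↪ ℕ) (i j : ℕ) (b : B) :
    reindex σ (single i j b) = single (σ i) (σ j) b := by
  change (star (isom σ)).snd ((isom σ).fst (single i j b)) = _
  rw [isom_fst_single, star_isom_snd_single]

theorem reindex_mem (σ : ℕ ↪ ℕ) {I : TwoSidedIdeal B} {x : Stab B} (hx : x ∈ ideal I) :
    reindex σ x ∈ ideal I := Mult.Ad_mem _ _ (isClosed_ideal I) hx

theorem reindex_reindex (σ τ : ℕ ↪ ℕ) (x : Stab B) :
    reindex σ (reindex τ x) = reindex (τ.trans σ) x := by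
  have : (reindex σ).comp (reindex τ) = reindex (B := B) (τ.trans σ) := hom_ext fun i j b => by
    rw [NonUnitalStarAlgHom.comp_apply, reindex_single, reindex_single, reindex_single]; rfl
  exact DFunLike.congr_fun this x

theorem corner_apply (b : B) : corner B b = single 0 0 b := rfl

theorem map_single {C : Type*} [NonUnitalCStarAlgebra C] (f : B →⋆ₙₐ[ℂ] C) (i j : ℕ) (b : B) :
    map f (single i j b) = single i j (f b) := by
  rw [map, single, lift_ofMat, NonUnitalStarAlgHom.comp_apply, single]
  congr 1
  refine FinMat.ext fun k l => ?_
  rw [FinMat.entry_map, FinMat.entry_single, FinMat.entry_single]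
  split_ifs <;> simp

theorem map_ofMat {C : Type*} [NonUnitalCStarAlgebra C] (f : B →⋆ₙₐ[ℂ] C) (M : FinMat B) :
    map f (ofMat B M) = ofMat C (FinMat.map f M) := by
  rw [map, lift_ofMat, NonUnitalStarAlgHom.comp_apply]

theorem map_map {C D : Type*} [NonUnitalCStarAlgebra C] [NonUnitalCStarAlgebra D]
    (g : C →⋆ₙₐ[ℂ] D) (f : B →⋆ₙₐ[ℂ] C) (x : Stab B) : map g (map f x) = map (g.comp f) x := by
  have : (map g).comp (map f) = map (g.comp f) := hom_ext fun i j b => by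
    rw [NonUnitalStarAlgHom.comp_apply, map_single, map_single, map_single]; rfl
  exact DFunLike.congr_fun this x

theorem map_reindex {C : Type*} [NonUnitalCStarAlgebra C] (f : B →⋆ₙₐ[ℂ] C) (σ : ℕ ↪ ℕ)
    (x : Stab B) : map f (reindex σ x) = reindex σ (map f x) := by
  have : (map f).comp (reindex σ) = (reindex σ).comp (map f) := hom_ext fun i j b => by
    simp only [NonUnitalStarAlgHom.comp_apply, map_single, reindex_single]
  exact DFunLike.congr_fun this x

/-- The injection `i ↦ 2 i + k`. -/
def parity (k : Fin 2) : ℕ ↪ ℕ := ⟨fun i => 2 * i + k, fun i j h => by simpa using h⟩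

theorem parity_apply (k : Fin 2) (i : ℕ) : parity k i = 2 * i + k := rfl

theorem spread_eq_reindex (k : Fin 2) (x : Stab B) : spread k x = reindex (parity k) x := by
  have : spread (B := B) k = reindex (parity k) := hom_ext fun i j b => by
    rw [reindex_single, spread, single, lift_ofMat, NonUnitalStarAlgHom.comp_apply, single]
    congr 1
    refine FinMat.ext fun m n => ?_
    have hk := k.2
    rw [FinMat.entry_spread, FinMat.entry_single, FinMat.entry_single, parity_apply, parity_apply,
      ← ite_and]
    congr 1
    exact propext ⟨fun h => by omega, fun h => by omega⟩
  exact DFunLike.congr_fun this x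

/-- The injection `k ↦ ⟨j, k⟩`. -/
def pairEmb (j : ℕ) : ℕ ↪ ℕ := ⟨fun k => Nat.pair j k, fun _ _ h => (Nat.pair_eq_pair.1 h).2⟩

theorem pairEmb_apply (j k : ℕ) : pairEmb j k = Nat.pair j k := rfl

theorem star_pairIsom_mul (i j : ℕ) : star (isom (pairEmb i) : Mult (Stab B)) * isom (pairEmb j) =
    if i = j then 1 else 0 := by
  split_ifs with h
  · rw [h, star_isom_mul_isom]
  · exact star_isom_mul_isom_of_disjoint fun _ _ hp => h (Nat.pair_eq_pair.1 hp).1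

/-- The operator `x ↦ S_i x S_j*` on `K ⊗ B`, where `S_j` maps the basis vector `δ_k` to
`δ_⟨j,k⟩`. -/
def blockEmb (i j : ℕ) (x : Stab B) : Stab B :=
  (star (isom (pairEmb j))).snd ((isom (pairEmb i)).fst x)

theorem of_blockEmb (i j : ℕ) (x : Stab B) : Mult.of _ (blockEmb i j x) =
    isom (pairEmb i) * Mult.of _ x * star (isom (pairEmb j)) := by
  rw [blockEmb, ← Mult.of_mul, ← Mult.mul_of]

theorem blockEmb_zero (i j : ℕ) : blockEmb i j (0 : Stab B) = 0 := by
  rw [blockEmb, map_zero, map_zero]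

theorem blockEmb_single (i j k l : ℕ) (b : B) :
    blockEmb i j (single k l b) = single (Nat.pair i k) (Nat.pair j l) b := by
  rw [blockEmb, isom_fst_single, star_isom_snd_single]; rfl

/-- The sum of the blocks `S_i M_ij S_j*`. -/
def flattenFun (M : FinMat (Stab B)) (n : ℕ) : Stab B :=
  ∑ i ∈ Finset.range n, ∑ j ∈ Finset.range n, blockEmb i j (M.entry i j)

theorem flattenFun_eq {n m : ℕ} {M : FinMat (Stab B)} (hn : FinMat.Within n M)
    (hm : FinMat.Within m M) : flattenFun M n = flattenFun M m := by
  have key : ∀ {n k : ℕ}, FinMat.Within n M → flattenFun M (n + k) = flattenFun M n := by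
    intro n k hn
    rw [flattenFun, flattenFun]
    symm
    trans ∑ i ∈ Finset.range (n + k), ∑ j ∈ Finset.range n, blockEmb i j (M.entry i j)
    · refine Finset.sum_subset (Finset.range_mono (by omega)) fun i _ hi => ?_
      exact Finset.sum_eq_zero fun j _ => by
        rw [hn i j (by simp at hi; omega), blockEmb_zero]
    · refine Finset.sum_congr rfl fun i _ => ?_
      refine Finset.sum_subset (Finset.range_mono (by omega)) fun j _ hj => ?_
      rw [hn i j (by simp at hj; omega), blockEmb_zero]
  rcases le_total n m with h | h
  · obtain ⟨k, rfl⟩ := Nat.exists_eq_add_of_le h; exact (key hn).symm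
  · obtain ⟨k, rfl⟩ := Nat.exists_eq_add_of_le h; exact key hm

theorem of_flattenFun (M : FinMat (Stab B)) (n : ℕ) : Mult.of _ (flattenFun M n) =
    ∑ i ∈ Finset.range n, ∑ j ∈ Finset.range n,
      isom (pairEmb i) * Mult.of _ (M.entry i j) * star (isom (pairEmb j)) := by
  simp only [flattenFun, map_sum, of_blockEmb]

/-- The homomorphism `M_∞(K ⊗ B) → K ⊗ B` given by the pairing bijection `ℕ × ℕ ≅ ℕ`. -/
def flattenMat : FinMat (Stab B) →⋆ₙₐ[ℂ] Stab B where
  toFun M := flattenFun M M.size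
  map_smul' c M := by
    have hn : FinMat.Within M.size (c • M) := fun i j h => by
      rw [FinMat.entry_smul, M.within_size i j h, smul_zero]
    rw [flattenFun_eq (FinMat.within_size _) hn]
    simp only [flattenFun, Finset.smul_sum, FinMat.entry_smul, blockEmb, map_smul]
    rfl
  map_zero' := by
    simp only [flattenFun, FinMat.entry_zero, blockEmb_zero, Finset.sum_const_zero]
  map_add' M N := by
    obtain ⟨n, hn, hn'⟩ := FinMat.exists_within₂ M N
    rw [flattenFun_eq (FinMat.within_size _) (hn.add hn'), flattenFun_eq (FinMat.within_size M) hn,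
      flattenFun_eq (FinMat.within_size N) hn']
    simp only [flattenFun, FinMat.entry_add, blockEmb, map_add, Finset.sum_add_distrib]
  map_mul' M N := Mult.of_injective (by
    obtain ⟨n, hn, hn'⟩ := FinMat.exists_within₂ M N
    rw [flattenFun_eq (FinMat.within_size _) (hn.mul hn'), flattenFun_eq (FinMat.within_size M) hn,
      flattenFun_eq (FinMat.within_size N) hn', map_mul, of_flattenFun, of_flattenFun,
      of_flattenFun]
    simp only [Finset.sum_mul, Finset.mul_sum]
    have h : ∀ i j k l, isom (pairEmb i) * Mult.of _ (M.entry i j) * star (isom (pairEmb j)) *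
        (isom (pairEmb k) * Mult.of _ (N.entry k l) * star (isom (pairEmb l))) =
        if j = k then isom (pairEmb i) * (Mult.of _ (M.entry i j) * Mult.of _ (N.entry j l)) *
          star (isom (pairEmb l)) else 0 := by
      intro i j k l
      have : isom (pairEmb i) * Mult.of _ (M.entry i j) * star (isom (pairEmb j)) *
          (isom (pairEmb k) * Mult.of _ (N.entry k l) * star (isom (pairEmb l))) =
          isom (pairEmb i) * Mult.of _ (M.entry i j) *
            ((star (isom (pairEmb j)) * isom (pairEmb k)) *
              (Mult.of _ (N.entry k l) * star (isom (pairEmb l)))) := by simp only [mul_assoc]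
      rw [this, star_pairIsom_mul]
      split_ifs with hjk
      · subst hjk; simp only [one_mul, mul_assoc]
      · simp only [zero_mul, mul_zero]
    simp only [h, FinMat.entry_mul_of_within hn, map_sum, map_mul, Finset.mul_sum, Finset.sum_mul,
      Finset.sum_ite_eq']
    symm
    rw [Finset.sum_comm]
    trans ∑ l ∈ Finset.range n, ∑ i ∈ Finset.range n, ∑ k ∈ Finset.range n,
      isom (pairEmb i) * (Mult.of _ (M.entry i k) * Mult.of _ (N.entry k l)) *
        star (isom (pairEmb l))
    · refine Finset.sum_congr rfl fun l _ => ?_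
      rw [Finset.sum_comm]
      refine Finset.sum_congr rfl fun i _ => Finset.sum_congr rfl fun k hk => ?_
      rw [if_pos hk]
    · rw [Finset.sum_comm])
  map_star' M := Mult.of_injective (by
    rw [flattenFun_eq (FinMat.within_size _) (FinMat.within_size M).star, map_star, of_flattenFun,
      of_flattenFun, Finset.sum_comm]
    simp only [star_sum, FinMat.entry_star, map_star, star_mul, star_star, mul_assoc])

/-- The homomorphism `K ⊗ (K ⊗ B) → K ⊗ B` given by the pairing bijection `ℕ × ℕ ≅ ℕ`. -/
def flatten : Stab (Stab B) →⋆ₙₐ[ℂ] Stab B := lift flattenMat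

theorem flatten_single (i j : ℕ) (x : Stab B) : flatten (single i j x) = blockEmb i j x := by
  rw [flatten, single, lift_ofMat]
  have hn : FinMat.Within (max i j + 1) (FinMat.single i j x) := fun k l h => if_neg (by omega)
  change flattenFun _ _ = _
  rw [flattenFun_eq (FinMat.within_size _) hn, flattenFun, Finset.sum_eq_single i,
    Finset.sum_eq_single j]
  · rw [FinMat.entry_single, if_pos ⟨rfl, rfl⟩]
  · intro l _ hl; rw [FinMat.entry_single, if_neg (by tauto), blockEmb_zero]
  · intro h; simp at h
  · intro k _ hk
    exact Finset.sum_eq_zero fun l _ => by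
      rw [FinMat.entry_single, if_neg (by tauto), blockEmb_zero]
  · intro h; simp at h

theorem flatten_mem {I : TwoSidedIdeal B} {x : Stab (Stab B)} (hx : x ∈ ideal (ideal I)) :
    flatten x ∈ ideal I := by
  rw [mem_ideal, idealCarrier] at hx
  rw [← SetLike.mem_coe, ← (isClosed_ideal I).closure_eq]
  refine map_mem_closure (continuous_cstarHom _) hx ?_
  rintro _ ⟨M, hM, rfl⟩
  rw [flatten, lift_ofMat]
  change flattenFun _ _ ∈ ideal I
  exact sum_mem fun i _ => sum_mem fun j _ => Mult.snd_mem (isClosed_ideal I) _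
    (Mult.fst_mem (isClosed_ideal I) _ (hM i j))

end Stab

end

noncomputable section

attribute [local instance] CStarAlgebra.spectralOrder CStarAlgebra.spectralOrderedRing

open Filter Topology

/-! ### Homotopies of `X`-equivariant homomorphisms -/

variable {X : Type v} [TopologicalSpace X]

namespace XHom

variable {A B C D E F : XAlgebra.{u} X}

theorem ext {f g : XHom D E} (h : ∀ z, f.hom z = g.hom z) : f = g := by
  cases f; cases g; congr 1; exact NonUnitalStarAlgHom.ext h

/-- The point-norm topology. -/
instance : TopologicalSpace (XHom D E) :=
  TopologicalSpace.induced (fun φ (z : D) => φ.hom z) inferInstance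

theorem continuous_eval (z : D) : Continuous fun φ : XHom D E => φ.hom z :=
  continuous_pi_iff.1 (continuous_induced_dom (f := fun (φ : XHom D E) (z : D) => φ.hom z)) z

theorem continuous_of {Y : Type*} [TopologicalSpace Y] {F : Y → XHom D E}
    (h : ∀ z, Continuous fun y => (F y).hom z) : Continuous F :=
  continuous_induced_rng.2 (continuous_pi h)

theorem joined_of_path {F : ℝ → XHom D E} (h : ∀ z, Continuous fun t => (F t).hom z) (a b : ℝ) :
    Joined (F a) (F b) := by
  obtain ⟨p⟩ := PathConnectedSpace.joined a b
  exact ⟨p.map (continuous_of h)⟩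

/-- A ray of homomorphisms which converges on a dense set is a homotopy. -/
theorem joined_of_tendsto {F : ℝ → XHom D E} (h : ∀ z, Continuous fun t => (F t).hom z)
    (G : XHom D E) {s : Set D} (hs : Dense s)
    (hG : ∀ z ∈ s, Tendsto (fun t => (F t).hom z) atTop (𝓝 (G.hom z))) : Joined (F 0) G := by
  have hG' : ∀ z, Tendsto (fun t => (F t).hom z) atTop (𝓝 (G.hom z)) := by
    intro z
    rw [Metric.tendsto_nhds]
    intro ε hε
    obtain ⟨w, hw, hzw⟩ := Metric.dense_iff.1 hs z (ε / 3) (by positivity)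
    filter_upwards [Metric.tendsto_nhds.1 (hG w hzw) (ε / 3) (by positivity)] with t ht
    have hlip : ∀ f : XHom D E, dist (f.hom z) (f.hom w) ≤ dist z w := fun f => by
      rw [dist_eq_norm, dist_eq_norm, ← map_sub]; exact NonUnitalStarAlgHom.norm_apply_le f.hom _
    have h1 := hlip (F t)
    have h2 := hlip G
    rw [Metric.mem_ball, dist_comm] at hw
    rw [dist_comm] at h2
    linarith [dist_triangle4 ((F t).hom z) ((F t).hom w) (G.hom w) (G.hom z)]
  let γ : ℝ → XHom D E := fun s => if s < 1 then F (s / (1 - s)) else G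
  have hγ : ContinuousOn γ unitInterval := by
    rw [continuousOn_iff_continuous_domRestrict]
    refine continuous_of fun z => ?_
    have key : ContinuousOn (fun s => (γ s).hom z) unitInterval := by
      intro s hs
      rcases hs.2.lt_or_eq with h1 | rfl
      · refine ContinuousAt.continuousWithinAt ?_
        have : (fun s => (F (s / (1 - s))).hom z) =ᶠ[𝓝 s] fun s => (γ s).hom z := by
          filter_upwards [Iio_mem_nhds h1] with t ht
          simp only [γ]
          rw [if_pos (Set.mem_Iio.1 ht)]
        refine ContinuousAt.congr ?_ this
        refine ContinuousAt.comp (g := fun t => (F t).hom z) (f := fun s : ℝ => s / (1 - s))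
          (h z).continuousAt ?_
        exact continuousAt_id.div (by fun_prop) (by linarith)
      · refine ContinuousWithinAt.mono (t := Set.Iic 1) ?_ Set.Icc_subset_Iic_self
        rw [← continuousWithinAt_Iio_iff_Iic, ContinuousWithinAt]
        have hγ1 : γ 1 = G := by simp [γ]
        rw [hγ1]
        have h2 : Tendsto (fun s : ℝ => s / (1 - s)) (𝓝[<] 1) atTop := by
          have h3 : Tendsto (fun s : ℝ => 1 - s) (𝓝[<] 1) (𝓝[>] 0) := by
            refine tendsto_nhdsWithin_iff.2 ⟨?_, ?_⟩
            · have : Tendsto (fun s : ℝ => 1 - s) (𝓝 1) (𝓝 (1 - 1)) :=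
                (continuous_const.sub continuous_id).tendsto 1
              rw [sub_self] at this
              exact this.mono_left nhdsWithin_le_nhds
            · filter_upwards [self_mem_nhdsWithin] with s hs
              exact sub_pos.2 (Set.mem_Iio.1 hs)
          have h4 : Tendsto (fun s : ℝ => s) (𝓝[<] 1) (𝓝 1) := nhdsWithin_le_nhds
          simp only [div_eq_mul_inv]
          exact h4.pos_mul_atTop one_pos (tendsto_inv_nhdsGT_zero.comp h3)
        refine ((hG' z).comp h2).congr' ?_
        filter_upwards [self_mem_nhdsWithin] with s hs
        simp only [γ, Function.comp]
        rw [if_pos (Set.mem_Iio.1 hs)]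
    exact continuousOn_iff_continuous_domRestrict.1 key
  refine (JoinedIn.ofLine (F := Set.univ) hγ ?_ ?_ (Set.subset_univ _)).joined
  · simp [γ]
  · simp [γ]

/-- The identity homomorphism. -/
def id (D : XAlgebra.{u} X) : XHom D D := ⟨NonUnitalStarAlgHom.id ℂ D, fun _ _ hx => hx⟩

theorem comp_assoc (h : XHom E F) (g : XHom D E) (f : XHom C D) :
    (h.comp g).comp f = h.comp (g.comp f) := rfl

theorem id_comp (f : XHom C D) : (id D).comp f = f := rfl

theorem joined_comp_left (g : XHom D E) {f f' : XHom C D} (h : Joined f f') :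
    Joined (g.comp f) (g.comp f') := by
  obtain ⟨p⟩ := h
  exact ⟨p.map (continuous_of fun z => (continuous_cstarHom g.hom).comp (continuous_eval z))⟩

theorem joined_comp_right {g g' : XHom D E} (f : XHom C D) (h : Joined g g') :
    Joined (g.comp f) (g'.comp f) := by
  obtain ⟨p⟩ := h
  exact ⟨p.map (f := fun g : XHom D E => g.comp f) (continuous_of fun z => continuous_eval (f.hom z))⟩

theorem joined_comp {g g' : XHom D E} {f f' : XHom C D} (hg : Joined g g') (hf : Joined f f') :
    Joined (g.comp f) (g'.comp f') :=
  (joined_comp_left g hf).trans (joined_comp_right _ hg)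

/-- The endomorphism of `K ⊗ E` given by an isometry in the multiplier algebra. -/
def Ad (V : Mult (Stab E)) (hV : star V * V = 1) : XHom E.stab E.stab :=
  ⟨Mult.Ad V hV, fun _ _ hx => Mult.Ad_mem V hV (Stab.isClosed_ideal _) hx⟩

/-- The endomorphism `e_ij ⊗ b ↦ e_{σ(i),σ(j)} ⊗ b` of `K ⊗ E`. -/
def reindex (σ : ℕ ↪ ℕ) : XHom E.stab E.stab := Ad (Stab.isom σ) (Stab.star_isom_mul_isom σ)

/-- The corner embedding `E → K ⊗ E`. -/
def corner (E : XAlgebra.{u} X) : XHom E E.stab :=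
  ⟨Stab.corner E, fun _ _ hx => Stab.corner_mem hx⟩

/-- The homomorphism `K ⊗ (K ⊗ E) → K ⊗ E` given by the pairing bijection. -/
def flatten (E : XAlgebra.{u} X) : XHom E.stab.stab E.stab :=
  ⟨Stab.flatten (B := E), fun _ _ hx => Stab.flatten_mem hx⟩

/-- The homomorphism `id ⊗ f : K ⊗ D → K ⊗ E`. -/
def stabMap (f : XHom D E) : XHom D.stab E.stab :=
  ⟨Stab.map f.hom, fun U _ hx => Stab.map_mem (f.equivariant U) hx⟩

theorem joined_Ad {V : ℝ → Mult (Stab E)} (hV : ∀ t, star (V t) * V t = 1) (hc : Continuous V)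
    (a b : ℝ) : Joined (Ad (V a) (hV a)) (Ad (V b) (hV b)) :=
  joined_of_path (F := fun t => Ad (V t) (hV t)) (fun z => Mult.continuous_Ad hV hc z) a b

/-- Isometries with orthogonal ranges give homotopic endomorphisms. -/
theorem joined_Ad_of_orthogonal {S T : Mult (Stab E)} (hS : star S * S = 1) (hT : star T * T = 1)
    (hST : star S * T = 0) : Joined (Ad S hS) (Ad T hT) := by
  have hTS : star T * S = 0 := by rw [← star_star S, ← star_mul, hST, star_zero]
  let V : ℝ → Mult (Stab E) := fun t => ((Real.cos t : ℝ) : ℂ) • S + ((Real.sin t : ℝ) : ℂ) • T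
  have hV : ∀ t, star (V t) * V t = 1 := fun t => by
    simp only [V, star_add, star_smul, add_mul, mul_add, smul_mul_assoc, mul_smul_comm, hS, hT, hST,
      hTS, smul_zero, add_zero, zero_add, Complex.star_def, Complex.conj_ofReal, smul_smul,
      ← add_smul]
    have : ((Real.cos t : ℝ) : ℂ) * ((Real.cos t : ℝ) : ℂ) +
        ((Real.sin t : ℝ) : ℂ) * ((Real.sin t : ℝ) : ℂ) = 1 := by
      have := Real.cos_sq_add_sin_sq t
      rw [← Complex.ofReal_mul, ← Complex.ofReal_mul, ← Complex.ofReal_add]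
      norm_cast
      nlinarith
    rw [this, one_smul]
  have hc : Continuous V := by fun_prop
  have h0 : V 0 = S := by simp [V]
  have h1 : V (Real.pi / 2) = T := by simp [V]
  have := joined_Ad hV hc 0 (Real.pi / 2)
  simpa only [h0, h1] using this

end XHom

/-! ### The infinite rotation -/

namespace Stab

variable {B : Type u} [NonUnitalCStarAlgebra B]

/-- The isometry that maps the basis vector `δ_k` to `δ_⟨j,k⟩`. -/
def blockIsom (j : ℕ) : Mult (Stab B) := isom (pairEmb j)

theorem star_blockIsom_mul (i j : ℕ) : star (blockIsom i : Mult (Stab B)) * blockIsom j =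
    if i = j then 1 else 0 := star_pairIsom_mul i j

/-- The projection onto the antisymmetric vectors in the sum of the blocks `0` and `m`. -/
def antiProj (m : ℕ) : Mult (Stab B) :=
  (1 / 2 : ℂ) • ((blockIsom 0 - blockIsom m) * star (blockIsom 0 - blockIsom m))

theorem star_antiProj (m : ℕ) : star (antiProj m : Mult (Stab B)) = antiProj m := by
  simp [antiProj, star_smul, star_mul]

theorem antiProj_mul_self {m : ℕ} (hm : m ≠ 0) :
    (antiProj m : Mult (Stab B)) * antiProj m = antiProj m := by
  have h : star (blockIsom 0 - blockIsom m : Mult (Stab B)) * (blockIsom 0 - blockIsom m) =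
      (2 : ℂ) • 1 := by
    simp only [star_sub, sub_mul, mul_sub, star_blockIsom_mul, if_pos, if_neg hm,
      if_neg (Ne.symm hm), two_smul]
    abel
  simp only [antiProj, smul_mul_assoc, mul_smul_comm, smul_smul]
  rw [mul_assoc, ← mul_assoc (star _), h, smul_mul_assoc, one_mul, mul_smul_comm, smul_smul]
  norm_num

theorem antiProj_mul_zero {m : ℕ} (hm : m ≠ 0) : (antiProj m : Mult (Stab B)) * blockIsom 0 =
    (1 / 2 : ℂ) • (blockIsom 0 - blockIsom m) := by
  simp only [antiProj, smul_mul_assoc, mul_assoc, star_sub, sub_mul (star _), star_blockIsom_mul,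
    if_neg hm, if_true, sub_zero, mul_one]

theorem antiProj_mul_same {m : ℕ} (hm : m ≠ 0) : (antiProj m : Mult (Stab B)) * blockIsom m =
    (1 / 2 : ℂ) • (blockIsom m - blockIsom 0) := by
  simp only [antiProj, smul_mul_assoc, mul_assoc, star_sub, sub_mul (star _), star_blockIsom_mul,
    if_neg hm.symm, if_true, zero_sub, mul_neg, mul_one, neg_sub]

theorem antiProj_mul_ne {m j : ℕ} (h0 : j ≠ 0) (hm : j ≠ m) :
    (antiProj m : Mult (Stab B)) * blockIsom j = 0 := by
  simp only [antiProj, smul_mul_assoc, mul_assoc, star_sub, sub_mul (star _), star_blockIsom_mul,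
    if_neg h0.symm, if_neg hm.symm, sub_zero, mul_zero, smul_zero]

/-- The unitary path between `1` and the transposition of the blocks `0` and `m`. -/
def swapPath (m : ℕ) (c : ℂ) : Mult (Stab B) := 1 + (c - 1) • antiProj m

theorem star_swapPath_mul {m : ℕ} (hm : m ≠ 0) {c : ℂ} (hc : star c * c = 1) :
    star (swapPath m c : Mult (Stab B)) * swapPath m c = 1 := by
  simp only [swapPath, star_add, star_one, star_smul, star_antiProj, add_mul, mul_add, one_mul,
    mul_one, smul_mul_assoc, mul_smul_comm, antiProj_mul_self hm, smul_add, smul_smul, add_assoc, ← add_smul]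
  rw [add_eq_left]
  convert zero_smul ℂ (antiProj m : Mult (Stab B)) using 2
  rw [star_sub, star_one]; linear_combination hc

theorem swapPath_one (m : ℕ) : (swapPath m 1 : Mult (Stab B)) = 1 := by simp [swapPath]

theorem swapPath_mul_ne {m j : ℕ} (c : ℂ) (h0 : j ≠ 0) (hm : j ≠ m) :
    (swapPath m c : Mult (Stab B)) * blockIsom j = blockIsom j := by
  rw [swapPath, add_mul, one_mul, smul_mul_assoc, antiProj_mul_ne h0 hm, smul_zero, add_zero]

theorem swapPath_neg_mul_zero {m : ℕ} (hm : m ≠ 0) :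
    (swapPath m (-1) : Mult (Stab B)) * blockIsom 0 = blockIsom m := by
  rw [swapPath, add_mul, one_mul, smul_mul_assoc, antiProj_mul_zero hm, smul_smul]
  norm_num

theorem swapPath_neg_mul_same {m : ℕ} (hm : m ≠ 0) :
    (swapPath m (-1) : Mult (Stab B)) * blockIsom m = blockIsom 0 := by
  rw [swapPath, add_mul, one_mul, smul_mul_assoc, antiProj_mul_same hm, smul_smul]
  norm_num

/-- The path in the unit circle with value `1` for `t ≤ 0` and `-1` for `t ≥ 1`. -/
def halfTurn (t : ℝ) : ℂ := Complex.exp ((Real.pi * max 0 (min t 1) : ℝ) * Complex.I)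

theorem continuous_halfTurn : Continuous halfTurn := by unfold halfTurn; fun_prop

theorem star_halfTurn_mul (t : ℝ) : star (halfTurn t) * halfTurn t = 1 := by
  rw [Complex.star_def, ← Complex.normSq_eq_conj_mul_self, Complex.normSq_eq_norm_sq, halfTurn,
    Complex.norm_exp_ofReal_mul_I]
  simp

theorem halfTurn_of_nonpos {t : ℝ} (ht : t ≤ 0) : halfTurn t = 1 := by
  rw [halfTurn, min_eq_left (by linarith), max_eq_left ht]; simp

theorem halfTurn_of_one_le {t : ℝ} (ht : 1 ≤ t) : halfTurn t = -1 := by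
  rw [halfTurn, min_eq_right ht, max_eq_right zero_le_one, mul_one, Complex.exp_pi_mul_I]

/-- The product of the paths of transpositions of the blocks `0` and `m`, for `m = 1, ..., n`, in
consecutive intervals of time. -/
def rotation : ℕ → ℝ → Mult (Stab B)
  | 0, _ => 1
  | n + 1, t => swapPath (n + 1) (halfTurn (t - n)) * rotation n t

theorem star_rotation_mul (n : ℕ) (t : ℝ) :
    star (rotation n t : Mult (Stab B)) * rotation n t = 1 := by
  induction n with
  | zero => simp [rotation]
  | succ n ih =>
    rw [rotation, star_mul, mul_assoc, ← mul_assoc (star (swapPath _ _)),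
      star_swapPath_mul n.succ_ne_zero (star_halfTurn_mul _), one_mul, ih]

theorem continuous_rotation (n : ℕ) : Continuous (rotation n : ℝ → Mult (Stab B)) := by
  induction n with
  | zero => exact continuous_const
  | succ n ih =>
    have h : Continuous fun t : ℝ => (swapPath (n + 1) (halfTurn (t - n)) : Mult (Stab B)) := by
      unfold swapPath
      have := continuous_halfTurn
      fun_prop
    exact h.mul ih

theorem rotation_succ_of_le {n : ℕ} {t : ℝ} (h : t ≤ n) :
    (rotation (n + 1) t : Mult (Stab B)) = rotation n t := by
  rw [rotation, halfTurn_of_nonpos (by linarith), swapPath_one, one_mul]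

theorem rotation_eq_of_le {n m : ℕ} {t : ℝ} (h : t ≤ n) (hnm : n ≤ m) :
    (rotation m t : Mult (Stab B)) = rotation n t := by
  induction m, hnm using Nat.le_induction with
  | base => rfl
  | succ m hm ih =>
    rw [rotation_succ_of_le (h.trans (by exact_mod_cast hm)), ih]

theorem rotation_mul_of_ge {n : ℕ} {t : ℝ} (h : (n : ℝ) ≤ t) (j : ℕ) :
    (rotation n t : Mult (Stab B)) * blockIsom j =
      blockIsom (if j < n then j + 1 else if j = n then 0 else j) := by
  induction n with
  | zero =>
    rw [rotation, one_mul]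
    congr 1
    split_ifs with h1 h2 <;> simp_all
  | succ n ih =>
    push_cast at h
    rw [rotation, mul_assoc, ih (by linarith), halfTurn_of_one_le (by linarith)]
    rcases lt_trichotomy j n with hj | rfl | hj
    · rw [if_pos hj, if_pos (by omega), swapPath_mul_ne _ (by omega) (by omega)]
    · rw [if_neg (by omega), if_pos rfl, if_pos (by omega), swapPath_neg_mul_zero (by omega)]
    · rw [if_neg (by omega), if_neg (by omega), if_neg (by omega)]
      by_cases hj' : j = n + 1
      · rw [if_pos hj', hj', swapPath_neg_mul_same (by omega)]
      · rw [if_neg hj', swapPath_mul_ne _ (by omega) hj']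

theorem rotation_mul_blockIsom {n j : ℕ} {t : ℝ} (hn : j + 1 ≤ n) (ht : (j : ℝ) + 1 ≤ t) :
    (rotation n t : Mult (Stab B)) * blockIsom j = blockIsom (j + 1) := by
  induction n, hn using Nat.le_induction with
  | base => rw [rotation_mul_of_ge (by push_cast; exact ht), if_pos (by omega)]
  | succ n hn ih => rw [rotation, mul_assoc, ih, swapPath_mul_ne _ (by omega) (by omega)]

/-- The injection `⟨j, k⟩ ↦ ⟨j + 1, k⟩`. -/
def blockShift : ℕ ↪ ℕ :=
  ⟨fun n => Nat.pair (n.unpair.1 + 1) n.unpair.2, fun m n h => by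
    obtain ⟨h1, h2⟩ := Nat.pair_eq_pair.1 h
    rw [← Nat.pair_unpair m, ← Nat.pair_unpair n, h2, Nat.succ_injective h1]⟩

theorem blockShift_pair (j k : ℕ) : blockShift (Nat.pair j k) = Nat.pair (j + 1) k := by
  change Nat.pair ((Nat.pair j k).unpair.1 + 1) (Nat.pair j k).unpair.2 = _
  rw [Nat.unpair_pair]

/-- The infinite rotation. -/
def ray (t : ℝ) : Mult (Stab B) := rotation (⌊t⌋₊ + 1) t

theorem star_ray_mul (t : ℝ) : star (ray t : Mult (Stab B)) * ray t = 1 := star_rotation_mul _ _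

theorem ray_eq {n : ℕ} {t : ℝ} (h : t ≤ n) : (ray t : Mult (Stab B)) = rotation n t := by
  have h' : t ≤ (⌊t⌋₊ + 1 : ℕ) := by push_cast; exact (Nat.lt_floor_add_one t).le
  rcases le_total n (⌊t⌋₊ + 1) with h1 | h1
  · exact rotation_eq_of_le h h1
  · exact (rotation_eq_of_le h' h1).symm

theorem continuous_ray : Continuous (ray : ℝ → Mult (Stab B)) := by
  rw [continuous_iff_continuousAt]
  intro t
  obtain ⟨n, hn⟩ := exists_nat_gt t
  refine ((continuous_rotation n).continuousAt).congr ?_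
  filter_upwards [Iio_mem_nhds hn] with s hs
  exact (ray_eq hs.le).symm

theorem ray_mul_blockIsom {j : ℕ} {t : ℝ} (ht : (j : ℝ) + 1 ≤ t) :
    (ray t : Mult (Stab B)) * blockIsom j = blockIsom (j + 1) := by
  refine rotation_mul_blockIsom ?_ ht
  have : j ≤ ⌊t⌋₊ := Nat.le_floor (by linarith)
  omega

theorem Ad_ray_single {i j k l : ℕ} (b : B) {t : ℝ} (hi : (i : ℝ) + 1 ≤ t) (hj : (j : ℝ) + 1 ≤ t) :
    Mult.Ad (ray t) (star_ray_mul t) (single (Nat.pair i k) (Nat.pair j l) b) =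
      reindex blockShift (single (Nat.pair i k) (Nat.pair j l) b) := by
  rw [reindex_single, blockShift_pair, blockShift_pair, ← blockEmb_single, ← blockEmb_single]
  refine Mult.of_injective ?_
  rw [Mult.of_Ad, of_blockEmb, of_blockEmb]
  change ray t * (blockIsom i * _ * star (blockIsom j)) * star (ray t) =
    blockIsom (i + 1) * _ * star (blockIsom (j + 1))
  rw [← ray_mul_blockIsom hi, ← ray_mul_blockIsom hj, star_mul]
  simp only [mul_assoc]

variable (B) in
theorem dense_tendsto_ray : Dense {z : Stab B | Tendsto
    (fun t => Mult.Ad (ray t) (star_ray_mul t) z) atTop (𝓝 (reindex blockShift z))} := by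
  intro z
  refine induction_on (p := fun z => z ∈ closure {z : Stab B | Tendsto
    (fun t => Mult.Ad (ray t) (star_ray_mul t) z) atTop (𝓝 (reindex blockShift z))})
    isClosed_closure (subset_closure ?_) ?_ ?_ z
  · simp only [Set.mem_ofPred_eq, map_zero]; exact tendsto_const_nhds
  · intro x y hx hy
    refine map_mem_closure₂ continuous_add hx hy fun x hx y hy => ?_
    simp only [Set.mem_ofPred_eq, map_add] at *; exact hx.add hy
  · intro i j b
    refine subset_closure (tendsto_const_nhds.congr' ?_)
    filter_upwards [eventually_ge_atTop ((i.unpair.1 : ℝ) + 1),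
      eventually_ge_atTop ((j.unpair.1 : ℝ) + 1)] with t hi hj
    have := Ad_ray_single (k := i.unpair.2) (l := j.unpair.2) b hi hj
    rw [Nat.pair_unpair, Nat.pair_unpair] at this
    exact this.symm

end Stab

namespace XHom

variable {D E : XAlgebra.{u} X}

theorem joined_id_blockShift : Joined (id E.stab) (reindex (E := E) Stab.blockShift) := by
  have h0 : Ad (E := E) (Stab.ray 0) (Stab.star_ray_mul 0) = id E.stab := by
    refine ext fun z => ?_
    change Mult.Ad (Stab.ray 0) (Stab.star_ray_mul 0) (show Stab E from z) = z
    refine Mult.of_injective ?_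
    have : (Stab.ray 0 : Mult (Stab E)) = 1 := by
      rw [Stab.ray_eq (n := 0) (by simp)]; rfl
    rw [Mult.of_Ad, this, star_one, one_mul, mul_one]
  rw [← h0]
  refine joined_of_tendsto (F := fun t => Ad (E := E) (Stab.ray t) (Stab.star_ray_mul t))
    (fun z => Mult.continuous_Ad Stab.star_ray_mul Stab.continuous_ray z) _
    (Stab.dense_tendsto_ray E) (fun z hz => hz)

/-- The endomorphism of `K ⊗ E` given by an injection of indices is homotopic to the identity. -/
theorem joined_reindex_id (τ : ℕ ↪ ℕ) : Joined (reindex (E := E) τ) (id E.stab) := by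
  have h1 : ∀ τ : ℕ ↪ ℕ, Joined (reindex (E := E) τ) (reindex (Stab.pairEmb 0)) := by
    intro τ
    have h2 : Joined ((id E.stab).comp (reindex τ))
        ((reindex (E := E) Stab.blockShift).comp (reindex τ)) :=
      joined_comp_right _ joined_id_blockShift
    have h3 : (reindex (E := E) Stab.blockShift).comp (reindex τ) =
        reindex (τ.trans Stab.blockShift) := ext fun z => Stab.reindex_reindex (B := E) _ _ z
    rw [h3, id_comp] at h2
    refine h2.trans (joined_Ad_of_orthogonal _ _
      (Stab.star_isom_mul_isom_of_disjoint fun i j h => ?_))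
    exact absurd (Nat.pair_eq_pair.1 h).1 (Nat.succ_ne_zero _)
  exact (h1 τ).trans ((h1 Stab.blockShift).symm.trans joined_id_blockShift.symm)

theorem joined_reindex_comp (τ : ℕ ↪ ℕ) (φ : XHom D E.stab) : Joined ((reindex τ).comp φ) φ :=
  joined_comp_right φ (joined_reindex_id τ)

end XHom

end

noncomputable section

attribute [local instance] CStarAlgebra.spectralOrder CStarAlgebra.spectralOrderedRing

open Filter Topology

variable {X : Type v} [TopologicalSpace X]

/-! ### Functoriality of the stabilization -/

namespace Stab

variable {B C : Type u} [NonUnitalCStarAlgebra B] [NonUnitalCStarAlgebra C]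

theorem isom_fst_map (f : B →⋆ₙₐ[ℂ] C) (σ : ℕ ↪ ℕ) (x : Stab B) :
    (isom σ).fst (map f x) = map f ((isom σ).fst x) := by
  refine induction_on (p := fun x => (isom σ).fst (map f x) = map f ((isom σ).fst x))
    (isClosed_eq ((isom σ).fst.continuous.comp (continuous_cstarHom _))
      ((continuous_cstarHom _).comp (isom σ).fst.continuous)) (by simp)
    (fun x y hx hy => by simp only [map_add, hx, hy]) (fun i j b => ?_) x
  rw [map_single, isom_fst_single, isom_fst_single, map_single]

theorem star_isom_snd_map (f : B →⋆ₙₐ[ℂ] C) (σ : ℕ ↪ ℕ) (x : Stab B) :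
    (star (isom σ)).snd (map f x) = map f ((star (isom σ)).snd x) := by
  rw [DoubleCentralizer.star_snd, DoubleCentralizer.star_snd, ← map_star (map f), isom_fst_map,
    map_star (map f)]

theorem blockEmb_map (f : B →⋆ₙₐ[ℂ] C) (i j : ℕ) (x : Stab B) :
    blockEmb i j (map f x) = map f (blockEmb i j x) := by
  rw [blockEmb, blockEmb, isom_fst_map, star_isom_snd_map]

theorem flatten_map_map (f : B →⋆ₙₐ[ℂ] C) (x : Stab (Stab B)) :
    flatten (map (map f) x) = map f (flatten x) := by
  have : flatten.comp (map (map f)) = (map f).comp flatten := hom_ext fun i j y => by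
    simp only [NonUnitalStarAlgHom.comp_apply, map_single, flatten_single, blockEmb_map]
  exact DFunLike.congr_fun this x

theorem blockEmb_reindex_eq {i j i' j' : ℕ} {σ τ : ℕ ↪ ℕ}
    (hi : ∀ k, τ (Nat.pair i k) = Nat.pair i' (σ k)) (hj : ∀ k, τ (Nat.pair j k) = Nat.pair j' (σ k))
    (x : Stab B) : blockEmb i' j' (reindex σ x) = reindex τ (blockEmb i j x) := by
  have hi' : (isom (pairEmb i') : Mult (Stab B)) * isom σ = isom τ * isom (pairEmb i) := by
    rw [isom_mul_isom, isom_mul_isom]; congr 1; ext k; exact (hi k).symm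
  have hj' : (isom (pairEmb j') : Mult (Stab B)) * isom σ = isom τ * isom (pairEmb j) := by
    rw [isom_mul_isom, isom_mul_isom]; congr 1; ext k; exact (hj k).symm
  refine Mult.of_injective ?_
  rw [of_blockEmb, reindex, Mult.of_Ad, reindex, Mult.of_Ad, of_blockEmb]
  calc _ = (isom (pairEmb i') * isom σ) * Mult.of _ x * star (isom (pairEmb j') * isom σ) := by
        rw [star_mul]; simp only [mul_assoc]
    _ = _ := by rw [hi', hj', star_mul]; simp only [mul_assoc]

theorem reindex_refl (x : Stab B) : reindex (Function.Embedding.refl ℕ) x = x := by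
  have : reindex (Function.Embedding.refl ℕ) = NonUnitalStarAlgHom.id ℂ (Stab B) :=
    hom_ext fun i j b => reindex_single _ i j b
  exact DFunLike.congr_fun this x

/-- The injection `⟨i, k⟩ ↦ ⟨σ(i), τ(k)⟩`. -/
def prodEmb (σ τ : ℕ ↪ ℕ) : ℕ ↪ ℕ :=
  ⟨fun n => Nat.pair (σ n.unpair.1) (τ n.unpair.2), fun m n h => by
    obtain ⟨h1, h2⟩ := Nat.pair_eq_pair.1 h
    rw [← Nat.pair_unpair m, ← Nat.pair_unpair n, σ.injective h1, τ.injective h2]⟩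

theorem prodEmb_pair (σ τ : ℕ ↪ ℕ) (i k : ℕ) :
    prodEmb σ τ (Nat.pair i k) = Nat.pair (σ i) (τ k) := by
  change Nat.pair (σ (Nat.pair i k).unpair.1) (τ (Nat.pair i k).unpair.2) = _
  rw [Nat.unpair_pair]

theorem flatten_reindex (σ : ℕ ↪ ℕ) (x : Stab (Stab B)) :
    flatten (reindex σ x) = reindex (prodEmb σ (.refl ℕ)) (flatten x) := by
  have : flatten.comp (reindex σ) = (reindex (B := B) (prodEmb σ (.refl ℕ))).comp flatten :=
    hom_ext fun i j y => by
      simp only [NonUnitalStarAlgHom.comp_apply, reindex_single, flatten_single]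
      rw [← blockEmb_reindex_eq (σ := .refl ℕ) (prodEmb_pair _ _ i) (prodEmb_pair _ _ j),
        reindex_refl]
  exact DFunLike.congr_fun this x

theorem flatten_map_reindex (σ : ℕ ↪ ℕ) (x : Stab (Stab B)) :
    flatten (map (reindex σ) x) = reindex (prodEmb (.refl ℕ) σ) (flatten x) := by
  have : flatten.comp (map (reindex σ)) = (reindex (B := B) (prodEmb (.refl ℕ) σ)).comp flatten :=
    hom_ext fun i j y => by
      simp only [NonUnitalStarAlgHom.comp_apply, map_single, flatten_single]
      rw [← blockEmb_reindex_eq (prodEmb_pair _ _ i) (prodEmb_pair _ _ j)]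
      rfl
  exact DFunLike.congr_fun this x

theorem flatten_corner (x : Stab B) : flatten (corner (Stab B) x) = reindex (pairEmb 0) x := by
  rw [corner_apply, flatten_single]; rfl

theorem flatten_map_corner (x : Stab B) : flatten (map (corner B) x) =
    reindex ⟨fun i => Nat.pair i 0, fun _ _ h => (Nat.pair_eq_pair.1 h).1⟩ x := by
  have : flatten.comp (map (corner B)) =
      reindex ⟨fun i => Nat.pair i 0, fun _ _ h => (Nat.pair_eq_pair.1 h).1⟩ :=
    hom_ext fun i j b => by
      simp only [NonUnitalStarAlgHom.comp_apply, map_single, flatten_single, corner_apply,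
        blockEmb_single, reindex_single]
      rfl
  exact DFunLike.congr_fun this x

/-- The injection `⟨i, ⟨k, m⟩⟩ ↦ ⟨⟨i, k⟩, m⟩`. -/
def assocEmb : ℕ ↪ ℕ :=
  ⟨fun n => Nat.pair (Nat.pair n.unpair.1 n.unpair.2.unpair.1) n.unpair.2.unpair.2, fun m n h => by
    obtain ⟨h1, h2⟩ := Nat.pair_eq_pair.1 h
    obtain ⟨h1, h3⟩ := Nat.pair_eq_pair.1 h1
    rw [← Nat.pair_unpair m, ← Nat.pair_unpair n, ← Nat.pair_unpair m.unpair.2,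
      ← Nat.pair_unpair n.unpair.2, h1, h2, h3]⟩

theorem assocEmb_pair (i k m : ℕ) :
    assocEmb (Nat.pair i (Nat.pair k m)) = Nat.pair (Nat.pair i k) m := by
  change Nat.pair (Nat.pair (Nat.pair i (Nat.pair k m)).unpair.1
    (Nat.pair i (Nat.pair k m)).unpair.2.unpair.1)
    (Nat.pair i (Nat.pair k m)).unpair.2.unpair.2 = _
  simp only [Nat.unpair_pair]

theorem pairEmb_pair (i k : ℕ) :
    pairEmb (Nat.pair i k) = ((pairEmb k).trans (pairEmb i)).trans assocEmb :=
  DFunLike.ext _ _ fun m => by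
    rw [Function.Embedding.trans_apply, Function.Embedding.trans_apply, pairEmb_apply,
      pairEmb_apply, pairEmb_apply, assocEmb_pair]

theorem isom_pairEmb_pair (i k : ℕ) : (isom (pairEmb (Nat.pair i k)) : Mult (Stab B)) =
    isom assocEmb * (isom (pairEmb i) * isom (pairEmb k)) := by
  rw [isom_mul_isom (pairEmb i) (pairEmb k), isom_mul_isom assocEmb, pairEmb_pair]

/-- The operator `blockEmb` as a bounded linear map. -/
def blockEmbL (i j : ℕ) : Stab B →L[ℂ] Stab B :=
  (star (isom (pairEmb j))).snd.comp (isom (pairEmb i)).fst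

/-- A homomorphism of C*-algebras as a bounded linear map. -/
def homL {D E : Type*} [NonUnitalCStarAlgebra D] [NonUnitalCStarAlgebra E] (f : D →⋆ₙₐ[ℂ] E) :
    D →L[ℂ] E := ⟨(f : D →ₗ[ℂ] E), continuous_cstarHom f⟩

theorem flatten_blockEmb (i j : ℕ) (x : Stab (Stab B)) :
    flatten (blockEmb i j x) = reindex assocEmb (blockEmb i j (flatten x)) := by
  have : (homL (flatten (B := B))).comp (blockEmbL i j) =
      (homL (reindex assocEmb)).comp ((blockEmbL i j).comp (homL (flatten (B := B)))) := by
    refine clm_ext fun k l y => ?_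
    change flatten (blockEmb i j (single k l y)) =
      reindex assocEmb (blockEmb i j (flatten (single k l y)))
    rw [blockEmb_single, flatten_single, flatten_single]
    refine Mult.of_injective ?_
    rw [of_blockEmb, reindex, Mult.of_Ad, of_blockEmb, of_blockEmb, isom_pairEmb_pair,
      isom_pairEmb_pair]
    simp only [star_mul, mul_assoc]
  exact DFunLike.congr_fun this x

theorem flatten_flatten (x : Stab (Stab (Stab B))) :
    flatten (flatten x) = reindex assocEmb (flatten (map flatten x)) := by
  have : flatten.comp flatten = (reindex (B := B) assocEmb).comp (flatten.comp (map flatten)) :=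
    hom_ext fun i j y => by
      simp only [NonUnitalStarAlgHom.comp_apply, map_single, flatten_single, flatten_blockEmb]
  exact DFunLike.congr_fun this x

/-- The injection `2 i + k ↦ σ_k(i)`, for injections `σ₀` and `σ₁` with disjoint ranges. -/
def mergeEmb (σ₀ σ₁ : ℕ ↪ ℕ) (h : ∀ i j, σ₀ i ≠ σ₁ j) : ℕ ↪ ℕ :=
  ⟨fun n => if n % 2 = 0 then σ₀ (n / 2) else σ₁ (n / 2), fun m n hmn => by
    beta_reduce at hmn
    split_ifs at hmn with h1 h2 h2
    · have := σ₀.injective hmn; omega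
    · exact absurd hmn (h _ _)
    · exact absurd hmn.symm (h _ _)
    · have := σ₁.injective hmn; omega⟩

theorem parity_zero_trans_mergeEmb (σ₀ σ₁ : ℕ ↪ ℕ) (h : ∀ i j, σ₀ i ≠ σ₁ j) :
    (parity 0).trans (mergeEmb σ₀ σ₁ h) = σ₀ := by
  ext i
  change (if (2 * i + 0) % 2 = 0 then σ₀ ((2 * i + 0) / 2) else σ₁ ((2 * i + 0) / 2)) = _
  rw [if_pos (by omega)]; congr 1; omega

theorem parity_one_trans_mergeEmb (σ₀ σ₁ : ℕ ↪ ℕ) (h : ∀ i j, σ₀ i ≠ σ₁ j) :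
    (parity 1).trans (mergeEmb σ₀ σ₁ h) = σ₁ := by
  ext i
  change (if (2 * i + 1) % 2 = 0 then σ₀ ((2 * i + 1) / 2) else σ₁ ((2 * i + 1) / 2)) = _
  rw [if_neg (by omega)]; congr 1; omega

theorem reindex_mergeEmb (σ₀ σ₁ : ℕ ↪ ℕ) (h : ∀ i j, σ₀ i ≠ σ₁ j) (x y : Stab B) :
    reindex (mergeEmb σ₀ σ₁ h) (spread 0 x + spread 1 y) = reindex σ₀ x + reindex σ₁ y := by
  rw [map_add, spread_eq_reindex, spread_eq_reindex, reindex_reindex, reindex_reindex,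
    parity_zero_trans_mergeEmb, parity_one_trans_mergeEmb]

theorem norm_single_le (i j : ℕ) (b : B) : ‖single i j b‖ ≤ ‖b‖ := by
  have h : ∀ b : B, ‖single j j b‖ ≤ ‖b‖ := fun b => by
    have hj : single j j b = reindex ⟨fun k => k + j, fun _ _ h => Nat.add_right_cancel h⟩
        (corner B b) := by 
      rw [corner_apply, reindex_single]
      change _ = single (0 + j) (0 + j) b
      rw [zero_add]
    rw [hj]
    exact (NonUnitalStarAlgHom.norm_apply_le _ _).trans (NonUnitalStarAlgHom.norm_apply_le _ _)
  refine abs_le_of_sq_le_sq' ?_ (norm_nonneg _) |>.2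
  rw [pow_two, pow_two, ← CStarRing.norm_star_mul_self, ← CStarRing.norm_star_mul_self, star_single,
    single_mul_single]
  exact h _

theorem parity_ne (i j : ℕ) : parity 0 i ≠ parity 1 j := by
  change 2 * i + 0 ≠ 2 * j + 1; omega

end Stab

namespace XHom

variable {C D E F : XAlgebra.{u} X}

theorem continuous_stabMap : Continuous fun f : XHom D E => f.stabMap := by
  refine continuous_of fun z => ?_
  refine Stab.induction_on (B := D) (p := fun z => Continuous fun f : XHom D E => Stab.map f.hom z)
    ?_ ?_ ?_ ?_ z
  · rw [← isSeqClosed_iff_isClosed]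
    intro x y hx hxy
    refine continuous_of_uniform_approx_of_continuous fun u hu => ?_
    obtain ⟨ε, hε, hu⟩ := Metric.mem_uniformity_dist.1 hu
    obtain ⟨n, hn⟩ := (Metric.tendsto_atTop.1 hxy ε hε)
    refine ⟨_, hx n, fun f => hu ?_⟩
    refine lt_of_le_of_lt ?_ (hn n le_rfl)
    rw [dist_comm (x n), dist_eq_norm, dist_eq_norm, ← map_sub]
    exact NonUnitalStarAlgHom.norm_apply_le (Stab.map f.hom) _
  · simp only [map_zero]; exact continuous_const
  · intro x y hx hy; simp only [map_add]; exact hx.add hy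
  · intro i j b
    simp only [Stab.map_single]
    have : Continuous fun b : E => Stab.single i j b := by
      refine AddMonoidHomClass.continuous_of_bound
        (AddMonoidHom.mk' (fun b : E => Stab.single i j b) (Stab.single_add i j)) 1 fun b => ?_
      rw [one_mul]
      exact Stab.norm_single_le i j b
    exact this.comp (continuous_eval b)

theorem joined_stabMap {f g : XHom D E} (h : Joined f g) : Joined f.stabMap g.stabMap := by
  obtain ⟨p⟩ := h
  exact ⟨p.map continuous_stabMap⟩

theorem stabMap_comp (g : XHom D E) (f : XHom C D) :
    (g.comp f).stabMap = g.stabMap.comp f.stabMap :=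
  ext fun z => (Stab.map_map (B := C) g.hom f.hom z).symm

theorem stabMap_comp_corner (f : XHom D E) : f.stabMap.comp (corner D) = (corner E).comp f :=
  ext fun z => Stab.map_single f.hom 0 0 z

theorem flatten_naturality (f : XHom D E) :
    (flatten E).comp f.stabMap.stabMap = f.stabMap.comp (flatten D) :=
  ext fun z => Stab.flatten_map_map (B := D) f.hom z

/-- A homomorphism to `K ⊗ E`, regarded as a homomorphism of C*-algebras. -/
def toStab (φ : XHom D E.stab) : D →⋆ₙₐ[ℂ] Stab E := φ.hom

theorem ext_stab {φ ψ : XHom D E.stab} (h : ∀ z, φ.toStab z = ψ.toStab z) : φ = ψ := ext h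

theorem toStab_reindex_comp (σ : ℕ ↪ ℕ) (φ : XHom D E.stab) (z : D) :
    ((reindex σ).comp φ).toStab z = Stab.reindex σ (φ.toStab z) := rfl

theorem toStab_flatten_comp (ψ : XHom E F.stab) (φ : XHom D E.stab) (z : D) :
    ((flatten F).comp (ψ.stabMap.comp φ)).toStab z =
      Stab.flatten (Stab.map ψ.toStab (φ.toStab z)) := rfl

/-- The block sum of two homomorphisms to `K ⊗ E`. -/
def blockSum (φ ψ : XHom D E.stab) : XHom D E.stab :=
  ⟨Stab.blockSum (B := E) φ.hom ψ.hom, fun U x hx =>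
      (Stab.ideal (E.ideal U)).add_mem (Stab.spread_mem 0 (φ.equivariant U x hx))
        (Stab.spread_mem 1 (ψ.equivariant U x hx))⟩

theorem toStab_blockSum (φ ψ : XHom D E.stab) (z : D) : (blockSum φ ψ).toStab z =
    Stab.reindex (Stab.parity 0) (φ.toStab z) + Stab.reindex (Stab.parity 1) (ψ.toStab z) := by
  rw [← Stab.spread_eq_reindex, ← Stab.spread_eq_reindex]; rfl

theorem continuous_blockSum :
    Continuous fun φψ : XHom D E.stab × XHom D E.stab => blockSum φψ.1 φψ.2 :=
  continuous_of fun z =>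
    Continuous.add (M := Stab E)
      ((continuous_cstarHom (Stab.spread (B := E) 0)).comp
        ((continuous_eval z).comp continuous_fst))
      ((continuous_cstarHom (Stab.spread (B := E) 1)).comp
        ((continuous_eval z).comp continuous_snd))

theorem joined_blockSum_of_disjoint {σ₀ σ₁ : ℕ ↪ ℕ} (h : ∀ i j, σ₀ i ≠ σ₁ j)
    {φ ψ χ : XHom D E.stab} (hχ : ∀ z, χ.toStab z =
      Stab.reindex σ₀ (φ.toStab z) + Stab.reindex σ₁ (ψ.toStab z)) :
    Joined χ (blockSum φ ψ) := by
  have : χ = (reindex (Stab.mergeEmb σ₀ σ₁ h)).comp (blockSum φ ψ) := ext_stab fun z => by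
    rw [hχ, toStab_reindex_comp, toStab_blockSum, ← Stab.spread_eq_reindex,
      ← Stab.spread_eq_reindex, Stab.reindex_mergeEmb]
  rw [this]
  exact joined_reindex_comp _ _

end XHom

/-! ### The category of homotopy classes of homomorphisms to stabilizations -/

/-- The homotopy classes of `X`-equivariant homomorphisms `D → K ⊗ E`. -/
def HClass (D E : XAlgebra.{u} X) : Type u := ZerothHomotopy (XHom D E.stab)

namespace HClass

variable {C D E F : XAlgebra.{u} X}

/-- The homotopy class of a homomorphism. -/
def mk (φ : XHom D E.stab) : HClass D E := ZerothHomotopy.mk φ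

theorem mk_eq_mk {φ ψ : XHom D E.stab} : mk φ = mk ψ ↔ Joined φ ψ := Quotient.eq (r := pathSetoid _)

theorem ind {p : HClass D E → Prop} (h : ∀ φ, p (mk φ)) (a : HClass D E) : p a := Quotient.ind h a

/-- The class of a homomorphism `D → E`. -/
def ofHom (f : XHom D E) : HClass D E := mk ((XHom.corner E).comp f)

/-- The composition of classes. -/
def comp (b : HClass E F) (a : HClass D E) : HClass D F :=
  Quotient.map₂ (fun (ψ : XHom E F.stab) (φ : XHom D E.stab) =>
      (XHom.flatten F).comp (ψ.stabMap.comp φ)) (fun _ _ h _ _ h' =>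
    XHom.joined_comp_left _ (XHom.joined_comp (XHom.joined_stabMap h) h')) b a

theorem mk_comp_mk (ψ : XHom E F.stab) (φ : XHom D E.stab) :
    comp (mk ψ) (mk φ) = mk ((XHom.flatten F).comp (ψ.stabMap.comp φ)) := rfl

theorem mk_reindex (τ : ℕ ↪ ℕ) (φ : XHom D E.stab) : mk ((XHom.reindex τ).comp φ) = mk φ :=
  mk_eq_mk.2 (XHom.joined_reindex_comp τ φ)

theorem ofHom_comp_mk (g : XHom E F) (φ : XHom D E.stab) :
    comp (ofHom g) (mk φ) = mk (g.stabMap.comp φ) := by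
  rw [ofHom, mk_comp_mk, XHom.stabMap_comp, ← mk_reindex
    ⟨fun i => Nat.pair i 0, fun _ _ h => (Nat.pair_eq_pair.1 h).1⟩ (g.stabMap.comp φ)]
  congr 1
  exact XHom.ext fun z => Stab.flatten_map_corner (B := F) _

theorem mk_comp_ofHom (ψ : XHom E F.stab) (f : XHom D E) :
    comp (mk ψ) (ofHom f) = mk (ψ.comp f) := by
  rw [ofHom, mk_comp_mk, ← mk_reindex (Stab.pairEmb 0) (ψ.comp f), ← XHom.comp_assoc ψ.stabMap,
    XHom.stabMap_comp_corner]
  congr 1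
  exact XHom.ext fun z => Stab.flatten_corner (B := F) _

theorem ofHom_comp_ofHom (g : XHom E F) (f : XHom D E) :
    comp (ofHom g) (ofHom f) = ofHom (g.comp f) := by
  exact mk_comp_ofHom _ _

theorem comp_id (a : HClass D E) : comp a (ofHom (XHom.id D)) = a := by
  induction a using ind with | h φ => ?_
  rw [mk_comp_ofHom]; rfl

theorem comp_assoc (c : HClass E F) (b : HClass D E) (a : HClass C D) :
    comp (comp c b) a = comp c (comp b a) := by
  induction a using ind with | h φ => ?_
  induction b using ind with | h ψ => ?_
  induction c using ind with | h χ => ?_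
  rw [mk_comp_mk, mk_comp_mk, mk_comp_mk, mk_comp_mk, XHom.stabMap_comp, XHom.stabMap_comp,
    ← mk_reindex Stab.assocEmb, ← XHom.comp_assoc χ.stabMap, ← XHom.flatten_naturality]
  congr 1
  exact XHom.ext fun z => (Stab.flatten_flatten (B := F) _).symm

instance : Add (HClass D E) where
  add := Quotient.map₂ XHom.blockSum fun _ _ ⟨p⟩ _ _ ⟨p'⟩ =>
    ⟨(p.prod p').map XHom.continuous_blockSum⟩

theorem mk_add_mk (φ ψ : XHom D E.stab) : mk φ + mk ψ = mk (XHom.blockSum φ ψ) := rfl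

theorem mk_eq_add {σ₀ σ₁ : ℕ ↪ ℕ} (h : ∀ i j, σ₀ i ≠ σ₁ j)
    {φ ψ χ : XHom D E.stab} (hχ : ∀ z, χ.toStab z =
      Stab.reindex σ₀ (φ.toStab z) + Stab.reindex σ₁ (ψ.toStab z)) :
    mk χ = mk φ + mk ψ := mk_eq_mk.2 (XHom.joined_blockSum_of_disjoint h hχ)

instance : Zero (HClass D E) where
  zero := mk ⟨0, fun U _ _ => (E.stab.ideal U).zero_mem⟩

theorem zero_def : (0 : HClass D E) = mk ⟨0, fun U _ _ => (E.stab.ideal U).zero_mem⟩ := rfl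

theorem add_comm' (a b : HClass D E) : a + b = b + a := by
  induction a using ind with | h φ => ?_
  induction b using ind with | h ψ => ?_
  rw [mk_add_mk φ ψ]
  refine mk_eq_add (σ₀ := Stab.parity 1) (σ₁ := Stab.parity 0)
    (fun i j => (Stab.parity_ne j i).symm) fun z => ?_
  rw [XHom.toStab_blockSum, add_comm]

theorem add_zero' (a : HClass D E) : a + 0 = a := by
  induction a using ind with | h φ => ?_
  rw [zero_def, mk_add_mk, ← mk_reindex (Stab.parity 0) φ]
  congr 1
  refine XHom.ext_stab fun z => ?_
  rw [XHom.toStab_blockSum, XHom.toStab_reindex_comp]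
  change _ + Stab.reindex _ (0 : Stab E) = _
  rw [map_zero, add_zero]

theorem add_assoc' (a b c : HClass D E) : a + b + c = a + (b + c) := by
  induction a using ind with | h φ => ?_
  induction b using ind with | h ψ => ?_
  induction c using ind with | h χ => ?_
  rw [mk_add_mk φ ψ, mk_add_mk, mk_add_mk ψ χ, mk_add_mk]
  have hne : ∀ i j, (Stab.parity 0) i ≠ ((Stab.parity 0).trans (Stab.parity 1)) j := fun i j =>
    Stab.parity_ne i _
  let τ := Stab.mergeEmb (Stab.mergeEmb (Stab.parity 0) ((Stab.parity 0).trans (Stab.parity 1)) hne)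
    ((Stab.parity 1).trans (Stab.parity 1)) fun i j => by
      change (if i % 2 = 0 then 2 * (i / 2) + 0 else 2 * (2 * (i / 2) + 0) + 1) ≠
        2 * (2 * j + 1) + 1
      split_ifs <;> omega
  rw [← mk_reindex τ]
  congr 1
  refine XHom.ext_stab fun z => ?_
  simp only [XHom.toStab_reindex_comp, XHom.toStab_blockSum, map_add, Stab.reindex_reindex,
    Function.Embedding.trans_assoc, τ, Stab.parity_zero_trans_mergeEmb,
    Stab.parity_one_trans_mergeEmb, add_assoc]

theorem comp_add (b : HClass E F) (a a' : HClass D E) :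
    comp b (a + a') = comp b a + comp b a' := by
  induction a using ind with | h φ => ?_
  induction a' using ind with | h φ' => ?_
  induction b using ind with | h ψ => ?_
  rw [mk_add_mk, mk_comp_mk, mk_comp_mk, mk_comp_mk]
  refine mk_eq_add (σ₀ := Stab.prodEmb (Stab.parity 0) (.refl ℕ))
    (σ₁ := Stab.prodEmb (Stab.parity 1) (.refl ℕ))
    (fun i j h => Stab.parity_ne _ _ (Nat.pair_eq_pair.1 h).1) fun z => ?_
  simp only [XHom.toStab_flatten_comp, XHom.toStab_blockSum, map_add, Stab.map_reindex,
    Stab.flatten_reindex]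

theorem add_comp (b b' : HClass E F) (a : HClass D E) :
    comp (b + b') a = comp b a + comp b' a := by
  induction a using ind with | h φ => ?_
  induction b using ind with | h ψ => ?_
  induction b' using ind with | h ψ' => ?_
  rw [mk_add_mk, mk_comp_mk, mk_comp_mk, mk_comp_mk]
  refine mk_eq_add (σ₀ := Stab.prodEmb (.refl ℕ) (Stab.parity 0))
    (σ₁ := Stab.prodEmb (.refl ℕ) (Stab.parity 1))
    (fun i j h => Stab.parity_ne _ _ (Nat.pair_eq_pair.1 h).2) fun z => ?_
  have h : ∀ x : Stab E, Stab.map (XHom.blockSum ψ ψ').toStab x =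
      Stab.map (Stab.reindex (Stab.parity 0)) (Stab.map ψ.toStab x) +
      Stab.map (Stab.reindex (Stab.parity 1)) (Stab.map ψ'.toStab x) := by
    intro x
    refine Stab.induction_on (p := fun x => Stab.map (XHom.blockSum ψ ψ').toStab x =
      Stab.map (Stab.reindex (Stab.parity 0)) (Stab.map ψ.toStab x) +
      Stab.map (Stab.reindex (Stab.parity 1)) (Stab.map ψ'.toStab x)) ?_ ?_ ?_ ?_ x
    · exact isClosed_eq (continuous_cstarHom _) (((continuous_cstarHom _).comp
        (continuous_cstarHom _)).add ((continuous_cstarHom _).comp (continuous_cstarHom _)))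
    · simp only [map_zero, add_zero]
    · intro x y hx hy; rw [map_add, hx, hy]; simp only [map_add]; abel
    · intro i j b
      simp only [Stab.map_single, ← Stab.single_add, XHom.toStab_blockSum]
  simp only [XHom.toStab_flatten_comp, h, map_add, Stab.flatten_map_reindex]

end HClass

end

noncomputable section

attribute [local instance] CStarAlgebra.spectralOrder CStarAlgebra.spectralOrderedRing

open Filter Topology

variable {X : Type v} [TopologicalSpace X]

/-! ### Ideals of stabilizations -/

namespace Stab

variable {B C : Type u} [NonUnitalCStarAlgebra B] [NonUnitalCStarAlgebra C]

theorem ofMat_injective : Function.Injective (ofMat B) := by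
  rw [injective_iff_map_eq_zero]
  intro M hM
  have h : ‖FinMat.block M.size M‖ = 0 := by
    rw [← FinMat.matNorm_apply, ← CStarSeminorm.Compl.norm_of]
    exact norm_eq_zero.2 hM
  rw [norm_eq_zero] at h
  rw [← FinMat.embed_block M.within_size, h, map_zero]

theorem map_injective {f : B →⋆ₙₐ[ℂ] C} (hf : Function.Injective f) :
    Function.Injective (map f) := by
  have h : ∀ M, ‖map f (ofMat B M)‖ = ‖ofMat B M‖ := by
    intro M
    let g : CStarMatrix (Fin M.size) (Fin M.size) B →⋆ₙₐ[ℂ] Stab C :=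
      (map f).comp ((ofMat B).comp (FinMat.embed B M.size))
    let g' : CStarMatrix (Fin M.size) (Fin M.size) B →⋆ₙₐ[ℂ] Stab B :=
      (ofMat B).comp (FinMat.embed B M.size)
    have hemb : Function.Injective (FinMat.embed B M.size) := fun N N' h => by
      rw [← FinMat.block_embed M.size N, h, FinMat.block_embed]
    have hg' : Function.Injective g' := ofMat_injective.comp hemb
    have hg : Function.Injective g := by
      intro N N' h
      have h' : map f (ofMat B (FinMat.embed B M.size N)) =
        map f (ofMat B (FinMat.embed B M.size N')) := h
      rw [map_ofMat, map_ofMat] at h'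
      refine hemb (FinMat.ext fun i j => hf ?_)
      rw [← FinMat.entry_map, ← FinMat.entry_map, ofMat_injective h']
    have h1 := NonUnitalStarAlgHom.norm_map g hg (FinMat.block M.size M)
    have h2 := NonUnitalStarAlgHom.norm_map g' hg' (FinMat.block M.size M)
    change ‖map f (ofMat B (FinMat.embed B M.size (FinMat.block M.size M)))‖ = _ at h1
    change ‖ofMat B (FinMat.embed B M.size (FinMat.block M.size M))‖ = _ at h2
    rw [FinMat.embed_block M.within_size] at h1 h2
    rw [h1, h2]
  rw [injective_iff_map_eq_zero]
  intro x hx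
  have : ‖map f x‖ = ‖x‖ := denseRange_ofMat.induction_on (p := fun x => ‖map f x‖ = ‖x‖) x
    (isClosed_eq (continuous_cstarHom _).norm continuous_norm) h
  rw [hx, norm_zero] at this
  exact norm_eq_zero.1 this.symm

/-- If `f` is injective and maps the ideal `I` onto `L`, then `K ⊗ L` is the image of `K ⊗ I`. -/
theorem mem_ideal_iff_exists {f : B →⋆ₙₐ[ℂ] C} (hf : Function.Injective f) {I : TwoSidedIdeal B}
    {L : TwoSidedIdeal C} (h : ∀ c, c ∈ L ↔ ∃ b ∈ I, f b = c) {x : Stab C} :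
    x ∈ ideal L ↔ ∃ y ∈ ideal I, map f y = x := by
  have h1 : ofMat C '' {M | ∀ i j, M.entry i j ∈ L} =
      map f '' (ofMat B '' {M | ∀ i j, M.entry i j ∈ I}) := by
    ext x
    constructor
    · rintro ⟨M, hM, rfl⟩
      have hM' : ∀ i j, ∃ b ∈ I, f b = M.entry i j := fun i j => (h _).1 (hM i j)
      choose N hN hN' using hM'
      let N' : FinMat B := FinMat.ofFun N M.size fun i j hij => hf (by
        rw [hN', M.within_size i j hij, map_zero])
      refine ⟨_, ⟨N', hN, rfl⟩, ?_⟩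
      rw [map_ofMat]
      congr 1
      exact FinMat.ext fun i j => hN' i j
    · rintro ⟨_, ⟨M, hM, rfl⟩, rfl⟩
      refine ⟨FinMat.map f M, fun i j => (h _).2 ⟨_, hM i j, rfl⟩, (map_ofMat f M).symm⟩
  have h2 : idealCarrier L = map f '' idealCarrier I := by
    rw [idealCarrier, idealCarrier, h1]
    exact ((isometry_cstarHom (map_injective hf)).isClosedEmbedding.closure_image_eq _)
  rw [mem_ideal, h2]
  simp only [Set.mem_image, mem_ideal]

theorem mem_ideal_top (x : Stab B) : x ∈ ideal (⊤ : TwoSidedIdeal B) := by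
  rw [mem_ideal]
  exact map_mem_closure continuous_id (denseRange_ofMat x) (by
    rintro _ ⟨M, rfl⟩; exact ⟨M, fun _ _ => trivial, rfl⟩)

theorem single_mem {I : TwoSidedIdeal B} {b : B} (hb : b ∈ I) (i j : ℕ) : single i j b ∈ ideal I :=
  mem_ideal.2 (subset_closure ⟨FinMat.single i j b, fun k l => by
    rw [FinMat.entry_single]
    split_ifs
    · exact hb
    · exact I.zero_mem, rfl⟩)

theorem ideal_induction {I : TwoSidedIdeal B} {p : Stab B → Prop} (hc : IsClosed {x | p x})
    (h0 : p 0) (hadd : ∀ x y, p x → p y → p (x + y)) (h : ∀ i j, ∀ b ∈ I, p (single i j b))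
    {x : Stab B} (hx : x ∈ ideal I) : p x := by
  rw [mem_ideal] at hx
  refine closure_minimal (t := {x | p x}) ?_ hc hx
  rintro _ ⟨M, hM, rfl⟩
  rw [Set.mem_ofPred_eq, FinMat.eq_sum_single M.within_size, map_sum]
  refine Finset.sum_induction _ p hadd h0 fun i _ => ?_
  rw [map_sum]
  exact Finset.sum_induction _ p hadd h0 fun j _ => h _ _ _ (hM i j)

theorem corner_mul_mem {I L : TwoSidedIdeal B} {b : B} (h : ∀ y ∈ I, b * y ∈ L) {x : Stab B}
    (hx : x ∈ ideal I) : corner B b * x ∈ ideal L := by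
  refine ideal_induction (p := fun x => corner B b * x ∈ ideal L)
    ((isClosed_ideal L).preimage (continuous_const_mul _)) (by rw [mul_zero]; exact zero_mem _)
    (fun x y hx hy => by rw [mul_add]; exact add_mem hx hy) (fun i j c hc => ?_) hx
  by_cases hi : i = 0
  · rw [corner_apply, hi, single_mul_single]; exact single_mem (h c hc) _ _
  · rw [corner_apply, single_mul_single_of_ne (Ne.symm hi)]; exact zero_mem _

theorem mul_corner_mem {I L : TwoSidedIdeal B} {b : B} (h : ∀ y ∈ I, y * b ∈ L) {x : Stab B}
    (hx : x ∈ ideal I) : x * corner B b ∈ ideal L := by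
  refine ideal_induction (p := fun x => x * corner B b ∈ ideal L)
    ((isClosed_ideal L).preimage (continuous_mul_const _)) (by rw [zero_mul]; exact zero_mem _)
    (fun x y hx hy => by rw [add_mul]; exact add_mem hx hy) (fun i j c hc => ?_) hx
  by_cases hj : j = 0
  · rw [corner_apply, hj, single_mul_single]; exact single_mem (h c hc) _ _
  · rw [corner_apply, single_mul_single_of_ne hj]; exact zero_mem _

end Stab

namespace qAlg.IdealEmbedding

variable {E M : Type*} [NonUnitalCStarAlgebra E] [NonUnitalCStarAlgebra M] {j : E →⋆ₙₐ[ℂ] M}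

/-- A closed ideal of a closed ideal is an ideal. -/
theorem mul_left_mem (hj : IdealEmbedding j) {I : TwoSidedIdeal E} (hI : IsClosed (I : Set E))
    (m : M) {x : E} (hx : x ∈ I) : ∃ y ∈ I, j y = m * j x := by
  obtain ⟨y, hy⟩ := hj.mul_left m x
  refine ⟨y, TwoSidedIdeal.mem_of_forall_norm_sub_lt hI fun ε hε => ?_, hy⟩
  obtain ⟨e, he, -, h⟩ := TwoSidedIdeal.exists_norm_sub_mul_lt hx
    (ε := ε / (‖m‖ + 1)) (by positivity)
  refine ⟨y * e, I.mul_mem_left _ _ he, ?_⟩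
  rw [← NonUnitalStarAlgHom.norm_map j hj.injective, map_sub, map_mul, hy, mul_assoc, ← map_mul,
    ← mul_sub, ← map_sub]
  refine (norm_mul_le _ _).trans_lt ?_
  rw [NonUnitalStarAlgHom.norm_map j hj.injective]
  rw [lt_div_iff₀ (by positivity)] at h
  nlinarith [norm_nonneg (x - x * e), norm_nonneg m]

theorem mul_right_mem (hj : IdealEmbedding j) {I : TwoSidedIdeal E} (hI : IsClosed (I : Set E))
    (m : M) {x : E} (hx : x ∈ I) : ∃ y ∈ I, j y = j x * m := by
  obtain ⟨y, hy, h⟩ := hj.mul_left_mem hI (star m) (TwoSidedIdeal.star_mem_of_isClosed hI hx)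
  refine ⟨star y, TwoSidedIdeal.star_mem_of_isClosed hI hy, ?_⟩
  rw [map_star, h, star_mul, map_star, star_star, star_star]

/-- The image of a closed ideal of a closed ideal. -/
def push (hj : IdealEmbedding j) (I : TwoSidedIdeal E) (hI : IsClosed (I : Set E)) :
    TwoSidedIdeal M :=
  TwoSidedIdeal.mk' (j '' I) ⟨0, I.zero_mem, map_zero _⟩
    (by rintro _ _ ⟨a, ha, rfl⟩ ⟨b, hb, rfl⟩; exact ⟨a + b, I.add_mem ha hb, map_add _ _ _⟩)
    (by rintro _ ⟨a, ha, rfl⟩; exact ⟨-a, I.neg_mem ha, map_neg _ _⟩)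
    (by rintro m _ ⟨a, ha, rfl⟩; exact hj.mul_left_mem hI m ha)
    (by rintro _ m ⟨a, ha, rfl⟩; exact hj.mul_right_mem hI m ha)

theorem mem_push (hj : IdealEmbedding j) {I : TwoSidedIdeal E} {hI : IsClosed (I : Set E)} {m : M} :
    m ∈ hj.push I hI ↔ ∃ a ∈ I, j a = m := TwoSidedIdeal.mem_mk' ..

theorem isClosed_push (hj : IdealEmbedding j) (I : TwoSidedIdeal E) (hI : IsClosed (I : Set E)) :
    IsClosed (hj.push I hI : Set M) := by
  have : (hj.push I hI : Set M) = j '' I := Set.ext fun _ => hj.mem_push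
  rw [this]
  exact (isometry_cstarHom hj.injective).isClosedEmbedding.isClosedMap _ hI

/-- The ideal `E` of `M`. -/
def range (hj : IdealEmbedding j) : TwoSidedIdeal M := hj.push ⊤ (by rw [TwoSidedIdeal.coe_top]; exact isClosed_univ)

theorem mem_range (hj : IdealEmbedding j) {m : M} : m ∈ hj.range ↔ m ∈ Set.range j := by
  rw [range, mem_push]
  exact ⟨fun ⟨a, _, h⟩ => ⟨a, h⟩, fun ⟨a, h⟩ => ⟨a, trivial, h⟩⟩

theorem isClosed_range (hj : IdealEmbedding j) : IsClosed (hj.range : Set M) :=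
  hj.isClosed_push _ _

theorem mem_stab_range {E M : Type u} [NonUnitalCStarAlgebra E] [NonUnitalCStarAlgebra M]
    {j : E →⋆ₙₐ[ℂ] M} (hj : IdealEmbedding j) {x : Stab M} :
    x ∈ Stab.ideal hj.range ↔ x ∈ Set.range (Stab.map j) := by
  rw [Stab.mem_ideal_iff_exists hj.injective (I := ⊤) (L := hj.range) fun c => hj.mem_push]
  exact ⟨fun ⟨a, _, h⟩ => ⟨a, h⟩, fun ⟨a, h⟩ => ⟨a, Stab.mem_ideal_top a, h⟩⟩

/-- `K ⊗ E` is an ideal of `K ⊗ M`. -/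
theorem stab {E M : Type u} [NonUnitalCStarAlgebra E] [NonUnitalCStarAlgebra M] {j : E →⋆ₙₐ[ℂ] M}
    (hj : IdealEmbedding j) : IdealEmbedding (Stab.map j) := by
  refine ⟨Stab.map_injective hj.injective, fun m e => ?_, fun m e => ?_⟩
  · rw [← hj.mem_stab_range]
    exact TwoSidedIdeal.mul_mem_left _ _ _ (hj.mem_stab_range.2 ⟨e, rfl⟩)
  · rw [← hj.mem_stab_range]
    exact TwoSidedIdeal.mul_mem_right _ _ _ (hj.mem_stab_range.2 ⟨e, rfl⟩)

theorem map_mem_ideal_push {E M : Type u} [NonUnitalCStarAlgebra E] [NonUnitalCStarAlgebra M]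
    {j : E →⋆ₙₐ[ℂ] M} (hj : IdealEmbedding j) {I : TwoSidedIdeal E} {hI : IsClosed (I : Set E)}
    {x : Stab E} : Stab.map j x ∈ Stab.ideal (hj.push I hI) ↔ x ∈ Stab.ideal I := by
  rw [Stab.mem_ideal_iff_exists hj.injective (I := I) fun c => hj.mem_push]
  exact ⟨fun ⟨a, ha, h⟩ => Stab.map_injective hj.injective h ▸ ha, fun h => ⟨x, h, rfl⟩⟩

end qAlg.IdealEmbedding

/-! ### The algebra `qA` with its action of `X` -/

namespace XAlgebra

/-- The algebra `qA`, with the smallest action of `X` for which `q : A → qA` is equivariant. -/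
def q (A : XAlgebra.{u} X) : XAlgebra.{u} X where
  carrier := qAlg A
  ideal U := sInf {I | IsClosed (I : Set (qAlg A)) ∧ ∀ x ∈ A.ideal U, qAlg.q x ∈ I}
  isClosed_ideal U := by
    have : ((sInf {I | IsClosed (I : Set (qAlg A)) ∧ ∀ x ∈ A.ideal U, qAlg.q x ∈ I} :
        TwoSidedIdeal (qAlg A)) : Set (qAlg A)) =
        ⋂ I ∈ {I : TwoSidedIdeal (qAlg A) | IsClosed (I : Set (qAlg A)) ∧
          ∀ x ∈ A.ideal U, qAlg.q x ∈ I}, (I : Set (qAlg A)) := by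
      ext x
      rw [SetLike.mem_coe, TwoSidedIdeal.mem_sInf]
      simp only [Set.mem_iInter, SetLike.mem_coe]
    rw [this]
    exact isClosed_biInter fun I hI => hI.1
  ideal_mono U V h := sInf_le_sInf fun I hI => ⟨hI.1, fun x hx => hI.2 x (A.ideal_mono U V h hx)⟩

variable (A : XAlgebra.{u} X)

/-- The ideal of the action of `X` on `qA`. -/
def qIdeal (U : TopologicalSpace.Opens X) : TwoSidedIdeal (qAlg A) := A.q.ideal U

theorem isClosed_qIdeal (U : TopologicalSpace.Opens X) : IsClosed (A.qIdeal U : Set (qAlg A)) :=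
  A.q.isClosed_ideal U

variable {A}

theorem q_mem_qIdeal {U : TopologicalSpace.Opens X} {x : A} (hx : x ∈ A.ideal U) :
    qAlg.q x ∈ A.qIdeal U := by
  change qAlg.q x ∈ sInf _
  rw [TwoSidedIdeal.mem_sInf]
  exact fun I hI => hI.2 x hx

theorem qIdeal_le {U : TopologicalSpace.Opens X} {I : TwoSidedIdeal (qAlg A)}
    (hI : IsClosed (I : Set (qAlg A))) (h : ∀ x ∈ A.ideal U, qAlg.q x ∈ I) : A.qIdeal U ≤ I :=
  sInf_le ⟨hI, h⟩

variable (A) in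
/-- The ideal of the action of `X` on `qA`, as an ideal of `QA`. -/
def QIdeal (U : TopologicalSpace.Opens X) : TwoSidedIdeal (QAlg A) :=
  qAlg.IdealEmbedding.incl.push (A.qIdeal U) (A.isClosed_qIdeal U)

theorem isClosed_QIdeal (U : TopologicalSpace.Opens X) : IsClosed (A.QIdeal U : Set (QAlg A)) :=
  qAlg.IdealEmbedding.isClosed_push _ _ _

theorem sub_mem_QIdeal {U : TopologicalSpace.Opens X} {x : A} (hx : x ∈ A.ideal U) :
    QAlg.ι A x - QAlg.ιbar A x ∈ A.QIdeal U :=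
  qAlg.IdealEmbedding.incl.mem_push.2 ⟨_, q_mem_qIdeal hx, rfl⟩

theorem ι_mul_q_mem {U : TopologicalSpace.Opens X} {x : A} (hx : x ∈ A.ideal U) (a : A) :
    QAlg.ι A x * (QAlg.ι A a - QAlg.ιbar A a) ∈ A.QIdeal U := by
  have h1 := sub_mem_QIdeal ((A.ideal U).mul_mem_right _ a hx)
  have h2 := (A.QIdeal U).mul_mem_right _ (QAlg.ιbar A a) (sub_mem_QIdeal hx)
  convert sub_mem h1 h2 using 1
  simp only [map_mul, mul_sub, sub_mul]; abel

theorem ιbar_mul_q_mem {U : TopologicalSpace.Opens X} {x : A} (hx : x ∈ A.ideal U) (a : A) :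
    QAlg.ιbar A x * (QAlg.ι A a - QAlg.ιbar A a) ∈ A.QIdeal U := by
  have h1 := sub_mem_QIdeal ((A.ideal U).mul_mem_right _ a hx)
  have h2 := (A.QIdeal U).mul_mem_right _ (QAlg.ι A a) (sub_mem_QIdeal hx)
  convert sub_mem h1 h2 using 1
  simp only [map_mul, mul_sub, sub_mul]; abel

/-- Elements of `qA`, multiplied by elements of the ideal `A(U)` of a copy of `A`. -/
theorem mul_mem_QIdeal {U : TopologicalSpace.Opens X} (z : qAlg A) {x : A} (hx : x ∈ A.ideal U) :
    QAlg.ι A x * z ∈ A.QIdeal U ∧ QAlg.ιbar A x * z ∈ A.QIdeal U := by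
  set s : Set (QAlg A) := {w | ∀ x ∈ A.ideal U,
    QAlg.ι A x * w ∈ A.QIdeal U ∧ QAlg.ιbar A x * w ∈ A.QIdeal U} with hs
  have hsmul : ∀ (c : ℂ), ∀ a ∈ s, c • a ∈ s := fun c a ha x hx => by
    rw [mul_smul_comm, mul_smul_comm]
    exact ⟨TwoSidedIdeal.smul_mem_of_isClosed (isClosed_QIdeal U) c (ha x hx).1,
      TwoSidedIdeal.smul_mem_of_isClosed (isClosed_QIdeal U) c (ha x hx).2⟩
  have hadd : ∀ a ∈ s, ∀ b ∈ s, a + b ∈ s := fun a ha b hb x hx => by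
    rw [mul_add, mul_add]
    exact ⟨add_mem (ha x hx).1 (hb x hx).1, add_mem (ha x hx).2 (hb x hx).2⟩
  have hcl : IsClosed s := by
    simp only [hs, Set.ofPred_forall]
    exact isClosed_iInter fun x => isClosed_iInter fun _ =>
      ((isClosed_QIdeal U).preimage (continuous_const_mul _)).inter
        ((isClosed_QIdeal U).preimage (continuous_const_mul _))
  have key := QAlg.lift_mem_of_sub_mem (f := QAlg.ι A) (g := QAlg.ιbar A) (s := s) hcl ?_ hadd hsmul
    ?_ ?_ ?_ z
  · have hid : QAlg.lift (QAlg.ι A) (QAlg.ιbar A) = NonUnitalStarAlgHom.id ℂ (QAlg A) :=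
      QAlg.hom_ext (fun x => QAlg.lift_ι _ _ x) (fun x => QAlg.lift_ιbar _ _ x)
    rw [hid] at key
    exact key x hx
  · intro x _; rw [mul_zero, mul_zero]; exact ⟨zero_mem _, zero_mem _⟩
  · intro m
    refine QAlg.induction_on (p := fun m => ∀ a ∈ s, m * a ∈ s) ?_ ?_ ?_ ?_ ?_ ?_ ?_ m
    · simp only [Set.ofPred_forall]
      exact isClosed_iInter fun a => isClosed_iInter fun _ => hcl.preimage (continuous_mul_const a)
    · intro a _; rw [zero_mul]; intro x _; rw [mul_zero, mul_zero]; exact ⟨zero_mem _, zero_mem _⟩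
    · intro z w hz hw a ha; rw [add_mul]; exact hadd _ (hz a ha) _ (hw a ha)
    · intro c z hz a ha; rw [smul_mul_assoc]; exact hsmul c _ (hz a ha)
    · intro z w hz hw a ha; rw [mul_assoc]; exact hz _ (hw a ha)
    · intro b a ha x hx
      have hxb := ha _ ((A.ideal U).mul_mem_right _ b hx)
      refine ⟨by rw [← mul_assoc, ← map_mul]; exact hxb.1, ?_⟩
      have h1 := (A.QIdeal U).mul_mem_right _ a (ιbar_mul_q_mem hx b)
      convert add_mem h1 hxb.2 using 1
      simp only [map_mul, mul_sub, sub_mul, mul_assoc]; abel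
    · intro b a ha x hx
      have hxb := ha _ ((A.ideal U).mul_mem_right _ b hx)
      refine ⟨?_, by rw [← mul_assoc, ← map_mul]; exact hxb.2⟩
      have h1 := (A.QIdeal U).mul_mem_right _ a (ι_mul_q_mem hx b)
      convert sub_mem hxb.1 h1 using 1
      simp only [map_mul, mul_sub, sub_mul, mul_assoc]; abel
  · intro m a ha x hx
    rw [← mul_assoc, ← mul_assoc]
    exact ⟨(A.QIdeal U).mul_mem_right _ _ (ha x hx).1, (A.QIdeal U).mul_mem_right _ _ (ha x hx).2⟩
  · intro a x hx
    exact ⟨ι_mul_q_mem hx a, ιbar_mul_q_mem hx a⟩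

theorem mem_mul_QIdeal {U : TopologicalSpace.Opens X} (z : qAlg A) {x : A} (hx : x ∈ A.ideal U) :
    z * QAlg.ι A x ∈ A.QIdeal U ∧ z * QAlg.ιbar A x ∈ A.QIdeal U := by
  have h := mul_mem_QIdeal (star z)
    (TwoSidedIdeal.star_mem_of_isClosed (A.isClosed_ideal U) hx)
  constructor
  · have h1 := TwoSidedIdeal.star_mem_of_isClosed (isClosed_QIdeal U) h.1
    rwa [map_star, star_mul, star_star, StarMemClass.coe_star, star_star] at h1
  · have h1 := TwoSidedIdeal.star_mem_of_isClosed (isClosed_QIdeal U) h.2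
    rwa [map_star, star_mul, star_star, StarMemClass.coe_star, star_star] at h1

end XAlgebra

end

noncomputable section

attribute [local instance] CStarAlgebra.spectralOrder CStarAlgebra.spectralOrderedRing

open Filter Topology

variable {X : Type v} [TopologicalSpace X]

/-! ### Rotations of `2 × 2` blocks -/

namespace Stab

variable {B C : Type u} [NonUnitalCStarAlgebra B] [NonUnitalCStarAlgebra C]

theorem isom_parity_sum : (isom (parity 0) : Mult (Stab B)) * star (isom (parity 0)) +
    isom (parity 1) * star (isom (parity 1)) = 1 := by
  refine mult_ext fun i j b => ?_
  change (isom (parity 0)).fst ((star (isom (parity 0))).fst (single i j b)) +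
    (isom (parity 1)).fst ((star (isom (parity 1))).fst (single i j b)) = single i j b
  have h1 : ∀ (k : Fin 2) (m : ℕ), FinMat.rowComap (parity k) (FinMat.single (2 * m + k) j b) =
      FinMat.single m j b := fun k m => by
    rw [← FinMat.rowComap_rowMap (parity k) (FinMat.single m j b), FinMat.rowMap_single]; rfl
  have h2 : ∀ (k : Fin 2) (i : ℕ), i % 2 ≠ k →
      FinMat.rowComap (parity k) (FinMat.single i j b) = 0 := fun k i hi => by
    refine FinMat.ext fun m l => ?_
    have hk := k.2
    rw [FinMat.entry_rowComap, FinMat.entry_single, parity_apply, if_neg (by omega),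
      FinMat.entry_zero]
  rw [single, star_isom_fst_ofMat, star_isom_fst_ofMat]
  obtain ⟨m, rfl | rfl⟩ := Nat.even_or_odd' i
  · have h0 := h1 0 m
    rw [Fin.val_zero, add_zero] at h0
    rw [h0, h2 1 _ (by simp), map_zero, map_zero, add_zero]
    exact isom_fst_single (parity 0) m j b
  · rw [h2 0 _ (by simp), map_zero, map_zero, zero_add]
    have h0 := h1 1 m
    rw [Fin.val_one] at h0
    rw [h0]
    exact isom_fst_single (parity 1) m j b

/-- The quarter turn that exchanges even and odd indices. -/
def quarterTurn : Mult (Stab B) :=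
  isom (parity 1) * star (isom (parity 0)) - isom (parity 0) * star (isom (parity 1))

theorem star_quarterTurn : star (quarterTurn : Mult (Stab B)) = -quarterTurn := by
  simp only [quarterTurn, star_sub, star_mul, star_star, neg_sub]

theorem star_parity_mul_ne {k l : Fin 2} (h : k ≠ l) :
    star (isom (parity k) : Mult (Stab B)) * isom (parity l) = 0 :=
  star_isom_mul_isom_of_disjoint fun i j h' => h (by
    have hk := k.2
    have hl := l.2
    rw [parity_apply, parity_apply] at h'
    exact Fin.ext (by omega))

theorem quarterTurn_mul_zero : (quarterTurn : Mult (Stab B)) * isom (parity 0) =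
    isom (parity 1) := by
  rw [quarterTurn, sub_mul, mul_assoc, mul_assoc, star_isom_mul_isom,
    star_parity_mul_ne (by decide), mul_one, mul_zero, sub_zero]

theorem quarterTurn_mul_one : (quarterTurn : Mult (Stab B)) * isom (parity 1) =
    -isom (parity 0) := by
  rw [quarterTurn, sub_mul, mul_assoc, mul_assoc, star_isom_mul_isom,
    star_parity_mul_ne (by decide), mul_one, mul_zero, zero_sub]

theorem quarterTurn_mul_self : (quarterTurn : Mult (Stab B)) * quarterTurn = -1 := by
  conv_lhs => rw [quarterTurn.eq_1 (B := B)]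
  rw [mul_sub, ← mul_assoc, ← mul_assoc, ← quarterTurn, quarterTurn_mul_zero, quarterTurn_mul_one,
    ← isom_parity_sum, neg_mul, neg_add]
  abel

/-- The rotation by the angle `t`. -/
def turn (t : ℝ) : Mult (Stab B) :=
  ((Real.cos t : ℝ) : ℂ) • 1 + ((Real.sin t : ℝ) : ℂ) • quarterTurn

theorem star_turn_mul (t : ℝ) : star (turn t : Mult (Stab B)) * turn t = 1 := by
  have : ((Real.cos t : ℝ) : ℂ) * ((Real.cos t : ℝ) : ℂ) +
      ((Real.sin t : ℝ) : ℂ) * ((Real.sin t : ℝ) : ℂ) = 1 := by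
    have := Real.cos_sq_add_sin_sq t
    rw [← Complex.ofReal_mul, ← Complex.ofReal_mul, ← Complex.ofReal_add]
    norm_cast
    nlinarith
  simp only [turn, star_add, star_smul, star_one, star_quarterTurn, Complex.star_def,
    Complex.conj_ofReal, add_mul, mul_add, smul_mul_assoc, mul_smul_comm, one_mul, mul_one, neg_mul,
    quarterTurn_mul_self, neg_neg, smul_neg, smul_add]
  have h2 : (1 : Mult (Stab B)) = (((Real.cos t : ℝ) : ℂ) * ((Real.cos t : ℝ) : ℂ) +
      ((Real.sin t : ℝ) : ℂ) * ((Real.sin t : ℝ) : ℂ)) • (1 : Mult (Stab B)) := by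
    rw [this, one_smul]
  conv_rhs => rw [h2]
  module

theorem continuous_turn : Continuous (turn : ℝ → Mult (Stab B)) := by
  unfold turn; fun_prop

theorem turn_zero : (turn 0 : Mult (Stab B)) = 1 := by simp [turn]

theorem turn_pi_div_two : (turn (Real.pi / 2) : Mult (Stab B)) = quarterTurn := by simp [turn]

/-- Conjugation by a rotation. -/
def rotate (t : ℝ) : Stab B →⋆ₙₐ[ℂ] Stab B := Mult.Ad (turn t) (star_turn_mul t)

theorem continuous_rotate (x : Stab B) : Continuous fun t => rotate t x :=
  Mult.continuous_Ad star_turn_mul continuous_turn x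

theorem rotate_zero (x : Stab B) : rotate 0 x = x := by
  refine Mult.of_injective ?_
  rw [rotate, Mult.of_Ad, turn_zero, star_one, one_mul, mul_one]

theorem rotate_pi_div_two (x y : Stab B) :
    rotate (Real.pi / 2) (reindex (parity 0) x + reindex (parity 1) y) =
      reindex (parity 1) x + reindex (parity 0) y := by
  refine Mult.of_injective ?_
  rw [rotate, Mult.of_Ad, turn_pi_div_two, map_add, map_add]
  simp only [reindex, Mult.of_Ad]
  have h0 : star (isom (parity 0) : Mult (Stab B)) * star quarterTurn = star (isom (parity 1)) := by
    rw [← star_mul, quarterTurn_mul_zero]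
  have h1 : star (isom (parity 1) : Mult (Stab B)) * star quarterTurn =
      -star (isom (parity 0)) := by
    rw [← star_mul, quarterTurn_mul_one, star_neg]
  calc _ = (quarterTurn * isom (parity 0)) * Mult.of _ x *
        (star (isom (parity 0)) * star quarterTurn) +
        (quarterTurn * isom (parity 1)) * Mult.of _ y *
        (star (isom (parity 1)) * star quarterTurn) := by
          simp only [mul_add, add_mul, mul_assoc]
    _ = _ := by
      rw [h0, h1, quarterTurn_mul_zero, quarterTurn_mul_one, neg_mul, neg_mul, mul_neg, neg_neg]

theorem turn_mul_star (t : ℝ) : (turn t : Mult (Stab B)) * star (turn t) = 1 := by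
  have h : ∀ t, star (turn t : Mult (Stab B)) = turn (-t) := fun t => by
    simp only [turn, star_add, star_smul, star_one, star_quarterTurn, Complex.star_def,
      Complex.conj_ofReal, Real.cos_neg, Real.sin_neg, Complex.ofReal_neg, neg_smul, smul_neg]
  have := star_turn_mul (B := B) (-t)
  rwa [← h, star_star] at this

theorem rotate_diag (t : ℝ) (x : Stab B) :
    rotate t (reindex (parity 0) x + reindex (parity 1) x) =
      reindex (parity 0) x + reindex (parity 1) x := by
  refine Mult.of_injective ?_
  rw [rotate, Mult.of_Ad, map_add]
  simp only [reindex, Mult.of_Ad]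
  set d : Mult (Stab B) := isom (parity 0) * Mult.of _ x * star (isom (parity 0)) +
    isom (parity 1) * Mult.of _ x * star (isom (parity 1)) with hd
  have hq : quarterTurn * d = d * quarterTurn := by
    have h0 : star (isom (parity 0) : Mult (Stab B)) * quarterTurn = -star (isom (parity 1)) := by
      rw [← quarterTurn_mul_zero, star_mul, star_quarterTurn, mul_neg, neg_neg]
    have h1 : star (isom (parity 1) : Mult (Stab B)) * quarterTurn = star (isom (parity 0)) := by
      rw [← neg_neg (isom (parity 0)), ← quarterTurn_mul_one, star_neg, star_mul, star_quarterTurn,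
        mul_neg, neg_neg]
    rw [hd, mul_add, add_mul]
    simp only [← mul_assoc, quarterTurn_mul_zero, quarterTurn_mul_one]
    simp only [mul_assoc, h0, h1]
    simp only [mul_neg, neg_mul]
    abel
  have : turn t * d = d * turn t := by
    clear_value d
    rw [turn, add_mul, mul_add, smul_mul_assoc, smul_mul_assoc, mul_smul_comm, mul_smul_comm, hq,
      one_mul, mul_one]
  rw [this, mul_assoc, turn_mul_star, mul_one]

theorem rotate_mem (t : ℝ) {I : TwoSidedIdeal B} {x : Stab B} (hx : x ∈ ideal I) :
    rotate t x ∈ ideal I := Mult.Ad_mem _ _ (isClosed_ideal I) hx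

theorem rotate_mul_mem (t : ℝ) {I L : TwoSidedIdeal B} {c : Stab B}
    (h : ∀ x ∈ ideal I, c * x ∈ ideal L) {x : Stab B} (hx : x ∈ ideal I) :
    rotate t c * x ∈ ideal L := by
  have : rotate t c * x = (turn t).fst (c * (star (turn t)).fst x) := by
    refine Mult.of_injective ?_
    rw [← Mult.mul_of, map_mul, map_mul, rotate, Mult.of_Ad, ← Mult.mul_of]
    simp only [mul_assoc]
  rw [this]
  exact Mult.fst_mem (isClosed_ideal L) _ (h _ (Mult.fst_mem (isClosed_ideal I) _ hx))

theorem mul_rotate_mem (t : ℝ) {I L : TwoSidedIdeal B} {c : Stab B}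
    (h : ∀ x ∈ ideal I, x * c ∈ ideal L) {x : Stab B} (hx : x ∈ ideal I) :
    x * rotate t c ∈ ideal L := by
  have : x * rotate t c = (star (turn t)).snd ((turn t).snd x * c) := by
    refine Mult.of_injective ?_
    rw [← Mult.of_mul, map_mul, map_mul, rotate, Mult.of_Ad, ← Mult.of_mul]
    simp only [mul_assoc]
  rw [this]
  exact Mult.snd_mem (isClosed_ideal L) _ (h _ (Mult.snd_mem (isClosed_ideal I) _ hx))

theorem reindex_parity_zero_corner (b : B) : reindex (parity 0) (corner B b) = corner B b := by
  rw [corner_apply, reindex_single]; rfl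

theorem map_corner (f : B →⋆ₙₐ[ℂ] C) (b : B) : map f (corner B b) = corner C (f b) := by
  rw [corner_apply, map_single]; rfl

end Stab

/-! ### Homomorphisms on `qA` -/

namespace qAlg

variable {A : Type u} [NonUnitalCStarAlgebra A]

theorem ιbar_sub_ι_mem (x : A) : QAlg.ιbar A x - QAlg.ι A x ∈ Set.range (incl A) :=
  ⟨-q x, by rw [map_neg, incl_q, neg_sub]⟩

variable (A) in
/-- The exchange of the two copies of `A`. -/
def flip : qAlg A →⋆ₙₐ[ℂ] qAlg A := ofPair IdealEmbedding.incl ιbar_sub_ι_mem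

theorem incl_flip (z : qAlg A) : incl A (flip A z) =
    QAlg.lift (QAlg.ιbar A) (QAlg.ι A) (incl A z) := ofPair_spec _ _ z

theorem flip_q (x : A) : flip A (q x) = -q x :=
  incl_injective (by rw [flip, ofPair_q, map_neg, incl_q, neg_sub])

end qAlg

namespace XHom

variable {A B C D E : XAlgebra.{u} X}

/-- Equivariance on `qA` can be checked on the elements `qx`. -/
def ofQ (f : qAlg A →⋆ₙₐ[ℂ] E) (hf : ∀ U, ∀ x ∈ A.ideal U, f (qAlg.q x) ∈ E.ideal U) :
    XHom A.q E :=
  ⟨f, fun U => by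
    have hm : ∀ x, x ∈ (E.ideal U).comap f ↔ f x ∈ E.ideal U := fun x => TwoSidedIdeal.mem_comap f
    have hle : A.qIdeal U ≤ (E.ideal U).comap f :=
      XAlgebra.qIdeal_le (by
        have : ((E.ideal U).comap f : Set (qAlg A)) = f ⁻¹' (E.ideal U) := Set.ext hm
        rw [this]
        exact (E.isClosed_ideal U).preimage (continuous_cstarHom f))
        fun x hx => (hm _).2 (hf U x hx)
    exact fun x hx => (hm x).1 (hle hx)⟩

theorem q_mem (φ : XHom A.q E) {U : TopologicalSpace.Opens X} {x : A} (hx : x ∈ A.ideal U) :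
    φ.hom (qAlg.q x) ∈ E.ideal U := φ.equivariant U _ (XAlgebra.q_mem_qIdeal hx)

/-- The evaluation map `qA → A`. -/
def π (A : XAlgebra.{u} X) : XHom A.q A :=
  ofQ (qAlg.π A) fun U x hx => by rw [qAlg.π_q]; exact hx

/-- The functor `q`. -/
def qMap (f : XHom A B) : XHom A.q B.q :=
  ofQ (E := B.q) (qAlg.map f.hom) fun U x hx => by
    have := XAlgebra.q_mem_qIdeal (f.equivariant U x hx)
    rw [← qAlg.map_q] at this
    exact this

theorem qMap_comp (g : XHom B C) (f : XHom A B) : (g.comp f).qMap = g.qMap.comp f.qMap := by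
  refine ext fun z => qAlg.incl_injective ?_
  have : (QAlg.lift ((QAlg.ι C).comp g.hom) ((QAlg.ιbar C).comp g.hom)).comp
      (QAlg.lift ((QAlg.ι B).comp f.hom) ((QAlg.ιbar B).comp f.hom)) =
      QAlg.lift ((QAlg.ι C).comp (g.comp f).hom) ((QAlg.ιbar C).comp (g.comp f).hom) := by
    refine QAlg.hom_ext (fun x => ?_) fun x => ?_
    · simp only [NonUnitalStarAlgHom.comp_apply, QAlg.lift_ι]; rfl
    · simp only [NonUnitalStarAlgHom.comp_apply, QAlg.lift_ιbar]; rfl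
  exact (DFunLike.congr_fun this (qAlg.incl A z)).symm

theorem π_comp_qMap (f : XHom A B) : (π B).comp f.qMap = f.comp (π A) := by
  refine ext fun z => ?_
  have : (QAlg.lift (NonUnitalStarAlgHom.id ℂ B) 0).comp
      (QAlg.lift ((QAlg.ι B).comp f.hom) ((QAlg.ιbar B).comp f.hom)) =
      f.hom.comp (QAlg.lift (NonUnitalStarAlgHom.id ℂ A) 0) := by
    refine QAlg.hom_ext (fun x => ?_) fun x => ?_
    · simp only [NonUnitalStarAlgHom.comp_apply, QAlg.lift_ι]; rfl
    · simp only [NonUnitalStarAlgHom.comp_apply, QAlg.lift_ιbar]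
      exact (map_zero f.hom).symm
  exact DFunLike.congr_fun this (qAlg.incl A z)

theorem joined_qMap {f g : XHom A B} (h : Joined f g) : Joined f.qMap g.qMap := by
  obtain ⟨p⟩ := h
  refine ⟨p.map (f := fun f : XHom A B => f.qMap) (continuous_of fun z => ?_)⟩
  have hi := (isometry_cstarHom (qAlg.incl_injective (A := B))).isEmbedding.continuous_iff
    (f := fun f : XHom A B => qAlg.map f.hom z)
  refine hi.2 ?_
  exact QAlg.continuous_lift
    (f := fun f : XHom A B => (QAlg.ι B).comp f.hom) (g := fun f : XHom A B => (QAlg.ιbar B).comp f.hom)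
    (fun x => (continuous_cstarHom (QAlg.ι B)).comp (continuous_eval x))
    (fun x => (continuous_cstarHom (QAlg.ιbar B)).comp (continuous_eval x)) (qAlg.incl A z)

/-- The homomorphism `qA → K ⊗ qB` given by a pair of homomorphisms `A → K ⊗ QB`
which agree modulo `K ⊗ qB`. -/
def ofPair (f g : A →⋆ₙₐ[ℂ] Stab (QAlg B))
    (h : ∀ x, f x - g x ∈ Stab.ideal (qAlg.IdealEmbedding.incl (A := B)).range)
    (hU : ∀ U, ∀ x ∈ A.ideal U, f x - g x ∈ Stab.ideal (B.QIdeal U)) : XHom A.q B.q.stab :=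
  ofQ (E := B.q.stab) (qAlg.ofPair (qAlg.IdealEmbedding.incl (A := B)).stab
      (fun x => qAlg.IdealEmbedding.incl.mem_stab_range.1 (h x))) fun U x hx => by
    have h1 := hU U x hx
    rw [← qAlg.ofPair_q (qAlg.IdealEmbedding.incl (A := B)).stab
      (fun x => qAlg.IdealEmbedding.incl.mem_stab_range.1 (h x)),
      XAlgebra.QIdeal, qAlg.IdealEmbedding.map_mem_ideal_push] at h1
    exact h1

/-- A homomorphism to `K ⊗ qB`, regarded as a homomorphism to `K ⊗ QB`. -/
def toQ (φ : XHom D B.q.stab) : D →⋆ₙₐ[ℂ] Stab (QAlg B) :=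
  (Stab.map (qAlg.incl B)).comp (show D →⋆ₙₐ[ℂ] Stab (qAlg B) from φ.hom)

theorem ext_toQ {φ ψ : XHom D B.q.stab} (h : ∀ z, φ.toQ z = ψ.toQ z) : φ = ψ :=
  ext fun z => Stab.map_injective (qAlg.incl_injective (A := B)) (h z)

theorem ext_qToQ {φ ψ : XHom A.q B.q.stab} (h : ∀ z : qAlg A, φ.toQ z = ψ.toQ z) : φ = ψ :=
  ext_toQ h

theorem toQ_ofPair (f g : A →⋆ₙₐ[ℂ] Stab (QAlg B))
    (h : ∀ x, f x - g x ∈ Stab.ideal (qAlg.IdealEmbedding.incl (A := B)).range)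
    (hU : ∀ U, ∀ x ∈ A.ideal U, f x - g x ∈ Stab.ideal (B.QIdeal U)) (z : qAlg A) :
    (ofPair f g h hU).toQ z = QAlg.lift f g (qAlg.incl A z) :=
  qAlg.ofPair_spec (qAlg.IdealEmbedding.incl (A := B)).stab
    (fun x => qAlg.IdealEmbedding.incl.mem_stab_range.1 (h x)) z

theorem joined_ofPair {f g : ℝ → A →⋆ₙₐ[ℂ] Stab (QAlg B)}
    (h : ∀ t x, f t x - g t x ∈ Stab.ideal (qAlg.IdealEmbedding.incl (A := B)).range)
    (hU : ∀ t U, ∀ x ∈ A.ideal U, f t x - g t x ∈ Stab.ideal (B.QIdeal U))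
    (hf : ∀ x, Continuous fun t => f t x) (hg : ∀ x, Continuous fun t => g t x) (a b : ℝ) :
    Joined (ofPair (f a) (g a) (h a) (hU a)) (ofPair (f b) (g b) (h b) (hU b)) :=
  joined_of_path (F := fun t => ofPair (f t) (g t) (h t) (hU t)) (fun z =>
    qAlg.continuous_ofPair (qAlg.IdealEmbedding.incl (A := B)).stab
      (fun t x => qAlg.IdealEmbedding.incl.mem_stab_range.1 (h t x)) hf hg z) a b

/-! ### Inverses -/

/-- The exchange of the two copies of `A`. -/
def flip (A : XAlgebra.{u} X) : XHom A.q A.q :=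
  ofQ (E := A.q) (qAlg.flip A) fun U x hx => by
    change qAlg.flip A (qAlg.q x) ∈ A.qIdeal U
    rw [qAlg.flip_q]
    exact neg_mem (XAlgebra.q_mem_qIdeal hx)

variable (A) in
/-- The first homomorphism in the homotopy that shows that `flip` is an inverse. -/
def flipSum : A →⋆ₙₐ[ℂ] Stab (QAlg A) :=
  Stab.blockSum ((Stab.corner _).comp (QAlg.ι A)) ((Stab.corner _).comp (QAlg.ιbar A))

variable (A) in
/-- The second homomorphism in the homotopy that shows that `flip` is an inverse. -/
def flipSum' : A →⋆ₙₐ[ℂ] Stab (QAlg A) :=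
  Stab.blockSum ((Stab.corner _).comp (QAlg.ιbar A)) ((Stab.corner _).comp (QAlg.ι A))

theorem flipSum_sub_rotate_mem (t : ℝ) {L : TwoSidedIdeal (QAlg A)} {x : A}
    (hx : QAlg.ι A x - QAlg.ιbar A x ∈ L) :
    flipSum A x - Stab.rotate t (flipSum' A x) ∈ Stab.ideal L := by
  have h1 : Stab.rotate t (Stab.reindex (Stab.parity 0) (Stab.corner _ (QAlg.ιbar A x)) +
      Stab.reindex (Stab.parity 1) (Stab.corner _ (QAlg.ιbar A x))) =
      Stab.reindex (Stab.parity 0) (Stab.corner _ (QAlg.ιbar A x)) +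
      Stab.reindex (Stab.parity 1) (Stab.corner _ (QAlg.ιbar A x)) := by
    exact Stab.rotate_diag t _
  have h2 : flipSum A x - Stab.rotate t (flipSum' A x) =
      Stab.reindex (Stab.parity 0) (Stab.corner _ (QAlg.ι A x - QAlg.ιbar A x)) -
        Stab.rotate t (Stab.reindex (Stab.parity 1)
          (Stab.corner _ (QAlg.ι A x - QAlg.ιbar A x))) := by
    simp only [flipSum, flipSum', Stab.blockSum_apply, Stab.spread_eq_reindex,
      NonUnitalStarAlgHom.comp_apply, map_sub, map_add] at h1 ⊢
    rw [← sub_eq_zero] at h1 ⊢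
    rw [← neg_eq_zero, ← h1]
    abel
  rw [h2]
  exact sub_mem (Stab.reindex_mem _ (Stab.corner_mem hx))
    (Stab.rotate_mem t (Stab.reindex_mem _ (Stab.corner_mem hx)))

theorem joined_flip : Joined (blockSum ((corner A.q).comp (id A.q)) ((corner A.q).comp (flip A)))
    ⟨0, fun U _ _ => (A.q.stab.ideal U).zero_mem⟩ := by
  have hj := joined_ofPair (A := A) (B := A) (f := fun _ => flipSum A)
    (g := fun t => (Stab.rotate t).comp (flipSum' A))
    (fun t x => flipSum_sub_rotate_mem t
      (qAlg.IdealEmbedding.incl.mem_range.2 ⟨qAlg.q x, rfl⟩))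
    (fun t U x hx => flipSum_sub_rotate_mem t (XAlgebra.sub_mem_QIdeal hx))
    (fun x => continuous_const) (fun x => Stab.continuous_rotate _) 0 (Real.pi / 2)
  convert hj using 1
  · refine ext_qToQ fun z => ?_
    have hz := toQ_ofPair (A := A) (B := A) (flipSum A) ((Stab.rotate 0).comp (flipSum' A))
      (fun x => flipSum_sub_rotate_mem 0
        (qAlg.IdealEmbedding.incl.mem_range.2 ⟨qAlg.q x, rfl⟩))
      (fun U x hx => flipSum_sub_rotate_mem 0 (XAlgebra.sub_mem_QIdeal hx)) z
    refine Eq.trans ?_ hz.symm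
    have h : QAlg.lift (flipSum A) ((Stab.rotate 0).comp (flipSum' A)) =
        Stab.blockSum (Stab.corner _)
          ((Stab.corner _).comp (QAlg.lift (QAlg.ιbar A) (QAlg.ι A))) := by
      refine QAlg.hom_ext (fun x => ?_) fun x => ?_
      · rw [QAlg.lift_ι, flipSum, Stab.blockSum_apply, Stab.blockSum_apply]
        simp only [NonUnitalStarAlgHom.comp_apply, QAlg.lift_ι]
      · rw [QAlg.lift_ιbar, NonUnitalStarAlgHom.comp_apply, Stab.rotate_zero, flipSum',
          Stab.blockSum_apply, Stab.blockSum_apply]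
        simp only [NonUnitalStarAlgHom.comp_apply, QAlg.lift_ιbar]
    rw [h]
    change Stab.map (qAlg.incl A) (Stab.blockSum (Stab.corner (qAlg A))
      ((Stab.corner _).comp (qAlg.flip A)) z) = _
    rw [Stab.blockSum_apply, Stab.blockSum_apply]
    simp only [map_add, Stab.spread_eq_reindex, Stab.map_reindex, NonUnitalStarAlgHom.comp_apply,
      Stab.map_corner, qAlg.incl_flip]
  · refine ext_qToQ fun z => ?_
    have hz := toQ_ofPair (A := A) (B := A) (flipSum A) ((Stab.rotate (Real.pi / 2)).comp
        (flipSum' A))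
      (fun x => flipSum_sub_rotate_mem _
        (qAlg.IdealEmbedding.incl.mem_range.2 ⟨qAlg.q x, rfl⟩))
      (fun U x hx => flipSum_sub_rotate_mem _ (XAlgebra.sub_mem_QIdeal hx)) z
    refine Eq.trans ?_ hz.symm
    have h : QAlg.lift (flipSum A) ((Stab.rotate (Real.pi / 2)).comp (flipSum' A)) =
        (flipSum A).comp (QAlg.fold A) := by
      refine QAlg.hom_ext (fun x => ?_) fun x => ?_
      · rw [QAlg.lift_ι, NonUnitalStarAlgHom.comp_apply, QAlg.fold_ι]
      · rw [QAlg.lift_ιbar, NonUnitalStarAlgHom.comp_apply, NonUnitalStarAlgHom.comp_apply,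
          QAlg.fold_ιbar, flipSum', flipSum, Stab.blockSum_apply, Stab.blockSum_apply,
          Stab.spread_eq_reindex, Stab.spread_eq_reindex, Stab.spread_eq_reindex,
          Stab.spread_eq_reindex, Stab.rotate_pi_div_two, add_comm]
    rw [h, NonUnitalStarAlgHom.comp_apply, qAlg.incl_apply, QAlg.fold_coe, map_zero]
    exact map_zero (Stab.map (qAlg.incl A))

end XHom

namespace HClass

variable {A B D E : XAlgebra.{u} X}

theorem comp_zero (b : HClass D E) : comp b (0 : HClass A D) = 0 := by
  induction b using ind with | h ψ => ?_
  rw [zero_def, zero_def, mk_comp_mk]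
  congr 1
  refine XHom.ext_stab fun z => ?_
  rw [XHom.toStab_flatten_comp]
  exact (congrArg _ (map_zero _)).trans (map_zero _)

theorem ofHom_id_add_flip : ofHom (XHom.id A.q) + ofHom (XHom.flip A) = 0 :=
  mk_eq_mk.2 XHom.joined_flip

theorem add_comp_flip (a : HClass A.q E) : a + comp a (ofHom (XHom.flip A)) = 0 := by
  rw [← comp_zero a, ← ofHom_id_add_flip, comp_add, comp_id]

end HClass

end

noncomputable section

attribute [local instance] CStarAlgebra.spectralOrder CStarAlgebra.spectralOrderedRing

open Filter Topology

variable {X : Type v} [TopologicalSpace X]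

/-! ### The two homomorphisms `q²B → qB` -/

namespace XHom

variable {A B C D E : XAlgebra.{u} X}

/-- A criterion for equivariance of pairs of homomorphisms on `qB`. -/
theorem sub_mem_of_mem_qIdeal {M : Type*} [NonUnitalCStarAlgebra M] {J L : TwoSidedIdeal M}
    (hL : IsClosed (L : Set M)) {f g : qAlg B →⋆ₙₐ[ℂ] M}
    (h : ∀ z, f z - g z ∈ J) {U : TopologicalSpace.Opens X}
    (hfg : ∀ b ∈ B.ideal U, f (qAlg.q b) - g (qAlg.q b) ∈ L)
    (hf : ∀ b ∈ B.ideal U, ∀ y ∈ J, f (qAlg.q b) * y ∈ L)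
    (hf' : ∀ b ∈ B.ideal U, ∀ y ∈ J, y * f (qAlg.q b) ∈ L)
    (hg : ∀ b ∈ B.ideal U, ∀ y ∈ J, g (qAlg.q b) * y ∈ L)
    (hg' : ∀ b ∈ B.ideal U, ∀ y ∈ J, y * g (qAlg.q b) ∈ L) {z : qAlg B} (hz : z ∈ B.qIdeal U) :
    f z - g z ∈ L := by
  have hcl : ∀ {F : qAlg B → M}, Continuous F → IsClosed {z | F z ∈ L} := fun hF => hL.preimage hF
  have hcf := continuous_cstarHom f
  have hcg := continuous_cstarHom g
  let I : TwoSidedIdeal (qAlg B) := TwoSidedIdeal.mk'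
    {z | f z - g z ∈ L ∧ (∀ y ∈ J, f z * y ∈ L) ∧ (∀ y ∈ J, y * f z ∈ L) ∧
      (∀ y ∈ J, g z * y ∈ L) ∧ (∀ y ∈ J, y * g z ∈ L)}
    (by
      simp only [Set.mem_ofPred_eq, map_zero, sub_zero, zero_mul, mul_zero]
      exact ⟨zero_mem _, fun _ _ => zero_mem _, fun _ _ => zero_mem _, fun _ _ => zero_mem _,
        fun _ _ => zero_mem _⟩)
    (by
      rintro a b ⟨h1, h2, h3, h4, h5⟩ ⟨k1, k2, k3, k4, k5⟩
      simp only [Set.mem_ofPred_eq, map_add, add_mul, mul_add, add_sub_add_comm]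
      exact ⟨add_mem h1 k1, fun y hy => add_mem (h2 y hy) (k2 y hy),
        fun y hy => add_mem (h3 y hy) (k3 y hy), fun y hy => add_mem (h4 y hy) (k4 y hy),
        fun y hy => add_mem (h5 y hy) (k5 y hy)⟩)
    (by
      rintro a ⟨h1, h2, h3, h4, h5⟩
      simp only [Set.mem_ofPred_eq, map_neg, neg_mul, mul_neg]
      exact ⟨by rw [← neg_sub']; exact neg_mem h1, fun y hy => neg_mem (h2 y hy),
        fun y hy => neg_mem (h3 y hy), fun y hy => neg_mem (h4 y hy),
        fun y hy => neg_mem (h5 y hy)⟩)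
    (by
      rintro a b ⟨h1, h2, h3, h4, h5⟩
      refine ⟨?_, fun y hy => ?_, fun y hy => ?_, fun y hy => ?_, fun y hy => ?_⟩
      · have : f (a * b) - g (a * b) = (f a - g a) * f b + g a * (f b - g b) := by
          simp only [map_mul, sub_mul, mul_sub]; abel
        rw [this]
        exact add_mem (h3 _ (h a)) (L.mul_mem_left _ _ h1)
      · rw [map_mul, mul_assoc]; exact L.mul_mem_left _ _ (h2 y hy)
      · rw [map_mul, ← mul_assoc]; exact h3 _ (J.mul_mem_right _ _ hy)
      · rw [map_mul, mul_assoc]; exact L.mul_mem_left _ _ (h4 y hy)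
      · rw [map_mul, ← mul_assoc]; exact h5 _ (J.mul_mem_right _ _ hy))
    (by
      rintro a b ⟨h1, h2, h3, h4, h5⟩
      refine ⟨?_, fun y hy => ?_, fun y hy => ?_, fun y hy => ?_, fun y hy => ?_⟩
      · have : f (a * b) - g (a * b) = (f a - g a) * f b + g a * (f b - g b) := by
          simp only [map_mul, sub_mul, mul_sub]; abel
        rw [this]
        exact add_mem (L.mul_mem_right _ _ h1) (h4 _ (h b))
      · rw [map_mul, mul_assoc]; exact h2 _ (J.mul_mem_left _ _ hy)
      · rw [map_mul, ← mul_assoc]; exact L.mul_mem_right _ _ (h3 y hy)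
      · rw [map_mul, mul_assoc]; exact h4 _ (J.mul_mem_left _ _ hy)
      · rw [map_mul, ← mul_assoc]; exact L.mul_mem_right _ _ (h5 y hy))
  have hI : ∀ z, z ∈ I ↔ f z - g z ∈ L ∧ (∀ y ∈ J, f z * y ∈ L) ∧ (∀ y ∈ J, y * f z ∈ L) ∧
      (∀ y ∈ J, g z * y ∈ L) ∧ (∀ y ∈ J, y * g z ∈ L) := fun z => TwoSidedIdeal.mem_mk' ..
  have hIc : IsClosed (I : Set (qAlg B)) := by
    have : (I : Set (qAlg B)) = {z | f z - g z ∈ L ∧ (∀ y ∈ J, f z * y ∈ L) ∧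
      (∀ y ∈ J, y * f z ∈ L) ∧ (∀ y ∈ J, g z * y ∈ L) ∧ (∀ y ∈ J, y * g z ∈ L)} := Set.ext hI
    rw [this]
    simp only [Set.ofPred_and, Set.ofPred_forall]
    refine (hcl (by fun_prop)).inter (IsClosed.inter ?_ (IsClosed.inter ?_ (IsClosed.inter ?_ ?_)))
    all_goals exact isClosed_iInter fun y => isClosed_iInter fun _ => hcl (by fun_prop)
  exact ((hI z).1 (XAlgebra.qIdeal_le hIc (fun b hb => (hI _).2
    ⟨hfg b hb, hf b hb, hf' b hb, hg b hb, hg' b hb⟩) hz)).1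

section

variable (B)

/-- The first homomorphism of the pair in the homotopy between `q(π_B)` and `π_{qB}`. -/
def turnHom (t : ℝ) : QAlg B →⋆ₙₐ[ℂ] Stab (QAlg B) :=
  QAlg.lift ((Stab.corner _).comp (QAlg.ι B))
    ((Stab.rotate t).comp ((Stab.corner _).comp (QAlg.ιbar B)))

/-- The second homomorphism of the pair in the homotopy between `q(π_B)` and `π_{qB}`. -/
def turnHom' (t : ℝ) : QAlg B →⋆ₙₐ[ℂ] Stab (QAlg B) :=
  QAlg.lift ((Stab.corner _).comp (QAlg.ιbar B))
    ((Stab.rotate t).comp ((Stab.corner _).comp (QAlg.ιbar B)))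

variable {B}

theorem turnHom_sub_mem (t : ℝ) (z : QAlg B) : turnHom B t z - turnHom' B t z ∈
    Stab.ideal (qAlg.IdealEmbedding.incl (A := B)).range := by
  have hc := Stab.isClosed_ideal (qAlg.IdealEmbedding.incl (A := B)).range
  refine QAlg.induction_on (p := fun z => turnHom B t z - turnHom' B t z ∈
    Stab.ideal (qAlg.IdealEmbedding.incl (A := B)).range) ?_ ?_ ?_ ?_ ?_ ?_ ?_ z
  · exact hc.preimage ((continuous_cstarHom _).sub (continuous_cstarHom _))
  · simp only [map_zero, sub_zero]; exact zero_mem _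
  · intro z w hz hw; simp only [map_add, add_sub_add_comm]; exact add_mem hz hw
  · intro c z hz
    simp only [map_smul, ← smul_sub]; exact TwoSidedIdeal.smul_mem_of_isClosed hc c hz
  · intro z w hz hw
    have : turnHom B t (z * w) - turnHom' B t (z * w) =
        (turnHom B t z - turnHom' B t z) * turnHom B t w +
          turnHom' B t z * (turnHom B t w - turnHom' B t w) := by
      simp only [map_mul, sub_mul, mul_sub]; abel
    rw [this]
    exact add_mem (TwoSidedIdeal.mul_mem_right _ _ _ hz) (TwoSidedIdeal.mul_mem_left _ _ _ hw)
  · intro x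
    rw [turnHom, turnHom', QAlg.lift_ι, QAlg.lift_ι, NonUnitalStarAlgHom.comp_apply,
      NonUnitalStarAlgHom.comp_apply, ← map_sub]
    exact Stab.corner_mem (qAlg.IdealEmbedding.incl.mem_range.2 ⟨qAlg.q x, rfl⟩)
  · intro x
    rw [turnHom, turnHom', QAlg.lift_ιbar, QAlg.lift_ιbar, sub_self]
    exact zero_mem _

theorem corner_ι_mul_mem {U : TopologicalSpace.Opens X} {b : B} (hb : b ∈ B.ideal U)
    {y : Stab (QAlg B)} (hy : y ∈ Stab.ideal (qAlg.IdealEmbedding.incl (A := B)).range) :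
    Stab.corner _ (QAlg.ι B b) * y ∈ Stab.ideal (B.QIdeal U) ∧
    Stab.corner _ (QAlg.ιbar B b) * y ∈ Stab.ideal (B.QIdeal U) ∧
    y * Stab.corner _ (QAlg.ι B b) ∈ Stab.ideal (B.QIdeal U) ∧
    y * Stab.corner _ (QAlg.ιbar B b) ∈ Stab.ideal (B.QIdeal U) := by
  have h : ∀ y ∈ (qAlg.IdealEmbedding.incl (A := B)).range, ∃ z : qAlg B, (z : QAlg B) = y :=
    fun y hy => qAlg.IdealEmbedding.incl.mem_range.1 hy
  refine ⟨Stab.corner_mul_mem (fun y hy => ?_) hy, Stab.corner_mul_mem (fun y hy => ?_) hy,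
    Stab.mul_corner_mem (fun y hy => ?_) hy, Stab.mul_corner_mem (fun y hy => ?_) hy⟩
  all_goals obtain ⟨z, rfl⟩ := h y hy
  · exact (XAlgebra.mul_mem_QIdeal z hb).1
  · exact (XAlgebra.mul_mem_QIdeal z hb).2
  · exact (XAlgebra.mem_mul_QIdeal z hb).1
  · exact (XAlgebra.mem_mul_QIdeal z hb).2

theorem turnHom_sub_mem_QIdeal (t : ℝ) {U : TopologicalSpace.Opens X} {z : qAlg B}
    (hz : z ∈ B.qIdeal U) : turnHom B t (qAlg.incl B z) - turnHom' B t (qAlg.incl B z) ∈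
      Stab.ideal (B.QIdeal U) := by
  have e1 : ∀ b, turnHom B t (qAlg.incl B (qAlg.q b)) = Stab.corner _ (QAlg.ι B b) -
      Stab.rotate t (Stab.corner _ (QAlg.ιbar B b)) := fun b => by
    rw [qAlg.incl_q, map_sub, turnHom, QAlg.lift_ι, QAlg.lift_ιbar]; rfl
  have e2 : ∀ b, turnHom' B t (qAlg.incl B (qAlg.q b)) = Stab.corner _ (QAlg.ιbar B b) -
      Stab.rotate t (Stab.corner _ (QAlg.ιbar B b)) := fun b => by
    rw [qAlg.incl_q, map_sub, turnHom', QAlg.lift_ι, QAlg.lift_ιbar]; rfl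
  refine sub_mem_of_mem_qIdeal (f := (turnHom B t).comp (qAlg.incl B))
    (g := (turnHom' B t).comp (qAlg.incl B)) (Stab.isClosed_ideal (B.QIdeal U))
    (fun z => turnHom_sub_mem t _) ?_ ?_ ?_ ?_ ?_ hz
  all_goals
    intro b hb
    simp only [NonUnitalStarAlgHom.comp_apply, e1, e2]
  · rw [sub_sub_sub_cancel_right, ← map_sub]
    exact Stab.corner_mem (XAlgebra.sub_mem_QIdeal hb)
  · intro y hy
    rw [sub_mul]
    exact sub_mem (corner_ι_mul_mem hb hy).1
      (Stab.rotate_mul_mem t (fun x hx => (corner_ι_mul_mem hb hx).2.1) hy)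
  · intro y hy
    rw [mul_sub]
    exact sub_mem (corner_ι_mul_mem hb hy).2.2.1
      (Stab.mul_rotate_mem t (fun x hx => (corner_ι_mul_mem hb hx).2.2.2) hy)
  · intro y hy
    rw [sub_mul]
    exact sub_mem (corner_ι_mul_mem hb hy).2.1
      (Stab.rotate_mul_mem t (fun x hx => (corner_ι_mul_mem hb hx).2.1) hy)
  · intro y hy
    rw [mul_sub]
    exact sub_mem (corner_ι_mul_mem hb hy).2.2.2
      (Stab.mul_rotate_mem t (fun x hx => (corner_ι_mul_mem hb hx).2.2.2) hy)

/-- The homotopy between `π_{qB}` and `q(π_B)`. -/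
def turnPair (B : XAlgebra.{u} X) (t : ℝ) : XHom B.q.q B.q.stab :=
  ofPair (A := B.q) ((turnHom B t).comp (qAlg.incl B)) ((turnHom' B t).comp (qAlg.incl B))
    (fun z => turnHom_sub_mem t (qAlg.incl B z)) fun _ _ hz => turnHom_sub_mem_QIdeal t hz

theorem toQ_turnPair (t : ℝ) (z : qAlg (qAlg B)) : (turnPair B t).toQ z =
    QAlg.lift ((turnHom B t).comp (qAlg.incl B)) ((turnHom' B t).comp (qAlg.incl B))
      (qAlg.incl (qAlg B) z) :=
  toQ_ofPair (A := B.q) (B := B) _ _ _ _ z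

theorem ext_qqToQ {φ ψ : XHom B.q.q B.q.stab} (h : ∀ z : qAlg (qAlg B), φ.toQ z = ψ.toQ z) :
    φ = ψ := ext_toQ h

theorem turnPair_zero : turnPair B 0 = (corner B.q).comp (π B.q) := by
  refine ext_qqToQ fun z => ?_
  rw [toQ_turnPair]
  change _ = Stab.map (qAlg.incl B) (Stab.corner _ (QAlg.lift (NonUnitalStarAlgHom.id ℂ (qAlg B)) 0
    (qAlg.incl (qAlg B) z)))
  have h1 : turnHom B 0 = Stab.corner _ := by
    refine QAlg.hom_ext (fun x => ?_) fun x => ?_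
    · rw [turnHom, QAlg.lift_ι]; rfl
    · rw [turnHom, QAlg.lift_ιbar, NonUnitalStarAlgHom.comp_apply, Stab.rotate_zero]; rfl
  have h2 : turnHom' B 0 = ((Stab.corner _).comp (QAlg.ιbar B)).comp (QAlg.fold B) := by
    refine QAlg.hom_ext (fun x => ?_) fun x => ?_
    · rw [turnHom', QAlg.lift_ι, NonUnitalStarAlgHom.comp_apply _ (QAlg.fold B), QAlg.fold_ι]
    · rw [turnHom', QAlg.lift_ιbar, NonUnitalStarAlgHom.comp_apply, Stab.rotate_zero,
        NonUnitalStarAlgHom.comp_apply _ (QAlg.fold B), QAlg.fold_ιbar]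
  have h3 : QAlg.lift ((turnHom B 0).comp (qAlg.incl B)) ((turnHom' B 0).comp (qAlg.incl B)) =
      ((Stab.corner _).comp (qAlg.incl B)).comp
        (QAlg.lift (NonUnitalStarAlgHom.id ℂ (qAlg B)) 0) := by
    refine QAlg.hom_ext (fun x => ?_) fun x => ?_
    · rw [QAlg.lift_ι, NonUnitalStarAlgHom.comp_apply _ (QAlg.lift _ _), QAlg.lift_ι, h1]; rfl
    · rw [QAlg.lift_ιbar, NonUnitalStarAlgHom.comp_apply _ (QAlg.lift _ _), QAlg.lift_ιbar, h2,
        NonUnitalStarAlgHom.comp_apply, NonUnitalStarAlgHom.comp_apply, qAlg.incl_apply,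
        QAlg.fold_coe, map_zero]
      exact (map_zero _).symm
  rw [h3, Stab.map_corner]
  rfl

theorem turnPair_pi_div_two : turnPair B (Real.pi / 2) = (corner B.q).comp (π B).qMap := by
  refine ext_qqToQ fun z => ?_
  rw [toQ_turnPair]
  change _ = Stab.map (qAlg.incl B) (Stab.corner _ (qAlg.map (qAlg.π B) z))
  rw [Stab.map_corner, qAlg.incl_map]
  have hr : ∀ x : QAlg B, Stab.rotate (Real.pi / 2) (Stab.corner _ x) =
      Stab.reindex (Stab.parity 1) (Stab.corner _ x) := fun x => by
    have := Stab.rotate_pi_div_two (Stab.corner _ x) 0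
    simpa only [map_zero, add_zero, Stab.reindex_parity_zero_corner] using this
  let p : QAlg B →⋆ₙₐ[ℂ] B := QAlg.lift (NonUnitalStarAlgHom.id ℂ B) 0
  let p' : QAlg B →⋆ₙₐ[ℂ] B := QAlg.lift 0 (NonUnitalStarAlgHom.id ℂ B)
  let H : QAlg B →⋆ₙₐ[ℂ] Stab (QAlg B) := (Stab.corner _).comp ((QAlg.ιbar B).comp p')
  have hp : ∀ x, p (QAlg.ι B x) = x := fun x => QAlg.lift_ι _ _ x
  have hp0 : ∀ x, p (QAlg.ιbar B x) = 0 := fun x => QAlg.lift_ιbar _ _ x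
  have hp' : ∀ x, p' (QAlg.ιbar B x) = x := fun x => QAlg.lift_ιbar _ _ x
  have hp0' : ∀ x, p' (QAlg.ι B x) = 0 := fun x => QAlg.lift_ι _ _ x
  have h1 : turnHom B (Real.pi / 2) =
      Stab.blockSum ((Stab.corner _).comp ((QAlg.ι B).comp p)) H := by
    refine QAlg.hom_ext (fun x => ?_) fun x => ?_
    · rw [turnHom, QAlg.lift_ι, Stab.blockSum_apply]
      simp only [H, NonUnitalStarAlgHom.comp_apply, hp, hp0', map_zero, add_zero,
        Stab.spread_eq_reindex, Stab.reindex_parity_zero_corner]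
    · rw [turnHom, QAlg.lift_ιbar, Stab.blockSum_apply]
      simp only [H, NonUnitalStarAlgHom.comp_apply, hp0, hp', map_zero, zero_add,
        Stab.spread_eq_reindex, hr]
  have h2 : turnHom' B (Real.pi / 2) =
      Stab.blockSum ((Stab.corner _).comp ((QAlg.ιbar B).comp p)) H := by
    refine QAlg.hom_ext (fun x => ?_) fun x => ?_
    · rw [turnHom', QAlg.lift_ι, Stab.blockSum_apply]
      simp only [H, NonUnitalStarAlgHom.comp_apply, hp, hp0', map_zero, add_zero,
        Stab.spread_eq_reindex, Stab.reindex_parity_zero_corner]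
    · rw [turnHom', QAlg.lift_ιbar, Stab.blockSum_apply]
      simp only [H, NonUnitalStarAlgHom.comp_apply, hp0, hp', map_zero, zero_add,
        Stab.spread_eq_reindex, hr]
  have h3 : QAlg.lift ((turnHom B (Real.pi / 2)).comp (qAlg.incl B))
      ((turnHom' B (Real.pi / 2)).comp (qAlg.incl B)) =
      Stab.blockSum ((Stab.corner _).comp (QAlg.lift ((QAlg.ι B).comp (qAlg.π B))
        ((QAlg.ιbar B).comp (qAlg.π B)))) ((H.comp (qAlg.incl B)).comp (QAlg.fold (qAlg B))) := by
    refine QAlg.hom_ext (fun x => ?_) fun x => ?_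
    · rw [QAlg.lift_ι, h1, NonUnitalStarAlgHom.comp_apply, Stab.blockSum_apply,
        Stab.blockSum_apply]
      simp only [NonUnitalStarAlgHom.comp_apply, QAlg.lift_ι, QAlg.fold_ι]
      rfl
    · rw [QAlg.lift_ιbar, h2, NonUnitalStarAlgHom.comp_apply, Stab.blockSum_apply,
        Stab.blockSum_apply]
      simp only [NonUnitalStarAlgHom.comp_apply, QAlg.lift_ιbar, QAlg.fold_ιbar]
      rfl
  rw [h3, Stab.blockSum_apply, NonUnitalStarAlgHom.comp_apply _ (QAlg.fold (qAlg B)),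
    qAlg.incl_apply, QAlg.fold_coe, map_zero, map_zero, add_zero, Stab.spread_eq_reindex,
    NonUnitalStarAlgHom.comp_apply, Stab.reindex_parity_zero_corner]

theorem joined_π_qMap : Joined ((corner B.q).comp (π B).qMap) ((corner B.q).comp (π B.q)) := by
  rw [← turnPair_zero, ← turnPair_pi_div_two]
  refine joined_ofPair (A := B.q) (B := B) (f := fun t => (turnHom B t).comp (qAlg.incl B))
    (g := fun t => (turnHom' B t).comp (qAlg.incl B))
    (fun t z => turnHom_sub_mem t (qAlg.incl B z)) (fun t _ _ hz => turnHom_sub_mem_QIdeal t hz)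
    (fun x => ?_) (fun x => ?_) _ _
  · exact QAlg.continuous_lift (f := fun _ : ℝ => (Stab.corner _).comp (QAlg.ι B))
      (g := fun t => (Stab.rotate t).comp ((Stab.corner _).comp (QAlg.ιbar B)))
      (fun _ => continuous_const) (fun _ => Stab.continuous_rotate _) _
  · exact QAlg.continuous_lift (f := fun _ : ℝ => (Stab.corner _).comp (QAlg.ιbar B))
      (g := fun t => (Stab.rotate t).comp ((Stab.corner _).comp (QAlg.ιbar B)))
      (fun _ => continuous_const) (fun _ => Stab.continuous_rotate _) _

end

/-! ### The homomorphism `q(K ⊗ B) → K ⊗ qB` -/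

theorem map_ι_sub_mem {B : Type u} [NonUnitalCStarAlgebra B] {I : TwoSidedIdeal B}
    {L : TwoSidedIdeal (QAlg B)} (h : ∀ b ∈ I, QAlg.ι B b - QAlg.ιbar B b ∈ L) {x : Stab B}
    (hx : x ∈ Stab.ideal I) : Stab.map (QAlg.ι B) x - Stab.map (QAlg.ιbar B) x ∈ Stab.ideal L := by
  refine Stab.ideal_induction (p := fun x => Stab.map (QAlg.ι B) x - Stab.map (QAlg.ιbar B) x ∈
    Stab.ideal L) ?_ ?_ ?_ ?_ hx
  · exact (Stab.isClosed_ideal L).preimage ((continuous_cstarHom _).sub (continuous_cstarHom _))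
  · simp only [map_zero, sub_zero]; exact zero_mem _
  · intro z w hz hw; simp only [map_add, add_sub_add_comm]; exact add_mem hz hw
  · intro i j b hb
    have : Stab.single i j (QAlg.ι B b) - Stab.single i j (QAlg.ιbar B b) =
        Stab.single i j (QAlg.ι B b - QAlg.ιbar B b) := by
      rw [sub_eq_iff_eq_add, ← Stab.single_add, sub_add_cancel]
    rw [Stab.map_single, Stab.map_single, this]
    exact Stab.single_mem (h b hb) i j

/-- The homomorphism `q(K ⊗ B) → K ⊗ qB`. -/
def kappa (B : XAlgebra.{u} X) : XHom B.stab.q B.q.stab :=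
  ofPair (A := B.stab) (Stab.map (QAlg.ι B)) (Stab.map (QAlg.ιbar B))
    (fun x => map_ι_sub_mem (fun b _ => qAlg.IdealEmbedding.incl.mem_range.2 ⟨qAlg.q b, rfl⟩)
      (Stab.mem_ideal_top (B := B) x))
    fun _ _ hx => map_ι_sub_mem (fun _ hb => XAlgebra.sub_mem_QIdeal hb) hx

theorem toQ_kappa (z : qAlg (Stab B)) : (kappa B).toQ z =
    QAlg.lift (Stab.map (QAlg.ι B)) (Stab.map (QAlg.ιbar B)) (qAlg.incl (Stab B) z) :=
  toQ_ofPair (A := B.stab) (B := B) _ _ _ _ z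

theorem π_stabMap_comp_kappa : (π B).stabMap.comp (kappa B) = π B.stab := by
  refine ext fun z => ?_
  have h : (Stab.map (QAlg.lift (NonUnitalStarAlgHom.id ℂ B) 0)).comp
      (QAlg.lift (Stab.map (QAlg.ι B)) (Stab.map (QAlg.ιbar B))) =
      QAlg.lift (NonUnitalStarAlgHom.id ℂ (Stab B)) 0 := by
    refine QAlg.hom_ext (fun x => ?_) fun x => ?_
    · rw [NonUnitalStarAlgHom.comp_apply, QAlg.lift_ι, QAlg.lift_ι, Stab.map_map]
      have : Stab.map ((QAlg.lift (NonUnitalStarAlgHom.id ℂ B) 0).comp (QAlg.ι B)) =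
          NonUnitalStarAlgHom.id ℂ (Stab B) := Stab.hom_ext fun i j b => by
        rw [Stab.map_single, NonUnitalStarAlgHom.comp_apply, QAlg.lift_ι]; rfl
      rw [this]
    · rw [NonUnitalStarAlgHom.comp_apply, QAlg.lift_ιbar, QAlg.lift_ιbar, Stab.map_map]
      have : Stab.map ((QAlg.lift (NonUnitalStarAlgHom.id ℂ B) 0).comp (QAlg.ιbar B)) = 0 :=
        Stab.hom_ext fun i j b => by
          rw [Stab.map_single, NonUnitalStarAlgHom.comp_apply, QAlg.lift_ιbar]
          exact Stab.single_zero i j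
      rw [this]
  refine Eq.trans ?_ ((congrArg (Stab.map _) (toQ_kappa z)).trans
    (DFunLike.congr_fun h (qAlg.incl (Stab B) z)))
  exact (Stab.map_map (B := qAlg B) (QAlg.lift (NonUnitalStarAlgHom.id ℂ B) 0) (qAlg.incl B)
    ((kappa B).hom z)).symm

theorem kappa_naturality (g : XHom E B) :
    (kappa B).comp g.stabMap.qMap = g.qMap.stabMap.comp (kappa E) := by
  refine ext_toQ fun z => ?_
  have h : (QAlg.lift (Stab.map (QAlg.ι B)) (Stab.map (QAlg.ιbar B))).comp
      (QAlg.lift ((QAlg.ι (Stab B)).comp (Stab.map g.hom))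
        ((QAlg.ιbar (Stab B)).comp (Stab.map g.hom))) =
      (Stab.map (QAlg.lift ((QAlg.ι B).comp g.hom) ((QAlg.ιbar B).comp g.hom))).comp
      (QAlg.lift (Stab.map (QAlg.ι E)) (Stab.map (QAlg.ιbar E))) := by
    refine QAlg.hom_ext (fun x => ?_) fun x => ?_
    · rw [NonUnitalStarAlgHom.comp_apply, NonUnitalStarAlgHom.comp_apply, QAlg.lift_ι, QAlg.lift_ι,
        NonUnitalStarAlgHom.comp_apply, QAlg.lift_ι, Stab.map_map, Stab.map_map]
      congr 2
      exact NonUnitalStarAlgHom.ext fun y => (QAlg.lift_ι _ _ y).symm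
    · rw [NonUnitalStarAlgHom.comp_apply, NonUnitalStarAlgHom.comp_apply, QAlg.lift_ιbar,
        QAlg.lift_ιbar, NonUnitalStarAlgHom.comp_apply, QAlg.lift_ιbar, Stab.map_map, Stab.map_map]
      congr 2
      exact NonUnitalStarAlgHom.ext fun y => (QAlg.lift_ιbar _ _ y).symm
  have h2 := DFunLike.congr_fun h (qAlg.incl (Stab E) z)
  refine Eq.trans (toQ_kappa (B := B) (qAlg.map (Stab.map g.hom) z)) (h2.trans
    ((congrArg (Stab.map _) (toQ_kappa (B := E) z)).symm.trans ?_))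
  exact (Stab.map_map (B := qAlg E) _ (qAlg.incl E) _).trans
    (Stab.map_map (B := qAlg E) (qAlg.incl B) (qAlg.map g.hom) _).symm

end XHom

/-! ### The functor `q` on homotopy classes -/

namespace HClass

variable {A B D E : XAlgebra.{u} X}

theorem ofHom_qMap_π : ofHom (XHom.π B).qMap = ofHom (XHom.π B.q) := mk_eq_mk.2 XHom.joined_π_qMap

/-- The functor `q` on homotopy classes. -/
def qLift (a : HClass D B) : HClass D.q B.q :=
  Quotient.map (fun α : XHom D B.stab => (XHom.kappa B).comp α.qMap)
    (fun _ _ h => XHom.joined_comp_left _ (XHom.joined_qMap h)) a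

theorem qLift_mk (α : XHom D B.stab) : qLift (mk α) = mk ((XHom.kappa B).comp α.qMap) := rfl

theorem π_comp_qLift (a : HClass D B) :
    comp (ofHom (XHom.π B)) (qLift a) = comp a (ofHom (XHom.π D)) := by
  induction a using ind with | h α => ?_
  rw [qLift_mk, ofHom_comp_mk, mk_comp_ofHom, ← XHom.comp_assoc, XHom.π_stabMap_comp_kappa,
    XHom.π_comp_qMap]

theorem qLift_ofHom_comp (g : XHom E B) (a : HClass D E) :
    qLift (comp (ofHom g) a) = comp (ofHom g.qMap) (qLift a) := by
  induction a using ind with | h α => ?_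
  rw [qLift_mk, ofHom_comp_mk, ofHom_comp_mk, qLift_mk, XHom.qMap_comp, ← XHom.comp_assoc,
    XHom.kappa_naturality]
  rfl

end HClass

end

noncomputable section

attribute [local instance] CStarAlgebra.spectralOrder CStarAlgebra.spectralOrderedRing

open Filter Topology

/-! ### Lifting modulo an ideal with control of commutators -/

section Technical

variable {M : Type*} [CStarAlgebra M]

theorem le_algebraMap_of_conjugate {B ε η : ℝ} {h w a g : M} (hε : 2 * η * ‖a‖ ≤ ε)
    (hw : w ≤ algebraMap ℝ M B) (ha : IsSelfAdjoint a) (haa : a * a = algebraMap ℝ M B - h)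
    (hg : IsSelfAdjoint g) (hg1 : ‖g‖ ≤ 1) (hag : ‖g * a - a * g‖ ≤ η) :
    h + g * (w - h) * g ≤ algebraMap ℝ M (B + ε) := by
  have h1 : 0 ≤ a * (1 - g * g) * a := by
    have : 0 ≤ 1 - g * g := by
      have h2 := CStarAlgebra.star_mul_le_algebraMap_norm_sq (a := g)
      rw [hg.star_eq] at h2
      refine sub_nonneg.2 (h2.trans ?_)
      rw [← map_one (algebraMap ℝ M)]
      exact algebraMap_mono M (by nlinarith [norm_nonneg g])
    have := star_left_conjugate_nonneg this a
    rwa [ha.star_eq] at this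
  have h2 : 0 ≤ g * (algebraMap ℝ M B - w) * g := by
    have := star_left_conjugate_nonneg (sub_nonneg.2 hw) g
    rwa [hg.star_eq] at this
  set x : M := a * g * (g * a) - g * a * (a * g) with hx
  have hxs : IsSelfAdjoint x := by
    rw [IsSelfAdjoint, hx]
    simp only [star_sub, star_mul, ha.star_eq, hg.star_eq]
  have hxn : ‖x‖ ≤ ε := by
    have e : x = (a * g - g * a) * (g * a) + g * a * (g * a - a * g) := by rw [hx]; noncomm_ring
    have hga : ‖g * a‖ ≤ ‖a‖ :=
      (norm_mul_le _ _).trans (by nlinarith [norm_nonneg a, norm_nonneg g])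
    have hag' : ‖a * g - g * a‖ ≤ η := by rwa [norm_sub_rev]
    rw [e]
    refine (norm_add_le _ _).trans ?_
    have e1 := (norm_mul_le (a * g - g * a) (g * a)).trans
      (mul_le_mul hag' hga (norm_nonneg _) ((norm_nonneg _).trans hag))
    have e2 := (norm_mul_le (g * a) (g * a - a * g)).trans
      (mul_le_mul hga hag (norm_nonneg _) (norm_nonneg _))
    nlinarith
  have h3 : 0 ≤ algebraMap ℝ M ε + x := by
    have h4 := hxs.neg_algebraMap_norm_le_self
    have h5 : algebraMap ℝ M ‖x‖ ≤ algebraMap ℝ M ε := algebraMap_mono M hxn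
    rw [← sub_nonneg] at h4 h5 ⊢
    have := add_nonneg h4 h5
    refine this.trans_eq (by abel)
  rw [← sub_nonneg]
  have := add_nonneg (add_nonneg h1 h2) h3
  refine this.trans_eq ?_
  have hh : h = algebraMap ℝ M B - a * a := by rw [haa]; abel
  rw [hx, hh, map_add]
  noncomm_ring

theorem exists_sqrt_norm {h : M} (hsa : IsSelfAdjoint h) {B : ℝ} (hB : ‖h‖ ≤ B) :
    ∃ a : M, IsSelfAdjoint a ∧ a * a = algebraMap ℝ M B - h := by
  have h0 : 0 ≤ algebraMap ℝ M B - h :=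
    sub_nonneg.2 (hsa.le_algebraMap_norm_self.trans (algebraMap_mono M hB))
  exact ⟨CFC.sqrt (algebraMap ℝ M B - h), (CFC.sqrt_nonneg _).isSelfAdjoint,
    CFC.sqrt_mul_sqrt_self _ h0⟩

theorem norm_one_sub_le {f : M} (h0 : 0 ≤ f) (h1 : ‖f‖ ≤ 1) : ‖1 - f‖ ≤ 1 := by
  have h2 := (CStarAlgebra.norm_le_one_iff_of_nonneg f h0).1 h1
  rw [CStarAlgebra.norm_le_one_iff_of_nonneg _ (sub_nonneg.2 h2)]
  exact sub_le_self 1 h0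

theorem norm_le_of_le_of_neg_le {h : M} (hsa : IsSelfAdjoint h) {B : ℝ} (hB : 0 ≤ B)
    (h1 : h ≤ algebraMap ℝ M B) (h2 : -h ≤ algebraMap ℝ M B) : ‖h‖ ≤ B := by
  rcases subsingleton_or_nontrivial M with hM | hM
  · rwa [Subsingleton.elim h 0, norm_zero]
  rcases CStarAlgebra.norm_or_neg_norm_mem_spectrum hsa with h3 | h3
  · exact (le_algebraMap_iff_spectrum_le hsa).1 h1 _ h3
  · have := (algebraMap_le_iff_le_spectrum (r := -B) hsa).1 (by rw [map_neg]; exact neg_le.1 h2) _ h3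
    linarith

variable {J : TwoSidedIdeal M} (hJ : IsClosed (J : Set M))

include hJ in
/-- One step of the approximation: `h` is moved within its class modulo the ideal towards the class
of `w'`, with control of the norm and of the operators `x ↦ x c - d x`. -/
theorem TwoSidedIdeal.exists_correction {B ε : ℝ} (hB : 0 ≤ B) (hε : 0 < ε) {h w w' : M}
    (hh : IsSelfAdjoint h) (hw' : IsSelfAdjoint w') (hhB : ‖h‖ ≤ B)
    (hwB : ‖w'‖ ≤ B) (hhw : h - w ∈ J) (S : Finset (M × M))
    (hS : ∀ p ∈ S, ∃ j ∈ J, ‖(w' - w) * p.1 - p.2 * (w' - w) - j‖ ≤ ε) :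
    ∃ h' : M, IsSelfAdjoint h' ∧ ‖h'‖ ≤ B + ε ∧ h' - w' ∈ J ∧
      ∀ p ∈ S, ‖(h' - h) * p.1 - p.2 * (h' - h)‖ ≤ 2 * ε := by
  classical
  obtain ⟨a, ha, haa⟩ := exists_sqrt_norm hh hhB
  obtain ⟨b, hb, hbb⟩ := exists_sqrt_norm hh.neg ((norm_neg h).trans_le hhB)
  choose! j hjJ hj using hS
  set D := w' - h with hD
  let j' : M × M → M := fun p => j p - ((h - w) * p.1 - p.2 * (h - w))
  have hj'J : ∀ p ∈ S, j' p ∈ J := fun p hp =>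
    J.sub_mem (hjJ p hp) (J.sub_mem (J.mul_mem_right _ _ hhw) (J.mul_mem_left _ _ hhw))
  have hj' : ∀ p ∈ S, ‖D * p.1 - p.2 * D - j' p‖ ≤ ε := fun p hp => by
    convert hj p hp using 2
    simp only [j', hD]; noncomm_ring
  set K : ℝ := 2 * ‖a‖ + 2 * ‖b‖ + 2 * ‖D‖ + 1 with hK
  have hK0 : 0 < K := by positivity
  set η : ℝ := ε / K with hη
  have hη0 : 0 < η := by positivity
  have hKη : K * η = ε := by rw [hη]; field_simp
  obtain ⟨f, hfJ, hf0, hf1, hfG, hfF⟩ := J.exists_quasicentral hJ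
    (insert a (insert b (S.image Prod.fst ∪ S.image Prod.snd))) (S.image j')
    (fun x hx => by obtain ⟨p, hp, rfl⟩ := Finset.mem_image.1 hx; exact hj'J p hp) hη0
  set g : M := 1 - f with hg
  have hgs : IsSelfAdjoint g := (IsSelfAdjoint.one M).sub hf0.isSelfAdjoint
  have hg1 : ‖g‖ ≤ 1 := norm_one_sub_le hf0 hf1
  have hgc : ∀ y, g * y - y * g = -(f * y - y * f) := fun y => by rw [hg]; noncomm_ring
  have hgF : ∀ y ∈ insert a (insert b (S.image Prod.fst ∪ S.image Prod.snd)),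
      ‖g * y - y * g‖ ≤ η := fun y hy => by
    rw [hgc, norm_neg]; exact (hfF y hy).le
  have hs : IsSelfAdjoint (g * D * g) := by
    rw [IsSelfAdjoint]
    simp only [star_mul, hgs.star_eq, (hw'.sub hh).star_eq, hD, mul_assoc]
  refine ⟨h + g * D * g, hh.add hs, ?_, ?_, fun p hp => ?_⟩
  · refine norm_le_of_le_of_neg_le (hh.add hs) (by positivity) ?_ ?_
    · refine le_algebraMap_of_conjugate (η := η) ?_
        (hw'.le_algebraMap_norm_self.trans (algebraMap_mono M hwB)) ha haa hgs hg1
        (hgF a (by simp))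
      rw [← hKη]; nlinarith [norm_nonneg a, norm_nonneg b, norm_nonneg D]
    · have := le_algebraMap_of_conjugate (h := -h) (w := -w') (g := g) (η := η) (ε := ε) ?_
        (hw'.neg.le_algebraMap_norm_self.trans (algebraMap_mono M ((norm_neg w').trans_le hwB)))
        hb hbb hgs hg1 (hgF b (by simp))
      · refine le_trans (le_of_eq ?_) this
        rw [hD]; noncomm_ring
      · rw [← hKη]; nlinarith [norm_nonneg a, norm_nonneg b, norm_nonneg D]
  · have e : h + g * D * g - w' = f * D * f - f * D - D * f := by rw [hg, hD]; noncomm_ring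
    rw [e]
    exact J.sub_mem (J.sub_mem (J.mul_mem_left _ _ hfJ) (J.mul_mem_right _ _ hfJ))
      (J.mul_mem_left _ _ hfJ)
  · have e : (h + g * D * g - h) * p.1 - p.2 * (h + g * D * g - h) =
        g * D * (g * p.1 - p.1 * g) + g * (D * p.1 - p.2 * D - j' p) * g + g * j' p * g
          + (g * p.2 - p.2 * g) * D * g := by noncomm_ring
    rw [e]
    have n1 : ∀ x y : M, ‖x‖ ≤ 1 → ‖x * y‖ ≤ ‖y‖ := fun x y hx =>
      (norm_mul_le _ _).trans (by nlinarith [norm_nonneg x, norm_nonneg y])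
    have n2 : ∀ x y : M, ‖y‖ ≤ 1 → ‖x * y‖ ≤ ‖x‖ := fun x y hx =>
      (norm_mul_le _ _).trans (by nlinarith [norm_nonneg x, norm_nonneg y])
    have t1 : ‖g * D * (g * p.1 - p.1 * g)‖ ≤ ‖D‖ * η :=
      (norm_mul_le _ _).trans (mul_le_mul (n1 _ _ hg1)
        (hgF _ (by simp only [Finset.mem_insert, Finset.mem_union, Finset.mem_image]
                   exact .inr (.inr (.inl ⟨p, hp, rfl⟩)))) (norm_nonneg _) (norm_nonneg _))
    have t2 : ‖g * (D * p.1 - p.2 * D - j' p) * g‖ ≤ ε :=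
      (n2 _ _ hg1).trans ((n1 _ _ hg1).trans (hj' p hp))
    have t3 : ‖g * j' p * g‖ ≤ η := by
      refine (n2 _ _ hg1).trans ?_
      have : g * j' p = -(f * j' p - j' p) := by rw [hg]; noncomm_ring
      rw [this, norm_neg]
      exact (hfG _ (Finset.mem_image_of_mem _ hp)).le
    have t4 : ‖(g * p.2 - p.2 * g) * D * g‖ ≤ η * ‖D‖ :=
      (n2 _ _ hg1).trans ((norm_mul_le _ _).trans (mul_le_mul_of_nonneg_right
        (hgF _ (by simp only [Finset.mem_insert, Finset.mem_union, Finset.mem_image]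
                   exact .inr (.inr (.inr ⟨p, hp, rfl⟩)))) (norm_nonneg _)))
    have := norm_add₄_le (a := g * D * (g * p.1 - p.1 * g))
      (b := g * (D * p.1 - p.2 * D - j' p) * g) (c := g * j' p * g)
      (d := (g * p.2 - p.2 * g) * D * g)
    nlinarith [norm_nonneg a, norm_nonneg b, norm_nonneg D]

include hJ in
/-- Let `w n` be a bounded sequence of self-adjoint elements. If the sequences `w n * c - d * w n`
are Cauchy modulo `J`, fast enough, for the pairs `(c, d)` in an increasing union of finite sets,
then there are `h n`, equal to `w n` modulo `J`, such that the sequences `h n * c - d * h n` are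
Cauchy. -/
theorem TwoSidedIdeal.exists_corrections {C B : ℝ} (w : ℕ → M) (hw : ∀ n, IsSelfAdjoint (w n))
    (hwB : ∀ n, ‖w n‖ ≤ B) (S : ℕ → Finset (M × M)) (hS : Monotone S)
    (hwS : ∀ n, ∀ p ∈ S n, ∃ j ∈ J,
      ‖(w (n + 1) - w n) * p.1 - p.2 * (w (n + 1) - w n) - j‖ ≤ C * (1 / 2) ^ n) :
    ∃ h : ℕ → M, (∀ n, IsSelfAdjoint (h n)) ∧ (∃ B', ∀ n, ‖h n‖ ≤ B') ∧ (∀ n, h n - w n ∈ J) ∧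
      ∀ n, ∀ p ∈ S n, CauchySeq fun m => h m * p.1 - p.2 * h m := by
  have hB : 0 ≤ B := (norm_nonneg _).trans (hwB 0)
  set C' : ℝ := max C 1
  have hC' : 0 < C' := lt_of_lt_of_le one_pos (le_max_right _ _)
  let b : ℕ → ℝ := fun n => B + C' * (2 - 2 * (1 / 2) ^ n)
  have hb : ∀ n, B ≤ b n := fun n => by
    have : (1 / 2 : ℝ) ^ n ≤ 1 := pow_le_one₀ (by norm_num) (by norm_num)
    simp only [b]; nlinarith
  have hbs : ∀ n, b (n + 1) = b n + C' * (1 / 2) ^ n := fun n => by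
    simp only [b, pow_succ]; ring
  let P : ℕ → Type _ := fun n => {h : M // IsSelfAdjoint h ∧ ‖h‖ ≤ b n ∧ h - w n ∈ J}
  have step : ∀ n (h : P n), ∃ h' : P (n + 1),
      ∀ p ∈ S n, ‖(h'.1 - h.1) * p.1 - p.2 * (h'.1 - h.1)‖ ≤ 2 * (C' * (1 / 2) ^ n) := by
    rintro n ⟨h, h1, h2, h3⟩
    obtain ⟨h', h4, h5, h6, h7⟩ := J.exists_correction hJ (hB.trans (hb n))
      (by positivity : 0 < C' * (1 / 2) ^ n) h1 (hw (n + 1)) h2 ((hwB _).trans (hb n)) h3 (S n)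
      (fun p hp => by
        obtain ⟨j, hj, h⟩ := hwS n p hp
        exact ⟨j, hj, h.trans (mul_le_mul_of_nonneg_right (le_max_left _ _) (by positivity))⟩)
    exact ⟨⟨h', h4, by rw [hbs]; exact h5, h6⟩, h7⟩
  choose next hnext using step
  let h : ∀ n, P n := fun n => Nat.rec
    ⟨w 0, hw 0, (hwB 0).trans (hb 0), by rw [sub_self]; exact J.zero_mem⟩ next n
  refine ⟨fun n => (h n).1, fun n => (h n).2.1, ⟨B + C' * 2, fun n => (h n).2.2.1.trans ?_⟩,
    fun n => (h n).2.2.2, fun n p hp => ?_⟩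
  · have : (0 : ℝ) < (1 / 2 : ℝ) ^ n := by positivity
    simp only [b]; nlinarith
  · rw [← cauchySeq_shift n]
    refine cauchySeq_of_le_geometric (1 / 2) (2 * C' * (1 / 2) ^ n) (by norm_num) fun m => ?_
    rw [dist_comm, dist_eq_norm]
    have e := hnext (m + n) (h (m + n)) p (hS (Nat.le_add_left n m) hp)
    have e' : next (m + n) (h (m + n)) = h (m + n + 1) := rfl
    rw [e', add_right_comm] at e
    refine le_trans (le_of_eq ?_) (e.trans (le_of_eq ?_))
    · congr 1; noncomm_ring
    · rw [pow_add]; ring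

end Technical

end

noncomputable section

attribute [local instance] CStarAlgebra.spectralOrder CStarAlgebra.spectralOrderedRing

open Filter Topology

/-! ### Extension of nondegenerate homomorphisms to multipliers -/

section Extension

variable {D R Y : Type*} [NonUnitalCStarAlgebra D] [NonUnitalCStarAlgebra R]
  [NonUnitalCStarAlgebra Y]

/-- A homomorphism `θ : D → R` is nondegenerate if the image of an approximate unit is an
approximate unit. -/
def Nondegenerate (θ : D →⋆ₙₐ[ℂ] R) : Prop :=
  ∀ r : R, Tendsto (fun e => θ e * r) (approxUnit D) (𝓝 r)

theorem Nondegenerate.induction_on {θ : D →⋆ₙₐ[ℂ] R} (hθ : Nondegenerate θ) {p : R → Prop}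
    (hp : IsClosed {r | p r}) (h : ∀ k r, p (θ k * r)) (r : R) : p r :=
  hp.mem_of_tendsto (hθ r) (Eventually.of_forall fun k => h k r)

namespace qAlg.IdealEmbedding

variable {j : D →⋆ₙₐ[ℂ] Y} (hj : IdealEmbedding j)

/-- The action of `Y` on its ideal `D` by left multiplication. -/
def act (y : Y) (k : D) : D := (hj.mul_left y k).choose

theorem apply_act (y : Y) (k : D) : j (hj.act y k) = y * j k := (hj.mul_left y k).choose_spec

theorem act_mul (y : Y) (k k' : D) : hj.act y (k * k') = hj.act y k * k' :=
  hj.injective (by simp only [apply_act, map_mul, mul_assoc])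

theorem add_act (y y' : Y) (k : D) : hj.act (y + y') k = hj.act y k + hj.act y' k :=
  hj.injective (by simp only [apply_act, map_add, add_mul])

theorem smul_act (c : ℂ) (y : Y) (k : D) : hj.act (c • y) k = c • hj.act y k :=
  hj.injective (by simp only [apply_act, map_smul, smul_mul_assoc])

theorem mul_act (y y' : Y) (k : D) : hj.act (y * y') k = hj.act y (hj.act y' k) :=
  hj.injective (by simp only [apply_act, mul_assoc])

theorem apply_act_eq (d k : D) : hj.act (j d) k = d * k :=
  hj.injective (by simp only [apply_act, map_mul])

theorem star_act_mul (y : Y) (k k' : D) : star (hj.act y k) * k' = star k * hj.act (star y) k' :=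
  hj.injective (by simp only [apply_act, map_mul, map_star, star_mul, mul_assoc])

theorem norm_act_le (y : Y) (k : D) : ‖hj.act y k‖ ≤ ‖y‖ * ‖k‖ := by
  rw [← NonUnitalStarAlgHom.norm_map j hj.injective, apply_act,
    ← NonUnitalStarAlgHom.norm_map j hj.injective k]
  exact norm_mul_le _ _

theorem continuous_act (y : Y) : Continuous (hj.act y) := by
  rw [(isometry_cstarHom hj.injective).isEmbedding.continuous_iff]
  have : j ∘ hj.act y = fun k => y * j k := funext fun k => hj.apply_act y k
  rw [this]
  exact continuous_const.mul (continuous_cstarHom j)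

theorem exists_tendsto_act {θ : D →⋆ₙₐ[ℂ] R} (hθ : Nondegenerate θ) (y : Y) (r : R) :
    ∃ t, Tendsto (fun e => θ (hj.act y e) * r) (approxUnit D) (𝓝 t) := by
  rw [← cauchy_map_iff_exists_tendsto, cauchy_map_iff]
  refine ⟨inferInstance, ?_⟩
  refine Metric.uniformity_basis_dist.tendsto_right_iff.2 fun ε hε => ?_
  have hy : 0 < 4 * (‖y‖ + 1) := by positivity
  obtain ⟨k, hk⟩ := ((Metric.tendsto_nhds.1 (hθ r) _ (div_pos hε hy))).exists
  rw [dist_eq_norm, lt_div_iff₀ hy] at hk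
  have h1 : Tendsto (fun e => θ (hj.act y e) * (θ k * r)) (approxUnit D)
      (𝓝 (θ (hj.act y k) * r)) := by
    have : (fun e => θ (hj.act y e) * (θ k * r)) = fun e => θ (hj.act y (e * k)) * r := by
      funext e; rw [act_mul, map_mul, mul_assoc]
    rw [this]
    exact ((((continuous_cstarHom θ).comp (hj.continuous_act y)).tendsto _).comp
      (approxUnit.tendsto_mul_right k)).mul_const r
  have h2 : ∀ᶠ e in approxUnit D, dist (θ (hj.act y e) * r) (θ (hj.act y k) * r) < ε / 2 := by
    filter_upwards [Metric.tendsto_nhds.1 h1 (ε / 4) (by positivity),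
      approxUnit.eventually_norm D] with e he he1
    have : dist (θ (hj.act y e) * r) (θ (hj.act y e) * (θ k * r)) ≤ ε / 4 := by
      rw [dist_comm, dist_eq_norm, ← mul_sub]
      have h3 : ‖θ (hj.act y e)‖ ≤ ‖y‖ + 1 :=
        (NonUnitalStarAlgHom.norm_apply_le θ _).trans ((hj.norm_act_le y e).trans
          (by nlinarith [norm_nonneg y, norm_nonneg e]))
      refine (norm_mul_le _ _).trans ?_
      nlinarith [norm_nonneg (θ k * r - r)]
    linarith [dist_triangle (θ (hj.act y e) * r) (θ (hj.act y e) * (θ k * r))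
      (θ (hj.act y k) * r)]
  filter_upwards [h2.prod_mk h2] with p hp
  linarith [dist_triangle_right (θ (hj.act y p.1) * r) (θ (hj.act y p.2) * r)
    (θ (hj.act y k) * r)]

variable {θ : D →⋆ₙₐ[ℂ] R} (hθ : Nondegenerate θ)

/-- The extension of a nondegenerate homomorphism to left multipliers. -/
def extFun (y : Y) (r : R) : R := (hj.exists_tendsto_act hθ y r).choose

theorem tendsto_extFun (y : Y) (r : R) :
    Tendsto (fun e => θ (hj.act y e) * r) (approxUnit D) (𝓝 (hj.extFun hθ y r)) :=
  (hj.exists_tendsto_act hθ y r).choose_spec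

theorem norm_extFun_le (y : Y) (r : R) : ‖hj.extFun hθ y r‖ ≤ ‖y‖ * ‖r‖ := by
  refine le_of_tendsto (hj.tendsto_extFun hθ y r).norm ?_
  filter_upwards [approxUnit.eventually_norm D] with e he
  have h3 : ‖θ (hj.act y e)‖ ≤ ‖y‖ :=
    (NonUnitalStarAlgHom.norm_apply_le θ _).trans ((hj.norm_act_le y e).trans
      (by nlinarith [norm_nonneg y, norm_nonneg e]))
  exact (norm_mul_le _ _).trans (mul_le_mul_of_nonneg_right h3 (norm_nonneg _))

/-- The extension of a nondegenerate homomorphism, as an operator. -/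
def extL (y : Y) : R →L[ℂ] R :=
  LinearMap.mkContinuous
    { toFun := hj.extFun hθ y
      map_add' := fun r s => tendsto_nhds_unique (hj.tendsto_extFun hθ y (r + s)) (by
        simpa only [mul_add] using (hj.tendsto_extFun hθ y r).add (hj.tendsto_extFun hθ y s))
      map_smul' := fun c r => tendsto_nhds_unique (hj.tendsto_extFun hθ y (c • r)) (by
        simpa only [mul_smul_comm, RingHom.id_apply] using
          (hj.tendsto_extFun hθ y r).const_smul c) }
    ‖y‖ (hj.norm_extFun_le hθ y)

theorem extL_apply_mul (y : Y) (k : D) (r : R) :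
    hj.extL hθ y (θ k * r) = θ (hj.act y k) * r := by
  refine tendsto_nhds_unique (hj.tendsto_extFun hθ y (θ k * r)) ?_
  have : (fun e => θ (hj.act y e) * (θ k * r)) = fun e => θ (hj.act y (e * k)) * r := by
    funext e; rw [act_mul, map_mul, mul_assoc]
  rw [this]
  exact ((((continuous_cstarHom θ).comp (hj.continuous_act y)).tendsto _).comp
    (approxUnit.tendsto_mul_right k)).mul_const r

theorem star_extL_mul (y : Y) (r s : R) :
    star (hj.extL hθ y r) * s = star r * hj.extL hθ (star y) s := by
  refine hθ.induction_on (p := fun r => star (hj.extL hθ y r) * s =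
    star r * hj.extL hθ (star y) s) (isClosed_eq (by fun_prop) (by fun_prop)) (fun k r => ?_) r
  refine hθ.induction_on (p := fun s => star (hj.extL hθ y (θ k * r)) * s =
    star (θ k * r) * hj.extL hθ (star y) s) (isClosed_eq (by fun_prop) (by fun_prop))
    (fun k' s => ?_) s
  have := congrArg θ (hj.star_act_mul y k k')
  rw [map_mul, map_mul, map_star, map_star] at this
  rw [extL_apply_mul, extL_apply_mul, star_mul, star_mul, mul_assoc, ← mul_assoc _ _ s, this]
  simp only [mul_assoc]

/-- A nondegenerate homomorphism `D → R` extends to algebras that contain `D` as an ideal, with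
values in multipliers. -/
def extend : Y →⋆ₙₐ[ℂ] Mult R :=
  let F : Y → Mult R := fun y =>
    Mult.ofAdjoint (hj.extL hθ y) (hj.extL hθ (star y)) (hj.star_extL_mul hθ y)
  have hF : ∀ y r, (F y).fst r = hj.extL hθ y r := fun _ _ => rfl
  have ext : ∀ m n : Mult R, (∀ k r, m.fst (θ k * r) = n.fst (θ k * r)) → m = n := fun m n h =>
    Mult.ext_fst fun r => hθ.induction_on (p := fun r => m.fst r = n.fst r)
      (isClosed_eq (by fun_prop) (by fun_prop)) h r
  { toFun := F
    map_smul' := fun c y => ext _ _ fun k r => by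
      rw [hF, extL_apply_mul, smul_act, map_smul, smul_mul_assoc]
      exact congrArg (c • ·) (hj.extL_apply_mul hθ y k r).symm
    map_zero' := ext _ _ fun k r => by
      rw [hF, extL_apply_mul]
      have : hj.act 0 k = 0 := hj.injective (by rw [apply_act, zero_mul, map_zero])
      rw [this, map_zero, zero_mul]; rfl
    map_add' := fun y y' => ext _ _ fun k r => by
      rw [hF, extL_apply_mul, add_act, map_add, add_mul]
      exact congrArg₂ (· + ·) (hj.extL_apply_mul hθ y k r).symm (hj.extL_apply_mul hθ y' k r).symm
    map_mul' := fun y y' => ext _ _ fun k r => by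
      rw [hF, extL_apply_mul, mul_act]
      change _ = hj.extL hθ y (hj.extL hθ y' (θ k * r))
      rw [extL_apply_mul, extL_apply_mul]
    map_star' := fun y => ext _ _ fun k r => by
      rw [hF, DoubleCentralizer.star_fst]
      change _ = star (star (hj.extL hθ (star y) (star (star (θ k * r)))))
      rw [star_star, star_star] }

theorem extend_fst_mul (y : Y) (k : D) (r : R) :
    (hj.extend hθ y).fst (θ k * r) = θ (hj.act y k) * r := hj.extL_apply_mul hθ y k r

theorem extend_apply (k : D) : hj.extend hθ (j k) = Mult.of R (θ k) :=
  Mult.ext_fst fun r => hθ.induction_on (p := fun r => (hj.extend hθ (j k)).fst r = _)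
    (isClosed_eq (by fun_prop) (by fun_prop)) (fun k' r => by
      rw [extend_fst_mul, apply_act_eq, map_mul, mul_assoc]; rfl) r

end qAlg.IdealEmbedding

end Extension

/-! ### Hereditary subalgebras -/

section Hereditary

variable {D N : Type*} [NonUnitalCStarAlgebra D] [NonUnitalCStarAlgebra N]

theorem isClosed_tendsto_map_mul (θ : D →⋆ₙₐ[ℂ] N) :
    IsClosed {r | Tendsto (fun e => θ e * r) (approxUnit D) (𝓝 r)} := by
  rw [← closure_subset_iff_isClosed]
  intro r hr
  refine Metric.tendsto_nhds.2 fun ε hε => ?_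
  obtain ⟨s, hs, hrs⟩ := Metric.mem_closure_iff.1 hr (ε / 3) (by positivity)
  filter_upwards [Metric.tendsto_nhds.1 hs (ε / 3) (by positivity),
    approxUnit.eventually_norm D] with e he he1
  have h1 : dist (θ e * r) (θ e * s) ≤ dist r s := by
    rw [dist_eq_norm, dist_eq_norm, ← mul_sub]
    refine (norm_mul_le _ _).trans ?_
    have := (NonUnitalStarAlgHom.norm_apply_le θ e).trans he1
    nlinarith [norm_nonneg (r - s)]
  have := dist_triangle4 (θ e * r) (θ e * s) s r
  rw [dist_comm s r] at this
  linarith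

/-- The hereditary subalgebra of `N` generated by the image of a homomorphism `D → N`. -/
def hered (θ : D →⋆ₙₐ[ℂ] N) : NonUnitalStarSubalgebra ℂ N where
  carrier := {r | Tendsto (fun e => θ e * r) (approxUnit D) (𝓝 r) ∧
    Tendsto (fun e => θ e * star r) (approxUnit D) (𝓝 (star r))}
  add_mem' := by
    rintro a b ⟨h1, h2⟩ ⟨h3, h4⟩
    exact ⟨by simpa only [mul_add] using h1.add h3, by simpa only [mul_add, star_add] using h2.add h4⟩
  zero_mem' := by simp only [Set.mem_ofPred_eq, star_zero, mul_zero]; exact ⟨tendsto_const_nhds, tendsto_const_nhds⟩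
  mul_mem' := by
    rintro a b ⟨h1, h2⟩ ⟨h3, h4⟩
    refine ⟨by simpa only [mul_assoc] using h1.mul_const b, ?_⟩
    simpa only [star_mul, mul_assoc] using h4.mul_const (star a)
  smul_mem' := by
    rintro c a ⟨h1, h2⟩
    refine ⟨by simpa only [mul_smul_comm] using h1.const_smul c, ?_⟩
    simpa only [star_smul, mul_smul_comm] using h2.const_smul (star c)
  star_mem' := by
    rintro a ⟨h1, h2⟩
    exact ⟨h2, by rwa [star_star]⟩

variable {θ : D →⋆ₙₐ[ℂ] N}

theorem isClosed_hered : IsClosed (hered θ : Set N) :=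
  (isClosed_tendsto_map_mul θ).inter ((isClosed_tendsto_map_mul θ).preimage continuous_star)

instance : IsClosed (hered θ : Set N) := isClosed_hered

theorem mem_hered_of_mul {r n n' : N} {k k' : D} (h : r = θ k * n) (h' : r = n' * θ k') :
    r ∈ hered θ := by
  have key : ∀ (k : D) (n : N), Tendsto (fun e => θ e * (θ k * n)) (approxUnit D)
      (𝓝 (θ k * n)) := fun k n => by
    have := (((continuous_cstarHom θ).tendsto _).comp (approxUnit.tendsto_mul_right k)).mul_const n
    simpa only [Function.comp_def, map_mul, mul_assoc] using this
  refine ⟨by rw [h]; exact key _ _, ?_⟩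
  have : star r = θ (star k') * star n' := by rw [h', star_mul, map_star]
  rw [this]; exact key _ _

theorem map_mem_hered (k : D) : θ k ∈ hered θ := by
  have key : ∀ k : D, Tendsto (fun e => θ e * θ k) (approxUnit D) (𝓝 (θ k)) := fun k => by
    simpa only [Function.comp_def, map_mul] using
      ((continuous_cstarHom θ).tendsto _).comp (approxUnit.tendsto_mul_right k)
  refine ⟨key k, ?_⟩
  rw [← map_star]; exact key _

variable (θ) in
/-- The homomorphism `θ` with values in the hereditary subalgebra. -/
def toHered : D →⋆ₙₐ[ℂ] hered θ := NonUnitalStarAlgHom.codRestrict θ (hered θ) map_mem_hered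

theorem nondegenerate_toHered : Nondegenerate (toHered θ) := fun r =>
  tendsto_subtype_rng.2 r.2.1

end Hereditary

end

noncomputable section

attribute [local instance] CStarAlgebra.spectralOrder CStarAlgebra.spectralOrderedRing

open Filter Topology

/-! ### The Cayley transform -/

section Cayley

variable {M : Type*} [CStarAlgebra M]

/-- The denominator `1 - i t h` of the Cayley transform. -/
def cayleyDenom (h : M) (t : ℝ) : M := 1 - (Complex.I * t) • h

variable {h : M}

theorem star_cayleyDenom (hh : IsSelfAdjoint h) (t : ℝ) :
    star (cayleyDenom h t) = 1 + (Complex.I * t) • h := by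
  simp [cayleyDenom, star_smul, hh.star_eq, sub_eq_add_neg]

theorem commute_cayleyDenom (hh : IsSelfAdjoint h) (t : ℝ) :
    Commute (star (cayleyDenom h t)) (cayleyDenom h t) := by
  rw [star_cayleyDenom hh, cayleyDenom]
  simp only [Commute, SemiconjBy, mul_sub, sub_mul, mul_add, add_mul, one_mul, mul_one]
  abel

theorem isUnit_cayleyDenom (hh : IsSelfAdjoint h) (t : ℝ) :
    IsUnit (cayleyDenom h t) ∧ IsUnit (star (cayleyDenom h t)) := by
  have h1 : star (cayleyDenom h t) * cayleyDenom h t = 1 + star ((t : ℂ) • h) * ((t : ℂ) • h) := by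
    rw [star_cayleyDenom hh, cayleyDenom, star_smul, hh.star_eq]
    simp only [mul_sub, add_mul, one_mul, mul_one, smul_mul_smul_comm]
    have e1 : Complex.I * (t : ℂ) * (Complex.I * t) = -(t * t : ℂ) := by
      linear_combination (t * t : ℂ) * Complex.I_mul_I
    have e2 : star (t : ℂ) = t := Complex.conj_ofReal t
    rw [e1, e2, neg_smul]
    abel
  have h2 : IsUnit (star (cayleyDenom h t) * cayleyDenom h t) :=
    CStarAlgebra.isUnit_of_le 1 (by
      rw [h1]; exact le_add_of_nonneg_right (star_mul_self_nonneg _)) isStrictlyPositive_one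
  have := (commute_cayleyDenom hh t).isUnit_mul_iff.1 h2
  exact ⟨this.2, this.1⟩

/-- The Cayley transform `(1 + i t h) (1 - i t h)⁻¹`. -/
def cayley (h : M) (t : ℝ) : M := star (cayleyDenom h t) * Ring.inverse (cayleyDenom h t)

theorem continuous_cayley (hh : IsSelfAdjoint h) : Continuous (cayley h) := by
  have h1 : Continuous (cayleyDenom h) := by unfold cayleyDenom; fun_prop
  refine h1.star.mul (continuous_iff_continuousAt.2 fun t => ?_)
  obtain ⟨u, hu⟩ := (isUnit_cayleyDenom hh t).1
  have := NormedRing.inverse_continuousAt u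
  rw [hu] at this
  exact this.comp h1.continuousAt

theorem cayley_zero : cayley h 0 = 1 := by simp [cayley, cayleyDenom]

theorem star_cayley (t : ℝ) : star (cayley h t) =
    Ring.inverse (star (cayleyDenom h t)) * cayleyDenom h t := by
  rw [cayley, star_mul, star_star, Ring.inverse_star]

theorem star_cayley_mul (hh : IsSelfAdjoint h) (t : ℝ) : star (cayley h t) * cayley h t = 1 := by
  obtain ⟨h1, h2⟩ := isUnit_cayleyDenom hh t
  rw [star_cayley, cayley, mul_assoc, ← mul_assoc (cayleyDenom h t),
    ← (commute_cayleyDenom hh t).eq, mul_assoc, Ring.mul_inverse_cancel _ h1, mul_one,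
    Ring.inverse_mul_cancel _ h2]

theorem cayley_mul_star (hh : IsSelfAdjoint h) (t : ℝ) : cayley h t * star (cayley h t) = 1 := by
  obtain ⟨h1, h2⟩ := isUnit_cayleyDenom hh t
  have hc : Ring.inverse (cayleyDenom h t) * Ring.inverse (star (cayleyDenom h t)) =
      Ring.inverse (star (cayleyDenom h t)) * Ring.inverse (cayleyDenom h t) :=
    (Commute.ringInverse_ringInverse (commute_cayleyDenom hh t).symm).eq
  rw [star_cayley, cayley, mul_assoc, ← mul_assoc (Ring.inverse (cayleyDenom h t)), hc, mul_assoc,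
    Ring.inverse_mul_cancel _ h1, mul_one, Ring.mul_inverse_cancel _ h2]

theorem TwoSidedIdeal.smul_mem_of_unital (J : TwoSidedIdeal M) (c : ℂ) {x : M} (hx : x ∈ J) :
    c • x ∈ J := by
  have := J.mul_mem_left (c • (1 : M)) x hx
  rwa [smul_mul_assoc, one_mul] at this

/-- If `h` commutes with `d` modulo an ideal then so does the Cayley transform. -/
theorem cayley_conj_sub_mem (hh : IsSelfAdjoint h) (t : ℝ) {J : TwoSidedIdeal M} {d : M}
    (hd : h * d - d * h ∈ J) : d - cayley h t * d * star (cayley h t) ∈ J := by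
  obtain ⟨h1, h2⟩ := isUnit_cayleyDenom hh t
  set b := cayleyDenom h t with hb
  set b' := Ring.inverse b with hb'
  set c := (Complex.I * t : ℂ)
  have e1 : star b * d - d * star b = c • (h * d - d * h) := by
    rw [hb, star_cayleyDenom hh]
    simp only [add_mul, mul_add, one_mul, mul_one, smul_mul_assoc, mul_smul_comm, smul_sub, c]
    abel
  have e2 : d * b - b * d = c • (h * d - d * h) := by
    rw [hb, cayleyDenom]
    simp only [sub_mul, mul_sub, one_mul, mul_one, smul_mul_assoc, mul_smul_comm, smul_sub, c]
    abel
  have hc := J.smul_mem_of_unital c hd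
  have e3 : d * cayley h t - cayley h t * d =
      -(star b * d - d * star b) * b' - star b * b' * (d * b - b * d) * b' := by
    have i1 : b * b' = 1 := Ring.mul_inverse_cancel _ h1
    have i2 : b' * b = 1 := Ring.inverse_mul_cancel _ h1
    have hcay : cayley h t = star b * b' := rfl
    rw [hcay]
    have : star b * b' * (d * b - b * d) * b' = star b * b' * d - star b * d * b' := by
      simp only [mul_sub, sub_mul]
      rw [mul_assoc (star b * b'), mul_assoc d, i1, mul_one, ← mul_assoc (star b * b'),
        mul_assoc (star b) b' b, i2, mul_one]
    rw [this]
    noncomm_ring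
  have e4 : d - cayley h t * d * star (cayley h t) =
      (d * cayley h t - cayley h t * d) * star (cayley h t) := by
    rw [sub_mul, mul_assoc d, cayley_mul_star hh, mul_one]
  rw [e4, e3, e1, e2]
  exact J.mul_mem_right _ _ (J.sub_mem (J.mul_mem_right _ _ (J.neg_mem hc))
    (J.mul_mem_right _ _ (J.mul_mem_left _ _ hc)))

/-- If `h² = 1` modulo an ideal then the Cayley transform at `1` is `i h` modulo the ideal. -/
theorem cayley_one_sub_mem (hh : IsSelfAdjoint h) {Z : TwoSidedIdeal M} (hZ : h * h - 1 ∈ Z) :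
    cayley h 1 - Complex.I • h ∈ Z := by
  have h1 := (isUnit_cayleyDenom hh 1).1
  have e : cayley h 1 - Complex.I • h = -(h * h - 1) * Ring.inverse (cayleyDenom h 1) := by
    have : Complex.I • h = Complex.I • h * cayleyDenom h 1 * Ring.inverse (cayleyDenom h 1) := by
      rw [mul_assoc, Ring.mul_inverse_cancel _ h1, mul_one]
    rw [this, cayley, ← sub_mul, star_cayleyDenom hh]
    congr 1
    simp only [cayleyDenom, Complex.ofReal_one, mul_one, mul_sub, smul_mul_smul_comm,
      Complex.I_mul_I, neg_smul, one_smul]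
    abel
  rw [e]
  exact Z.mul_mem_right _ _ (Z.neg_mem hZ)

end Cayley

/-! ### Separability of free products -/

section Separable

open TopologicalSpace

variable {A : Type u} [NonUnitalCStarAlgebra A]

/-- Products of at most `2 ^ n` elements of the two copies of `A`. -/
def QAlg.words (A : Type u) [NonUnitalCStarAlgebra A] : ℕ → Set (QAlg A)
  | 0 => Set.range (QAlg.ι A) ∪ Set.range (QAlg.ιbar A)
  | n + 1 => words A n ∪ (fun p : QAlg A × QAlg A => p.1 * p.2) '' (words A n ×ˢ words A n)

theorem QAlg.monotone_words : Monotone (QAlg.words A) :=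
  monotone_nat_of_le_succ fun _ => Set.subset_union_left

variable [SeparableSpace A]

theorem QAlg.isSeparable_words (n : ℕ) : IsSeparable (QAlg.words A n) := by
  induction n with
  | zero =>
    exact (isSeparable_range (continuous_cstarHom (QAlg.ι A))).union
      (isSeparable_range (continuous_cstarHom (QAlg.ιbar A)))
  | succ n ih => exact ih.union ((ih.prod ih).image continuous_mul)

instance : SeparableSpace (QAlg A) := by
  set W : Submodule ℂ (QAlg A) := Submodule.span ℂ (⋃ n, QAlg.words A n) with hW
  have hs : IsSeparable (closure (W : Set (QAlg A))) :=
    (IsSeparable.iUnion fun n => QAlg.isSeparable_words n).span.closure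
  have hmul : ∀ z ∈ W, ∀ w ∈ W, z * w ∈ W := by
    intro z hz w hw
    induction hz using Submodule.span_induction with
    | zero => rw [zero_mul]; exact W.zero_mem
    | add x y _ _ hx hy => rw [add_mul]; exact W.add_mem hx hy
    | smul c x _ hx => rw [smul_mul_assoc]; exact W.smul_mem c hx
    | mem x hx =>
      induction hw using Submodule.span_induction with
      | zero => rw [mul_zero]; exact W.zero_mem
      | add y z _ _ hy hz => rw [mul_add]; exact W.add_mem hy hz
      | smul c y _ hy => rw [mul_smul_comm]; exact W.smul_mem c hy
      | mem y hy =>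
        obtain ⟨n, hn⟩ := Set.mem_iUnion.1 hx
        obtain ⟨m, hm⟩ := Set.mem_iUnion.1 hy
        refine Submodule.subset_span (Set.mem_iUnion.2 ⟨max n m + 1, .inr ⟨(x, y), ⟨?_, ?_⟩, rfl⟩⟩)
        · exact QAlg.monotone_words (le_max_left n m) hn
        · exact QAlg.monotone_words (le_max_right n m) hm
  have huniv : ∀ z, z ∈ closure (W : Set (QAlg A)) := by
    apply QAlg.induction_on
    · exact isClosed_closure
    · exact subset_closure W.zero_mem
    · exact fun z w hz hw => map_mem_closure₂ continuous_add hz hw fun a ha b hb => W.add_mem ha hb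
    · exact fun c z hz => map_mem_closure (continuous_const_smul c) hz fun a ha => W.smul_mem c ha
    · exact fun z w hz hw => map_mem_closure₂ continuous_mul hz hw hmul
    · exact fun x => subset_closure (Submodule.subset_span (Set.mem_iUnion.2 ⟨0, .inl ⟨x, rfl⟩⟩))
    · exact fun x => subset_closure (Submodule.subset_span (Set.mem_iUnion.2 ⟨0, .inr ⟨x, rfl⟩⟩))
  rw [← isSeparable_univ_iff]
  exact hs.mono fun z _ => huniv z

instance : SeparableSpace (qAlg A) := by
  have : SecondCountableTopology (QAlg A) := UniformSpace.secondCountable_of_separable _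
  exact inferInstanceAs (SeparableSpace (qSub A))

end Separable

/-! ### Multipliers modulo an ideal -/

section MultIdeal

variable {R : Type*} [NonUnitalCStarAlgebra R]

/-- The multipliers which map `R` to a closed ideal. -/
def Mult.annihilator (I : TwoSidedIdeal R) (hI : IsClosed (I : Set R)) : TwoSidedIdeal (Mult R) :=
  TwoSidedIdeal.mk' {m | ∀ r, m.fst r ∈ I} (fun _ => I.zero_mem)
    (fun h h' r => I.add_mem (h r) (h' r)) (fun h r => I.neg_mem (h r))
    (fun {m _} h r => Mult.fst_mem hI m (h r)) (fun {_ n} h r => h (n.fst r))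

theorem Mult.mem_annihilator {I : TwoSidedIdeal R} {hI : IsClosed (I : Set R)} {m : Mult R} :
    m ∈ Mult.annihilator I hI ↔ ∀ r, m.fst r ∈ I := TwoSidedIdeal.mem_mk' ..

variable {A : Type*} [NonUnitalCStarAlgebra A]

/-- If two homomorphisms `f, g : A → M(R)` differ by elements of `K`, then they differ by elements
of a closed ideal `L` on any closed ideal `I` of `A` with `f(I) K ⊆ L` and `K g(I) ⊆ L`. -/
theorem Mult.sub_mem_of_mul_mem {f g : A →⋆ₙₐ[ℂ] Mult R} {K : Set R} {L : TwoSidedIdeal R}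
    (hL : IsClosed (L : Set R)) {I : TwoSidedIdeal A} (hK : ∀ x, f x - g x ∈ Mult.of R '' K)
    (hf : ∀ x ∈ I, ∀ κ ∈ K, (f x).fst κ ∈ L) (hg : ∀ x ∈ I, ∀ κ ∈ K, (g x).snd κ ∈ L) {x : A}
    (hx : x ∈ I) : f x - g x ∈ Mult.ideal L hL := by
  refine TwoSidedIdeal.mem_of_forall_norm_sub_lt (Mult.isClosed_ideal L hL) fun ε hε => ?_
  obtain ⟨y, hy, -, h⟩ := TwoSidedIdeal.exists_norm_sub_mul_lt hx (half_pos hε)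
  refine ⟨f (x * y) - g (x * y), ?_, ?_⟩
  · have e : f (x * y) - g (x * y) = f x * (f y - g y) + (f x - g x) * g y := by
      rw [map_mul, map_mul]; noncomm_ring
    obtain ⟨κ, hκ, e1⟩ := hK y
    obtain ⟨κ', hκ', e2⟩ := hK x
    rw [e, ← e1, ← e2, Mult.mul_of, Mult.of_mul]
    exact add_mem (Mult.mem_ideal.2 ⟨_, hf x hx κ hκ, rfl⟩)
      (Mult.mem_ideal.2 ⟨_, hg y hy κ' hκ', rfl⟩)
  · have e : f x - g x - (f (x * y) - g (x * y)) = f (x - x * y) - g (x - x * y) := by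
      simp only [map_sub]; abel
    rw [e]
    have h1 := NonUnitalStarAlgHom.norm_apply_le f (x - x * y)
    have h2 := NonUnitalStarAlgHom.norm_apply_le g (x - x * y)
    linarith [norm_sub_le (f (x - x * y)) (g (x - x * y))]

end MultIdeal

end

noncomputable section

attribute [local instance] CStarAlgebra.spectralOrder CStarAlgebra.spectralOrderedRing

open Filter Topology

namespace qAlg.IdealEmbedding

variable {D N Y : Type*} [NonUnitalCStarAlgebra D] [NonUnitalCStarAlgebra N]
  [NonUnitalCStarAlgebra Y] {j : D →⋆ₙₐ[ℂ] Y} (hj : IdealEmbedding j) {θ : D →⋆ₙₐ[ℂ] N}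

theorem coe_extend_fst (y : Y) {ρ : hered θ} {k : D} {n : N} (h : (ρ : N) = θ k * n) :
    ((hj.extend nondegenerate_toHered y).fst ρ : N) = θ (hj.act y k) * n := by
  have h1 := (continuous_subtype_val.tendsto _).comp
    (hj.tendsto_extFun nondegenerate_toHered y ρ)
  refine tendsto_nhds_unique h1 ?_
  have : (Subtype.val ∘ fun e => toHered θ (hj.act y e) * ρ) =
      fun e => θ (hj.act y (e * k)) * n := by
    funext e
    change θ (hj.act y e) * (ρ : N) = _
    rw [h, act_mul, map_mul, mul_assoc]
  rw [this]
  exact ((((continuous_cstarHom θ).comp (hj.continuous_act y)).tendsto _).comp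
    (approxUnit.tendsto_mul_right k)).mul_const n

variable {D₂ Y₂ : Type*} [NonUnitalCStarAlgebra D₂] [NonUnitalCStarAlgebra Y₂]

/-- The product of two homomorphisms. -/
def _root_.NonUnitalStarAlgHom.prodHom (f : D →⋆ₙₐ[ℂ] Y) (g : D₂ →⋆ₙₐ[ℂ] Y₂) :
    D × D₂ →⋆ₙₐ[ℂ] Y × Y₂ :=
  (f.comp (NonUnitalStarAlgHom.fst ℂ D D₂)).prod (g.comp (NonUnitalStarAlgHom.snd ℂ D D₂))

variable {j₂ : D₂ →⋆ₙₐ[ℂ] Y₂} (hj₂ : IdealEmbedding j₂)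

include hj hj₂ in
theorem prodMap : IdealEmbedding (j.prodHom j₂) where
  injective p p' h := Prod.ext (hj.injective (congrArg Prod.fst h))
    (hj₂.injective (congrArg Prod.snd h))
  mul_left m e := ⟨(hj.act m.1 e.1, hj₂.act m.2 e.2), Prod.ext (hj.apply_act _ _)
    (hj₂.apply_act _ _)⟩
  mul_right m e := by
    obtain ⟨a, ha⟩ := hj.mul_right m.1 e.1
    obtain ⟨b, hb⟩ := hj₂.mul_right m.2 e.2
    exact ⟨(a, b), Prod.ext ha hb⟩

theorem prodMap_act (y : Y × Y₂) (k : D × D₂) :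
    (hj.prodMap hj₂).act y k = (hj.act y.1 k.1, hj₂.act y.2 k.2) :=
  (hj.prodMap hj₂).injective (by
    rw [apply_act]
    exact Prod.ext (hj.apply_act _ _).symm (hj₂.apply_act _ _).symm)

end qAlg.IdealEmbedding

/-! ### The matrix algebra in which `q(qA)` absorbs `qA` -/

namespace Doubling

open Stab qAlg

variable (A : Type u) [NonUnitalCStarAlgebra A]

/-- The homomorphism `(z, z') ↦ diag(η z, η̄ z')`, with `η, η̄ : qA → Q(qA)`. -/
def theta : qAlg A × qAlg A →⋆ₙₐ[ℂ] Stab (QAlg (qAlg A)) :=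
  blockSum ((corner _).comp ((QAlg.ι (qAlg A)).comp (NonUnitalStarAlgHom.fst ℂ _ _)))
    ((corner _).comp ((QAlg.ιbar (qAlg A)).comp (NonUnitalStarAlgHom.snd ℂ _ _)))

theorem theta_apply (k : qAlg A × qAlg A) : theta A k =
    single 0 0 (QAlg.ι (qAlg A) k.1) + single 1 1 (QAlg.ιbar (qAlg A) k.2) := by
  change spread 0 (corner _ (QAlg.ι (qAlg A) k.1)) + spread 1 (corner _ (QAlg.ιbar (qAlg A) k.2)) = _
  rw [spread_eq_reindex, spread_eq_reindex, corner_apply, corner_apply, reindex_single,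
    reindex_single]
  rfl

/-- The hereditary subalgebra generated by `diag(η z, η̄ z')`. -/
def Her : Type u := hered (theta A)

instance : NonUnitalCStarAlgebra (Her A) :=
  inferInstanceAs (NonUnitalCStarAlgebra (hered (theta A)))

/-- The inclusion of the hereditary subalgebra. -/
def Her.val : Her A →⋆ₙₐ[ℂ] Stab (QAlg (qAlg A)) :=
  NonUnitalStarSubalgebraClass.subtype (hered (theta A))

/-- The homomorphism `diag(η z, η̄ z')` with values in the hereditary subalgebra. -/
def thetaR : qAlg A × qAlg A →⋆ₙₐ[ℂ] Her A := toHered (theta A)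

theorem nondegenerate_thetaR : Nondegenerate (thetaR A) :=
  nondegenerate_toHered (θ := theta A)

/-- The homomorphism that identifies the two copies of `qA` in `Q(qA)`. -/
def tauR : Her A →⋆ₙₐ[ℂ] Stab (qAlg A) := (Stab.map (QAlg.fold (qAlg A))).comp (Her.val A)

variable {A}

theorem Her.val_injective : Function.Injective (Her.val A) := Subtype.val_injective

theorem Her.exists_val_eq {n n' x : Stab (QAlg (qAlg A))} {k k' : qAlg A × qAlg A}
    (h : x = theta A k * n) (h' : x = n' * theta A k') : ∃ r : Her A, Her.val A r = x :=
  ⟨⟨x, mem_hered_of_mul h h'⟩, rfl⟩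

theorem Her.val_thetaR (k : qAlg A × qAlg A) : Her.val A (thetaR A k) = theta A k := rfl

theorem tauR_apply (r : Her A) : tauR A r = Stab.map (QAlg.fold (qAlg A)) (Her.val A r) := rfl

theorem tauR_thetaR (k : qAlg A × qAlg A) :
    tauR A (thetaR A k) = single 0 0 k.1 + single 1 1 k.2 := by
  rw [tauR_apply, Her.val_thetaR, theta_apply, map_add, map_single, map_single, QAlg.fold_ι,
    QAlg.fold_ιbar]

variable (A) in
/-- The kernel of the identification of the two copies of `qA`. -/
def kerTau : TwoSidedIdeal (Her A) := TwoSidedIdeal.ker (tauR A)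

theorem mem_kerTau {r : Her A} : r ∈ kerTau A ↔ tauR A r = 0 := TwoSidedIdeal.mem_ker _

variable (A) in
theorem isClosed_kerTau : IsClosed (kerTau A : Set (Her A)) := by
  have : (kerTau A : Set (Her A)) = {r | tauR A r = 0} := Set.ext fun _ => mem_kerTau
  rw [this]
  exact isClosed_eq (continuous_cstarHom _) continuous_const

theorem exists_tauR_eq (x : Her A) {e : qAlg A × qAlg A} (he : ‖e‖ ≤ 1) :
    ∃ y : Her A, tauR A y = tauR A (thetaR A e * x * thetaR A e) ∧ ‖y‖ ≤ ‖tauR A x‖ := by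
  obtain ⟨y, hy⟩ := Her.exists_val_eq
    (x := theta A e * Stab.map (QAlg.ι (qAlg A)) (tauR A x) * theta A e) (mul_assoc _ _ _) rfl
  refine ⟨y, ?_, ?_⟩
  · have : Stab.map (QAlg.fold (qAlg A)) (Stab.map (QAlg.ι (qAlg A)) (tauR A x)) = tauR A x := by
      rw [Stab.map_map]
      have : (QAlg.fold (qAlg A)).comp (QAlg.ι (qAlg A)) = NonUnitalStarAlgHom.id ℂ _ :=
        NonUnitalStarAlgHom.ext fun z => QAlg.fold_ι z
      rw [this]
      exact DFunLike.congr_fun (hom_ext (f := Stab.map (NonUnitalStarAlgHom.id ℂ (qAlg A)))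
        (g := NonUnitalStarAlgHom.id ℂ _) fun i j b => by rw [map_single]; rfl) _
    rw [tauR_apply, hy, map_mul, map_mul, this, map_mul, map_mul]
    rfl
  · rw [← NonUnitalStarAlgHom.norm_map (Her.val A) Her.val_injective, hy]
    have h5 : ‖theta A e‖ ≤ 1 := (NonUnitalStarAlgHom.norm_apply_le _ _).trans he
    have h6 := NonUnitalStarAlgHom.norm_apply_le (Stab.map (QAlg.ι (qAlg A))) (tauR A x)
    exact (norm_mul_le _ _).trans ((mul_le_of_le_one_right (norm_nonneg _) h5).trans
      ((norm_mul_le _ _).trans ((mul_le_of_le_one_left (norm_nonneg _) h5).trans h6)))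

/-- The quotient norm. -/
theorem exists_kerTau_norm_sub_le (x : Her A) {ε : ℝ} (hε : 0 < ε) :
    ∃ j ∈ kerTau A, ‖x - j‖ ≤ ‖tauR A x‖ + ε := by
  have h1 := Metric.tendsto_nhds.1 (nondegenerate_thetaR A x) (ε / 2) (half_pos hε)
  have h2 := Metric.tendsto_nhds.1 (nondegenerate_thetaR A (star x)) (ε / 2) (half_pos hε)
  obtain ⟨e, h1, h2, h3, h4⟩ := (h1.and (h2.and ((approxUnit.eventually_norm _).and
    (approxUnit.eventually_isSelfAdjoint _)))).exists
  obtain ⟨y, hy, hyn⟩ := exists_tauR_eq x h3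
  set t := thetaR A e with ht
  have hts : star t = t := by rw [ht, ← map_star, h4.star_eq]
  have htn : ‖t‖ ≤ 1 := (NonUnitalStarAlgHom.norm_apply_le _ _).trans h3
  refine ⟨t * x * t - y, ?_, ?_⟩
  · rw [mem_kerTau, map_sub, hy, sub_self]
  · have e1 : x - (t * x * t - y) = -(t * x - x) + -(t * (star (t * star x - star x))) + y := by
      rw [star_sub, star_mul, star_star, hts]; noncomm_ring
    rw [e1]
    refine norm_add₃_le.trans ?_
    rw [norm_neg, norm_neg]
    rw [dist_eq_norm] at h1 h2
    have h7 : ‖t * star (t * star x - star x)‖ ≤ ‖t * star x - star x‖ :=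
      (norm_mul_le _ _).trans ((mul_le_of_le_one_left (norm_nonneg _) htn).trans_eq (norm_star _))
    linarith

theorem exists_mem_ideal_norm_sub_le (x : Her A) {C ε : ℝ} (hε : 0 < ε) (hx : ‖tauR A x‖ ≤ C) :
    ∃ j ∈ Mult.ideal (kerTau A) (isClosed_kerTau A), ‖Mult.of (Her A) x - j‖ ≤ C + ε := by
  obtain ⟨j, hj, h⟩ := exists_kerTau_norm_sub_le x hε
  refine ⟨_, Mult.mem_ideal.2 ⟨j, hj, rfl⟩, ?_⟩
  rw [← map_sub, Mult.norm_of]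
  linarith

/-- The self-adjoint matrix with the entries `i b` and `-i b` off the diagonal. -/
def skew (b : qAlg A) : Stab (qAlg A) := Complex.I • single 0 1 b - Complex.I • single 1 0 b

theorem _root_.Stab.single_sub {B : Type u} [NonUnitalCStarAlgebra B] (i j : ℕ) (b c : B) :
    single i j (b - c) = single i j b - single i j c := by
  rw [eq_sub_iff_add_eq, ← single_add, sub_add_cancel]

theorem skew_sub (b c : qAlg A) : skew (b - c) = skew b - skew c := by
  simp only [skew, single_sub, smul_sub]; abel

theorem norm_smul_I_single_sub_le (b c : qAlg A) :
    ‖Complex.I • single 0 1 b - Complex.I • single 1 0 c‖ ≤ ‖b‖ + ‖c‖ := by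
  refine (norm_sub_le _ _).trans (add_le_add ?_ ?_) <;>
  · rw [norm_smul, Complex.norm_I, one_mul]; exact norm_single_le _ _ _

theorem norm_skew_le (b : qAlg A) : ‖skew b‖ ≤ 2 * ‖b‖ :=
  (norm_smul_I_single_sub_le b b).trans_eq (by ring)

theorem star_skew (b : qAlg A) : star (skew b) = skew (star b) := by
  simp only [skew, star_sub, star_smul, star_single, Complex.star_def, Complex.conj_I, neg_smul]
  abel

theorem skew_mul (b : qAlg A) (k : qAlg A × qAlg A) : skew b * tauR A (thetaR A k) =
    Complex.I • single 0 1 (b * k.2) - Complex.I • single 1 0 (b * k.1) := by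
  rw [tauR_thetaR, skew]
  simp only [sub_mul, mul_add, smul_mul_assoc, single_mul_single,
    single_mul_single_of_ne (show (1 : ℕ) ≠ 0 by decide),
    single_mul_single_of_ne (show (0 : ℕ) ≠ 1 by decide), smul_zero]
  abel

/-- The factor of `approxSymm`. -/
def offDiag (e : qAlg A) : Stab (QAlg (qAlg A)) :=
  Complex.I • single 0 1 (QAlg.ιbar (qAlg A) (star e)) -
    Complex.I • single 1 0 (QAlg.ι (qAlg A) (star e))

theorem theta_mul_offDiag (k : qAlg A × qAlg A) (e : qAlg A) : theta A k * offDiag e =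
    Complex.I • single 0 1 (QAlg.ι (qAlg A) k.1 * QAlg.ιbar (qAlg A) (star e)) -
    Complex.I • single 1 0 (QAlg.ιbar (qAlg A) k.2 * QAlg.ι (qAlg A) (star e)) := by
  rw [theta_apply, offDiag]
  simp only [mul_sub, add_mul, mul_smul_comm, single_mul_single,
    single_mul_single_of_ne (show (1 : ℕ) ≠ 0 by decide),
    single_mul_single_of_ne (show (0 : ℕ) ≠ 1 by decide), zero_add, add_zero]

theorem isSelfAdjoint_theta_mul_offDiag (e : qAlg A) :
    IsSelfAdjoint (theta A (e, e) * offDiag e) := by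
  rw [IsSelfAdjoint, theta_mul_offDiag]
  simp only [star_sub, star_smul, star_single, star_mul, map_star, star_star, Complex.star_def,
    Complex.conj_I, neg_smul]
  abel

theorem exists_val_eq_theta_mul_offDiag (e : qAlg A) :
    ∃ r : Her A, Her.val A r = theta A (e, e) * offDiag e :=
  Her.exists_val_eq rfl ((isSelfAdjoint_theta_mul_offDiag e).star_eq.symm.trans (by
    rw [star_mul, ← map_star]))

/-- An approximation of the symmetry with the entries `i` and `-i` off the diagonal. -/
def approxSymm (e : qAlg A) : Her A := (exists_val_eq_theta_mul_offDiag e).choose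

theorem val_approxSymm (e : qAlg A) : Her.val A (approxSymm e) = theta A (e, e) * offDiag e :=
  (exists_val_eq_theta_mul_offDiag e).choose_spec

theorem isSelfAdjoint_approxSymm (e : qAlg A) : IsSelfAdjoint (approxSymm e) :=
  Her.val_injective (by
    rw [map_star, val_approxSymm]; exact isSelfAdjoint_theta_mul_offDiag e)

theorem norm_approxSymm_le {e : qAlg A} (he : ‖e‖ ≤ 1) : ‖approxSymm e‖ ≤ 2 := by
  rw [← NonUnitalStarAlgHom.norm_map (Her.val A) Her.val_injective, val_approxSymm]
  have h1 : ‖theta A (e, e)‖ ≤ 1 :=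
    (NonUnitalStarAlgHom.norm_apply_le _ _).trans (by rw [Prod.norm_mk, max_self]; exact he)
  have hs : ‖star e‖ ≤ 1 := (norm_star e).trans_le he
  have h2 : ‖offDiag e‖ ≤ 2 := by
    refine (norm_sub_le _ _).trans ?_
    rw [norm_smul, norm_smul, Complex.norm_I, one_mul, one_mul]
    have := (norm_single_le 0 1 _).trans
      (NonUnitalStarAlgHom.norm_apply_le (QAlg.ιbar (qAlg A)) (star e))
    have := (norm_single_le 1 0 _).trans
      (NonUnitalStarAlgHom.norm_apply_le (QAlg.ι (qAlg A)) (star e))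
    linarith
  exact (norm_mul_le _ _).trans ((mul_le_of_le_one_left (norm_nonneg _) h1).trans h2)

theorem map_fold_theta_mul_offDiag (k e : qAlg A) :
    Stab.map (QAlg.fold (qAlg A)) (theta A (k, k) * offDiag e) = skew (k * star e) := by
  rw [theta_mul_offDiag, skew]
  simp only [map_sub, map_smul, map_single, map_mul, QAlg.fold_ι, QAlg.fold_ιbar]

theorem tauR_approxSymm (e : qAlg A) : tauR A (approxSymm e) = skew (e * star e) := by
  rw [tauR_apply, val_approxSymm, map_fold_theta_mul_offDiag]

variable (A) in
theorem idealEmbedding_incl_prod : IdealEmbedding ((incl A).prodHom (incl A)) :=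
  IdealEmbedding.incl.prodMap IdealEmbedding.incl

variable (A) in
/-- The extension of `theta` to multipliers. -/
def thetaExt : QAlg A × QAlg A →⋆ₙₐ[ℂ] Mult (Her A) :=
  (idealEmbedding_incl_prod A).extend (nondegenerate_thetaR A)

theorem thetaExt_incl (k : qAlg A × qAlg A) :
    thetaExt A (incl A k.1, incl A k.2) = Mult.of (Her A) (thetaR A k) :=
  (idealEmbedding_incl_prod A).extend_apply (nondegenerate_thetaR A) k

theorem prod_act (y : QAlg A × QAlg A) (k : qAlg A × qAlg A) :
    (idealEmbedding_incl_prod A).act y k =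
      (IdealEmbedding.incl.act y.1 k.1, IdealEmbedding.incl.act y.2 k.2) :=
  IdealEmbedding.prodMap_act _ _ _ _

theorem thetaExt_fst_mul (y : QAlg A × QAlg A) (k : qAlg A × qAlg A) (r : Her A) :
    (thetaExt A y).fst (thetaR A k * r) =
      thetaR A (IdealEmbedding.incl.act y.1 k.1, IdealEmbedding.incl.act y.2 k.2) * r := by
  rw [← prod_act]
  exact (idealEmbedding_incl_prod A).extend_fst_mul (nondegenerate_thetaR A) y k r

theorem val_thetaExt_fst (y : QAlg A × QAlg A) {r : Her A} {k : qAlg A × qAlg A}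
    {n : Stab (QAlg (qAlg A))} (h : Her.val A r = theta A k * n) :
    Her.val A ((thetaExt A y).fst r) =
      theta A (IdealEmbedding.incl.act y.1 k.1, IdealEmbedding.incl.act y.2 k.2) * n := by
  rw [← prod_act]
  exact (idealEmbedding_incl_prod A).coe_extend_fst (θ := theta A) y (ρ := r) h

theorem tauR_thetaExt_approxSymm (y : QAlg A) (e : qAlg A) :
    tauR A ((thetaExt A (y, y)).fst (approxSymm e)) =
      skew (IdealEmbedding.incl.act y e * star e) := by
  rw [← map_fold_theta_mul_offDiag, tauR_apply, val_thetaExt_fst _ (val_approxSymm e)]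

/-- The commutator of an approximate symmetry with an element of the diagonal copy of `QA`. -/
theorem norm_tauR_commutator_le (y : QAlg A) {e : qAlg A} (he : IsSelfAdjoint e) (he1 : ‖e‖ ≤ 1) :
    ‖tauR A ((thetaExt A (y, y)).snd (approxSymm e) - (thetaExt A (y, y)).fst (approxSymm e))‖ ≤
      4 * ‖incl A e * y - y * incl A e‖ := by
  have h1 : (thetaExt A (y, y)).snd (approxSymm e) =
      star ((thetaExt A (star y, star y)).fst (approxSymm e)) := by
    have : thetaExt A (star y, star y) = star (thetaExt A (y, y)) := map_star (thetaExt A) (y, y)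
    rw [this, DoubleCentralizer.star_fst, star_star, (isSelfAdjoint_approxSymm e).star_eq]
  rw [map_sub, h1, map_star, tauR_thetaExt_approxSymm, tauR_thetaExt_approxSymm, star_skew,
    ← skew_sub]
  refine (norm_skew_le _).trans ?_
  have h2 : ‖star (IdealEmbedding.incl.act (star y) e * star e) -
      IdealEmbedding.incl.act y e * star e‖ ≤ 2 * ‖incl A e * y - y * incl A e‖ := by
    rw [← NonUnitalStarAlgHom.norm_map (incl A) incl_injective]
    set f := incl A e with hf
    have hfs : star f = f := by rw [hf, ← map_star, he.star_eq]
    have hf1 : ‖f‖ ≤ 1 := (NonUnitalStarAlgHom.norm_apply_le _ _).trans he1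
    have e1 : incl A (star (IdealEmbedding.incl.act (star y) e * star e) -
        IdealEmbedding.incl.act y e * star e) = f * (f * y - y * f) + (f * y - y * f) * f := by
      rw [map_sub, map_star, map_mul, map_mul, IdealEmbedding.apply_act, IdealEmbedding.apply_act,
        he.star_eq, ← hf, star_mul, star_mul, star_star, hfs]
      noncomm_ring
    rw [e1]
    refine (norm_add_le _ _).trans ?_
    have := (norm_mul_le f (f * y - y * f)).trans (mul_le_of_le_one_left (norm_nonneg _) hf1)
    have := (norm_mul_le (f * y - y * f) f).trans (mul_le_of_le_one_right (norm_nonneg _) hf1)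
    linarith
  linarith

end Doubling

end

noncomputable section

attribute [local instance] CStarAlgebra.spectralOrder CStarAlgebra.spectralOrderedRing

open Filter Topology

theorem isClosed_cauchySeq_mul {R : Type*} [NonUnitalCStarAlgebra R] {ρ : ℕ → R} {C : ℝ}
    (hρ : ∀ n, ‖ρ n‖ ≤ C) : IsClosed {r : R | CauchySeq fun n => ρ n * r} := by
  rw [← closure_subset_iff_isClosed]
  intro r hr
  have hC : 0 ≤ C := (norm_nonneg _).trans (hρ 0)
  refine Metric.cauchySeq_iff'.2 fun ε hε => ?_
  obtain ⟨s, hs, hrs⟩ := Metric.mem_closure_iff.1 hr (ε / (4 * (C + 1))) (by positivity)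
  rw [lt_div_iff₀ (by positivity), dist_eq_norm] at hrs
  obtain ⟨N, hN⟩ := Metric.cauchySeq_iff'.1 hs (ε / 2) (by positivity)
  refine ⟨N, fun n hn => ?_⟩
  have h1 := hN n hn
  have key : ∀ n, dist (ρ n * r) (ρ n * s) ≤ ε / 4 := fun n => by
    rw [dist_eq_norm, ← mul_sub]
    refine (norm_mul_le _ _).trans ?_
    nlinarith [hρ n, norm_nonneg (r - s), mul_le_mul_of_nonneg_right (hρ n) (norm_nonneg (r - s))]
  have := dist_triangle4 (ρ n * r) (ρ n * s) (ρ N * s) (ρ N * r)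
  have h2 := key n
  have h3 := key N
  rw [dist_comm] at h3
  linarith

theorem norm_sq_mul_sub_le {B : Type*} [NonUnitalCStarAlgebra B] {e z : B} {ε : ℝ} (he : ‖e‖ ≤ 1)
    (h : ‖e * z - z‖ ≤ ε) : ‖e * e * z - z‖ ≤ 2 * ε := by
  have e1 : e * e * z - z = e * (e * z - z) + (e * z - z) := by noncomm_ring
  rw [e1]
  refine (norm_add_le _ _).trans ?_
  have := (norm_mul_le e (e * z - z)).trans (mul_le_of_le_one_left (norm_nonneg _) he)
  linarith

namespace Doubling

open Stab qAlg TopologicalSpace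

variable {A : Type u} [NonUnitalCStarAlgebra A]

theorem exists_quasicentral_seq (z : ℕ → qAlg A × qAlg A) (y : ℕ → QAlg A) :
    ∃ e : ℕ → qAlg A, ∀ n, IsSelfAdjoint (e n) ∧ ‖e n‖ ≤ 1 ∧
      (∀ k ≤ n, ‖e n * (z k).1 - (z k).1‖ ≤ (1 / 2) ^ n ∧ ‖e n * (z k).2 - (z k).2‖ ≤ (1 / 2) ^ n) ∧
      ∀ k ≤ n, ‖incl A (e n) * y k - y k * incl A (e n)‖ ≤ (1 / 2) ^ n := by
  classical
  have : ∀ n : ℕ, ∃ e : qAlg A, IsSelfAdjoint e ∧ ‖e‖ ≤ 1 ∧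
      (∀ k ≤ n, ‖e * (z k).1 - (z k).1‖ ≤ (1 / 2) ^ n ∧ ‖e * (z k).2 - (z k).2‖ ≤ (1 / 2) ^ n) ∧
      ∀ k ≤ n, ‖incl A e * y k - y k * incl A e‖ ≤ (1 / 2) ^ n := fun n => by
    obtain ⟨f, hf, hf0, hf1, hfG, hfF⟩ := TwoSidedIdeal.exists_quasicentral
      (IdealEmbedding.incl (A := A)).isClosed_range ((Finset.range (n + 1)).image y)
      ((Finset.range (n + 1)).image (fun k => incl A (z k).1) ∪
        (Finset.range (n + 1)).image (fun k => incl A (z k).2))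
      (fun j hj => by
        rw [IdealEmbedding.mem_range]
        rcases Finset.mem_union.1 hj with h | h <;>
        · obtain ⟨k, -, rfl⟩ := Finset.mem_image.1 h
          exact ⟨_, rfl⟩) (show (0 : ℝ) < (1 / 2) ^ n by positivity)
    obtain ⟨e, rfl⟩ := IdealEmbedding.incl.mem_range.1 hf
    have hG : ∀ x : qAlg A, ‖incl A e * incl A x - incl A x‖ < (1 / 2) ^ n →
        ‖e * x - x‖ ≤ (1 / 2) ^ n := fun x hx => by
      rw [← NonUnitalStarAlgHom.norm_map (incl A) incl_injective, map_sub, map_mul]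
      exact hx.le
    have hmem : ∀ k ≤ n, k ∈ Finset.range (n + 1) := fun k hk => by
      rw [Finset.mem_range]; lia
    refine ⟨e, ?_, ?_, fun k hk => ⟨hG _ (hfG _ ?_), hG _ (hfG _ ?_)⟩,
      fun k hk => (hfF _ (Finset.mem_image_of_mem y (hmem k hk))).le⟩
    · apply incl_injective
      rw [map_star]
      exact hf0.isSelfAdjoint.star_eq
    · rwa [← NonUnitalStarAlgHom.norm_map (incl A) incl_injective]
    · exact Finset.mem_union_left _ (Finset.mem_image_of_mem (fun k => incl A (z k).1) (hmem k hk))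
    · exact Finset.mem_union_right _ (Finset.mem_image_of_mem (fun k => incl A (z k).2) (hmem k hk))
  choose e he using this
  exact ⟨e, he⟩

/-- The norm, modulo the kernel, of the difference of two approximate symmetries. -/
theorem norm_tauR_sub_mul_le {e e' : qAlg A} (he : IsSelfAdjoint e) (he' : IsSelfAdjoint e')
    (he1 : ‖e‖ ≤ 1) (he1' : ‖e'‖ ≤ 1) {k : qAlg A × qAlg A} {ε : ℝ}
    (h : ‖e * k.1 - k.1‖ ≤ ε ∧ ‖e * k.2 - k.2‖ ≤ ε)
    (h' : ‖e' * k.1 - k.1‖ ≤ ε ∧ ‖e' * k.2 - k.2‖ ≤ ε) :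
    ‖tauR A ((approxSymm e' - approxSymm e) * thetaR A k)‖ ≤ 8 * ε := by
  rw [map_mul, map_sub, tauR_approxSymm, tauR_approxSymm, ← skew_sub, skew_mul, he.star_eq,
    he'.star_eq]
  refine (norm_smul_I_single_sub_le _ _).trans ?_
  have key : ∀ z : qAlg A, ‖e * z - z‖ ≤ ε → ‖e' * z - z‖ ≤ ε →
      ‖(e' * e' - e * e) * z‖ ≤ 4 * ε := fun z h1 h2 => by
    have e1 : (e' * e' - e * e) * z = (e' * e' * z - z) - (e * e * z - z) := by noncomm_ring
    rw [e1]
    have := norm_sq_mul_sub_le he1 h1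
    have := norm_sq_mul_sub_le he1' h2
    have := norm_sub_le (e' * e' * z - z) (e * e * z - z)
    linarith
  linarith [key k.1 h.1 h'.1, key k.2 h.2 h'.2]

variable (A) in
/-- The diagonal copy of `A` (by `ῑ`) in the multipliers. -/
def delta : A →⋆ₙₐ[ℂ] Mult (Her A) := (thetaExt A).comp ((QAlg.ιbar A).prod (QAlg.ιbar A))

theorem delta_apply (x : A) : delta A x = thetaExt A (QAlg.ιbar A x, QAlg.ιbar A x) := rfl

variable (A) in
/-- The ideal of the multipliers given by the kernel of the identification. -/
def kerIdeal : TwoSidedIdeal (Mult (Her A)) := Mult.ideal (kerTau A) (isClosed_kerTau A)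

variable (A) in
theorem isClosed_kerIdeal : IsClosed (kerIdeal A : Set (Mult (Her A))) := Mult.isClosed_ideal _ _

theorem exists_kerIdeal_commutator (x : A) {e : qAlg A} (he : IsSelfAdjoint e) (he1 : ‖e‖ ≤ 1)
    {ε : ℝ} (hε : 0 < ε) (h : ‖incl A e * QAlg.ιbar A x - QAlg.ιbar A x * incl A e‖ ≤ ε) :
    ∃ j ∈ kerIdeal A, ‖Mult.of (Her A) (approxSymm e) * delta A x -
      delta A x * Mult.of (Her A) (approxSymm e) - j‖ ≤ 5 * ε := by
  obtain ⟨j, hj, h1⟩ := exists_mem_ideal_norm_sub_le (A := A) _ hε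
    (norm_tauR_commutator_le (QAlg.ιbar A x) he he1)
  refine ⟨j, hj, ?_⟩
  rw [map_sub, ← Mult.mul_of, ← Mult.of_mul, ← delta_apply] at h1
  linarith

variable [SeparableSpace A]

theorem exists_sequence : ∃ (z : ℕ → qAlg A × qAlg A) (e : ℕ → qAlg A) (ρ : ℕ → Her A),
    DenseRange z ∧ (∀ n, IsSelfAdjoint (e n)) ∧
    (∀ k, Tendsto (fun n => e n * e n * (z k).1) atTop (𝓝 (z k).1) ∧
      Tendsto (fun n => e n * e n * (z k).2) atTop (𝓝 (z k).2)) ∧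
    (∀ n, IsSelfAdjoint (ρ n)) ∧ (∃ C, ∀ n, ‖ρ n‖ ≤ C) ∧
    (∀ n, tauR A (ρ n) = tauR A (approxSymm (e n))) ∧
    (∀ k, CauchySeq fun n => ρ n * thetaR A (z k)) ∧
    ∃ x : ℕ → A, DenseRange x ∧ ∀ k, ∃ l ∈ kerIdeal A,
      Tendsto (fun n => Mult.of _ (ρ n) * delta A (x k) - delta A (x k) * Mult.of _ (ρ n))
        atTop (𝓝 l) := by
  classical
  have : SecondCountableTopology (qAlg A) := UniformSpace.secondCountable_of_separable _
  set z := denseSeq (qAlg A × qAlg A)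
  set x := denseSeq A
  obtain ⟨e, he⟩ := exists_quasicentral_seq z fun k => QAlg.ιbar A (x k)
  choose hes he1 hez hex using he
  set w : ℕ → Mult (Her A) := fun n => Mult.of _ (approxSymm (e n)) with hw
  let S : ℕ → Finset (Mult (Her A) × Mult (Her A)) := fun n =>
    (Finset.range (n + 1)).image (fun k => (Mult.of _ (thetaR A (z k)), 0)) ∪
      (Finset.range (n + 1)).image (fun k => (delta A (x k), delta A (x k)))
  have hS : Monotone S := fun n m hnm => by
    have := Finset.range_mono (Nat.succ_le_succ hnm)
    exact Finset.union_subset_union (Finset.image_subset_image this)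
      (Finset.image_subset_image this)
  have hpow : ∀ n : ℕ, (0 : ℝ) < (1 / 2) ^ n := fun n => by positivity
  have hpow' : ∀ n : ℕ, ((1 / 2) ^ (n + 1) : ℝ) ≤ (1 / 2) ^ n := fun n =>
    pow_le_pow_of_le_one (by norm_num) (by norm_num) (Nat.le_succ n)
  have hwS : ∀ n, ∀ p ∈ S n, ∃ j ∈ kerIdeal A,
      ‖(w (n + 1) - w n) * p.1 - p.2 * (w (n + 1) - w n) - j‖ ≤ 10 * (1 / 2) ^ n := by
    intro n p hp
    rcases Finset.mem_union.1 hp with h | h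
    · obtain ⟨k, hk, rfl⟩ := Finset.mem_image.1 h
      have hk' : k ≤ n := by rw [Finset.mem_range] at hk; lia
      obtain ⟨j, hj, h1⟩ := exists_mem_ideal_norm_sub_le _ (hpow n)
        (norm_tauR_sub_mul_le (hes n) (hes (n + 1)) (he1 n) (he1 (n + 1)) (hez n k hk')
          ⟨(hez (n + 1) k (by lia)).1.trans (hpow' n), (hez (n + 1) k (by lia)).2.trans (hpow' n)⟩)
      refine ⟨j, hj, ?_⟩
      rw [map_mul, map_sub] at h1
      simp only [zero_mul, sub_zero]
      linarith [hpow n]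
    · obtain ⟨k, hk, rfl⟩ := Finset.mem_image.1 h
      have hk' : k ≤ n := by rw [Finset.mem_range] at hk; lia
      obtain ⟨j, hj, h1⟩ := exists_kerIdeal_commutator (x k) (hes n) (he1 n) (hpow n) (hex n k hk')
      obtain ⟨j', hj', h2⟩ := exists_kerIdeal_commutator (x k) (hes (n + 1)) (he1 (n + 1)) (hpow n)
        ((hex (n + 1) k (by lia)).trans (hpow' n))
      refine ⟨j' - j, (kerIdeal A).sub_mem hj' hj, ?_⟩
      have e1 : (w (n + 1) - w n) * delta A (x k) - delta A (x k) * (w (n + 1) - w n) - (j' - j) =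
          (w (n + 1) * delta A (x k) - delta A (x k) * w (n + 1) - j') -
            (w n * delta A (x k) - delta A (x k) * w n - j) := by
        simp only [sub_mul, mul_sub]; abel
      rw [e1]
      refine (norm_sub_le _ _).trans ?_
      linarith
  obtain ⟨h, hsa, ⟨C, hC⟩, hhw, hcau⟩ := TwoSidedIdeal.exists_corrections (isClosed_kerIdeal A) w
    (fun n => by
      rw [IsSelfAdjoint, hw, ← map_star, (isSelfAdjoint_approxSymm _).star_eq])
    (fun n => (Mult.norm_of _).trans_le (norm_approxSymm_le (he1 n))) S hS hwS
  have hρ : ∀ n, ∃ r : Her A, Mult.of _ r = h n ∧ tauR A r = tauR A (approxSymm (e n)) := by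
    intro n
    obtain ⟨j, hj, h1⟩ := Mult.mem_ideal.1 (hhw n)
    refine ⟨j + approxSymm (e n), by rw [map_add, h1]; exact sub_add_cancel _ _, ?_⟩
    rw [map_add, mem_kerTau.1 hj, zero_add]
  choose ρ hρ hρt using hρ
  have hmem : ∀ k : ℕ, k ∈ Finset.range (k + 1) := fun k => Finset.self_mem_range_succ k
  refine ⟨z, e, ρ, denseRange_denseSeq _, hes, fun k => ?_, fun n => ?_, ⟨C, fun n => ?_⟩, hρt,
    fun k => ?_, x, denseRange_denseSeq _, fun k => ?_⟩
  · have hlim : Tendsto (fun n : ℕ => 2 * (1 / 2 : ℝ) ^ n) atTop (𝓝 0) := by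
      simpa using (tendsto_pow_atTop_nhds_zero_of_lt_one (by norm_num : (0 : ℝ) ≤ 1 / 2)
        (by norm_num)).const_mul 2
    constructor
    · refine tendsto_iff_norm_sub_tendsto_zero.2 (squeeze_zero' (.of_forall fun n => norm_nonneg _)
        ?_ hlim)
      filter_upwards [eventually_ge_atTop k] with n hn
      exact norm_sq_mul_sub_le (he1 n) (hez n k hn).1
    · refine tendsto_iff_norm_sub_tendsto_zero.2 (squeeze_zero' (.of_forall fun n => norm_nonneg _)
        ?_ hlim)
      filter_upwards [eventually_ge_atTop k] with n hn
      exact norm_sq_mul_sub_le (he1 n) (hez n k hn).2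
  · apply Mult.of_injective
    rw [map_star, hρ, (hsa n).star_eq]
  · rw [← Mult.norm_of, hρ]; exact hC n
  · have := hcau k _ (Finset.mem_union_left _ (Finset.mem_image_of_mem
      (fun k => (Mult.of _ (thetaR A (z k)), (0 : Mult (Her A)))) (hmem k)))
    simp only [zero_mul, sub_zero, ← hρ, ← map_mul] at this
    exact (isometry_cstarHom Mult.of_injective).isUniformInducing.cauchy_map_iff.1 this
  · have := hcau k _ (Finset.mem_union_right _ (Finset.mem_image_of_mem
      (fun k => (delta A (x k), delta A (x k))) (hmem k)))
    simp only [← hρ] at this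
    obtain ⟨l, hl⟩ := cauchySeq_tendsto_of_complete this
    refine ⟨l, TwoSidedIdeal.mem_of_forall_norm_sub_lt (isClosed_kerIdeal A) fun ε hε => ?_, hl⟩
    have hlim : Tendsto (fun n : ℕ => 5 * (1 / 2 : ℝ) ^ n) atTop (𝓝 0) := by
      simpa using (tendsto_pow_atTop_nhds_zero_of_lt_one (by norm_num : (0 : ℝ) ≤ 1 / 2)
        (by norm_num)).const_mul 5
    obtain ⟨n, h1, h2, h3⟩ := ((Metric.tendsto_nhds.1 hl (ε / 2) (half_pos hε)).and
      ((hlim.eventually (gt_mem_nhds (half_pos hε))).and (eventually_ge_atTop k))).exists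
    obtain ⟨j, hj, h4⟩ := exists_kerIdeal_commutator (x k) (hes n) (he1 n) (hpow n) (hex n k h3)
    have hd : h n - w n ∈ kerIdeal A := hhw n
    refine ⟨j + ((h n - w n) * delta A (x k) - delta A (x k) * (h n - w n)),
      (kerIdeal A).add_mem hj ((kerIdeal A).sub_mem ((kerIdeal A).mul_mem_right _ _ hd)
        ((kerIdeal A).mul_mem_left _ _ hd)), ?_⟩
    rw [dist_eq_norm, norm_sub_rev, hρ] at h1
    have e1 : l - (j + ((h n - w n) * delta A (x k) - delta A (x k) * (h n - w n))) =
        (l - (h n * delta A (x k) - delta A (x k) * h n)) +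
          (w n * delta A (x k) - delta A (x k) * w n - j) := by
      simp only [sub_mul, mul_sub]; abel
    rw [e1]
    refine (norm_add_le _ _).trans_lt ?_
    have h5 : ‖w n * delta A (x k) - delta A (x k) * w n - j‖ ≤ 5 * (1 / 2) ^ n := h4
    linarith

end Doubling

end

noncomputable section

attribute [local instance] CStarAlgebra.spectralOrder CStarAlgebra.spectralOrderedRing

open Filter Topology

theorem Mult.continuous_fst {E : Type*} [NonUnitalCStarAlgebra E] (r : E) :
    Continuous fun m : Mult E => m.fst r := by
  rw [(isometry_cstarHom (Mult.of_injective (E := E))).isEmbedding.continuous_iff]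
  have : Mult.of E ∘ (fun m : Mult E => m.fst r) = fun m => m * Mult.of E r :=
    funext fun m => (Mult.mul_of m r).symm
  rw [this]
  exact continuous_id.mul continuous_const

theorem Stab.quarterTurn_fst {B : Type u} [NonUnitalCStarAlgebra B] (b c : B) :
    (quarterTurn : Mult (Stab B)).fst (single 0 0 b + single 1 1 c) =
      single 1 0 b - single 0 1 c := by
  have h0 : single 0 0 b = (isom (parity 0) : Mult (Stab B)).fst (single 0 0 b) := by
    rw [isom_fst_single]; rfl
  have h1 : single 1 1 c = (isom (parity 1) : Mult (Stab B)).fst (single 0 1 c) := by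
    rw [isom_fst_single]; rfl
  have e0 : (quarterTurn : Mult (Stab B)).fst (single 0 0 b) = single 1 0 b := by
    rw [h0]
    change ((quarterTurn : Mult (Stab B)) * isom (parity 0)).fst _ = _
    rw [quarterTurn_mul_zero, isom_fst_single]; rfl
  have e1 : (quarterTurn : Mult (Stab B)).fst (single 1 1 c) = -single 0 1 c := by
    rw [h1]
    change ((quarterTurn : Mult (Stab B)) * isom (parity 1)).fst _ = _
    rw [quarterTurn_mul_one]
    change -((isom (parity 0) : Mult (Stab B)).fst _) = _
    rw [isom_fst_single]; rfl
  rw [map_add, e0, e1, sub_eq_add_neg]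

namespace Doubling

open Stab qAlg TopologicalSpace

variable {A : Type u} [NonUnitalCStarAlgebra A]

theorem tauR_fst_of_forall {h : Mult (Her A)} {W : Mult (Stab (qAlg A))}
    (hW : ∀ k, tauR A (h.fst (thetaR A k)) = W.fst (tauR A (thetaR A k))) (r : Her A) :
    tauR A (h.fst r) = W.fst (tauR A r) := by
  have := continuous_cstarHom (tauR A)
  refine (nondegenerate_thetaR A).induction_on (p := fun r => tauR A (h.fst r) = W.fst (tauR A r))
    (isClosed_eq (by fun_prop) (by fun_prop)) (fun k r => ?_) r
  rw [Mult.fst_mul, map_mul, map_mul, Mult.fst_mul, hW]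

/-- There is a self-adjoint multiplier which lifts the symmetry with the entries `i` and `-i` off
the diagonal and commutes with `A` modulo the kernel. -/
theorem exists_symmetry [SeparableSpace A] : ∃ h : Mult (Her A), IsSelfAdjoint h ∧
    (∀ x, h * delta A x - delta A x * h ∈ kerIdeal A) ∧
    ∀ r, tauR A (h.fst r) = (-Complex.I • (quarterTurn : Mult (Stab (qAlg A)))).fst (tauR A r) := by
  obtain ⟨z, e, ρ, hz, hes, hez, hρs, ⟨C, hC⟩, hρt, hcau, x, hx, hl⟩ := exists_sequence (A := A)
  have hcau' : ∀ r : Her A, CauchySeq fun n => ρ n * r := by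
    refine (nondegenerate_thetaR A).induction_on (isClosed_cauchySeq_mul hC) fun k r => ?_
    refine hz.induction_on (p := fun k => CauchySeq fun n => ρ n * (thetaR A k * r)) k ?_ fun n => ?_
    · exact (isClosed_cauchySeq_mul hC).preimage
        ((continuous_cstarHom (thetaR A)).mul continuous_const)
    · obtain ⟨l, hl⟩ := cauchySeq_tendsto_of_complete (hcau n)
      have := (hl.mul_const r).cauchySeq
      simpa only [mul_assoc] using this
  choose g hg using fun r => cauchySeq_tendsto_of_complete (hcau' r)
  obtain ⟨h, hh, hhg⟩ := Mult.exists_strict_limit ρ hρs g hg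
  have hlim : ∀ r, Tendsto (fun n => ρ n * r) atTop (𝓝 (h.fst r)) := fun r => by
    rw [hhg]; exact hg r
  refine ⟨h, hh, fun y => ?_, tauR_fst_of_forall fun k => ?_⟩
  · have hcont := continuous_cstarHom (delta A)
    refine hx.induction_on (p := fun y => h * delta A y - delta A y * h ∈ kerIdeal A) y
      ((isClosed_kerIdeal A).preimage (by fun_prop)) fun k => ?_
    obtain ⟨l, hlk, hlt⟩ := hl k
    have : h * delta A (x k) - delta A (x k) * h = l := by
      refine Mult.ext_fst fun r => ?_
      refine tendsto_nhds_unique (f := fun n => ρ n * (delta A (x k)).fst r -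
        (delta A (x k)).fst (ρ n * r)) (l := atTop) ?_ (((Mult.continuous_fst r).tendsto l).comp hlt)
      exact (hlim _).sub (((delta A (x k)).fst.continuous.tendsto _).comp (hlim r))
    rw [this]; exact hlk
  · have h1 := continuous_cstarHom (tauR A)
    have h2 := continuous_cstarHom (thetaR A)
    refine hz.induction_on (p := fun k => tauR A (h.fst (thetaR A k)) =
      (-Complex.I • (quarterTurn : Mult (Stab (qAlg A)))).fst (tauR A (thetaR A k))) k
      (isClosed_eq (by fun_prop) (by fun_prop)) fun n => ?_
    refine tendsto_nhds_unique ((h1.tendsto _).comp (hlim (thetaR A (z n)))) ?_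
    have e1 : (tauR A ∘ fun m => ρ m * thetaR A (z n)) = fun m =>
        Complex.I • single 0 1 (e m * e m * (z n).2) -
          Complex.I • single 1 0 (e m * e m * (z n).1) := by
      funext m
      change tauR A (ρ m * thetaR A (z n)) = _
      rw [map_mul, hρt, tauR_approxSymm, skew_mul, (hes m).star_eq]
    have e2 : (-Complex.I • (quarterTurn : Mult (Stab (qAlg A)))).fst (tauR A (thetaR A (z n))) =
        Complex.I • single 0 1 (z n).2 - Complex.I • single 1 0 (z n).1 := by
      rw [tauR_thetaR, DoubleCentralizer.smul_fst]
      change -Complex.I • (quarterTurn : Mult (Stab (qAlg A))).fst _ = _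
      rw [quarterTurn_fst, neg_smul, smul_sub, neg_sub]
    have hs : ∀ i j, Continuous fun b : qAlg A => (single i j b : Stab (qAlg A)) := fun i j => by
      refine (LipschitzWith.of_dist_le' (K := 1) fun b c => ?_).continuous
      rw [dist_eq_norm, dist_eq_norm, ← single_sub, one_mul]
      exact norm_single_le _ _ _
    rw [e1, e2]
    exact ((((hs 0 1).tendsto _).comp (hez n).2).const_smul Complex.I).sub
      ((((hs 1 0).tendsto _).comp (hez n).1).const_smul Complex.I)

/-- The unitary multiplier obtained from a lift of the symmetry implements the exchange of the
diagonal entries modulo the kernel. -/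
theorem tauR_Ad_cayley {h : Mult (Her A)} (hh : IsSelfAdjoint h)
    (hW : ∀ r, tauR A (h.fst r) =
      (-Complex.I • (quarterTurn : Mult (Stab (qAlg A)))).fst (tauR A r)) (z : qAlg A) :
    tauR A (Mult.Ad (cayley h 1) (star_cayley_mul hh 1) (thetaR A (0, z))) =
      tauR A (thetaR A (z, 0)) := by
  have hW' : ∀ r, tauR A (h.fst r) =
      -Complex.I • (quarterTurn : Mult (Stab (qAlg A))).fst (tauR A r) := hW
  have h1 : h * h - 1 ∈ Mult.annihilator (kerTau A) (isClosed_kerTau A) := by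
    rw [Mult.mem_annihilator]
    intro r
    rw [mem_kerTau]
    change tauR A (h.fst (h.fst r) - r) = 0
    rw [map_sub, hW', hW', map_smul, smul_smul]
    have : (quarterTurn : Mult (Stab (qAlg A))).fst
        ((quarterTurn : Mult (Stab (qAlg A))).fst (tauR A r)) = -tauR A r := by
      change ((quarterTurn : Mult (Stab (qAlg A))) * quarterTurn).fst (tauR A r) = _
      rw [quarterTurn_mul_self]; rfl
    rw [this, neg_mul_neg, Complex.I_mul_I, neg_smul, one_smul, neg_neg, sub_self]
  have h2 : ∀ r, tauR A ((cayley h 1).fst r) = (quarterTurn : Mult (Stab (qAlg A))).fst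
      (tauR A r) := fun r => by
    have h3 := Mult.mem_annihilator.1 (cayley_one_sub_mem hh h1) r
    rw [mem_kerTau] at h3
    change tauR A ((cayley h 1).fst r - Complex.I • h.fst r) = 0 at h3
    rw [map_sub, sub_eq_zero] at h3
    rw [h3, map_smul, hW', smul_smul, mul_neg, Complex.I_mul_I, neg_neg, one_smul]
  have h4 : ∀ r, tauR A ((star (cayley h 1)).snd r) =
      (star (quarterTurn : Mult (Stab (qAlg A)))).snd (tauR A r) := fun r => by
    rw [DoubleCentralizer.star_snd, DoubleCentralizer.star_snd, map_star, h2, map_star]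
  change tauR A ((star (cayley h 1)).snd ((cayley h 1).fst (thetaR A (0, z)))) = _
  rw [h4, h2, tauR_thetaR, tauR_thetaR]
  have h5 := rotate_pi_div_two (0 : Stab (qAlg A)) (single 0 0 z)
  rw [map_zero, map_zero, reindex_single, reindex_single, zero_add, zero_add] at h5
  have h6 : rotate (Real.pi / 2) (single 1 1 z) = (single 0 0 z : Stab (qAlg A)) := h5
  have h7 : ∀ y : Stab (qAlg A), rotate (Real.pi / 2) y =
      (star (quarterTurn : Mult (Stab (qAlg A)))).snd
        ((quarterTurn : Mult (Stab (qAlg A))).fst y) := fun y => by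
    change (star (turn (Real.pi / 2))).snd ((turn (Real.pi / 2)).fst y) = _
    rw [turn_pi_div_two]
  rw [h7] at h6
  change (star (quarterTurn : Mult (Stab (qAlg A)))).snd
    ((quarterTurn : Mult (Stab (qAlg A))).fst (single 0 0 (0 : qAlg A) + single 1 1 z)) =
      single 0 0 z + single 1 1 (0 : qAlg A)
  rw [single_zero, single_zero, zero_add, add_zero, h6]

/-! ### The pairs of homomorphisms -/

variable (A) in
/-- The homomorphism `diag(ι, ῑ)`. -/
def alpha : A →⋆ₙₐ[ℂ] Mult (Her A) := (thetaExt A).comp ((QAlg.ι A).prod (QAlg.ιbar A))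

variable (A) in
/-- The homomorphism `diag(ῑ, ι)`. -/
def beta : A →⋆ₙₐ[ℂ] Mult (Her A) := (thetaExt A).comp ((QAlg.ιbar A).prod (QAlg.ι A))

theorem alpha_apply (x : A) : alpha A x = thetaExt A (QAlg.ι A x, QAlg.ιbar A x) := rfl

theorem beta_apply (x : A) : beta A x = thetaExt A (QAlg.ιbar A x, QAlg.ι A x) := rfl

theorem alpha_eq (x : A) : alpha A x = delta A x + Mult.of _ (thetaR A (q x, 0)) := by
  rw [← thetaExt_incl, alpha_apply, delta_apply, ← map_add, Prod.mk_add_mk]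
  congr 2
  · rw [incl_q]; abel
  · rw [map_zero, add_zero]

theorem beta_eq (x : A) : beta A x = delta A x + Mult.of _ (thetaR A (0, q x)) := by
  rw [← thetaExt_incl, beta_apply, delta_apply, ← map_add, Prod.mk_add_mk]
  congr 2
  · rw [map_zero, add_zero]
  · rw [incl_q]; abel

/-- Conjugation by an isometry. -/
def _root_.conjHom {M : Type*} [CStarAlgebra M] (u : M) (hu : star u * u = 1) : M →⋆ₙₐ[ℂ] M where
  toFun x := u * x * star u
  map_smul' c x := by simp only [mul_smul_comm, smul_mul_assoc, MonoidHom.id_apply]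
  map_zero' := by simp only [mul_zero, zero_mul]
  map_add' x y := by simp only [mul_add, add_mul]
  map_mul' x y := by
    have : u * x * star u * (u * y * star u) = u * x * (star u * u) * y * star u := by
      simp only [mul_assoc]
    rw [this, hu, mul_one]; simp only [mul_assoc]
  map_star' x := by simp only [star_mul, star_star, mul_assoc]

/-- The conjugate of `diag(ῑ, ι)` by the Cayley transform of a symmetry. -/
def betaConj {h : Mult (Her A)} (hh : IsSelfAdjoint h) (t : ℝ) : A →⋆ₙₐ[ℂ] Mult (Her A) :=
  (conjHom (cayley h t) (star_cayley_mul hh t)).comp (beta A)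

variable {h : Mult (Her A)} (hh : IsSelfAdjoint h)

theorem betaConj_apply (t : ℝ) (x : A) : betaConj hh t x =
    cayley h t * beta A x * star (cayley h t) := rfl

theorem alpha_sub_betaConj (t : ℝ) (x : A) : alpha A x - betaConj hh t x =
    (delta A x - cayley h t * delta A x * star (cayley h t)) +
      Mult.of _ (thetaR A (q x, 0) -
        Mult.Ad (cayley h t) (star_cayley_mul hh t) (thetaR A (0, q x))) := by
  rw [betaConj_apply, alpha_eq, beta_eq, map_sub, Mult.of_Ad, mul_add, add_mul]
  abel

variable (hd : ∀ x, h * delta A x - delta A x * h ∈ kerIdeal A)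

theorem kerIdeal_subset_range {m : Mult (Her A)} (hm : m ∈ kerIdeal A) :
    m ∈ Set.range (Mult.of (Her A)) := by
  obtain ⟨a, -, ha⟩ := Mult.mem_ideal.1 hm
  exact ⟨a, ha⟩

include hd in
theorem alpha_sub_betaConj_mem_range (t : ℝ) (x : A) :
    alpha A x - betaConj hh t x ∈ Set.range (Mult.of (Her A)) := by
  obtain ⟨a, ha⟩ := kerIdeal_subset_range (cayley_conj_sub_mem hh t (hd x))
  rw [alpha_sub_betaConj, ← ha, ← map_add]
  exact ⟨_, rfl⟩

include hd in
theorem alpha_sub_betaConj_one_mem (hW : ∀ r, tauR A (h.fst r) =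
    (-Complex.I • (quarterTurn : Mult (Stab (qAlg A)))).fst (tauR A r)) (x : A) :
    alpha A x - betaConj hh 1 x ∈ kerIdeal A := by
  rw [alpha_sub_betaConj]
  refine (kerIdeal A).add_mem (cayley_conj_sub_mem hh 1 (hd x)) (Mult.mem_ideal.2 ⟨_, ?_, rfl⟩)
  rw [mem_kerTau, map_sub, tauR_Ad_cayley hh hW, sub_self]

/-- The path of homomorphisms on `qA` given by `diag(ι, ῑ)` and the conjugates of `diag(ῑ, ι)`. -/
def path (t : ℝ) : qAlg A →⋆ₙₐ[ℂ] Her A :=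
  qAlg.ofPair IdealEmbedding.of (alpha_sub_betaConj_mem_range hh hd t)

theorem of_path (t : ℝ) (z : qAlg A) :
    Mult.of _ (path hh hd t z) = QAlg.lift (alpha A) (betaConj hh t) (incl A z) :=
  qAlg.ofPair_spec IdealEmbedding.of (alpha_sub_betaConj_mem_range hh hd t) z

theorem of_path_q (t : ℝ) (x : A) :
    Mult.of _ (path hh hd t (q x)) = alpha A x - betaConj hh t x :=
  qAlg.ofPair_q IdealEmbedding.of (alpha_sub_betaConj_mem_range hh hd t) x

theorem continuous_path (z : qAlg A) : Continuous fun t => path hh hd t z := by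
  refine continuous_ofPair IdealEmbedding.of (alpha_sub_betaConj_mem_range hh hd)
    (fun _ => continuous_const) (fun x => ?_) z
  have := continuous_cayley hh
  simp only [betaConj_apply]
  fun_prop

theorem path_zero (z : qAlg A) : path hh hd 0 z = thetaR A (z, flip A z) := by
  apply Mult.of_injective
  rw [of_path, ← thetaExt_incl]
  have h1 : QAlg.lift (alpha A) (betaConj hh 0) = (thetaExt A).comp
      ((QAlg.lift (QAlg.ι A) (QAlg.ιbar A)).prod (QAlg.lift (QAlg.ιbar A) (QAlg.ι A))) := by
    apply QAlg.hom_ext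
    · intro x
      rw [QAlg.lift_ι, alpha_apply]
      change _ = thetaExt A (QAlg.lift _ _ (QAlg.ι A x), QAlg.lift _ _ (QAlg.ι A x))
      rw [QAlg.lift_ι, QAlg.lift_ι]
    · intro x
      rw [QAlg.lift_ιbar, betaConj_apply, cayley_zero, star_one, one_mul, mul_one, beta_apply]
      change _ = thetaExt A (QAlg.lift _ _ (QAlg.ιbar A x), QAlg.lift _ _ (QAlg.ιbar A x))
      rw [QAlg.lift_ιbar, QAlg.lift_ιbar]
  have h2 : QAlg.lift (QAlg.ι A) (QAlg.ιbar A) = NonUnitalStarAlgHom.id ℂ (QAlg A) :=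
    QAlg.hom_ext (fun x => QAlg.lift_ι _ _ x) (fun x => QAlg.lift_ιbar _ _ x)
  rw [h1, h2, incl_flip]
  rfl

theorem path_one_mem (hW : ∀ r, tauR A (h.fst r) =
    (-Complex.I • (quarterTurn : Mult (Stab (qAlg A)))).fst (tauR A r)) (z : qAlg A) :
    path hh hd 1 z ∈ kerTau A := by
  have := QAlg.lift_mem_of_sub_mem (f := alpha A) (g := betaConj hh 1) (s := (kerIdeal A : Set _))
    (isClosed_kerIdeal A) (kerIdeal A).zero_mem (fun _ ha _ hb => (kerIdeal A).add_mem ha hb)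
    (fun c _ ha => TwoSidedIdeal.smul_mem_of_unital _ c ha)
    (fun _ _ ha => (kerIdeal A).mul_mem_left _ _ ha)
    (fun _ _ ha => (kerIdeal A).mul_mem_right _ _ ha)
    (alpha_sub_betaConj_one_mem hh hd hW) z
  have h1 : Mult.of _ (path hh hd 1 z) ∈ kerIdeal A := by rw [of_path]; exact this
  obtain ⟨a, ha, e⟩ := Mult.mem_ideal.1 h1
  rwa [← Mult.of_injective e]

end Doubling

end

noncomputable section

attribute [local instance] CStarAlgebra.spectralOrder CStarAlgebra.spectralOrderedRing

open Filter Topology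

variable {X : Type v} [TopologicalSpace X]

namespace Stab

variable {B : Type u} [NonUnitalCStarAlgebra B]

theorem single_mul_mem {I L : TwoSidedIdeal B} {b : B} (h : ∀ y ∈ I, b * y ∈ L) (k l : ℕ)
    {x : Stab B} (hx : x ∈ ideal I) : single k l b * x ∈ ideal L := by
  refine ideal_induction (p := fun x => single k l b * x ∈ ideal L)
    ((isClosed_ideal L).preimage (continuous_const_mul _)) (by rw [mul_zero]; exact zero_mem _)
    (fun x y hx hy => by rw [mul_add]; exact add_mem hx hy) (fun i j c hc => ?_) hx
  by_cases hi : l = i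
  · rw [hi, single_mul_single]; exact single_mem (h c hc) _ _
  · rw [single_mul_single_of_ne hi]; exact zero_mem _

/-- The kernel of `K ⊗ QB → K ⊗ B` is `K ⊗ qB`. -/
theorem mem_range_of_map_fold_eq_zero {x : Stab (QAlg B)} (hx : map (QAlg.fold B) x = 0) :
    x ∈ Set.range (map (qAlg.incl B)) := by
  rw [← qAlg.IdealEmbedding.incl.mem_stab_range]
  have key : ∀ x : Stab (QAlg B), x - map (QAlg.ι B) (map (QAlg.fold B) x) ∈
      ideal (qAlg.IdealEmbedding.incl (A := B)).range := by
    apply Stab.induction_on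
    · exact (isClosed_ideal _).preimage (continuous_id.sub
        ((continuous_cstarHom _).comp (continuous_cstarHom _)))
    · simp only [map_zero, sub_zero]; exact zero_mem _
    · intro x y hx hy
      have : x + y - map (QAlg.ι B) (map (QAlg.fold B) (x + y)) =
          (x - map (QAlg.ι B) (map (QAlg.fold B) x)) +
            (y - map (QAlg.ι B) (map (QAlg.fold B) y)) := by simp only [map_add]; abel
      rw [this]; exact add_mem hx hy
    · intro i j b
      rw [map_single, map_single, ← single_sub]
      refine single_mem (qAlg.IdealEmbedding.incl.mem_range.2 ⟨⟨b - QAlg.ι B (QAlg.fold B b), ?_⟩,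
        rfl⟩) _ _
      rw [qAlg.mem_iff]
      change QAlg.fold B _ = 0
      rw [map_sub, QAlg.fold_ι, sub_self]
  have := key x
  rwa [hx, map_zero, sub_zero] at this

end Stab

namespace Doubling

open Stab qAlg TopologicalSpace

variable {A : XAlgebra.{u} X} {U : Opens X} {h : Mult (Her A)} (hh : IsSelfAdjoint h)
  {K L : TwoSidedIdeal (Her A)} (hK : IsClosed (K : Set (Her A))) (hL : IsClosed (L : Set (Her A)))
  (hKL : ∀ k : qAlg A × qAlg A, k.1 ∈ A.qIdeal U → k.2 ∈ A.qIdeal U → ∀ r ∈ K, thetaR A k * r ∈ L)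

include hL hKL in
theorem thetaExt_fst_mem {y : QAlg A × QAlg A} (hy : ∀ z : qAlg A, y.1 * z ∈ A.QIdeal U)
    (hy' : ∀ z : qAlg A, y.2 * z ∈ A.QIdeal U) {r : Her A} (hr : r ∈ K) :
    (thetaExt A y).fst r ∈ L := by
  have key : ∀ (y : QAlg A), (∀ z : qAlg A, y * z ∈ A.QIdeal U) → ∀ z : qAlg A,
      IdealEmbedding.incl.act y z ∈ A.qIdeal U := fun y hy z => by
    obtain ⟨a, ha, e⟩ := IdealEmbedding.incl.mem_push.1 (hy z)
    rwa [show IdealEmbedding.incl.act y z = a from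
      incl_injective ((IdealEmbedding.apply_act _ _ _).trans e.symm)]
  have h1 : Tendsto (fun e => (thetaExt A y).fst (thetaR A e * r)) (approxUnit _)
      (𝓝 ((thetaExt A y).fst r)) :=
    ((thetaExt A y).fst.continuous.tendsto _).comp (nondegenerate_thetaR A r)
  refine hL.mem_of_tendsto h1 (Eventually.of_forall fun e => ?_)
  rw [thetaExt_fst_mul]
  exact hKL _ (key _ hy _) (key _ hy' _) r hr

include hL hKL in
theorem alpha_fst_mem {x : A} (hx : x ∈ A.ideal U) {r : Her A} (hr : r ∈ K) :
    (alpha A x).fst r ∈ L := by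
  rw [alpha_apply]
  exact thetaExt_fst_mem hL hKL (y := (QAlg.ι A x, QAlg.ιbar A x))
    (fun z => (XAlgebra.mul_mem_QIdeal z hx).1) (fun z => (XAlgebra.mul_mem_QIdeal z hx).2) hr

include hK hL hKL in
theorem beta_snd_mem {x : A} (hx : x ∈ A.ideal U) {r : Her A} (hr : r ∈ K) :
    (beta A x).snd r ∈ L := by
  have hx' := TwoSidedIdeal.star_mem_of_isClosed (A.isClosed_ideal U) hx
  have h1 : (beta A (star x)).fst (star r) ∈ L := by
    rw [beta_apply]
    exact thetaExt_fst_mem hL hKL (y := (QAlg.ιbar A (star x), QAlg.ι A (star x)))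
      (fun z => (XAlgebra.mul_mem_QIdeal z hx').2) (fun z => (XAlgebra.mul_mem_QIdeal z hx').1)
      (TwoSidedIdeal.star_mem_of_isClosed hK hr)
  rw [map_star (beta A), DoubleCentralizer.star_fst, star_star] at h1
  have := TwoSidedIdeal.star_mem_of_isClosed hL h1
  rwa [star_star] at this

include hKL in
theorem alpha_sub_betaConj_mem {t : ℝ} (hab : ∀ x, alpha A x - betaConj hh t x ∈ Mult.ideal K hK)
    {x : A} (hx : x ∈ A.ideal U) : alpha A x - betaConj hh t x ∈ Mult.ideal L hL := by
  refine Mult.sub_mem_of_mul_mem (K := (K : Set (Her A))) hL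
    (fun x => by obtain ⟨a, ha, e⟩ := Mult.mem_ideal.1 (hab x); exact ⟨a, ha, e⟩)
    (fun x hx κ hκ => alpha_fst_mem hL hKL hx hκ) (fun x hx κ hκ => ?_) hx
  change (star (cayley h t)).snd ((beta A x).snd ((cayley h t).snd κ)) ∈ L
  exact Mult.snd_mem hL _ (beta_snd_mem hK hL hKL hx (Mult.snd_mem hK _ hκ))

/-- The homomorphism `id ⋆ 0`. -/
def evalLeft (B : Type u) [NonUnitalCStarAlgebra B] : QAlg B →⋆ₙₐ[ℂ] B :=
  QAlg.lift (NonUnitalStarAlgHom.id ℂ B) 0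

theorem map_evalLeft_theta (k : qAlg A × qAlg A) :
    Stab.map (evalLeft (qAlg A)) (theta A k) = single 0 0 k.1 := by
  rw [theta_apply, map_add, map_single, map_single]
  have h1 : evalLeft (qAlg A) (QAlg.ι (qAlg A) k.1) = k.1 := QAlg.lift_ι _ _ _
  have h2 : evalLeft (qAlg A) (QAlg.ιbar (qAlg A) k.2) = 0 := QAlg.lift_ιbar _ _ _
  rw [h1, h2, single_zero, add_zero]

variable (A U) in
/-- The elements which `id ⋆ 0` maps to the ideal of `qA` given by `U`. -/
def evalIdeal : TwoSidedIdeal (Her A) :=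
  (Stab.ideal (A.qIdeal U)).comap ((Stab.map (evalLeft (qAlg A))).comp (Her.val A))

theorem mem_evalIdeal {r : Her A} : r ∈ evalIdeal A U ↔
    Stab.map (evalLeft (qAlg A)) (Her.val A r) ∈ Stab.ideal (A.qIdeal U) :=
  TwoSidedIdeal.mem_comap _

variable (A U) in
theorem isClosed_evalIdeal : IsClosed (evalIdeal A U : Set (Her A)) := by
  have : (evalIdeal A U : Set (Her A)) = ((Stab.map (evalLeft (qAlg A))).comp (Her.val A)) ⁻¹'
      (Stab.ideal (A.qIdeal U)) := Set.ext fun _ => mem_evalIdeal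
  rw [this]
  exact (Stab.isClosed_ideal _).preimage (continuous_cstarHom _)

variable (A U) in
/-- The ideal of the action of `X` on `q(qA)`. -/
def qqIdeal : TwoSidedIdeal (qAlg (qAlg A)) := A.q.qIdeal U

variable (A U) in
theorem isClosed_qqIdeal : IsClosed (qqIdeal A U : Set (qAlg (qAlg A))) := A.q.isClosed_qIdeal U

variable (A U) in
/-- The ideal of the action of `X` on `q(qA)`, as an ideal of `Q(qA)`. -/
def QqIdeal : TwoSidedIdeal (QAlg (qAlg A)) :=
  IdealEmbedding.incl.push (qqIdeal A U) (isClosed_qqIdeal A U)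

variable (A U) in
/-- The elements of the ideal of `Q(qA)` given by `U`. -/
def valIdeal : TwoSidedIdeal (Her A) := (Stab.ideal (QqIdeal A U)).comap (Her.val A)

theorem mem_valIdeal {r : Her A} : r ∈ valIdeal A U ↔
    Her.val A r ∈ Stab.ideal (QqIdeal A U) := TwoSidedIdeal.mem_comap _

variable (A U) in
theorem isClosed_valIdeal : IsClosed (valIdeal A U : Set (Her A)) := by
  have : (valIdeal A U : Set (Her A)) = Her.val A ⁻¹' (Stab.ideal (QqIdeal A U)) :=
    Set.ext fun _ => mem_valIdeal
  rw [this]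
  exact (Stab.isClosed_ideal _).preimage (continuous_cstarHom _)

theorem thetaR_mul_mem_evalIdeal {k : qAlg A × qAlg A} (hk : k.1 ∈ A.qIdeal U) (r : Her A) :
    thetaR A k * r ∈ evalIdeal A U := by
  rw [mem_evalIdeal, map_mul, map_mul, Her.val_thetaR, map_evalLeft_theta]
  exact TwoSidedIdeal.mul_mem_right _ _ _ (single_mem hk _ _)

theorem val_mem_of_mem_kerTau {r : Her A} (hr : r ∈ kerTau A) :
    Her.val A r ∈ Set.range (Stab.map (incl (qAlg A))) :=
  mem_range_of_map_fold_eq_zero (mem_kerTau.1 hr)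

theorem thetaR_mul_mem_valIdeal {k : qAlg A × qAlg A} (hk : k.1 ∈ A.qIdeal U)
    (hk' : k.2 ∈ A.qIdeal U) {r : Her A} (hr : r ∈ kerTau A) : thetaR A k * r ∈ valIdeal A U := by
  rw [mem_valIdeal, map_mul, Her.val_thetaR, theta_apply, add_mul]
  have h1 := IdealEmbedding.incl.mem_stab_range.2 (val_mem_of_mem_kerTau hr)
  refine (Stab.ideal (QqIdeal A U)).add_mem (single_mul_mem (fun y hy => ?_) 0 0 h1)
    (single_mul_mem (fun y hy => ?_) 1 1 h1)
  · obtain ⟨z, rfl⟩ := IdealEmbedding.incl.mem_range.1 hy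
    exact (XAlgebra.mul_mem_QIdeal (A := A.q) z hk).1
  · obtain ⟨z, rfl⟩ := IdealEmbedding.incl.mem_range.1 hy
    exact (XAlgebra.mul_mem_QIdeal (A := A.q) z hk').2

variable (hd : ∀ x, h * delta A x - delta A x * h ∈ kerIdeal A)

theorem path_q_mem_evalIdeal (t : ℝ) {x : A} (hx : x ∈ A.ideal U) :
    path hh hd t (qAlg.q x) ∈ evalIdeal A U := by
  have hcl : IsClosed ((⊤ : TwoSidedIdeal (Her A)) : Set (Her A)) := by
    rw [TwoSidedIdeal.coe_top]; exact isClosed_univ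
  have h1 := alpha_sub_betaConj_mem hh hcl (isClosed_evalIdeal A U) (U := U)
    (fun k hk _ r _ => thetaR_mul_mem_evalIdeal hk r) (t := t) (fun x => by
      obtain ⟨a, ha⟩ := alpha_sub_betaConj_mem_range hh hd t x
      exact Mult.mem_ideal.2 ⟨a, trivial, ha⟩) hx
  rw [← of_path_q hh hd] at h1
  obtain ⟨a, ha, e⟩ := Mult.mem_ideal.1 h1
  rwa [← Mult.of_injective e]

variable (hW : ∀ r, tauR A (h.fst r) =
  (-Complex.I • (quarterTurn : Mult (Stab (qAlg A)))).fst (tauR A r))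

include hW in
theorem path_one_q_mem_valIdeal {x : A} (hx : x ∈ A.ideal U) :
    path hh hd 1 (qAlg.q x) ∈ valIdeal A U := by
  have h1 := alpha_sub_betaConj_mem hh (isClosed_kerTau A) (isClosed_valIdeal A U) (U := U)
    (fun k hk hk' r hr => thetaR_mul_mem_valIdeal hk hk' hr) (t := 1)
    (alpha_sub_betaConj_one_mem hh hd hW) hx
  rw [← of_path_q hh hd] at h1
  obtain ⟨a, ha, e⟩ := Mult.mem_ideal.1 h1
  rwa [← Mult.of_injective e]

/-- The path of equivariant homomorphisms `qA → K ⊗ qA`. -/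
def pathHom (t : ℝ) : XHom A.q A.q.stab :=
  XHom.ofQ ((Stab.map (evalLeft (qAlg A))).comp ((Her.val A).comp (path hh hd t)))
    fun _ _ hx => mem_evalIdeal.1 (path_q_mem_evalIdeal hh hd t hx)

theorem toStab_pathHom (t : ℝ) (z : qAlg A) : (pathHom hh hd t).toStab z =
    Stab.map (evalLeft (qAlg A)) (Her.val A (path hh hd t z)) := rfl

/-- The homomorphism `qA → K ⊗ q(qA)` at the end of the path. -/
def endHom : qAlg A →⋆ₙₐ[ℂ] Stab (qAlg (qAlg A)) :=
  ((Her.val A).comp (path hh hd 1)).factor (Stab.map (incl (qAlg A)))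
    (Stab.map_injective incl_injective) fun z => val_mem_of_mem_kerTau (path_one_mem hh hd hW z)

theorem map_incl_endHom (z : qAlg A) :
    Stab.map (incl (qAlg A)) (endHom hh hd hW z) = Her.val A (path hh hd 1 z) :=
  NonUnitalStarAlgHom.factor_spec _ _ _ _ _

theorem endHom_q_mem {x : A} (hx : x ∈ A.ideal U) :
    endHom hh hd hW (qAlg.q x) ∈ Stab.ideal (qqIdeal A U) := by
  rw [← IdealEmbedding.incl.map_mem_ideal_push (hI := isClosed_qqIdeal A U), map_incl_endHom]
  exact mem_valIdeal.1 (path_one_q_mem_valIdeal hh hd hW hx)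

/-- The homomorphism at the end of the path, as an equivariant homomorphism. -/
def endXHom : XHom A.q A.q.q.stab :=
  XHom.ofQ (endHom hh hd hW) fun _ _ hx => endHom_q_mem hh hd hW hx

end Doubling

open Doubling in
/-- For separable `A`, the evaluation map `q(qA) → qA` has a right inverse up to homotopy. -/
theorem HClass.exists_section (A : XAlgebra.{u} X) [TopologicalSpace.SeparableSpace A] :
    ∃ s : HClass A.q A.q.q, comp (ofHom (XHom.π A.q)) s = ofHom (XHom.id A.q) := by
  obtain ⟨h, hh, hd, hW⟩ := exists_symmetry (A := A)
  refine ⟨mk (endXHom hh hd hW), ?_⟩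
  rw [ofHom_comp_mk, ofHom, mk_eq_mk]
  have h1 : pathHom hh hd 1 = (XHom.π A.q).stabMap.comp (endXHom hh hd hW) := by
    refine XHom.ext_stab fun z => ?_
    refine (toStab_pathHom hh hd 1 z).trans ?_
    rw [← map_incl_endHom hh hd hW z]
    exact Stab.map_map _ _ _
  have h0 : pathHom hh hd 0 = (XHom.corner A.q).comp (XHom.id A.q) := by
    refine XHom.ext_stab fun z => ?_
    refine (toStab_pathHom hh hd 0 z).trans ?_
    exact (congrArg (fun r => Stab.map (evalLeft (qAlg A)) (Her.val A r))
      (path_zero hh hd z)).trans (map_evalLeft_theta (A := A) (z, qAlg.flip A z))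
  rw [← h1, ← h0]
  exact XHom.joined_of_path (F := pathHom hh hd) (fun z => (continuous_cstarHom
    (Stab.map (evalLeft (qAlg A)))).comp ((continuous_cstarHom (Her.val A)).comp
      (continuous_path hh hd z))) 1 0

end

noncomputable section

attribute [local instance] CStarAlgebra.spectralOrder CStarAlgebra.spectralOrderedRing

open Filter Topology

variable {X : Type v} [TopologicalSpace X]

/-! ### The product -/

namespace HClass

variable {A A' B B' C D E : XAlgebra.{u} X}

/-- A section of the evaluation map `π_{qA}` up to homotopy, for separable `A`. -/
def dil (A : XAlgebra.{u} X) [TopologicalSpace.SeparableSpace A] : HClass A.q A.q.q :=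
  (exists_section A).choose

theorem π_comp_dil [TopologicalSpace.SeparableSpace A] :
    comp (ofHom (XHom.π A.q)) (dil A) = ofHom (XHom.id A.q) := (exists_section A).choose_spec

/-- The lift of a class along the evaluation map `π_B`. -/
def lift [TopologicalSpace.SeparableSpace A] (a : HClass A.q B) : HClass A.q B.q :=
  comp (qLift a) (dil A)

theorem π_comp_lift [TopologicalSpace.SeparableSpace A] (a : HClass A.q B) :
    comp (ofHom (XHom.π B)) (lift a) = a := by
  rw [lift, ← comp_assoc, π_comp_qLift, comp_assoc, π_comp_dil, comp_id]

theorem lift_π_comp [TopologicalSpace.SeparableSpace A] (a : HClass A.q B.q) :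
    lift (comp (ofHom (XHom.π B)) a) = a := by
  rw [lift, qLift_ofHom_comp, ofHom_qMap_π, π_comp_qLift, comp_assoc, π_comp_dil, comp_id]

theorem lift_eq [TopologicalSpace.SeparableSpace A] {a : HClass A.q B} {b : HClass A.q B.q}
    (h : comp (ofHom (XHom.π B)) b = a) : lift a = b := by rw [← h, lift_π_comp]

/-- The product of classes. -/
def prod [TopologicalSpace.SeparableSpace A] (a : HClass A.q B) (b : HClass B.q C) :
    HClass A.q C := comp b (lift a)

theorem add_prod [TopologicalSpace.SeparableSpace A] (a a' : HClass A.q B) (b : HClass B.q C) :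
    prod (a + a') b = prod a b + prod a' b := by
  rw [prod, prod, prod, ← comp_add, lift_eq]
  rw [comp_add, π_comp_lift, π_comp_lift]

theorem prod_add [TopologicalSpace.SeparableSpace A] (a : HClass A.q B) (b b' : HClass B.q C) :
    prod a (b + b') = prod a b + prod a b' := add_comp _ _ _

theorem prod_assoc [TopologicalSpace.SeparableSpace A] [TopologicalSpace.SeparableSpace B]
    (a : HClass A.q B) (b : HClass B.q C) (c : HClass C.q D) :
    prod (prod a b) c = prod a (prod b c) := by
  rw [prod, prod, prod, prod, comp_assoc, lift_eq]
  rw [← comp_assoc, π_comp_lift]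

theorem pullback_prod [TopologicalSpace.SeparableSpace A] [TopologicalSpace.SeparableSpace A']
    (f : XHom A' A) (a : HClass A.q B) (b : HClass B.q C) :
    prod (comp a (ofHom f.qMap)) b = comp (prod a b) (ofHom f.qMap) := by
  rw [prod, prod, comp_assoc, lift_eq]
  rw [← comp_assoc, π_comp_lift]

theorem pushforward_prod [TopologicalSpace.SeparableSpace A] (h : XHom B B') (a : HClass A.q B)
    (b : HClass B'.q C) : prod (comp (ofHom h) a) b = prod a (comp b (ofHom h.qMap)) := by
  rw [prod, prod, comp_assoc, lift_eq]
  rw [← comp_assoc, ofHom_comp_ofHom, XHom.π_comp_qMap, ← ofHom_comp_ofHom, comp_assoc, π_comp_lift]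

theorem prod_pushforward [TopologicalSpace.SeparableSpace A] (g : XHom C D) (a : HClass A.q B)
    (b : HClass B.q C) : prod a (comp (ofHom g) b) = comp (ofHom g) (prod a b) :=
  comp_assoc _ _ _

theorem ofHom_prod [TopologicalSpace.SeparableSpace A] (f : XHom A B) (b : HClass B.q C) :
    prod (ofHom (f.comp (XHom.π A))) b = comp b (ofHom f.qMap) := by
  rw [prod, lift_eq]
  rw [ofHom_comp_ofHom, XHom.π_comp_qMap]

theorem prod_ofHom [TopologicalSpace.SeparableSpace A] (a : HClass A.q B) (g : XHom B C) :
    prod a (ofHom (g.comp (XHom.π B))) = comp (ofHom g) a := by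
  rw [prod, ← ofHom_comp_ofHom, comp_assoc, π_comp_lift]

end HClass

namespace KK

variable {A A' B B' C : XAlgebra.{u} X}

/-- Equivariant homomorphisms `qA → E` for the action of `X` on `qA`. -/
def repEquiv (A E : XAlgebra.{u} X) : QXHom A E ≃ₜ XHom A.q E where
  toFun φ := XHom.ofQ φ.hom φ.equivariant
  invFun φ := ⟨φ.hom, fun _ _ hx => φ.q_mem hx⟩
  left_inv _ := rfl
  right_inv _ := rfl
  continuous_toFun := XHom.continuous_of fun z => QXHom.continuous_eval z
  continuous_invFun := QXHom.continuous_of fun z => XHom.continuous_eval (D := A.q) z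

/-- Classes in `KK(X; A, B)` are homotopy classes of equivariant homomorphisms on `qA`. -/
def equiv (A B : XAlgebra.{u} X) : KK A B ≃ HClass A.q B where
  toFun := Quotient.map (repEquiv A B.stab) fun _ _ ⟨p⟩ => ⟨p.map (repEquiv A B.stab).continuous⟩
  invFun := Quotient.map (repEquiv A B.stab).symm
    fun _ _ ⟨p⟩ => ⟨p.map (repEquiv A B.stab).symm.continuous⟩
  left_inv a := Quotient.inductionOn a fun _ => rfl
  right_inv a := Quotient.inductionOn a fun _ => rfl

theorem equiv_add (a b : KK A B) : equiv A B (a + b) = equiv A B a + equiv A B b :=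
  Quotient.inductionOn₂ a b fun _ _ => rfl

theorem equiv_pullback (f : XHom A' A) (a : KK A B) :
    equiv A' B (pullback f a) = HClass.comp (equiv A B a) (HClass.ofHom f.qMap) :=
  Quotient.inductionOn a fun φ => (HClass.mk_comp_ofHom (repEquiv A B.stab φ) f.qMap).symm

theorem equiv_pushforward (g : XHom B B') (a : KK A B) :
    equiv A B' (pushforward g a) = HClass.comp (HClass.ofHom g) (equiv A B a) :=
  Quotient.inductionOn a fun φ => (HClass.ofHom_comp_mk g (repEquiv A B.stab φ)).symm

theorem equiv_ofHom (f : XHom A B) :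
    equiv A B (ofHom f) = HClass.ofHom (f.comp (XHom.π A)) := rfl

theorem exists_addCommGroup (A B : XAlgebra.{u} X) :
    ∃ G : AddCommGroup (KK A B), ∀ a a' : KK A B, G.add a a' = a + a' := by
  let e := equiv A B
  let _ : Zero (KK A B) := ⟨e.symm 0⟩
  let _ : Neg (KK A B) := ⟨fun a => e.symm (HClass.comp (e a) (HClass.ofHom (XHom.flip A)))⟩
  have h0 : e 0 = 0 := e.apply_symm_apply 0
  have hneg : ∀ a, e (-a) = HClass.comp (e a) (HClass.ofHom (XHom.flip A)) := fun a =>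
    e.apply_symm_apply _
  have hadd : ∀ a b, e (a + b) = e a + e b := equiv_add
  let G : AddGroup (KK A B) := AddGroup.ofLeftAxioms
    (fun a b c => e.injective (by simp only [hadd, HClass.add_assoc']))
    (fun a => e.injective (by rw [hadd, h0, HClass.add_comm', HClass.add_zero']))
    (fun a => e.injective (by rw [hadd, h0, hneg, HClass.add_comm', HClass.add_comp_flip]))
  exact ⟨{ G with add_comm := fun a b => e.injective (by
    refine (hadd a b).trans ((HClass.add_comm' _ _).trans (hadd b a).symm)) }, fun _ _ => rfl⟩

end KK

end

theorem statement10 (X : Type v) [TopologicalSpace X] :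
    -- the block sum makes every `KK(X; A, B)` an abelian group
    (∀ A B : XAlgebra.{u} X, ∃ G : AddCommGroup (KK A B), ∀ a a' : KK A B, G.add a a' = a + a') ∧
    -- there is a product `KK(X; A, B) × KK(X; B, C) → KK(X; A, C)` for separable `A` ...
    ∃ prod : ∀ (A B C : XAlgebra.{u} X) [TopologicalSpace.SeparableSpace A],
        KK A B → KK B C → KK A C,
      -- ... which is bilinear,
      (∀ (A B C : XAlgebra.{u} X) [TopologicalSpace.SeparableSpace A]
        (a a' : KK A B) (b : KK B C),
        prod A B C (a + a') b = prod A B C a b + prod A B C a' b) ∧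
      (∀ (A B C : XAlgebra.{u} X) [TopologicalSpace.SeparableSpace A]
        (a : KK A B) (b b' : KK B C),
        prod A B C a (b + b') = prod A B C a b + prod A B C a b') ∧
      -- associative,
      (∀ (A B C D : XAlgebra.{u} X) [TopologicalSpace.SeparableSpace A]
        [TopologicalSpace.SeparableSpace B] (a : KK A B) (b : KK B C) (c : KK C D),
        prod A C D (prod A B C a b) c = prod A B D a (prod B C D b c)) ∧
      -- natural in `A`, `B` and `C`,
      (∀ (A A' B C : XAlgebra.{u} X) [TopologicalSpace.SeparableSpace A]
        [TopologicalSpace.SeparableSpace A'] (f : XHom A' A) (a : KK A B) (b : KK B C),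
        prod A' B C (KK.pullback f a) b = KK.pullback f (prod A B C a b)) ∧
      (∀ (A B B' C : XAlgebra.{u} X) [TopologicalSpace.SeparableSpace A]
        (h : XHom B B') (a : KK A B) (b : KK B' C),
        prod A B' C (KK.pushforward h a) b = prod A B C a (KK.pullback h b)) ∧
      (∀ (A B C C' : XAlgebra.{u} X) [TopologicalSpace.SeparableSpace A]
        (g : XHom C C') (a : KK A B) (b : KK B C),
        prod A B C' a (KK.pushforward g b) = KK.pushforward g (prod A B C a b)) ∧
      -- and extends the composition of `X`-equivariant homomorphisms
      (∀ (A B C : XAlgebra.{u} X) [TopologicalSpace.SeparableSpace A]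
        (f : XHom A B) (g : XHom B C),
        prod A B C (KK.ofHom f) (KK.ofHom g) = KK.ofHom (g.comp f)) ∧
      (∀ (A B C : XAlgebra.{u} X) [TopologicalSpace.SeparableSpace A]
        (f : XHom A B) (b : KK B C),
        prod A B C (KK.ofHom f) b = KK.pullback f b) ∧
      (∀ (A B C : XAlgebra.{u} X) [TopologicalSpace.SeparableSpace A]
        (a : KK A B) (g : XHom B C),
        prod A B C a (KK.ofHom g) = KK.pushforward g a) := by
  refine ⟨KK.exists_addCommGroup, fun A B C _ a b => (KK.equiv A C).symm
    (HClass.prod (KK.equiv A B a) (KK.equiv B C b)), ?_, ?_, ?_, ?_, ?_, ?_, ?_, ?_, ?_⟩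
  · intro A B C _ a a' b
    apply (KK.equiv A C).injective
    simp only [KK.equiv_add, Equiv.apply_symm_apply, HClass.add_prod]
  · intro A B C _ a b b'
    apply (KK.equiv A C).injective
    simp only [KK.equiv_add, Equiv.apply_symm_apply, HClass.prod_add]
  · intro A B C D _ _ a b c
    simp only [Equiv.apply_symm_apply, HClass.prod_assoc]
  · intro A A' B C _ _ f a b
    apply (KK.equiv A' C).injective
    simp only [KK.equiv_pullback, Equiv.apply_symm_apply, HClass.pullback_prod]
  · intro A B B' C _ h a b
    simp only [KK.equiv_pullback, KK.equiv_pushforward, HClass.pushforward_prod]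
  · intro A B C C' _ g a b
    apply (KK.equiv A C').injective
    simp only [KK.equiv_pushforward, Equiv.apply_symm_apply, HClass.prod_pushforward]
  · intro A B C _ f g
    apply (KK.equiv A C).injective
    simp only [KK.equiv_ofHom, Equiv.apply_symm_apply, HClass.prod_ofHom, HClass.ofHom_comp_ofHom]
    rfl
  · intro A B C _ f b
    apply (KK.equiv A C).injective
    simp only [KK.equiv_ofHom, KK.equiv_pullback, Equiv.apply_symm_apply, HClass.ofHom_prod]
  · intro A B C _ a g
    apply (KK.equiv A C).injective
    simp only [KK.equiv_ofHom, KK.equiv_pushforward, Equiv.apply_symm_apply, HClass.prod_ofHom]
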